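/- Let I ⊂ ℝ be an interval, J ⊂ I a bounded interval, and d, m ≥ 1. Assume: (regularity) for some α ∈ (0,1), q_{ij} and the entries of B_i belong to C^{α/2,1+α}_loc(I×ℝ^d) and the entries of C belong to C^{α/2,α}_loc(I×ℝ^d); Q, B_i, C are symmetric and ν₀ := inf_{I×ℝ^d} λ_Q > 0; (drift decomposition with σ = 1) B_i = b_i I_m + B̃_i with b_i scalar and |(B̃_i)_{jk}(t,x)| ≤ ξ(t) λ_Q(t,x) for some ξ : I → (0,∞); (potential balance) for some β ≥ 1/4, sup_{J×ℝ^d}(Λ_C + β d m² ξ² λ_Q) < +∞; (Lyapunov) there exist λ_J > 0 and a positive φ ∈ C²(ℝ^d) with φ(x) → +∞ as |x| → +∞ and sup_{J×ℝ^d}(𝒜φ − λ_J φ) < +∞; (gradient hypotheses) there exist γ ≥ 1/4 and a function k ≥ 0 with |D_x q_{ij}| ≤ k λ_Q on I×ℝ^d, such that sup_{J×ℝ^d}[√d m ξ λ_Q + (∑_{i=1}^d |D_i C|²)^{1/2} + 2Λ_C] < +∞ and sup_{J×ℝ^d}[√d(∑_{i,j,l=1}^d |D_{il} q_{ij}|²)^{1/2}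 + (∑_{i,j=1}^d |D_j B̃_i|²)^{1/2} + Λ_{D_x b} + Λ_C + M_γ λ_Q + ½(∑_{i=1}^d |D_i C|²)^{1/2}] < +∞, where M_γ = γ(√d m ξ + d k)² + ½√d m ξ + 1/(4γ). Then for every p ≥ 1 + 1/(4(β∧γ)) there exists a constant C_{p,J} > 0 such that, setting c_p = 2^{(p/2−1)∨0}, for every f ∈ C_c^∞(ℝ^d;ℝ^m), every s < t in J, every bounded classical solution u of D_t u = 𝓐(·)u on (s,·]×ℝ^d with u(s,·) = f and every bounded classical solution v of the scalar problem D_t v = 𝒜(·)v with v(s,·) = |f|^p + |Df|^p, one has |D_x u(t,x)|^p ≤ c_p e^{C_{p,J}(t−s)} v(t,x) for all x ∈ ℝ^d. -/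

import Mathlib

open MeasureTheory Set Filter
open scoped BigOperators

/-- Partial derivative in the `i`-th coordinate direction. -/
noncomputable def pd {d : ℕ} {F : Type*} [NormedAddCommGroup F] [NormedSpace ℝ F]
    (f : EuclideanSpace ℝ (Fin d) → F) (x : EuclideanSpace ℝ (Fin d)) (i : Fin d) : F :=
  fderiv ℝ f x (EuclideanSpace.single i 1)

/-- `lam` is the minimum eigenvalue of the symmetric matrix `M` (via the Rayleigh quotient). -/
def IsMinEigen {n : ℕ} (M : Matrix (Fin n) (Fin n) ℝ) (lam : ℝ) : Prop :=
  (∀ w : Fin n → ℝ, lam * ∑ k, (w k) ^ 2 ≤ ∑ k, ∑ l, M k l * w k * w l) ∧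
    ∃ w : Fin n → ℝ, w ≠ 0 ∧ (∑ k, ∑ l, M k l * w k * w l) = lam * ∑ k, (w k) ^ 2

/-- `lam` is the maximum of the Rayleigh quotient of `M` (for symmetric `M`, the maximum
eigenvalue). -/
def IsMaxEigen {n : ℕ} (M : Matrix (Fin n) (Fin n) ℝ) (lam : ℝ) : Prop :=
  (∀ w : Fin n → ℝ, (∑ k, ∑ l, M k l * w k * w l) ≤ lam * ∑ k, (w k) ^ 2) ∧
    ∃ w : Fin n → ℝ, w ≠ 0 ∧ (∑ k, ∑ l, M k l * w k * w l) = lam * ∑ k, (w k) ^ 2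

/-- Local parabolic Hölder continuity of exponent `α/2` in time and `α` in space,
on `I × ℝ^d`. -/
def HolderLocPar (d : ℕ) (α : ℝ) (I : Set ℝ)
    (f : ℝ → EuclideanSpace ℝ (Fin d) → ℝ) : Prop :=
  ∀ K : Set (ℝ × EuclideanSpace ℝ (Fin d)), IsCompact K → (∀ pt ∈ K, pt.1 ∈ I) →
    ∃ c : ℝ, ∀ pt ∈ K, ∀ qt ∈ K,
      |f pt.1 pt.2 - f qt.1 qt.2| ≤ c * (|pt.1 - qt.1| ^ (α / 2) + ‖pt.2 - qt.2‖ ^ α)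

/-- Membership in `C^{α/2,1+α}_loc(I×ℝ^d)`: the function and its first-order spatial
derivatives are locally parabolic `α`-Hölder continuous. -/
def Cpar1 (d : ℕ) (α : ℝ) (I : Set ℝ)
    (f : ℝ → EuclideanSpace ℝ (Fin d) → ℝ) : Prop :=
  HolderLocPar d α I f ∧ (∀ t ∈ I, Differentiable ℝ (f t)) ∧
    ∀ i : Fin d, HolderLocPar d α I (fun t x => pd (f t) x i)

set_option autoImplicit false
set_option maxSynthPendingDepth 3
open scoped ContDiff Topology Convolution

/-- The coordinate vectors. -/
local notation "𝐞" i:max => EuclideanSpace.single i 1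

/-- A family of smooth functions all of whose derivatives are bounded uniformly in the family. -/
structure SmoothBdd {Λ E F : Type*} [NormedAddCommGroup E] [NormedSpace ℝ E]
    [NormedAddCommGroup F] [NormedSpace ℝ F] (f : Λ → E → F) : Prop where
  smooth : ∀ a, ContDiff ℝ ∞ (f a)
  bdd : ∀ k : ℕ, ∃ c : ℝ, ∀ a x, ‖iteratedFDeriv ℝ k (f a) x‖ ≤ c

namespace SmoothBdd

variable {Λ E F G H : Type*} [NormedAddCommGroup E] [NormedSpace ℝ E]
  [NormedAddCommGroup F] [NormedSpace ℝ F] [NormedAddCommGroup G] [NormedSpace ℝ G]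
  [NormedAddCommGroup H] [NormedSpace ℝ H]

lemma nonneg_bound {f : Λ → E → F} (hf : SmoothBdd f) (k : ℕ) :
    ∃ c : ℝ, 0 ≤ c ∧ ∀ a x, ‖iteratedFDeriv ℝ k (f a) x‖ ≤ c := by
  obtain ⟨c, hc⟩ := hf.bdd k
  exact ⟨max c 0, le_max_right _ _, fun a x => (hc a x).trans (le_max_left _ _)⟩

lemma bound_zero {f : Λ → E → F} (hf : SmoothBdd f) : ∃ c : ℝ, 0 ≤ c ∧ ∀ a x, ‖f a x‖ ≤ c := by
  obtain ⟨c, h0, hc⟩ := hf.nonneg_bound 0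
  exact ⟨c, h0, fun a x => by simpa using hc a x⟩

lemma differentiable {f : Λ → E → F} (hf : SmoothBdd f) (a : Λ) : Differentiable ℝ (f a) :=
  (hf.smooth a).differentiable (by simp)

lemma fderiv {f : Λ → E → F} (hf : SmoothBdd f) :
    SmoothBdd (fun a => fderiv ℝ (f a)) where
  smooth a := (hf.smooth a).fderiv_right (by simp)
  bdd k := by
    obtain ⟨c, hc⟩ := hf.bdd (k + 1)
    exact ⟨c, fun a x => by simpa only [norm_iteratedFDeriv_fderiv] using hc a x⟩

lemma clm {f : Λ → E → F} (hf : SmoothBdd f) (L : F →L[ℝ] G) :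
    SmoothBdd (fun a x => L (f a x)) where
  smooth a := L.contDiff.comp (hf.smooth a)
  bdd k := by
    obtain ⟨c, hc⟩ := hf.bdd k
    refine ⟨‖L‖ * c, fun a x => ?_⟩
    exact (L.norm_iteratedFDeriv_comp_left (n := k) (hf.smooth a).contDiffAt
      (by exact_mod_cast le_top)).trans (mul_le_mul_of_nonneg_left (hc a x) (norm_nonneg _))

lemma bilin {f : Λ → E → F} {g : Λ → E → G} (hf : SmoothBdd f) (hg : SmoothBdd g)
    (B : F →L[ℝ] G →L[ℝ] H) : SmoothBdd (fun a x => B (f a x) (g a x)) where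
  smooth a := (B.isBoundedBilinearMap.contDiff).comp₂ (hf.smooth a) (hg.smooth a)
  bdd k := by
    choose c hc0 hc using hf.nonneg_bound
    choose e he0 he using hg.nonneg_bound
    refine ⟨‖B‖ * ∑ i ∈ Finset.range (k + 1), (k.choose i : ℝ) * c i * e (k - i), fun a x => ?_⟩
    refine (B.norm_iteratedFDeriv_le_of_bilinear (hf.smooth a) (hg.smooth a) x
      (n := k) (by exact_mod_cast le_top)).trans ?_
    gcongr with i hi
    · exact mul_nonneg (by positivity) (hc0 i)
    · exact hc i a x
    · exact he _ a x

lemma add {f g : Λ → E → F} (hf : SmoothBdd f) (hg : SmoothBdd g) :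
    SmoothBdd (fun a x => f a x + g a x) where
  smooth a := (hf.smooth a).add (hg.smooth a)
  bdd k := by
    obtain ⟨c, hc⟩ := hf.bdd k
    obtain ⟨e, he⟩ := hg.bdd k
    refine ⟨c + e, fun a x => ?_⟩
    have := iteratedFDeriv_add_apply (𝕜 := ℝ) (i := k) (x := x) (f := f a) (g := g a)
      ((hf.smooth a).contDiffAt.of_le (by exact_mod_cast le_top))
      ((hg.smooth a).contDiffAt.of_le (by exact_mod_cast le_top))
    change ‖iteratedFDeriv ℝ k (f a + g a) x‖ ≤ _
    rw [this]
    exact (norm_add_le _ _).trans (add_le_add (hc a x) (he a x))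

lemma const {c : Λ → F} (hc : ∃ K : ℝ, ∀ a, ‖c a‖ ≤ K) : SmoothBdd (fun a (_ : E) => c a) where
  smooth a := contDiff_const
  bdd k := by
    obtain ⟨K, hK⟩ := hc
    rcases Nat.eq_zero_or_pos k with rfl | hk
    · exact ⟨K, fun a x => by simpa using hK a⟩
    · exact ⟨0, fun a x => by rw [iteratedFDeriv_const_of_ne hk.ne']; simp⟩

lemma const' (c : F) : SmoothBdd (fun (_ : Λ) (_ : E) => c) := const ⟨‖c‖, fun _ => le_rfl⟩

lemma smul {r : Λ → E → ℝ} {f : Λ → E → F} (hr : SmoothBdd r) (hf : SmoothBdd f) :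
    SmoothBdd (fun a x => r a x • f a x) := hr.bilin hf (ContinuousLinearMap.lsmul ℝ ℝ)

lemma const_smul {f : Λ → E → F} (hf : SmoothBdd f) (r : ℝ) :
    SmoothBdd (fun a x => r • f a x) := (const' r).smul hf

lemma neg {f : Λ → E → F} (hf : SmoothBdd f) : SmoothBdd (fun a x => - f a x) := by
  simpa using hf.const_smul (-1)

lemma sub {f g : Λ → E → F} (hf : SmoothBdd f) (hg : SmoothBdd g) :
    SmoothBdd (fun a x => f a x - g a x) := by
  simpa [sub_eq_add_neg] using hf.add hg.neg

lemma sum {ι : Type*} {s : Finset ι} {f : ι → Λ → E → F} (hf : ∀ i ∈ s, SmoothBdd (f i)) :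
    SmoothBdd (fun a x => ∑ i ∈ s, f i a x) := by
  classical
  induction s using Finset.induction_on with
  | empty => simpa using const' (0 : F)
  | insert i s hi ih =>
    simp only [Finset.sum_insert hi]
    exact (hf i (Finset.mem_insert_self _ _)).add
      (ih fun j hj => hf j (Finset.mem_insert_of_mem hj))

lemma clm_apply {L : Λ → E → F →L[ℝ] G} {f : Λ → E → F} (hL : SmoothBdd L) (hf : SmoothBdd f) :
    SmoothBdd (fun a x => L a x (f a x)) :=
  hL.bilin hf (ContinuousLinearMap.id ℝ (F →L[ℝ] G))

lemma clm_comp {L : Λ → E → G →L[ℝ] H} {f : Λ → E → F →L[ℝ] G} (hL : SmoothBdd L)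
    (hf : SmoothBdd f) : SmoothBdd (fun a x => (L a x).comp (f a x)) :=
  hL.bilin hf (ContinuousLinearMap.compL ℝ F G H)

lemma reindex {Λ' : Type*} {f : Λ → E → F} (hf : SmoothBdd f) (g : Λ' → Λ) :
    SmoothBdd (fun a => f (g a)) where
  smooth a := hf.smooth _
  bdd k := by
    obtain ⟨c, hc⟩ := hf.bdd k
    exact ⟨c, fun a => hc _⟩

/-- Composition with a fixed function smooth on a neighbourhood of a compact set containing
the range. -/
lemma comp_left {f : Λ → E → F} (hf : SmoothBdd f) {g : F → G} {U K : Set F} (hU : IsOpen U)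
    (hg : ContDiffOn ℝ ∞ g U) (hK : IsCompact K) (hKU : K ⊆ U) (hfK : ∀ a x, f a x ∈ K) :
    SmoothBdd (fun a x => g (f a x)) where
  smooth a := by
    rw [contDiff_iff_contDiffAt]
    intro x
    exact ((hg.contDiffAt (hU.mem_nhds (hKU (hfK a x)))).comp x (hf.smooth a).contDiffAt)
  bdd k := by
    have h1 : ∀ i : ℕ, ∃ c : ℝ, ∀ y ∈ K, ‖iteratedFDerivWithin ℝ i g U y‖ ≤ c := by
      intro i
      have := (hg.continuousOn_iteratedFDerivWithin (m := i) (by exact_mod_cast le_top)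
        hU.uniqueDiffOn).mono hKU
      exact hK.exists_bound_of_continuousOn this
    choose c hc using h1
    choose e he0 he using hf.nonneg_bound
    set C := ∑ i ∈ Finset.range (k + 1), |c i|
    set D := 1 + ∑ i ∈ Finset.range (k + 1), e i
    have hD : 1 ≤ D := by
      have := Finset.sum_nonneg (s := Finset.range (k + 1)) (f := e) (fun i _ => he0 i)
      simp only [D]; linarith
    refine ⟨(Nat.factorial k : ℝ) * C * D ^ k, fun a x => ?_⟩
    refine norm_iteratedFDeriv_comp_le' (t := U) (N := ∞) ?_ hU.uniqueDiffOn hg (hf.smooth a)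
      (by exact_mod_cast le_top) x ?_ ?_
    · rintro _ ⟨x, rfl⟩; exact hKU (hfK a x)
    · intro i hi
      refine (hc i _ (hfK a x)).trans ((le_abs_self _).trans ?_)
      exact Finset.single_le_sum (f := fun i => |c i|) (fun _ _ => abs_nonneg _)
        (Finset.mem_range.2 (Nat.lt_succ_of_le hi))
    · intro i h1i hi
      refine (he i a x).trans ?_
      have h2 : e i ≤ D := by
        have := Finset.single_le_sum (f := e) (s := Finset.range (k + 1)) (fun i _ => he0 i)
          (Finset.mem_range.2 (Nat.lt_succ_of_le hi))
        simp only [D]; linarith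
      exact h2.trans (le_self_pow₀ hD (by omega))

end SmoothBdd

section Mollification

variable {E : Type} [NormedAddCommGroup E] [NormedSpace ℝ E] [FiniteDimensional ℝ E]
  [MeasurableSpace E] [BorelSpace E] {μ : Measure E} [μ.IsAddHaarMeasure]

lemma convolution_bound {Λ F G H : Type} [NormedAddCommGroup F] [NormedSpace ℝ F]
    [NormedAddCommGroup G] [NormedSpace ℝ G] [NormedAddCommGroup H] [NormedSpace ℝ H]
    (L : F →L[ℝ] G →L[ℝ] H) {θ : E → F} (hθ : ContDiff ℝ ∞ θ) (hcθ : HasCompactSupport θ)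
    {g : Λ → E → G} (hg : ∀ a, Continuous (g a)) {K : ℝ} (hK : ∀ a x, ‖g a x‖ ≤ K) (k : ℕ) :
    ∃ c : ℝ, ∀ a x, ‖iteratedFDeriv ℝ k (θ ⋆[L, μ] g a) x‖ ≤ c := by
  induction k generalizing F H with
  | zero =>
    refine ⟨∫ t, ‖L‖ * ‖θ t‖ * K ∂μ, fun a x => ?_⟩
    rw [norm_iteratedFDeriv_zero]
    refine norm_integral_le_of_norm_le ?_ (Filter.Eventually.of_forall fun t => ?_)
    · exact ((hθ.continuous.norm.integrable_of_hasCompactSupport hcθ.norm).const_mul _).mul_const _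
    · refine (L.le_opNorm₂ _ _).trans ?_
      exact mul_le_mul_of_nonneg_left (hK a _) (by positivity)
  | succ k ih =>
    obtain ⟨c, hc⟩ := ih (L.precompL E) (hθ.fderiv_right (m := ∞) (by simp)) (hcθ.fderiv ℝ)
    refine ⟨c, fun a x => ?_⟩
    have : fderiv ℝ (θ ⋆[L, μ] g a) = (fderiv ℝ θ ⋆[L.precompL E, μ] g a) := by
      funext y
      exact (hcθ.hasFDerivAt_convolution_left L (hθ.of_le (by simp))
        ((hg a).locallyIntegrable) y).fderiv
    rw [← norm_iteratedFDeriv_fderiv, this]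
    exact hc a x

/-- Mollification of `g` with kernel `ρ`. -/
noncomputable def mollify {F : Type} [NormedAddCommGroup F] [NormedSpace ℝ F] (μ : Measure E)
    (ρ : E → ℝ) (g : E → F) (x : E) : F :=
  ∫ z, ρ z • g (x - z) ∂μ

variable {F : Type} [NormedAddCommGroup F] [NormedSpace ℝ F]

set_option linter.unusedSectionVars false in
lemma mollify_eq (ρ : E → ℝ) (g : E → F) :
    mollify μ ρ g = (ρ ⋆[ContinuousLinearMap.lsmul ℝ ℝ, μ] g) := rfl

lemma SmoothBdd.mollify {Λ : Type} {ρ : E → ℝ} (hρ : ContDiff ℝ ∞ ρ) (hcρ : HasCompactSupport ρ)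
    {g : Λ → E → F} (hg : ∀ a, Continuous (g a)) {K : ℝ} (hK : ∀ a x, ‖g a x‖ ≤ K) :
    SmoothBdd (fun a => mollify μ ρ (g a)) where
  smooth a := by
    rw [mollify_eq]
    exact hcρ.contDiff_convolution_left _ hρ (hg a).locallyIntegrable
  bdd k := by
    obtain ⟨c, hc⟩ := convolution_bound (μ := μ) (ContinuousLinearMap.lsmul ℝ ℝ) hρ hcρ hg hK k
    exact ⟨c, fun a x => by rw [mollify_eq]; exact hc a x⟩

/-- The derivative of a mollification depends continuously, in the uniform norm, on the
function. -/
lemma exists_norm_fderiv_mollify_sub_le {ρ : E → ℝ} (hρ : ContDiff ℝ ∞ ρ)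
    (hcρ : HasCompactSupport ρ) :
    ∃ c : ℝ, 0 ≤ c ∧ ∀ f g : E → F, Continuous f → Continuous g → ∀ δ : ℝ,
      (∀ x, ‖f x - g x‖ ≤ δ) → ∀ x,
      ‖mollify μ ρ f x - mollify μ ρ g x‖ ≤ c * δ ∧
      ‖fderiv ℝ (mollify μ ρ f) x - fderiv ℝ (mollify μ ρ g) x‖ ≤ c * δ := by
  set L := (ContinuousLinearMap.lsmul ℝ ℝ : ℝ →L[ℝ] F →L[ℝ] F)
  have hρ' : ContDiff ℝ ∞ (fderiv ℝ ρ) := hρ.fderiv_right (by simp)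
  have hcρ' := hcρ.fderiv ℝ
  have key : ∀ {P H : Type} [NormedAddCommGroup P] [NormedSpace ℝ P] [NormedAddCommGroup H]
      [NormedSpace ℝ H] (L : P →L[ℝ] F →L[ℝ] H) {θ : E → P} (_ : Continuous θ)
      (_ : HasCompactSupport θ), ∃ c : ℝ, 0 ≤ c ∧
      ∀ (f g : E → F), Continuous f → Continuous g → ∀ δ : ℝ,
      (∀ x, ‖f x - g x‖ ≤ δ) → ∀ x,
      ‖(θ ⋆[L, μ] f) x - (θ ⋆[L, μ] g) x‖ ≤ c * δ := by
    intro P H _ _ _ _ L θ hθ hcθ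
    refine ⟨∫ t, ‖L‖ * ‖θ t‖ ∂μ, integral_nonneg fun t => by positivity, ?_⟩
    intro f g hf hg δ hδ x
    have h1 := hcθ.convolutionExists_left L hθ hf.locallyIntegrable (μ := μ) x
    have h2 := hcθ.convolutionExists_left L hθ hg.locallyIntegrable (μ := μ) x
    rw [convolution_def, convolution_def, ← integral_sub h1 h2, ← integral_mul_const]
    refine norm_integral_le_of_norm_le ?_ (Filter.Eventually.of_forall fun t => ?_)
    · exact ((hθ.norm.integrable_of_hasCompactSupport hcθ.norm).const_mul _).mul_const _
    · rw [← map_sub]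
      exact (L.le_opNorm₂ _ _).trans (mul_le_mul_of_nonneg_left (hδ _) (by positivity))
  obtain ⟨c, hc0, hc⟩ := key L hρ.continuous hcρ
  obtain ⟨e, -, he⟩ := key (L.precompL E) hρ'.continuous hcρ'
  refine ⟨max c e, le_max_of_le_left hc0, ?_⟩
  intro f g hf hg δ hδ x
  have hδ0 : 0 ≤ δ := (norm_nonneg _).trans (hδ x)
  rw [mollify_eq, mollify_eq,
    (hcρ.hasFDerivAt_convolution_left L (hρ.of_le (by simp)) (hf.locallyIntegrable) x).fderiv,
    (hcρ.hasFDerivAt_convolution_left L (hρ.of_le (by simp)) (hg.locallyIntegrable) x).fderiv]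
  exact ⟨(hc f g hf hg δ hδ x).trans
      (mul_le_mul_of_nonneg_right (le_max_left _ _) hδ0),
    (he f g hf hg δ hδ x).trans
      (mul_le_mul_of_nonneg_right (le_max_right _ _) hδ0)⟩

/-- Mollification commutes with differentiation, for a function differentiable with bounded
derivative near the relevant ball. -/
lemma hasFDerivAt_mollify [FiniteDimensional ℝ F] {ρ : E → ℝ} (hρ : Continuous ρ) {κ r C : ℝ} (hr : 0 < r)
    (hsupp : ∀ z, κ < ‖z‖ → ρ z = 0) {g : E → F} (hg : Continuous g) {x : E}
    (hd : ∀ y ∈ Metric.ball x (κ + r), DifferentiableAt ℝ g y)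
    (hC : ∀ y ∈ Metric.ball x (κ + r), ‖fderiv ℝ g y‖ ≤ C) :
    Integrable (fun z => ρ z • fderiv ℝ g (x - z)) μ ∧
    HasFDerivAt (mollify μ ρ g) (∫ z, ρ z • fderiv ℝ g (x - z) ∂μ) x := by
  have hcρ : HasCompactSupport ρ := by
    refine HasCompactSupport.intro (isCompact_closedBall (0 : E) κ) fun z hz => hsupp z ?_
    simpa using hz
  borelize (E →L[ℝ] F)
  have hintg : Integrable ρ μ := hρ.integrable_of_hasCompactSupport hcρ
  have hmem : ∀ z, ‖z‖ ≤ κ → ∀ y ∈ Metric.ball x r, y - z ∈ Metric.ball x (κ + r) := by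
    intro z hz y hy
    rw [Metric.mem_ball, dist_eq_norm] at hy ⊢
    calc ‖y - z - x‖ = ‖(y - x) - z‖ := by congr 1; abel
      _ ≤ ‖y - x‖ + ‖z‖ := norm_sub_le _ _
      _ < κ + r := by linarith
  have hmeas : AEStronglyMeasurable (fun z => ρ z • fderiv ℝ g (x - z)) μ := by
    refine (hρ.measurable.smul ?_).aestronglyMeasurable
    exact (measurable_fderiv ℝ g).comp (measurable_const.sub measurable_id)
  have h := hasFDerivAt_integral_of_dominated_of_fderiv_le (𝕜 := ℝ) (μ := μ)
    (F := fun y z => ρ z • g (y - z)) (F' := fun y z => ρ z • fderiv ℝ g (y - z))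
    (bound := fun z => ‖ρ z‖ * C) (Metric.ball_mem_nhds x hr)
    (Filter.Eventually.of_forall fun y =>
      (hρ.smul (hg.comp (continuous_const.sub continuous_id))).aestronglyMeasurable)
    ((hρ.smul (hg.comp (continuous_const.sub continuous_id))).integrable_of_hasCompactSupport
      hcρ.smul_right) hmeas
    (Filter.Eventually.of_forall fun z y hy => ?_) (hintg.norm.mul_const C)
    (Filter.Eventually.of_forall fun z y hy => ?_)
  · refine ⟨?_, h⟩
    refine (hintg.norm.mul_const C).mono' hmeas (Filter.Eventually.of_forall fun z => ?_)
    rw [norm_smul]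
    by_cases hz : ‖z‖ ≤ κ
    · exact mul_le_mul_of_nonneg_left (hC _ (hmem z hz x (Metric.mem_ball_self hr)))
        (norm_nonneg _)
    · simp [hsupp z (not_le.1 hz)]
  · rw [norm_smul]
    by_cases hz : ‖z‖ ≤ κ
    · exact mul_le_mul_of_nonneg_left (hC _ (hmem z hz y hy)) (norm_nonneg _)
    · simp [hsupp z (not_le.1 hz)]
  · by_cases hz : ‖z‖ ≤ κ
    · have h1 := (hd _ (hmem z hz y hy)).hasFDerivAt
      have h2 : HasFDerivAt (fun y => g (y - z)) (fderiv ℝ g (y - z)) y := by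
        simpa [Function.comp_def] using h1.comp y ((hasFDerivAt_id y).sub_const z)
      exact h2.const_smul (ρ z)
    · simpa [hsupp z (not_le.1 hz)] using hasFDerivAt_const (0 : F) y

end Mollification

section Taylor

variable {E F : Type*} [NormedAddCommGroup E] [NormedSpace ℝ E]
  [NormedAddCommGroup F] [NormedSpace ℝ F]

lemma norm_sub_le_of_fderiv_bound {f : E → F} (hf : Differentiable ℝ f) {C : ℝ}
    (hC : ∀ x, ‖fderiv ℝ f x‖ ≤ C) (x v : E) : ‖f (x + v) - f x‖ ≤ C * ‖v‖ := by
  simpa using convex_univ.norm_image_sub_le_of_norm_fderiv_le (𝕜 := ℝ) (f := f) (C := C)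
    (x := x) (y := x + v) (fun y _ => hf y) (fun y _ => hC y) (mem_univ _) (mem_univ _)

lemma hasDerivAt_line {f : E → F} {x v : E} {t : ℝ} (hf : DifferentiableAt ℝ f (x + t • v)) :
    HasDerivAt (fun τ : ℝ => f (x + τ • v)) (fderiv ℝ f (x + t • v) v) t := by
  have h : HasDerivAt (fun τ : ℝ => x + τ • v) v t := by
    simpa using ((hasDerivAt_id t).smul_const v).const_add x
  exact hf.hasFDerivAt.comp_hasDerivAt t h

lemma taylor_two {f : E → F} (hf : ContDiff ℝ 2 f) {C : ℝ}
    (hC : ∀ x, ‖fderiv ℝ (fderiv ℝ f) x‖ ≤ C) (x v : E) :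
    ‖f (x + v) - f x - fderiv ℝ f x v‖ ≤ C * ‖v‖ ^ 2 := by
  have hd := hf.differentiable (by norm_num)
  have hd2 : Differentiable ℝ (fderiv ℝ f) :=
    (hf.fderiv_right (m := 1) (by norm_num)).differentiable (by norm_num)
  have hC0 : 0 ≤ C := (norm_nonneg _).trans (hC x)
  have h := norm_image_sub_le_of_norm_deriv_le_segment_01'
    (f := fun τ : ℝ => f (x + τ • v) - τ • fderiv ℝ f x v)
    (f' := fun τ => fderiv ℝ f (x + τ • v) v - fderiv ℝ f x v) (C := C * ‖v‖ ^ 2)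
    (fun τ _ => ((hasDerivAt_line (hd _)).sub
      (by simpa using (hasDerivAt_id τ).smul_const (fderiv ℝ f x v))).hasDerivWithinAt) ?_
  · simpa [sub_right_comm] using h
  · intro τ hτ
    have h1 := norm_sub_le_of_fderiv_bound hd2 hC x (τ • v)
    rw [norm_smul, Real.norm_of_nonneg hτ.1] at h1
    rw [← sub_apply]
    calc _ ≤ ‖fderiv ℝ f (x + τ • v) - fderiv ℝ f x‖ * ‖v‖ := ContinuousLinearMap.le_opNorm _ _
      _ ≤ C * (τ * ‖v‖) * ‖v‖ := by gcongr
      _ ≤ C * (1 * ‖v‖) * ‖v‖ := by gcongr; exact hτ.2.le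
      _ = _ := by ring

lemma taylor_three {f : E → F} (hf : ContDiff ℝ 3 f) {C : ℝ}
    (hC : ∀ x, ‖fderiv ℝ (fderiv ℝ (fderiv ℝ f)) x‖ ≤ C) (x v : E) :
    ‖f (x + v) - f x - fderiv ℝ f x v - (1 / 2 : ℝ) • fderiv ℝ (fderiv ℝ f) x v v‖
      ≤ C * ‖v‖ ^ 3 := by
  have hd := hf.differentiable (by norm_num)
  have hd2 : ContDiff ℝ 2 (fderiv ℝ f) := hf.fderiv_right (m := 2) (by norm_num)
  have hC0 : 0 ≤ C := (norm_nonneg _).trans (hC x)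
  set D1 := fderiv ℝ f x v
  set D2 := fderiv ℝ (fderiv ℝ f) x v v with hD2
  have h := norm_image_sub_le_of_norm_deriv_le_segment_01'
    (f := fun τ : ℝ => f (x + τ • v) - τ • D1 - (τ ^ 2 / 2) • D2)
    (f' := fun τ => fderiv ℝ f (x + τ • v) v - D1 - τ • D2) (C := C * ‖v‖ ^ 3)
    (fun τ _ => (((hasDerivAt_line (hd _)).sub
      (by simpa using (hasDerivAt_id τ).smul_const D1)).sub
      (by simpa using ((hasDerivAt_pow 2 τ).div_const 2).smul_const D2)).hasDerivWithinAt) ?_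
  · convert h using 2
    simp only [one_smul, zero_smul]
    simp
    abel
  · intro τ hτ
    have h1 := taylor_two hd2 hC x (τ • v)
    rw [norm_smul, Real.norm_of_nonneg hτ.1] at h1
    have h2 : fderiv ℝ f (x + τ • v) v - D1 - τ • D2 =
        (fderiv ℝ f (x + τ • v) - fderiv ℝ f x - fderiv ℝ (fderiv ℝ f) x (τ • v)) v := by
      simp [D1, hD2]
    rw [h2]
    calc _ ≤ ‖fderiv ℝ f (x + τ • v) - fderiv ℝ f x - fderiv ℝ (fderiv ℝ f) x (τ • v)‖ * ‖v‖ :=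
          ContinuousLinearMap.le_opNorm _ _
      _ ≤ C * (τ * ‖v‖) ^ 2 * ‖v‖ := by gcongr
      _ ≤ C * (1 * ‖v‖) ^ 2 * ‖v‖ := by gcongr; exacts [mul_nonneg hτ.1 (norm_nonneg _), hτ.2.le]
      _ = _ := by ring

/-- Interpolation: a bounded function with bounded second derivative has a controlled first
derivative. -/
lemma norm_fderiv_le_interpolation {f : E → F} (hf : ContDiff ℝ 2 f) {A C : ℝ}
    (hA : ∀ x, ‖f x‖ ≤ A) (hC : ∀ x, ‖fderiv ℝ (fderiv ℝ f) x‖ ≤ C) {r : ℝ} (hr : 0 < r) (x : E) :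
    ‖fderiv ℝ f x‖ ≤ 2 * A / r + C * r := by
  have hA0 : 0 ≤ A := (norm_nonneg _).trans (hA x)
  have hC0 : 0 ≤ C := (norm_nonneg _).trans (hC x)
  refine ContinuousLinearMap.opNorm_le_of_unit_norm (by positivity) fun v hv => ?_
  have h := taylor_two hf hC x (r • v)
  rw [norm_smul, hv, Real.norm_of_nonneg hr.le, mul_one, map_smul] at h
  have h2 : ‖r • fderiv ℝ f x v‖ ≤ 2 * A + C * r ^ 2 := by
    calc ‖r • fderiv ℝ f x v‖
        = ‖(f (x + r • v) - f x) - (f (x + r • v) - f x - r • fderiv ℝ f x v)‖ := by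
          congr 1; abel
      _ ≤ ‖f (x + r • v) - f x‖ + ‖f (x + r • v) - f x - r • fderiv ℝ f x v‖ := norm_sub_le _ _
      _ ≤ (‖f (x + r • v)‖ + ‖f x‖) + C * r ^ 2 := add_le_add (norm_sub_le _ _) h
      _ ≤ _ := by linarith [hA x, hA (x + r • v)]
  rw [norm_smul, Real.norm_of_nonneg hr.le] at h2
  have h3 : ‖fderiv ℝ f x v‖ ≤ (2 * A + C * r ^ 2) / r := by
    rw [le_div_iff₀ hr]; linarith
  refine h3.trans (le_of_eq ?_)
  field_simp

end Taylor

/-- Coefficients of a symmetric jump scheme: `A` indexes the jumps, `inv` pairs opposite jumps. -/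
structure JumpData (Λ A E V : Type) [NormedAddCommGroup E] [NormedSpace ℝ E]
    [NormedAddCommGroup V] [NormedSpace ℝ V] where
  h : Λ → ℝ
  σ : A → Λ → E → E
  M : A → Λ → E → V →L[ℝ] V
  N : A → Λ → E → V →L[ℝ] V
  inv : A ≃ A

namespace JumpData

variable {Λ A E V : Type} [NormedAddCommGroup E] [NormedSpace ℝ E]

structure Good [NormedAddCommGroup V] [NormedSpace ℝ V] (D : JumpData Λ A E V) : Prop where
  h_pos : ∀ a, 0 < D.h a
  h_le : ∀ a, D.h a ≤ 1
  σ_odd : ∀ i, D.σ (D.inv i) = fun a x => - D.σ i a x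
  M_odd : ∀ i, D.M (D.inv i) = fun a x => - D.M i a x
  σ_sb : ∀ i, SmoothBdd (D.σ i)
  M_sb : ∀ i, SmoothBdd (D.M i)
  N_sb : ∀ i, SmoothBdd (D.N i)

/-- One step of the scheme. -/
noncomputable def step [Fintype A] [NormedAddCommGroup V] [NormedSpace ℝ V]
    (D : JumpData Λ A E V) (a : Λ) (w : E → V) (x : E) : V :=
  (Fintype.card A : ℝ)⁻¹ • ∑ i, (w (x + D.h a • D.σ i a x)
    + D.h a • D.M i a x (w (x + D.h a • D.σ i a x))
    + (D.h a) ^ 2 • D.N i a x (w (x + D.h a • D.σ i a x)))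

/-- The limiting generator of the scheme. -/
noncomputable def gen [Fintype A] [NormedAddCommGroup V] [NormedSpace ℝ V]
    (D : JumpData Λ A E V) (a : Λ) (w : E → V) (x : E) : V :=
  (Fintype.card A : ℝ)⁻¹ • ∑ i, ((1 / 2 : ℝ) • fderiv ℝ (fderiv ℝ w) x (D.σ i a x) (D.σ i a x)
    + D.M i a x (fderiv ℝ w x (D.σ i a x)) + D.N i a x (w x))

noncomputable def iter [Fintype A] [NormedAddCommGroup V] [NormedSpace ℝ V]
    (D : JumpData Λ A E V) (f : E → V) (r : ℕ → Λ) : ℕ → E → V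
  | 0 => f
  | j + 1 => D.step (r j) (D.iter f r j)

section Stability

variable [NormedAddCommGroup V] [InnerProductSpace ℝ V]

lemma norm_pair_le {p q : V} {K m : ℝ} (hp : ‖p‖ ≤ K) (hq : ‖q‖ ≤ K) (L : V →L[ℝ] V)
    (hL : ‖L‖ ≤ m) : ‖(p + L p) + (q - L q)‖ ≤ (2 + m ^ 2) * K := by
  have hK : 0 ≤ K := (norm_nonneg _).trans hp
  have hm : 0 ≤ m := (norm_nonneg _).trans hL
  have h1 : (p + L p) + (q - L q) = (p + q) + L (p - q) := by rw [map_sub]; abel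
  have h2 := parallelogram_law_with_norm ℝ p q
  have h3 : ‖L (p - q)‖ ≤ m * ‖p - q‖ := (L.le_opNorm _).trans (by gcongr)
  rw [h1]
  refine (norm_add_le _ _).trans ?_
  set X := ‖p + q‖
  set Y := ‖p - q‖
  have hX : 0 ≤ X := norm_nonneg _
  have hY : 0 ≤ Y := norm_nonneg _
  have h4 : X ^ 2 + Y ^ 2 ≤ 4 * K ^ 2 := by nlinarith [norm_nonneg p, norm_nonneg q]
  have h5 : (X + m * Y) ^ 2 ≤ ((2 + m ^ 2) * K) ^ 2 := by
    nlinarith [sq_nonneg (m * X - Y), mul_nonneg (sq_nonneg m) (sq_nonneg K), sq_nonneg (m ^ 2 * K)]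
  have h6 := abs_le_of_sq_le_sq h5 (by positivity)
  linarith [le_abs_self (X + m * Y)]

variable [Fintype A] [Nonempty A]

lemma step_bound {D : JumpData Λ A E V} (hD : D.Good) :
    ∃ c : ℝ, 0 ≤ c ∧ ∀ a (w : E → V) (K : ℝ), (∀ x, ‖w x‖ ≤ K) →
      ∀ x, ‖D.step a w x‖ ≤ (1 + c * (D.h a) ^ 2) * K := by
  choose m hm0 hm using fun i => (hD.M_sb i).bound_zero
  choose n hn0 hn using fun i => (hD.N_sb i).bound_zero
  set n' := ∑ i, n i
  set m' := ∑ i, (m i) ^ 2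
  have hn' : ∀ i, n i ≤ n' := fun i =>
    Finset.single_le_sum (f := n) (fun i _ => hn0 i) (Finset.mem_univ i)
  have hm' : ∀ i, (m i) ^ 2 ≤ m' := fun i =>
    Finset.single_le_sum (f := fun i => (m i) ^ 2) (fun i _ => by positivity) (Finset.mem_univ i)
  have hm'0 : 0 ≤ m' := Finset.sum_nonneg fun i _ => by positivity
  have hn'0 : 0 ≤ n' := Finset.sum_nonneg fun i _ => hn0 i
  refine ⟨m' + n', by positivity, fun a w K hw x => ?_⟩
  have hK : 0 ≤ K := (norm_nonneg _).trans (hw x)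
  have hcard : (0 : ℝ) < Fintype.card A := by exact_mod_cast Fintype.card_pos
  set h := D.h a
  have hh : 0 ≤ h := (hD.h_pos a).le
  set W : A → V := fun i => w (x + h • D.σ i a x)
  have e1 : ∑ i, (W i + h • D.M i a x (W i)) =
      (1 / 2 : ℝ) • ∑ i, ((W i + h • D.M i a x (W i)) +
        (W (D.inv i) - h • D.M i a x (W (D.inv i)))) := by
    have h2 : ∑ i, (W (D.inv i) - h • D.M i a x (W (D.inv i)))
        = ∑ i, (W i + h • D.M i a x (W i)) := by
      rw [← D.inv.sum_comp (fun i => W i + h • D.M i a x (W i))]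
      refine Finset.sum_congr rfl fun i _ => ?_
      rw [hD.M_odd i]; simp [sub_eq_add_neg]
    rw [Finset.sum_add_distrib (f := fun i => W i + h • D.M i a x (W i)), h2, ← two_smul ℝ (∑ i, (W i + h • D.M i a x (W i))), smul_smul]
    norm_num
  have e2 : ‖∑ i, (W i + h • D.M i a x (W i))‖ ≤
      Fintype.card A * ((1 + m' * h ^ 2) * K) := by
    rw [e1, norm_smul]
    have : ‖∑ i, ((W i + h • D.M i a x (W i)) +
        (W (D.inv i) - h • D.M i a x (W (D.inv i))))‖ ≤ ∑ _i : A, (2 + m' * h ^ 2) * K := by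
      refine norm_sum_le_of_le _ fun i _ => ?_
      refine (norm_pair_le (hw _) (hw _) (h • D.M i a x) (m := h * m i) ?_).trans ?_
      · rw [norm_smul, Real.norm_of_nonneg hh]
        exact mul_le_mul_of_nonneg_left (hm i a x) hh
      · refine mul_le_mul_of_nonneg_right ?_ hK
        nlinarith [hm' i, sq_nonneg h]
    rw [Finset.sum_const, nsmul_eq_mul, Finset.card_univ] at this
    rw [Real.norm_of_nonneg (by norm_num)]
    have h0 : 0 ≤ (Fintype.card A : ℝ) * (m' * h ^ 2 * K) := by positivity
    nlinarith
  have e3 : ‖∑ i, h ^ 2 • D.N i a x (W i)‖ ≤ Fintype.card A * (n' * h ^ 2 * K) := by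
    have : ‖∑ i, h ^ 2 • D.N i a x (W i)‖ ≤ ∑ _i : A, n' * h ^ 2 * K := by
      refine norm_sum_le_of_le _ fun i _ => ?_
      rw [norm_smul, Real.norm_of_nonneg (by positivity)]
      have h1 := (D.N i a x).le_opNorm (W i)
      have h2 : ‖D.N i a x‖ * ‖W i‖ ≤ n' * K := by
        gcongr
        · exact (hn i a x).trans (hn' i)
        · exact hw _
      nlinarith [sq_nonneg h]
    rwa [Finset.sum_const, nsmul_eq_mul, Finset.card_univ] at this
  rw [step, Finset.sum_add_distrib, norm_smul, Real.norm_of_nonneg (by positivity),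
    inv_mul_le_iff₀ hcard]
  refine (norm_add_le _ _).trans ((add_le_add e2 e3).trans (le_of_eq ?_))
  ring

lemma iter_bound {D : JumpData Λ A E V} (hD : D.Good) (τ : ℝ) :
    ∃ c : ℝ, 0 ≤ c ∧ ∀ (f : E → V) (K : ℝ), (∀ x, ‖f x‖ ≤ K) → ∀ (r : ℕ → Λ) (j : ℕ),
      ∑ i ∈ Finset.range j, (D.h (r i)) ^ 2 ≤ τ → ∀ x, ‖D.iter f r j x‖ ≤ c * K := by
  obtain ⟨c, hc0, hc⟩ := step_bound hD
  have key : ∀ (f : E → V) (K : ℝ), (∀ x, ‖f x‖ ≤ K) → ∀ (r : ℕ → Λ) (j : ℕ) x,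
      ‖D.iter f r j x‖ ≤ Real.exp (c * ∑ i ∈ Finset.range j, (D.h (r i)) ^ 2) * K := by
    intro f K hf r j
    induction j with
    | zero => intro x; simpa [iter] using hf x
    | succ j ih =>
      intro x
      have hK : 0 ≤ K := (norm_nonneg _).trans (hf x)
      refine (hc (r j) _ _ ih x).trans ?_
      rw [Finset.sum_range_succ, mul_add, Real.exp_add, ← mul_assoc]
      refine mul_le_mul_of_nonneg_right ?_ hK
      rw [mul_comm]
      refine mul_le_mul_of_nonneg_left ?_ (Real.exp_pos _).le
      linarith [Real.add_one_le_exp (c * (D.h (r j)) ^ 2)]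
  refine ⟨Real.exp (c * τ), (Real.exp_pos _).le, fun f K hf r j hj x => ?_⟩
  have hK : 0 ≤ K := (norm_nonneg _).trans (hf x)
  refine (key f K hf r j x).trans (mul_le_mul_of_nonneg_right ?_ hK)
  exact Real.exp_le_exp.2 (mul_le_mul_of_nonneg_left hj hc0)

end Stability

end JumpData

section Jet

variable {d : ℕ} {V : Type} [NormedAddCommGroup V] [InnerProductSpace ℝ V]

/-- First-order jets of `V`-valued functions on `ℝ^d`. -/
abbrev Jet (d : ℕ) (V : Type) [NormedAddCommGroup V] [InnerProductSpace ℝ V] : Type :=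
  PiLp 2 (fun _ : Option (Fin d) => V)

noncomputable def jetSingle (o : Option (Fin d)) : V →L[ℝ] Jet d V :=
  ((PiLp.continuousLinearEquiv 2 ℝ (fun _ : Option (Fin d) => V)).symm :
    (Option (Fin d) → V) →L[ℝ] Jet d V) ∘L ContinuousLinearMap.single ℝ (fun _ : Option (Fin d) => V) o

noncomputable def jetProj (o : Option (Fin d)) : Jet d V →L[ℝ] V :=
  PiLp.proj 2 (fun _ : Option (Fin d) => V) o

lemma jetProj_single (o o' : Option (Fin d)) (v : V) :
    jetProj o (jetSingle o' v) = if o = o' then v else 0 := by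
  simp [jetProj, jetSingle]

lemma jet_ext {a b : Jet d V} (h : ∀ o, jetProj o a = jetProj o b) : a = b := by
  ext o
  exact h o

/-- The first-order jet of `w`. -/
noncomputable def jet (w : EuclideanSpace ℝ (Fin d) → V) (x : EuclideanSpace ℝ (Fin d)) :
    Jet d V :=
  jetSingle none (w x) + ∑ l, jetSingle (some l) (fderiv ℝ w x (𝐞 l))

lemma jetProj_none_jet (w : EuclideanSpace ℝ (Fin d) → V) (x) :
    jetProj none (jet w x) = w x := by
  simp [jet, jetProj_single]

lemma jetProj_some_jet (w : EuclideanSpace ℝ (Fin d) → V) (x) (l : Fin d) :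
    jetProj (some l) (jet w x) = fderiv ℝ w x (𝐞 l) := by
  simp [jet, jetProj_single]

/-- Recover the derivative from the jet. -/
noncomputable def jetDeriv : Jet d V →L[ℝ] (EuclideanSpace ℝ (Fin d) →L[ℝ] V) :=
  ∑ l, (ContinuousLinearMap.smulRightL ℝ (EuclideanSpace ℝ (Fin d)) V
    (EuclideanSpace.proj l)).comp (jetProj (some l))

lemma clm_eq_sum {F : Type*} [NormedAddCommGroup F] [NormedSpace ℝ F]
    (L : EuclideanSpace ℝ (Fin d) →L[ℝ] F) (v : EuclideanSpace ℝ (Fin d)) :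
    L v = ∑ l, v l • L (𝐞 l) := by
  conv_lhs => rw [← (EuclideanSpace.basisFun (Fin d) ℝ).sum_repr v]
  simp [map_sum]

lemma jetDeriv_jet (w : EuclideanSpace ℝ (Fin d) → V) (x) : jetDeriv (jet w x) = fderiv ℝ w x := by
  ext v
  rw [clm_eq_sum (fderiv ℝ w x) v]
  simp [jetDeriv, jetProj_some_jet, ContinuousLinearMap.smulRight_apply]

lemma SmoothBdd.jet {Λ : Type} {w : Λ → EuclideanSpace ℝ (Fin d) → V} (hw : SmoothBdd w) :
    SmoothBdd (fun a => jet (w a)) :=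
  (hw.clm (jetSingle none)).add (SmoothBdd.sum fun l _ =>
    (hw.fderiv.clm (ContinuousLinearMap.apply ℝ V (𝐞 l))).clm
      (jetSingle (some l)))

lemma contDiff_jet {w : EuclideanSpace ℝ (Fin d) → V} (hw : ContDiff ℝ ∞ w) :
    ContDiff ℝ ∞ (jet w) := by
  refine ((jetSingle none).contDiff.comp hw).add (ContDiff.sum fun l _ => ?_)
  exact (jetSingle (some l)).contDiff.comp
    ((hw.fderiv_right (m := ∞) (by simp)).clm_apply contDiff_const)

lemma norm_iteratedFDeriv_clm_comp_le {E F G : Type*} [NormedAddCommGroup E] [NormedSpace ℝ E]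
    [NormedAddCommGroup F] [NormedSpace ℝ F] [NormedAddCommGroup G] [NormedSpace ℝ G]
    (L : F →L[ℝ] G) {f : E → F} (hf : ContDiff ℝ ∞ f) (k : ℕ) (x : E) :
    ‖iteratedFDeriv ℝ k (fun y => L (f y)) x‖ ≤ ‖L‖ * ‖iteratedFDeriv ℝ k f x‖ :=
  L.norm_iteratedFDeriv_comp_left hf.contDiffAt (by exact_mod_cast le_top)

lemma iteratedFDeriv_succ_le_jet {w : EuclideanSpace ℝ (Fin d) → V} (hw : ContDiff ℝ ∞ w)
    (k : ℕ) (x) : ‖iteratedFDeriv ℝ (k + 1) w x‖ ≤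
      ‖(jetDeriv : Jet d V →L[ℝ] _)‖ * ‖iteratedFDeriv ℝ k (jet w) x‖ := by
  rw [← norm_iteratedFDeriv_fderiv]
  have : fderiv ℝ w = fun x => jetDeriv (jet w x) := by
    funext x; exact (jetDeriv_jet w x).symm
  rw [this]
  exact norm_iteratedFDeriv_clm_comp_le _ (contDiff_jet hw) k x

end Jet

namespace JumpData

variable {Λ A V : Type} {d : ℕ} [NormedAddCommGroup V] [InnerProductSpace ℝ V]

local notation "𝔼" => EuclideanSpace ℝ (Fin d)

/-- The scheme satisfied by the jets of the iterates. -/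
noncomputable def jet (D : JumpData Λ A (EuclideanSpace ℝ (Fin d)) V) :
    JumpData Λ A (EuclideanSpace ℝ (Fin d)) (Jet d V) where
  h := D.h
  σ := D.σ
  M i a x := (∑ o, (jetSingle o).comp ((D.M i a x).comp (jetProj o))) +
    ∑ l, (jetSingle (some l)).comp
      ((fderiv ℝ (D.M i a) x (𝐞 l)).comp (jetProj none) +
        ∑ j, (fderiv ℝ (D.σ i a) x (𝐞 l) j) • jetProj (some j))
  N i a x := (∑ o, (jetSingle o).comp ((D.N i a x).comp (jetProj o))) +
    ∑ l, (jetSingle (some l)).comp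
      ((fderiv ℝ (D.N i a) x (𝐞 l)).comp (jetProj none) +
        ∑ j, (fderiv ℝ (D.σ i a) x (𝐞 l) j) •
          (D.M i a x + D.h a • D.N i a x).comp (jetProj (some j)))
  inv := D.inv

lemma jet_good {D : JumpData Λ A 𝔼 V} (hD : D.Good) : D.jet.Good where
  h_pos := hD.h_pos
  h_le := hD.h_le
  σ_odd := hD.σ_odd
  M_odd i := by
    funext a x
    simp only [jet]
    rw [hD.M_odd i, hD.σ_odd i]
    have e1 : fderiv ℝ (fun x => - D.M i a x) x = - fderiv ℝ (D.M i a) x := fderiv_fun_neg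
    have e2 : fderiv ℝ (fun x => - D.σ i a x) x = - fderiv ℝ (D.σ i a) x := fderiv_fun_neg
    rw [e1, e2]
    refine ContinuousLinearMap.ext fun W => jet_ext fun o => ?_
    cases o with
    | none => simp [map_sum, jetProj_single, Fintype.sum_option]
    | some l =>
      simp only [map_add, map_sum, map_neg, add_apply, sum_apply,
        neg_apply, ContinuousLinearMap.comp_apply, jetProj_single, Fintype.sum_option,
        Option.some.injEq, Finset.sum_ite_eq, Finset.mem_univ, if_true, reduceCtorEq, if_false,
        FunLike.coe_smul, Pi.smul_apply, PiLp.neg_apply, neg_smul, Finset.sum_neg_distrib]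
      rw [neg_add, ← Finset.sum_neg_distrib]
      congr 1
      · abel
      · refine Finset.sum_congr rfl fun j _ => ?_
        abel
  σ_sb := hD.σ_sb
  M_sb i := by
    refine SmoothBdd.add (SmoothBdd.sum fun o _ => ?_) (SmoothBdd.sum fun l _ => ?_)
    · exact (SmoothBdd.const' _).clm_comp ((hD.M_sb i).clm_comp (SmoothBdd.const' _))
    · refine (SmoothBdd.const' _).clm_comp (SmoothBdd.add ?_ (SmoothBdd.sum fun j _ => ?_))
      · exact ((hD.M_sb i).fderiv.clm_apply (SmoothBdd.const' _)).clm_comp (SmoothBdd.const' _)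
      · refine SmoothBdd.smul ?_ (SmoothBdd.const' _)
        exact ((hD.σ_sb i).fderiv.clm_apply (SmoothBdd.const' _)).clm
          (EuclideanSpace.proj j : 𝔼 →L[ℝ] ℝ)
  N_sb i := by
    refine SmoothBdd.add (SmoothBdd.sum fun o _ => ?_) (SmoothBdd.sum fun l _ => ?_)
    · exact (SmoothBdd.const' _).clm_comp ((hD.N_sb i).clm_comp (SmoothBdd.const' _))
    · refine (SmoothBdd.const' _).clm_comp (SmoothBdd.add ?_ (SmoothBdd.sum fun j _ => ?_))
      · exact ((hD.N_sb i).fderiv.clm_apply (SmoothBdd.const' _)).clm_comp (SmoothBdd.const' _)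
      · refine SmoothBdd.smul ?_ (SmoothBdd.clm_comp ?_ (SmoothBdd.const' _))
        · exact ((hD.σ_sb i).fderiv.clm_apply (SmoothBdd.const' _)).clm
            (EuclideanSpace.proj j : 𝔼 →L[ℝ] ℝ)
        · refine (hD.M_sb i).add (SmoothBdd.smul (SmoothBdd.const ⟨1, fun a => ?_⟩) (hD.N_sb i))
          rw [Real.norm_of_nonneg (hD.h_pos a).le]
          exact hD.h_le a

variable [Fintype A]

lemma contDiff_step {D : JumpData Λ A 𝔼 V} (hD : D.Good) (a : Λ) {w : 𝔼 → V}
    (hw : ContDiff ℝ ∞ w) : ContDiff ℝ ∞ (D.step a w) := by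
  have h1 : ∀ i, ContDiff ℝ ∞ (fun x => w (x + D.h a • D.σ i a x)) := fun i =>
    hw.comp (contDiff_id.add (((hD.σ_sb i).smooth a).const_smul _))
  refine ContDiff.const_smul _ (ContDiff.sum fun i _ => ?_)
  exact ((h1 i).add ((((hD.M_sb i).smooth a).clm_apply (h1 i)).const_smul _)).add
    ((((hD.N_sb i).smooth a).clm_apply (h1 i)).const_smul _)

lemma contDiff_iter {D : JumpData Λ A 𝔼 V} (hD : D.Good) {f : 𝔼 → V} (hf : ContDiff ℝ ∞ f)
    (r : ℕ → Λ) (j : ℕ) : ContDiff ℝ ∞ (D.iter f r j) := by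
  induction j with
  | zero => exact hf
  | succ j ih => exact contDiff_step hD _ ih

lemma jetProj_some_jet_M (D : JumpData Λ A 𝔼 V) (i : A) (a : Λ) (x : 𝔼) (l : Fin d) (w : 𝔼 → V)
    (y : 𝔼) : jetProj (some l) (D.jet.M i a x (_root_.jet w y)) =
      D.M i a x (fderiv ℝ w y (𝐞 l)) +
        (fderiv ℝ (D.M i a) x (𝐞 l) (w y) +
        fderiv ℝ w y (fderiv ℝ (D.σ i a) x (𝐞 l))) := by
  rw [clm_eq_sum (fderiv ℝ w y) (fderiv ℝ (D.σ i a) x (𝐞 l))]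
  simp only [jet, map_add, map_sum, add_apply, sum_apply,
    ContinuousLinearMap.comp_apply, jetProj_single, Fintype.sum_option, jetProj_some_jet,
    Option.some.injEq, Finset.sum_ite_eq, Finset.mem_univ, if_true, reduceCtorEq, if_false,
    FunLike.coe_smul, Pi.smul_apply, jetProj_none_jet, zero_add]
  rw [Finset.sum_eq_single l (fun b _ hb => by simp [Ne.symm hb]) (by simp)]
  simp

lemma jetProj_some_jet_N (D : JumpData Λ A 𝔼 V) (i : A) (a : Λ) (x : 𝔼) (l : Fin d) (w : 𝔼 → V)
    (y : 𝔼) : jetProj (some l) (D.jet.N i a x (_root_.jet w y)) =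
      D.N i a x (fderiv ℝ w y (𝐞 l)) +
        (fderiv ℝ (D.N i a) x (𝐞 l) (w y) +
        (D.M i a x + D.h a • D.N i a x)
          (fderiv ℝ w y (fderiv ℝ (D.σ i a) x (𝐞 l)))) := by
  rw [clm_eq_sum (fderiv ℝ w y) (fderiv ℝ (D.σ i a) x (𝐞 l)), map_sum]
  simp only [jet, map_add, map_sum, map_smul, add_apply, sum_apply,
    ContinuousLinearMap.comp_apply, jetProj_single, Fintype.sum_option, jetProj_some_jet,
    Option.some.injEq, Finset.sum_ite_eq, Finset.mem_univ, if_true, reduceCtorEq, if_false,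
    FunLike.coe_smul, Pi.smul_apply, jetProj_none_jet, zero_add]
  rw [Finset.sum_eq_single l (fun b _ hb => by simp [Ne.symm hb]) (by simp)]
  simp

lemma jet_step {D : JumpData Λ A 𝔼 V} (hD : D.Good) (a : Λ) {w : 𝔼 → V} (hw : ContDiff ℝ ∞ w) :
    _root_.jet (D.step a w) = D.jet.step a (_root_.jet w) := by
  have hwd : Differentiable ℝ w := hw.differentiable (by simp)
  funext x
  refine jet_ext fun o => ?_
  cases o with
  | none =>
    simp [jetProj_none_jet, step, map_sum, jet, jetProj_single, Fintype.sum_option]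
  | some l =>
    rw [jetProj_some_jet]
    have hs : ∀ i, HasFDerivAt (fun x => w (x + D.h a • D.σ i a x))
        ((fderiv ℝ w (x + D.h a • D.σ i a x)).comp
          (ContinuousLinearMap.id ℝ 𝔼 + D.h a • fderiv ℝ (D.σ i a) x)) x := fun i =>
      (hwd _).hasFDerivAt.comp x
        ((hasFDerivAt_id x).add (((hD.σ_sb i).differentiable a x).hasFDerivAt.fun_const_smul (D.h a)))
    have hM : ∀ i, HasFDerivAt (D.M i a) (fderiv ℝ (D.M i a) x) x := fun i =>
      ((hD.M_sb i).differentiable a x).hasFDerivAt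
    have hN : ∀ i, HasFDerivAt (D.N i a) (fderiv ℝ (D.N i a) x) x := fun i =>
      ((hD.N_sb i).differentiable a x).hasFDerivAt
    have hT : HasFDerivAt (D.step a w) _ x := HasFDerivAt.fun_const_smul
      (HasFDerivAt.fun_sum (u := Finset.univ) fun i _ =>
      ((hs i).fun_add (((hM i).clm_apply (hs i)).fun_const_smul (D.h a))).fun_add
        (((hN i).clm_apply (hs i)).fun_const_smul ((D.h a) ^ 2)))
          ((Fintype.card A : ℝ)⁻¹)
    refine (congrArg (fun L : 𝔼 →L[ℝ] V => L (𝐞 l)) hT.fderiv).trans ?_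
    simp only [step, map_smul, map_sum, FunLike.coe_smul, Pi.smul_apply,
      sum_apply]
    congr 1
    refine Finset.sum_congr rfl fun i _ => ?_
    have hMp := jetProj_some_jet_M D i a x l w (x + D.h a • D.σ i a x)
    have hNp := jetProj_some_jet_N D i a x l w (x + D.h a • D.σ i a x)
    simp only [map_add, map_smul]
    change _ = jetProj (some l) (_root_.jet w (x + D.h a • D.σ i a x)) + D.h a • jetProj (some l) (D.jet.M i a x (_root_.jet w (x + D.h a • D.σ i a x)))
      + (D.h a) ^ 2 • jetProj (some l) (D.jet.N i a x (_root_.jet w (x + D.h a • D.σ i a x)))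
    rw [hMp, hNp, jetProj_some_jet]
    simp
    module

end JumpData

lemma ofNat_le_infty (n : ℕ) : (n : WithTop ℕ∞) ≤ ∞ := by
  exact_mod_cast (le_top : (n : ℕ∞) ≤ ⊤)

namespace JumpData

variable {Λ A V Θ : Type} {d : ℕ} [NormedAddCommGroup V] [InnerProductSpace ℝ V]
  [Fintype A] [Nonempty A]

local notation "𝔼" => EuclideanSpace ℝ (Fin d)

lemma jet_iter {D : JumpData Λ A 𝔼 V} (hD : D.Good) {f : 𝔼 → V} (hf : ContDiff ℝ ∞ f)
    (r : ℕ → Λ) (j : ℕ) : _root_.jet (D.iter f r j) = D.jet.iter (_root_.jet f) r j := by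
  induction j with
  | zero => rfl
  | succ j ih =>
    change _root_.jet (D.step (r j) (D.iter f r j)) = D.jet.step (r j) (D.jet.iter (_root_.jet f) r j)
    rw [jet_step hD _ (contDiff_iter hD hf r j), ih]

/-- Step sequences of total squared length at most `τ`. -/
abbrev Run (D : JumpData Λ A 𝔼 V) (τ : ℝ) : Type :=
  {p : (ℕ → Λ) × ℕ // ∑ i ∈ Finset.range p.2, (D.h (p.1 i)) ^ 2 ≤ τ}

lemma exists_bound_iteratedFDeriv_iter (τ : ℝ) (k : ℕ) : ∀ {V : Type} [NormedAddCommGroup V]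
    [InnerProductSpace ℝ V] {D : JumpData Λ A 𝔼 V}, D.Good → ∀ {f : 𝔼 → V},
    SmoothBdd (fun _ : Unit => f) →
    ∃ c : ℝ, ∀ (r : ℕ → Λ) (j : ℕ), ∑ i ∈ Finset.range j, (D.h (r i)) ^ 2 ≤ τ → ∀ x,
      ‖iteratedFDeriv ℝ k (D.iter f r j) x‖ ≤ c := by
  induction k with
  | zero =>
    intro V _ _ D hD f hf
    obtain ⟨c, hc0, hc⟩ := iter_bound hD τ
    obtain ⟨K, hK0, hK⟩ := hf.bound_zero
    refine ⟨c * K, fun r j hj x => ?_⟩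
    rw [norm_iteratedFDeriv_zero]
    exact hc f K (hK ()) r j hj x
  | succ k ih =>
    intro V _ _ D hD f hf
    obtain ⟨c, hc⟩ := ih (jet_good hD) hf.jet
    refine ⟨‖(jetDeriv : Jet d V →L[ℝ] _)‖ * c, fun r j hj x => ?_⟩
    refine (iteratedFDeriv_succ_le_jet (contDiff_iter hD (hf.smooth ()) r j) k x).trans ?_
    rw [jet_iter hD (hf.smooth ())]
    gcongr
    exact hc r j hj x

lemma smoothBdd_iter {D : JumpData Λ A 𝔼 V} (hD : D.Good) (τ : ℝ) {f : 𝔼 → V}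
    (hf : SmoothBdd (fun _ : Unit => f)) :
    SmoothBdd (fun p : D.Run τ => D.iter f p.1.1 p.1.2) where
  smooth p := contDiff_iter hD (hf.smooth ()) _ _
  bdd k := by
    obtain ⟨c, hc⟩ := exists_bound_iteratedFDeriv_iter τ k hD hf
    exact ⟨c, fun p => hc _ _ p.2⟩

lemma smoothBdd_gen {D : JumpData Λ A 𝔼 V} (hD : D.Good) {W : Θ → 𝔼 → V} (hW : SmoothBdd W) :
    SmoothBdd (fun p : Λ × Θ => D.gen p.1 (W p.2)) := by
  have hW' : SmoothBdd (fun p : Λ × Θ => W p.2) := hW.reindex _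
  have hσ : ∀ i, SmoothBdd (fun p : Λ × Θ => D.σ i p.1) := fun i => (hD.σ_sb i).reindex _
  have hM : ∀ i, SmoothBdd (fun p : Λ × Θ => D.M i p.1) := fun i => (hD.M_sb i).reindex _
  have hN : ∀ i, SmoothBdd (fun p : Λ × Θ => D.N i p.1) := fun i => (hD.N_sb i).reindex _
  refine SmoothBdd.const_smul (SmoothBdd.sum fun i _ => ?_) _
  refine ((SmoothBdd.const_smul ?_ _).add ?_).add ?_
  · exact (hW'.fderiv.fderiv.clm_apply (hσ i)).clm_apply (hσ i)
  · exact (hM i).clm_apply (hW'.fderiv.clm_apply (hσ i))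
  · exact (hN i).clm_apply hW'

lemma consistency {D : JumpData Λ A 𝔼 V} (hD : D.Good) {W : Θ → 𝔼 → V} (hW : SmoothBdd W) :
    ∃ C : ℝ, 0 ≤ C ∧ ∀ a θ x,
      ‖(((D.h a) ^ 2)⁻¹ • (D.step a (W θ) x - W θ x)) - D.gen a (W θ) x‖ ≤ C * D.h a := by
  obtain ⟨C1, hC10, hC1⟩ := hW.fderiv.bound_zero
  obtain ⟨C2, hC20, hC2⟩ := hW.fderiv.fderiv.bound_zero
  obtain ⟨C3, hC30, hC3⟩ := hW.fderiv.fderiv.fderiv.bound_zero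
  choose s hs0 hs using fun i => (hD.σ_sb i).bound_zero
  choose m hm0 hm using fun i => (hD.M_sb i).bound_zero
  choose n hn0 hn using fun i => (hD.N_sb i).bound_zero
  refine ⟨(Fintype.card A : ℝ)⁻¹ * ∑ i, (C3 * s i ^ 3 + m i * (C2 * s i ^ 2) + n i * (C1 * s i)),
    by have := fun i => add_nonneg (add_nonneg (mul_nonneg hC30 (pow_nonneg (hs0 i) 3))
        (mul_nonneg (hm0 i) (mul_nonneg hC20 (pow_nonneg (hs0 i) 2))))
        (mul_nonneg (hn0 i) (mul_nonneg hC10 (hs0 i)))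
       exact mul_nonneg (by positivity) (Finset.sum_nonneg fun i _ => this i), fun a θ x => ?_⟩
  set w := W θ
  set h := D.h a
  have hh : 0 < h := hD.h_pos a
  have hsm : ContDiff ℝ ∞ w := hW.smooth θ
  have hcard : (Fintype.card A : ℝ) ≠ 0 := by exact_mod_cast Fintype.card_ne_zero
  have hodd : ∑ i, (fderiv ℝ w x (h • D.σ i a x) + h • D.M i a x (w x)) = 0 := by
    have h1 := Equiv.sum_comp D.inv
      (fun i => fderiv ℝ w x (h • D.σ i a x) + h • D.M i a x (w x))
    simp only [hD.σ_odd, hD.M_odd, smul_neg, map_neg, neg_apply, ← neg_add,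
      Finset.sum_neg_distrib] at h1
    have h2 : (2 : ℝ) • ∑ i, (fderiv ℝ w x (h • D.σ i a x) + h • D.M i a x (w x)) = 0 := by
      rw [two_smul]; nth_rewrite 1 [← h1]; simp
    exact (smul_eq_zero.1 h2).resolve_left two_ne_zero
  have key : D.step a w x - w x - h ^ 2 • D.gen a w x = (Fintype.card A : ℝ)⁻¹ • ∑ i,
      ((w (x + h • D.σ i a x) - w x - fderiv ℝ w x (h • D.σ i a x) -
          (1 / 2 : ℝ) • fderiv ℝ (fderiv ℝ w) x (h • D.σ i a x) (h • D.σ i a x)) +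
        h • D.M i a x (w (x + h • D.σ i a x) - w x - fderiv ℝ w x (h • D.σ i a x)) +
        h ^ 2 • D.N i a x (w (x + h • D.σ i a x) - w x)) := by
    have hw : w x = (Fintype.card A : ℝ)⁻¹ • ∑ i : A, w x := by
      rw [Finset.sum_const, Finset.card_univ, ← Nat.cast_smul_eq_nsmul ℝ, smul_smul,
        inv_mul_cancel₀ hcard, one_smul]
    rw [step, gen, smul_comm (h ^ 2)]
    conv_lhs => enter [1, 2]; rw [hw]
    rw [← smul_sub, ← smul_sub, Finset.smul_sum, ← Finset.sum_sub_distrib,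
      ← Finset.sum_sub_distrib, ← sub_zero (Finset.sum _ _), ← hodd, ← Finset.sum_sub_distrib]
    congr 1
    refine Finset.sum_congr rfl fun i _ => ?_
    simp only [map_sub, map_smul, smul_add, FunLike.coe_smul, Pi.smul_apply, smul_sub]
    change _ + h • _ + h ^ 2 • _ - _ - _ - _ = _
    module
  have hb : ∀ i, ‖(w (x + h • D.σ i a x) - w x - fderiv ℝ w x (h • D.σ i a x) -
          (1 / 2 : ℝ) • fderiv ℝ (fderiv ℝ w) x (h • D.σ i a x) (h • D.σ i a x)) +
        h • D.M i a x (w (x + h • D.σ i a x) - w x - fderiv ℝ w x (h • D.σ i a x)) +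
        h ^ 2 • D.N i a x (w (x + h • D.σ i a x) - w x)‖ ≤
      h ^ 3 * (C3 * s i ^ 3 + m i * (C2 * s i ^ 2) + n i * (C1 * s i)) := by
    intro i
    have hv : ‖h • D.σ i a x‖ ≤ h * s i := by
      rw [norm_smul, Real.norm_of_nonneg hh.le]; gcongr; exact hs i a x
    have t3 := taylor_three (hsm.of_le (ofNat_le_infty 3)) (hC3 θ) x (h • D.σ i a x)
    have t2 := taylor_two (hsm.of_le (ofNat_le_infty 2)) (hC2 θ) x (h • D.σ i a x)
    have t1 := norm_sub_le_of_fderiv_bound (hW.differentiable θ) (hC1 θ) x (h • D.σ i a x)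
    refine (norm_add₃_le).trans ?_
    rw [norm_smul, norm_smul, Real.norm_of_nonneg hh.le, Real.norm_of_nonneg (by positivity : 0 ≤ h ^ 2)]
    have hM := (D.M i a x).le_of_opNorm_le_of_le (hm i a x) t2
    have hN := (D.N i a x).le_of_opNorm_le_of_le (hn i a x) t1
    have := hm0 i; have := hn0 i
    calc _ ≤ C3 * (h * s i) ^ 3 + h * (m i * (C2 * (h * s i) ^ 2)) +
          h ^ 2 * (n i * (C1 * (h * s i))) := by
            refine add_le_add (add_le_add (t3.trans (by gcongr)) ?_) ?_
            · exact mul_le_mul_of_nonneg_left (hM.trans (by gcongr)) hh.le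
            · exact mul_le_mul_of_nonneg_left (hN.trans (by gcongr)) (by positivity)
      _ = _ := by ring
  have e : ((h ^ 2)⁻¹ • (D.step a w x - w x)) - D.gen a w x =
      (h ^ 2)⁻¹ • (D.step a w x - w x - h ^ 2 • D.gen a w x) := by
    rw [smul_sub _ _ (h ^ 2 • _), smul_smul, inv_mul_cancel₀ (by positivity), one_smul]
  rw [e, key, norm_smul, norm_smul, norm_inv, norm_inv, Real.norm_of_nonneg (by positivity : 0 ≤ h ^ 2),
    Real.norm_of_nonneg (by positivity : (0:ℝ) ≤ Fintype.card A)]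
  calc _ ≤ (h ^ 2)⁻¹ * ((Fintype.card A : ℝ)⁻¹ * ∑ i,
        h ^ 3 * (C3 * s i ^ 3 + m i * (C2 * s i ^ 2) + n i * (C1 * s i))) := by
        gcongr
        exact (norm_sum_le _ _).trans (Finset.sum_le_sum fun i _ => hb i)
    _ = _ := by
      rw [← Finset.mul_sum]
      generalize ∑ i, (C3 * s i ^ 3 + m i * (C2 * s i ^ 2) + n i * (C1 * s i)) = X
      field_simp

/-- The difference quotient in time of the scheme. -/
noncomputable def quot (D : JumpData Λ A 𝔼 V) (a : Λ) (w : 𝔼 → V) (x : 𝔼) : V :=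
  ((D.h a) ^ 2)⁻¹ • (D.step a w x - w x)

lemma contDiff_quot {D : JumpData Λ A 𝔼 V} (hD : D.Good) (a : Λ) {w : 𝔼 → V}
    (hw : ContDiff ℝ ∞ w) : ContDiff ℝ ∞ (D.quot a w) :=
  ((contDiff_step hD a hw).sub hw).const_smul _

lemma jet_quot {D : JumpData Λ A 𝔼 V} (hD : D.Good) (a : Λ) {w : 𝔼 → V} (hw : ContDiff ℝ ∞ w) :
    _root_.jet (D.quot a w) = D.jet.quot a (_root_.jet w) := by
  funext x
  have h1 : fderiv ℝ (D.quot a w) x = ((D.h a) ^ 2)⁻¹ • (fderiv ℝ (D.step a w) x - fderiv ℝ w x) :=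
    ((((contDiff_step hD a hw).differentiable (by simp) x).hasFDerivAt.fun_sub
      (hw.differentiable (by simp) x).hasFDerivAt).fun_const_smul _).fderiv
  rw [quot, ← jet_step hD a hw]
  refine jet_ext fun o => ?_
  cases o with
  | none => simp [jetProj_none_jet, quot, jet]
  | some l => simp [jetProj_some_jet, h1, jet]

lemma exists_bound_iteratedFDeriv_quot (k : ℕ) : ∀ {V : Type} [NormedAddCommGroup V]
    [InnerProductSpace ℝ V] {D : JumpData Λ A 𝔼 V}, D.Good → ∀ {W : Θ → 𝔼 → V}, SmoothBdd W →
    ∃ c : ℝ, ∀ a θ x, ‖iteratedFDeriv ℝ k (D.quot a (W θ)) x‖ ≤ c := by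
  induction k with
  | zero =>
    intro V _ _ D hD W hW
    obtain ⟨C, hC0, hC⟩ := consistency hD hW
    obtain ⟨K, hK0, hK⟩ := (smoothBdd_gen hD hW).bound_zero
    refine ⟨C + K, fun a θ x => ?_⟩
    rw [norm_iteratedFDeriv_zero]
    have h1 := norm_le_norm_sub_add (D.quot a (W θ) x) (D.gen a (W θ) x)
    refine h1.trans (add_le_add ((hC a θ x).trans ?_) (hK (a, θ) x))
    exact mul_le_of_le_one_right hC0 (hD.h_le a)
  | succ k ih =>
    intro V _ _ D hD W hW
    obtain ⟨c, hc⟩ := ih (jet_good hD) hW.jet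
    refine ⟨‖(jetDeriv : Jet d V →L[ℝ] _)‖ * c, fun a θ x => ?_⟩
    refine (iteratedFDeriv_succ_le_jet (contDiff_quot hD a (hW.smooth θ)) k x).trans ?_
    rw [jet_quot hD a (hW.smooth θ)]
    gcongr
    exact hc a θ x

lemma smoothBdd_quot {D : JumpData Λ A 𝔼 V} (hD : D.Good) {W : Θ → 𝔼 → V} (hW : SmoothBdd W) :
    SmoothBdd (fun p : Λ × Θ => D.quot p.1 (W p.2)) where
  smooth p := contDiff_quot hD _ (hW.smooth _)
  bdd k := by
    obtain ⟨c, hc⟩ := exists_bound_iteratedFDeriv_quot k hD hW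
    exact ⟨c, fun p => hc _ _⟩

/-- The scheme is consistent with its generator, including first derivatives. -/
lemma exists_residual_bound {D : JumpData Λ A 𝔼 V} (hD : D.Good) {W : Θ → 𝔼 → V}
    (hW : SmoothBdd W) :
    ∃ C : ℝ, 0 ≤ C ∧ ∀ a θ x, ‖D.quot a (W θ) x - D.gen a (W θ) x‖ ≤ C * √(D.h a) ∧
      ‖fderiv ℝ (fun y => D.quot a (W θ) y - D.gen a (W θ) y) x‖ ≤ C * √(D.h a) := by
  obtain ⟨C, hC0, hC⟩ := consistency hD hW
  have hR : SmoothBdd (fun (p : Λ × Θ) x => D.quot p.1 (W p.2) x - D.gen p.1 (W p.2) x) :=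
    (smoothBdd_quot hD hW).sub (smoothBdd_gen hD hW)
  obtain ⟨K, hK0, hK⟩ := hR.fderiv.fderiv.bound_zero
  refine ⟨2 * C + K, by positivity, fun a θ x => ?_⟩
  have hh := hD.h_pos a
  have hs : 0 < √(D.h a) := Real.sqrt_pos.2 hh
  have hsq : √(D.h a) * √(D.h a) = D.h a := Real.mul_self_sqrt hh.le
  have hs1 : √(D.h a) ≤ 1 := Real.sqrt_le_one.2 (hD.h_le a)
  constructor
  · refine (hC a θ x).trans ?_
    nlinarith [mul_nonneg hC0 hs.le, mul_nonneg hK0 hs.le]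
  · have h1 := norm_fderiv_le_interpolation ((hR.smooth (a, θ)).of_le (ofNat_le_infty 2))
      (hC a θ) (hK (a, θ)) hs x
    refine h1.trans (le_of_eq ?_)
    rw [mul_comm C, ← mul_assoc, mul_div_assoc]
    have : D.h a / √(D.h a) = √(D.h a) := Real.div_sqrt
    have e : 2 * D.h a * (C / √(D.h a)) = 2 * C * (D.h a / √(D.h a)) := by ring
    rw [e, this]; ring

end JumpData

section Lop

variable {E V : Type} [NormedAddCommGroup E] [NormedSpace ℝ E] [NormedAddCommGroup V]
  [NormedSpace ℝ V]

/-- A second-order linear differential operator. -/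
noncomputable def secondOrder (P : E → (E →L[ℝ] E →L[ℝ] V) →L[ℝ] V) (Q : E → (E →L[ℝ] V) →L[ℝ] V)
    (R : E → V →L[ℝ] V) (w : E → V) (x : E) : V :=
  P x (fderiv ℝ (fderiv ℝ w) x) + Q x (fderiv ℝ w x) + R x (w x)

/-- `f` and its derivative are bounded by `A`. -/
def COneBound {E F : Type*} [NormedAddCommGroup E] [NormedSpace ℝ E] [NormedAddCommGroup F]
    [NormedSpace ℝ F] (f : E → F) (A : ℝ) : Prop :=
  Differentiable ℝ f ∧ ∀ x, ‖f x‖ ≤ A ∧ ‖fderiv ℝ f x‖ ≤ A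

lemma COneBound.add {E F : Type*} [NormedAddCommGroup E] [NormedSpace ℝ E] [NormedAddCommGroup F]
    [NormedSpace ℝ F] {f g : E → F} {A B : ℝ} (hf : COneBound f A) (hg : COneBound g B) :
    COneBound (fun x => f x + g x) (A + B) := by
  refine ⟨hf.1.add hg.1, fun x => ⟨norm_add_le_of_le (hf.2 x).1 (hg.2 x).1, ?_⟩⟩
  rw [fderiv_fun_add (hf.1 x) (hg.1 x)]
  exact norm_add_le_of_le (hf.2 x).2 (hg.2 x).2

lemma COneBound.clm_apply {E F G : Type*} [NormedAddCommGroup E] [NormedSpace ℝ E]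
    [NormedAddCommGroup F] [NormedSpace ℝ F] [NormedAddCommGroup G] [NormedSpace ℝ G]
    {L : E → F →L[ℝ] G} {g : E → F} {A B : ℝ} (hf : COneBound L A) (hg : COneBound g B) :
    COneBound (fun x => L x (g x)) (2 * A * B) := by
  refine ⟨hf.1.clm_apply hg.1, fun x => ?_⟩
  have hA : 0 ≤ A := (norm_nonneg _).trans (hf.2 x).1
  have hB : 0 ≤ B := (norm_nonneg _).trans (hg.2 x).1
  constructor
  · have := (L x).le_of_opNorm_le_of_le (hf.2 x).1 (hg.2 x).1
    nlinarith [mul_nonneg hA hB]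
  · rw [fderiv_clm_apply (hf.1 x) (hg.1 x)]
    have h1 : ‖(L x).comp (fderiv ℝ g x)‖ ≤ A * B :=
      (ContinuousLinearMap.opNorm_comp_le _ _).trans
        (mul_le_mul (hf.2 x).1 (hg.2 x).2 (norm_nonneg _) hA)
    have h2 : ‖(fderiv ℝ L x).flip (g x)‖ ≤ A * B :=
      ((fderiv ℝ L x).flip.le_opNorm _).trans (by
        rw [ContinuousLinearMap.opNorm_flip]
        exact mul_le_mul (hf.2 x).2 (hg.2 x).1 (norm_nonneg _) hA)
    exact (norm_add_le_of_le h1 h2).trans (le_of_eq (by ring))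

lemma COneBound.secondOrder {P : E → (E →L[ℝ] E →L[ℝ] V) →L[ℝ] V} {Q : E → (E →L[ℝ] V) →L[ℝ] V}
    {R : E → V →L[ℝ] V} {w : E → V} {A B : ℝ} (hP : COneBound P A) (hQ : COneBound Q A)
    (hR : COneBound R A) (h0 : COneBound w B) (h1 : COneBound (fderiv ℝ w) B)
    (h2 : COneBound (fderiv ℝ (fderiv ℝ w)) B) :
    COneBound (secondOrder P Q R w) (6 * A * B) := by
  have h := ((hP.clm_apply h2).add (hQ.clm_apply h1)).add (hR.clm_apply h0)
  have e : 2 * A * B + 2 * A * B + 2 * A * B = 6 * A * B := by ring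
  rw [← e]
  exact h

lemma SmoothBdd.exists_cOneBound {Λ E F : Type*} [NormedAddCommGroup E] [NormedSpace ℝ E]
    [NormedAddCommGroup F] [NormedSpace ℝ F] {f : Λ → E → F} (hf : SmoothBdd f) :
    ∃ A, 0 ≤ A ∧ ∀ a, COneBound (f a) A := by
  obtain ⟨c, hc0, hc⟩ := hf.bound_zero
  obtain ⟨e, he0, he⟩ := hf.fderiv.bound_zero
  exact ⟨c + e, by positivity, fun a => ⟨hf.differentiable a, fun x =>
    ⟨(hc a x).trans (by linarith), (he a x).trans (by linarith)⟩⟩⟩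

lemma COneBound.mono {E F : Type*} [NormedAddCommGroup E] [NormedSpace ℝ E] [NormedAddCommGroup F]
    [NormedSpace ℝ F] {f : E → F} {A B : ℝ} (hf : COneBound f A) (h : A ≤ B) : COneBound f B :=
  ⟨hf.1, fun x => ⟨(hf.2 x).1.trans h, (hf.2 x).2.trans h⟩⟩

lemma COneBound.const_smul {E F : Type*} [NormedAddCommGroup E] [NormedSpace ℝ E]
    [NormedAddCommGroup F] [NormedSpace ℝ F] {f : E → F} {A : ℝ} (hf : COneBound f A) {c κ : ℝ}
    (h : |c| ≤ κ) : COneBound (fun x => c • f x) (κ * A) := by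
  refine ⟨hf.1.const_smul c, fun x => ?_⟩
  rw [fderiv_fun_const_smul (hf.1 x), norm_smul, norm_smul, Real.norm_eq_abs]
  have hA : 0 ≤ A := (norm_nonneg _).trans (hf.2 x).1
  exact ⟨mul_le_mul h (hf.2 x).1 (norm_nonneg _) ((abs_nonneg _).trans h),
    mul_le_mul h (hf.2 x).2 (norm_nonneg _) ((abs_nonneg _).trans h)⟩

lemma SmoothBdd.exists_cThreeBound {Λ E F : Type*} [NormedAddCommGroup E] [NormedSpace ℝ E]
    [NormedAddCommGroup F] [NormedSpace ℝ F] {f : Λ → E → F} (hf : SmoothBdd f) :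
    ∃ A, 0 ≤ A ∧ ∀ a, COneBound (f a) A ∧ COneBound (_root_.fderiv ℝ (f a)) A ∧
      COneBound (_root_.fderiv ℝ (_root_.fderiv ℝ (f a))) A := by
  obtain ⟨a, ha0, ha⟩ := hf.exists_cOneBound
  obtain ⟨b, hb0, hb⟩ := hf.fderiv.exists_cOneBound
  obtain ⟨c, hc0, hc⟩ := hf.fderiv.fderiv.exists_cOneBound
  exact ⟨a + b + c, by positivity, fun i => ⟨(ha i).mono (by linarith), (hb i).mono (by linarith),
    (hc i).mono (by linarith)⟩⟩

/-- A family of functions is equicontinuous in the parameter, together with first derivatives. -/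
def TimeUnif {E F : Type*} [NormedAddCommGroup E] [NormedSpace ℝ E] [NormedAddCommGroup F]
    [NormedSpace ℝ F] (f : ℝ → E → F) : Prop :=
  ∀ η > 0, ∃ δ > 0, ∀ t t', |t - t'| ≤ δ → COneBound (fun x => f t x - f t' x) η

end Lop

section Interp

/-- The clamped affine ramp from `0` at `a` to `1` at `a + k`. -/
noncomputable def ramp (a k t : ℝ) : ℝ := max 0 (min 1 ((t - a) / k))

lemma continuous_ramp (a k : ℝ) : Continuous (ramp a k) := by
  unfold ramp; fun_prop

lemma ramp_nonneg (a k t : ℝ) : 0 ≤ ramp a k t := le_max_left _ _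

lemma ramp_le_one (a k t : ℝ) : ramp a k t ≤ 1 := max_le zero_le_one (min_le_left _ _)

lemma ramp_of_le {a k t : ℝ} (hk : 0 < k) (h : t ≤ a) : ramp a k t = 0 := by
  refine max_eq_left ((min_le_right _ _).trans ?_)
  exact div_nonpos_of_nonpos_of_nonneg (by linarith) hk.le

lemma ramp_of_ge {a k t : ℝ} (hk : 0 < k) (h : a + k ≤ t) : ramp a k t = 1 := by
  have : 1 ≤ (t - a) / k := by rw [le_div_iff₀ hk]; linarith
  rw [ramp, min_eq_left this, max_eq_right zero_le_one]

lemma ramp_of_mem {a k t : ℝ} (hk : 0 < k) (h : t ∈ Icc a (a + k)) : ramp a k t = (t - a) / k := by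
  have h1 : (t - a) / k ≤ 1 := by rw [div_le_one hk]; linarith [h.2]
  have h2 : 0 ≤ (t - a) / k := div_nonneg (by linarith [h.1]) hk.le
  rw [ramp, min_eq_right h1, max_eq_right h2]

variable {F : Type*} [AddCommGroup F] [Module ℝ F]

/-- Piecewise affine interpolation of the first `n` terms of a sequence. -/
noncomputable def interp (s k : ℝ) (n : ℕ) (y : ℕ → F) (t : ℝ) : F :=
  y 0 + ∑ i ∈ Finset.range n, ramp (s + i * k) k t • (y (i + 1) - y i)

lemma interp_of_mem {s k : ℝ} (hk : 0 < k) {n j : ℕ} (hj : j < n) (y : ℕ → F) {t : ℝ}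
    (ht : t ∈ Icc (s + j * k) (s + (j + 1 : ℕ) * k)) :
    interp s k n y t = y j + ((t - (s + j * k)) / k) • (y (j + 1) - y j) := by
  have h1 : ∑ i ∈ Finset.range j, ramp (s + i * k) k t • (y (i + 1) - y i) = y j - y 0 := by
    rw [← Finset.sum_range_sub]
    refine Finset.sum_congr rfl fun i hi => ?_
    have : ((i : ℝ) + 1) ≤ j := by exact_mod_cast Finset.mem_range.1 hi
    rw [ramp_of_ge hk (by nlinarith [ht.1]), one_smul]
  have h2 : ∑ i ∈ Finset.Ico (j + 1) n, ramp (s + i * k) k t • (y (i + 1) - y i) = 0 := by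
    refine Finset.sum_eq_zero fun i hi => ?_
    have : ((j : ℝ) + 1) ≤ i := by exact_mod_cast (Finset.mem_Ico.1 hi).1
    have h3 := ht.2
    push_cast at h3
    rw [ramp_of_le hk (by nlinarith), zero_smul]
  have ht' := ht
  push_cast at ht'
  rw [interp, ← Finset.sum_range_add_sum_Ico _ (Nat.succ_le_of_lt hj), h2, Finset.sum_range_succ, h1,
    ramp_of_mem hk ⟨ht'.1, by linarith [ht'.2]⟩]
  abel

lemma interp_zero {s k : ℝ} (hk : 0 < k) (n : ℕ) (y : ℕ → F) : interp s k n y s = y 0 := by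
  rw [interp, Finset.sum_eq_zero, add_zero]
  intro i _
  rw [ramp_of_le hk (by nlinarith [(Nat.cast_nonneg i : (0:ℝ) ≤ i)]), zero_smul]

lemma hasDerivWithinAt_interp {F : Type*} [NormedAddCommGroup F] [NormedSpace ℝ F] {s k : ℝ}
    (hk : 0 < k) {n j : ℕ} (hj : j < n) (y : ℕ → F) {t : ℝ}
    (ht : t ∈ Ioc (s + j * k) (s + (j + 1 : ℕ) * k)) :
    HasDerivWithinAt (interp s k n y) (k⁻¹ • (y (j + 1) - y j)) (Iic t) t := by
  have h1 : HasDerivAt (fun τ => y j + ((τ - (s + j * k)) / k) • (y (j + 1) - y j))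
      (k⁻¹ • (y (j + 1) - y j)) t := by
    have := (((hasDerivAt_id t).sub_const (s + j * k)).div_const k).smul_const (y (j + 1) - y j)
    simpa using this.const_add (y j)
  refine h1.hasDerivWithinAt.congr_of_eventuallyEq ?_
    (interp_of_mem hk hj y (Ioc_subset_Icc_self ht))
  have : Ioc (s + j * k) t ∈ 𝓝[≤] t := Ioc_mem_nhdsLE ht.1
  filter_upwards [this] with τ hτ
  exact interp_of_mem hk hj y ⟨hτ.1.le, hτ.2.trans ht.2⟩

lemma exists_index {s k t : ℝ} (hk : 0 < k) {n : ℕ} (ht : t ∈ Ioc s (s + n * k)) :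
    ∃ j < n, t ∈ Ioc (s + j * k) (s + (j + 1 : ℕ) * k) := by
  have h0 : 0 < (t - s) / k := div_pos (by linarith [ht.1]) hk
  have h1 : 0 < ⌈(t - s) / k⌉₊ := Nat.ceil_pos.2 h0
  refine ⟨⌈(t - s) / k⌉₊ - 1, ?_, ?_, ?_⟩
  · have : ⌈(t - s) / k⌉₊ ≤ n := Nat.ceil_le.2 (by rw [div_le_iff₀ hk]; linarith [ht.2])
    omega
  · have h2 : ⌈(t - s) / k⌉₊ - 1 < ⌈(t - s) / k⌉₊ := by omega
    have := Nat.lt_ceil.1 h2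
    rw [lt_div_iff₀ hk] at this
    linarith
  · have e : ⌈(t - s) / k⌉₊ - 1 + 1 = ⌈(t - s) / k⌉₊ := by omega
    rw [e]
    have := Nat.le_ceil ((t - s) / k)
    rw [div_le_iff₀ hk] at this
    linarith

end Interp

section Evolution

variable {A V : Type} {d : ℕ} [NormedAddCommGroup V] [InnerProductSpace ℝ V]
  [Fintype A] [Nonempty A]

local notation "𝔼" => EuclideanSpace ℝ (Fin d)

/-- An approximate solution on `[s, T]` of the evolution equation `w' = L w`, with residual `η`. -/
structure ApproxSol (P : ℝ → 𝔼 → (𝔼 →L[ℝ] 𝔼 →L[ℝ] V) →L[ℝ] V) (Q : ℝ → 𝔼 → (𝔼 →L[ℝ] V) →L[ℝ] V)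
    (R : ℝ → 𝔼 → V →L[ℝ] V) (f : 𝔼 → V) (s T η : ℝ) (w : ℝ → 𝔼 → V) : Prop where
  smoothBdd : SmoothBdd w
  start : w s = f
  cont : Continuous (fun p : ℝ × 𝔼 => w p.1 p.2)
  cont_fderiv : Continuous (fun p : ℝ × 𝔼 => fderiv ℝ (w p.1) p.2)
  deriv : ∀ t ∈ Ioc s T, ∃ g : 𝔼 → V, ContDiff ℝ ∞ g ∧
    (∀ x, HasDerivWithinAt (fun τ => w τ x) (g x) (Iic t) t) ∧
    (∀ x, HasDerivWithinAt (fun τ => fderiv ℝ (w τ) x) (fderiv ℝ g x) (Iic t) t) ∧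
    COneBound (fun x => g x - secondOrder (P t) (Q t) (R t) (w t) x) η

theorem exists_approxSol (D : JumpData (ℝ × Ioc (0:ℝ) 1) A 𝔼 V) (hD : D.Good)
    (hDh : ∀ a, D.h a = a.2)
    {P : ℝ → 𝔼 → (𝔼 →L[ℝ] 𝔼 →L[ℝ] V) →L[ℝ] V} {Q : ℝ → 𝔼 → (𝔼 →L[ℝ] V) →L[ℝ] V}
    {R : ℝ → 𝔼 → V →L[ℝ] V} (hP : SmoothBdd P) (hQ : SmoothBdd Q) (hR : SmoothBdd R)
    (hPt : TimeUnif P) (hQt : TimeUnif Q) (hRt : TimeUnif R)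
    (hgen : ∀ a w, D.gen a w = secondOrder (P a.1) (Q a.1) (R a.1) w)
    {f : 𝔼 → V} (hf : SmoothBdd (fun _ : Unit => f)) {s T : ℝ} (hsT : s < T) {η : ℝ} (hη : 0 < η) :
    ∃ w, ApproxSol P Q R f s T η w := by
  have hW := JumpData.smoothBdd_iter hD (T - s) hf
  obtain ⟨C1, hC10, hC1⟩ := JumpData.exists_residual_bound hD hW
  obtain ⟨C2, hC20, hC2⟩ := hW.exists_cThreeBound
  obtain ⟨C3, hC30, hC3⟩ := (JumpData.smoothBdd_quot hD hW).exists_cThreeBound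
  obtain ⟨p, hp0, hp⟩ := hP.exists_cOneBound
  obtain ⟨q, hq0, hq⟩ := hQ.exists_cOneBound
  obtain ⟨r, hr0, hr⟩ := hR.exists_cOneBound
  set ε : ℝ := η / (3 * (6 * (C2 + 1))) with hε
  have hε0 : 0 < ε := by positivity
  obtain ⟨δP, hδP0, hδP⟩ := hPt ε hε0
  obtain ⟨δQ, hδQ0, hδQ⟩ := hQt ε hε0
  obtain ⟨δR, hδR0, hδR⟩ := hRt ε hε0
  -- choose the time step
  have hev : ∀ᶠ k : ℝ in 𝓝[>] 0, k ≤ δP ∧ k ≤ δQ ∧ k ≤ δR ∧ k ≤ 1 ∧ C1 * √(√k) ≤ η / 3 ∧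
      6 * (p + q + r) * (k * C3) ≤ η / 3 := by
    have c1 : Tendsto (fun k : ℝ => C1 * √(√k)) (𝓝[>] 0) (𝓝 0) := by
      have : Continuous (fun k : ℝ => C1 * √(√k)) := by fun_prop
      simpa using this.tendsto 0 |>.mono_left nhdsWithin_le_nhds
    have c2 : Tendsto (fun k : ℝ => 6 * (p + q + r) * (k * C3)) (𝓝[>] 0) (𝓝 0) := by
      have : Continuous (fun k : ℝ => 6 * (p + q + r) * (k * C3)) := by fun_prop
      simpa using this.tendsto 0 |>.mono_left nhdsWithin_le_nhds
    have c3 : Tendsto (fun k : ℝ => k) (𝓝[>] 0) (𝓝 0) := nhdsWithin_le_nhds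
    filter_upwards [c3.eventually_le_const hδP0, c3.eventually_le_const hδQ0,
      c3.eventually_le_const hδR0, c3.eventually_le_const one_pos,
      c1.eventually_le_const (by positivity : 0 < η / 3),
      c2.eventually_le_const (by positivity : 0 < η / 3)] with k h1 h2 h3 h4 h5 h6
    exact ⟨h1, h2, h3, h4, h5, h6⟩
  have hseq : Tendsto (fun n : ℕ => (T - s) / ((n : ℝ) + 1)) atTop (𝓝[>] 0) := by
    refine tendsto_nhdsWithin_iff.2 ⟨?_, Eventually.of_forall fun n => ?_⟩
    · have := (tendsto_one_div_add_atTop_nhds_zero_nat (𝕜 := ℝ)).const_mul (T - s)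
      simpa [div_eq_mul_inv] using this
    · exact div_pos (sub_pos.2 hsT) (Nat.cast_add_one_pos n)
  obtain ⟨n', hn1, hn2, hn3, hn4, hn5, hn6⟩ := (hseq.eventually hev).exists
  set k : ℝ := (T - s) / ((n' : ℝ) + 1) with hk
  set n : ℕ := n' + 1 with hn
  have hk0 : 0 < k := div_pos (by linarith) (by positivity)
  have hnk : (n : ℝ) * k = T - s := by rw [hk, hn]; push_cast; field_simp
  have hsk0 : 0 < √k := Real.sqrt_pos.2 hk0
  set h : Ioc (0:ℝ) 1 := ⟨√k, hsk0, Real.sqrt_le_one.2 hn4⟩ with hh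
  set ρ : ℕ → ℝ × Ioc (0:ℝ) 1 := fun j => (s + j * k, h) with hρ
  have hρh : ∀ j, D.h (ρ j) ^ 2 = k := fun j => by
    rw [hDh]; exact Real.sq_sqrt hk0.le
  have hrun : ∀ j ≤ n, ∑ i ∈ Finset.range j, (D.h (ρ i)) ^ 2 ≤ T - s := by
    intro j hj
    have hj' : (j : ℝ) ≤ n := by exact_mod_cast hj
    simp only [hρh, Finset.sum_const, Finset.card_range, nsmul_eq_mul]
    rw [← hnk]; gcongr
  set y : ℕ → 𝔼 → V := D.iter f ρ with hy
  have hys : ∀ j, ContDiff ℝ ∞ (y j) := fun j => JumpData.contDiff_iter hD (hf.smooth ()) ρ j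
  have hyd : ∀ j, Differentiable ℝ (y j) := fun j => (hys j).differentiable (by simp)
  have hysb : ∀ j ≤ n, SmoothBdd (fun _ : ℝ => y j) := fun j hj =>
    hW.reindex (fun _ => ⟨(ρ, j), hrun j hj⟩)
  set w : ℝ → 𝔼 → V := fun t x => interp s k n (fun j => y j x) t with hw
  have hwexp : w = fun t x => y 0 x + ∑ i ∈ Finset.range n,
      ramp (s + i * k) k t • (y (i + 1) x - y i x) := rfl
  have hDw : ∀ t x, fderiv ℝ (w t) x = interp s k n (fun j => fderiv ℝ (y j) x) t := by
    intro t x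
    have : HasFDerivAt (w t) (interp s k n (fun j => fderiv ℝ (y j) x) t) x := by
      rw [hwexp]
      exact (hyd 0 x).hasFDerivAt.fun_add (HasFDerivAt.fun_sum fun i _ =>
        (((hyd (i + 1) x).hasFDerivAt.fun_sub (hyd i x).hasFDerivAt).fun_const_smul _))
    exact this.fderiv
  refine ⟨w, ⟨?_, ?_, ?_, ?_, ?_⟩⟩
  · rw [hwexp]
    refine (hysb 0 (Nat.zero_le _)).add (SmoothBdd.sum fun i hi => ?_)
    have hi' := Finset.mem_range.1 hi
    refine SmoothBdd.smul (SmoothBdd.const ⟨1, fun t => ?_⟩) ((hysb _ hi').sub (hysb _ hi'.le))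
    rw [Real.norm_of_nonneg (ramp_nonneg _ _ _)]
    exact ramp_le_one _ _ _
  · funext x
    exact interp_zero hk0 n _
  · rw [hwexp]
    refine ((hys 0).continuous.comp continuous_snd).add (continuous_finsetSum _ fun i _ => ?_)
    exact ((continuous_ramp _ _).comp continuous_fst).smul
      (((hys (i + 1)).continuous.comp continuous_snd).sub ((hys i).continuous.comp continuous_snd))
  · have hc : ∀ j, Continuous (fderiv ℝ (y j)) := fun j => (hys j).continuous_fderiv (by simp)
    simp only [hDw, interp]
    refine ((hc 0).comp continuous_snd).add (continuous_finsetSum _ fun i _ => ?_)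
    exact ((continuous_ramp _ _).comp continuous_fst).smul
      (((hc (i + 1)).comp continuous_snd).sub ((hc i).comp continuous_snd))
  · intro t ht
    have hT : T = s + n * k := by rw [hnk]; ring
    obtain ⟨j, hj, htj⟩ := exists_index (s := s) hk0 (hT ▸ ht)
    set θ : D.Run (T - s) := ⟨(ρ, j), hrun j hj.le⟩ with hθ
    set g : 𝔼 → V := D.quot (ρ j) (y j) with hg
    have hge : ∀ x, g x = k⁻¹ • (y (j + 1) x - y j x) := fun x => by
      rw [hg, JumpData.quot, hρh]; rfl
    have hgs : ContDiff ℝ ∞ g := JumpData.contDiff_quot hD _ (hys j)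
    have hDg : ∀ x, fderiv ℝ g x = k⁻¹ • (fderiv ℝ (y (j + 1)) x - fderiv ℝ (y j) x) := fun x => by
      rw [funext hge]
      exact ((((hyd (j + 1) x).hasFDerivAt.fun_sub (hyd j x).hasFDerivAt)).fun_const_smul _).fderiv
    refine ⟨g, hgs, fun x => ?_, fun x => ?_, ?_⟩
    · rw [hge]; exact hasDerivWithinAt_interp hk0 hj _ htj
    · simp only [hDw]; rw [hDg]; exact hasDerivWithinAt_interp hk0 hj _ htj
    · set τ : ℝ := (t - (s + j * k)) with hτ
      have hτ0 : 0 ≤ τ := by linarith [htj.1]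
      have htj2 := htj.2
      push_cast at htj2
      have hτk : τ ≤ k := by rw [hτ]; linarith
      have habs : |(s + j * k) - t| ≤ k := by rw [abs_sub_comm, abs_of_nonneg hτ0]; exact hτk
      have hwt : w t = fun x => y j x + τ • g x := by
        funext x
        rw [hge, smul_smul, ← div_eq_mul_inv]
        exact interp_of_mem hk0 hj _ (Ioc_subset_Icc_self htj)
      have hDwt : fderiv ℝ (w t) = fun x => fderiv ℝ (y j) x + τ • fderiv ℝ g x := by
        funext x
        rw [hwt]
        exact ((hyd j x).hasFDerivAt.fun_add
          (((hgs.differentiable (by simp)) x).hasFDerivAt.fun_const_smul τ)).fderiv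
      have hD2wt : ∀ x, fderiv ℝ (fderiv ℝ (w t)) x =
          fderiv ℝ (fderiv ℝ (y j)) x + τ • fderiv ℝ (fderiv ℝ g) x := by
        intro x
        rw [hDwt]
        have h1 := (((hys j).fderiv_right (m := ∞) (by simp)).differentiable (by simp) x).hasFDerivAt
        have h2 := ((hgs.fderiv_right (m := ∞) (by simp)).differentiable (by simp) x).hasFDerivAt
        exact (h1.fun_add (h2.fun_const_smul τ)).fderiv
      have b1 : COneBound (fun x => D.quot (ρ j) (y j) x - D.gen (ρ j) (y j) x) (η / 3) := by
        have hs : C1 * √(D.h (ρ j)) ≤ η / 3 := by rw [hDh]; exact hn5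
        refine ⟨?_, fun x => ⟨((hC1 (ρ j) θ x).1).trans hs, ((hC1 (ρ j) θ x).2).trans hs⟩⟩
        have h1 := (JumpData.smoothBdd_gen hD hW).differentiable (ρ j, θ)
        exact (hgs.differentiable (by simp)).sub h1
      have b2 : COneBound (secondOrder (fun x => P (s + j * k) x - P t x)
          (fun x => Q (s + j * k) x - Q t x) (fun x => R (s + j * k) x - R t x) (y j)) (η / 3) := by
        refine (COneBound.secondOrder (hδP _ _ (habs.trans hn1)) (hδQ _ _ (habs.trans hn2))
          (hδR _ _ (habs.trans hn3)) (hC2 θ).1 (hC2 θ).2.1 (hC2 θ).2.2).mono ?_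
        rw [hε]
        have : 6 * (η / (3 * (6 * (C2 + 1)))) * C2 = η / 3 * (C2 / (C2 + 1)) := by
          field_simp
        rw [this]
        exact mul_le_of_le_one_right (by positivity) ((div_le_one (by positivity)).2 (by linarith))
      have b3 : COneBound (fun x => (-τ) • secondOrder (P t) (Q t) (R t) g x) (η / 3) := by
        refine ((COneBound.secondOrder ((hp t).mono (by linarith : p ≤ p + q + r))
          ((hq t).mono (by linarith)) ((hr t).mono (by linarith)) (hC3 (ρ j, θ)).1
          (hC3 (ρ j, θ)).2.1 (hC3 (ρ j, θ)).2.2).const_smul (c := -τ) (κ := k) ?_).mono ?_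
        · rwa [abs_neg, abs_of_nonneg hτ0]
        · refine le_trans (le_of_eq ?_) hn6
          ring
      have hb := (b1.add b2).add b3
      have e3 : η / 3 + η / 3 + η / 3 = η := by ring
      rw [e3] at hb
      convert hb using 2 with x
      have eρ : (ρ j).1 = s + j * k := rfl
      rw [hgen, eρ]
      simp only [secondOrder]
      rw [hD2wt]
      simp only [hDwt]
      rw [hwt]
      simp only [map_add, map_smul, sub_apply]
      change g x - _ = g x - _ + _ + _
      module

end Evolution

section SqrtSeries

variable {𝔸 : Type} [NormedRing 𝔸] [NormedAlgebra ℝ 𝔸]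

/-- The square root of `1 + z` through the binomial series. -/
noncomputable def sqrtOneAdd (z : 𝔸) : 𝔸 := (binomialSeries 𝔸 (1 / 2 : ℝ)).sum z

lemma summable_choose_half {r : ℝ} (hr0 : 0 ≤ r) (hr : r < 1) :
    Summable (fun n : ℕ => |Ring.choose (1 / 2 : ℝ) n| * r ^ n) := by
  lift r to NNReal using hr0
  have h := (binomialSeries ℝ (1 / 2 : ℝ)).summable_norm_mul_pow (r := r)
    (lt_of_lt_of_le (by exact_mod_cast hr) binomialSeries_radius_ge_one)
  refine h.congr fun n => ?_
  rw [binomialSeries, FormalMultilinearSeries.ofScalars_norm, Real.norm_eq_abs]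

variable [NormOneClass 𝔸]

lemma one_le_radius_binomialSeries_half : 1 ≤ (binomialSeries 𝔸 (1 / 2 : ℝ)).radius := by
  refine ENNReal.le_of_forall_nnreal_lt fun r hr => ?_
  refine FormalMultilinearSeries.le_radius_of_summable _ ?_
  refine (summable_choose_half r.2 (by exact_mod_cast hr)).congr fun n => ?_
  rw [binomialSeries, FormalMultilinearSeries.ofScalars_norm, Real.norm_eq_abs]
  rfl

lemma sqrtOneAdd_eq_tsum (z : 𝔸) : sqrtOneAdd z = ∑' n, Ring.choose (1 / 2 : ℝ) n • z ^ n := by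
  simp [sqrtOneAdd, FormalMultilinearSeries.sum, binomialSeries, FormalMultilinearSeries.ofScalars]

lemma summable_norm_sqrtOneAdd {z : 𝔸} (hz : ‖z‖ < 1) :
    Summable (fun n : ℕ => ‖Ring.choose (1 / 2 : ℝ) n • z ^ n‖) := by
  refine Summable.of_nonneg_of_le (fun _ => norm_nonneg _) (fun n => ?_)
    (summable_choose_half (norm_nonneg z) hz)
  rw [norm_smul, Real.norm_eq_abs]
  exact mul_le_mul_of_nonneg_left (norm_pow_le z n) (abs_nonneg _)

variable [CompleteSpace 𝔸]

lemma contDiffOn_sqrtOneAdd : ContDiffOn ℝ ∞ (sqrtOneAdd (𝔸 := 𝔸)) (Metric.ball 0 1) := by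
  have h0 := (binomialSeries 𝔸 (1 / 2 : ℝ)).hasFPowerSeriesOnBall
    (lt_of_lt_of_le one_pos one_le_radius_binomialSeries_half)
  have h := h0.analyticOnNhd
  refine AnalyticOnNhd.contDiffOn (h.mono fun z hz => ?_) Metric.isOpen_ball.uniqueDiffOn
  rw [mem_ball_zero_iff] at hz
  rw [Metric.mem_eball, edist_zero_right]
  refine lt_of_lt_of_le ?_ one_le_radius_binomialSeries_half
  rw [← ofReal_norm, ENNReal.ofReal_lt_one]
  exact hz

lemma sqrtOneAdd_mul_self {z : 𝔸} (hz : ‖z‖ < 1) : sqrtOneAdd z * sqrtOneAdd z = 1 + z := by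
  have hs := summable_norm_sqrtOneAdd hz
  rw [sqrtOneAdd_eq_tsum, tsum_mul_tsum_eq_tsum_sum_antidiagonal_of_summable_norm hs hs]
  have h1 : ∀ n : ℕ, ∑ kl ∈ Finset.HasAntidiagonal.antidiagonal n, Ring.choose (1 / 2 : ℝ) kl.1 • z ^ kl.1 *
      Ring.choose (1 / 2 : ℝ) kl.2 • z ^ kl.2 = Ring.choose (1 : ℝ) n • z ^ n := by
    intro n
    have := Ring.add_choose_eq n (Commute.all (1 / 2 : ℝ) (1 / 2))
    rw [add_halves] at this
    rw [this, Finset.sum_smul]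
    refine Finset.sum_congr rfl fun kl hkl => ?_
    rw [smul_mul_smul_comm, ← pow_add, Finset.HasAntidiagonal.mem_antidiagonal.1 hkl]
  simp_rw [h1]
  have h2 : ∀ n : ℕ, n ∉ Finset.range 2 → Ring.choose (1 : ℝ) n • z ^ n = 0 := by
    intro n hn
    have : Ring.choose (1 : ℝ) n = 0 := by
      have := Ring.choose_natCast (R := ℝ) 1 n
      rw [Nat.cast_one] at this
      rw [this, Nat.choose_eq_zero_of_lt (by simpa using hn)]; simp
    rw [this, zero_smul]
  rw [tsum_eq_sum h2]
  simp [Finset.sum_range_succ]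

lemma isSelfAdjoint_sqrtOneAdd [StarRing 𝔸] [NormedStarGroup 𝔸] [StarModule ℝ 𝔸] {z : 𝔸}
    (hz : IsSelfAdjoint z) : IsSelfAdjoint (sqrtOneAdd z) := by
  rw [IsSelfAdjoint, sqrtOneAdd_eq_tsum, tsum_star]
  simp [hz.star_eq]

end SqrtSeries

section MatrixSqrt

variable {d : ℕ}

local notation "𝔼" => EuclideanSpace ℝ (Fin d)

lemma norm_le_of_abs_inner_self_le {E : Type*} [NormedAddCommGroup E] [InnerProductSpace ℝ E]
    {T : E →L[ℝ] E} (hT : ∀ x y, inner ℝ (T x) y = inner ℝ x (T y)) {k : ℝ} (hk : 0 ≤ k)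
    (h : ∀ x, |inner ℝ (T x) x| ≤ k * ‖x‖ ^ 2) : ‖T‖ ≤ k := by
  refine T.opNorm_le_bound hk fun x => ?_
  rcases eq_or_ne (T x) 0 with h0 | h0
  · rw [h0, norm_zero]; positivity
  have hn : 0 < ‖T x‖ := norm_pos_iff.2 h0
  have hx : 0 < ‖x‖ := norm_pos_iff.2 fun hx => h0 (by simp [hx])
  set y : E := (‖x‖ / ‖T x‖) • T x with hy
  have hyn : ‖y‖ = ‖x‖ := by
    rw [hy, norm_smul, Real.norm_of_nonneg (by positivity)]; field_simp
  have hyi : inner ℝ (T x) y = ‖T x‖ * ‖x‖ := by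
    rw [hy, inner_smul_right, real_inner_self_eq_norm_sq]; field_simp
  have h1 := (abs_le.1 (h (x + y))).2
  have h2 := (abs_le.1 (h (x - y))).1
  have h3 : inner ℝ (T (x + y)) (x + y) - inner ℝ (T (x - y)) (x - y) = 4 * inner ℝ (T x) y := by
    simp only [map_add, map_sub, inner_add_left, inner_add_right, inner_sub_left, inner_sub_right]
    rw [hT y x, real_inner_comm y]
    simp only [real_inner_comm]
    ring
  have h4 := parallelogram_law_with_norm ℝ x y
  have h5 : 4 * (‖T x‖ * ‖x‖) ≤ 4 * k * ‖x‖ ^ 2 := by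
    rw [← hyi, ← h3]
    rw [hyn] at h4
    have : k * ‖x + y‖ ^ 2 + k * ‖x - y‖ ^ 2 = k * (2 * (‖x‖ ^ 2 + ‖x‖ ^ 2)) := by
      rw [← h4]; ring
    linarith
  nlinarith

lemma toEuclideanCLM_apply_coord (M : Matrix (Fin d) (Fin d) ℝ) (x : 𝔼) (i : Fin d) :
    Matrix.toEuclideanCLM (𝕜 := ℝ) M x i = ∑ j, M i j * x j := by
  rw [Matrix.ofLp_toEuclideanCLM]; rfl

lemma inner_toEuclideanCLM (M : Matrix (Fin d) (Fin d) ℝ) (x : 𝔼) :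
    inner ℝ (Matrix.toEuclideanCLM (𝕜 := ℝ) M x) x = ∑ i, ∑ j, M i j * x i * x j := by
  rw [PiLp.inner_apply]
  refine Finset.sum_congr rfl fun i _ => ?_
  rw [toEuclideanCLM_apply_coord]
  simp only [RCLike.inner_apply, conj_trivial, Finset.mul_sum]
  exact Finset.sum_congr rfl fun j _ => by ring

lemma quadForm_le_of_abs_le {M : Matrix (Fin d) (Fin d) ℝ} {K : ℝ} (hM : ∀ i j, |M i j| ≤ K)
    (x : 𝔼) : |∑ i, ∑ j, M i j * x i * x j| ≤ K * d * ‖x‖ ^ 2 := by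
  have h1 : |∑ i, ∑ j, M i j * x i * x j| ≤ ∑ i : Fin d, ∑ j : Fin d, K * (((x i) ^ 2 + (x j) ^ 2) / 2) := by
    refine (Finset.abs_sum_le_sum_abs _ _).trans (Finset.sum_le_sum fun i _ => ?_)
    refine (Finset.abs_sum_le_sum_abs _ _).trans (Finset.sum_le_sum fun j _ => ?_)
    rw [mul_assoc, abs_mul, abs_mul]
    have hK := hM i j
    have h0 := abs_nonneg (M i j)
    have : |x i| * |x j| ≤ ((x i) ^ 2 + (x j) ^ 2) / 2 := by
      nlinarith [sq_nonneg (|x i| - |x j|), sq_abs (x i), sq_abs (x j)]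
    exact mul_le_mul hK this (by positivity) (h0.trans hK)
  refine h1.trans (le_of_eq ?_)
  rw [EuclideanSpace.real_norm_sq_eq]
  simp only [← Finset.mul_sum, ← Finset.sum_div, Finset.sum_add_distrib, Finset.sum_const,
    Finset.card_univ, Fintype.card_fin, nsmul_eq_mul]
  ring

/-- Uniformly elliptic bounded symmetric matrices have a smooth square root, given through the
columns of a matrix. -/
theorem exists_smooth_matrixSqrt (hd : 1 ≤ d) {ν : ℝ} (hν : 0 < ν) (K : ℝ) :
    ∃ (g : (𝔼 →L[ℝ] 𝔼) → (𝔼 →L[ℝ] 𝔼)) (U S : Set (𝔼 →L[ℝ] 𝔼)) (L : ℝ), IsOpen U ∧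
      ContDiffOn ℝ ∞ g U ∧ IsCompact S ∧ S ⊆ U ∧
      (∀ M : Matrix (Fin d) (Fin d) ℝ, M.IsSymm → (∀ z : 𝔼, ν * ‖z‖ ^ 2 ≤ ∑ i, ∑ j, M i j * z i * z j) →
        (∀ i j, |M i j| ≤ K) → Matrix.toEuclideanCLM (𝕜 := ℝ) M ∈ S ∧
        ∀ i j, ∑ a, g (Matrix.toEuclideanCLM (𝕜 := ℝ) M) (𝐞 a) i *
          g (Matrix.toEuclideanCLM (𝕜 := ℝ) M) (𝐞 a) j = M i j) ∧
      0 ≤ L ∧ ∀ A ∈ S, ∀ A' ∈ S, ‖g A - g A'‖ ≤ L * ‖A - A'‖ := by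
  have : Nonempty (Fin d) := ⟨⟨0, hd⟩⟩
  have : Nontrivial 𝔼 := inferInstance
  set c : ℝ := |K| * d + ν + 1 with hc
  have hc0 : 0 < c := by positivity
  have hνc : ν < c := by rw [hc]; nlinarith [abs_nonneg K, (Nat.cast_nonneg d : (0:ℝ) ≤ d)]
  set g : (𝔼 →L[ℝ] 𝔼) → (𝔼 →L[ℝ] 𝔼) := fun A => √c • sqrtOneAdd (c⁻¹ • A - 1) with hg
  set U : Set (𝔼 →L[ℝ] 𝔼) := Metric.ball (c • 1) c with hU
  set S : Set (𝔼 →L[ℝ] 𝔼) := Metric.closedBall (c • 1) (c - ν) with hS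
  have hmem : ∀ A ∈ U, ‖c⁻¹ • A - 1‖ < 1 := by
    intro A hA
    rw [hU, mem_ball_iff_norm] at hA
    have : c⁻¹ • A - 1 = c⁻¹ • (A - c • 1) := by
      rw [smul_sub, smul_smul, inv_mul_cancel₀ hc0.ne', one_smul]
    rw [this, norm_smul, Real.norm_of_nonneg (by positivity)]
    rw [inv_mul_lt_one₀ hc0]; exact hA
  have hgd : ContDiffOn ℝ ∞ g U := by
    have h1 : ContDiff ℝ ∞ (fun A : 𝔼 →L[ℝ] 𝔼 => c⁻¹ • A - 1) := by fun_prop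
    refine ContDiffOn.const_smul (√c) (contDiffOn_sqrtOneAdd.comp h1.contDiffOn fun A hA => ?_)
    simpa using hmem A hA
  have hSU : S ⊆ U := Metric.closedBall_subset_ball (by linarith)
  have hSc : IsCompact S := isCompact_closedBall _ _
  have hfd : ContinuousOn (fderiv ℝ g) U := hgd.continuousOn_fderiv_of_isOpen Metric.isOpen_ball (by simp)
  obtain ⟨L, hL⟩ := hSc.exists_bound_of_continuousOn (hfd.mono hSU)
  refine ⟨g, U, S, max L 0, Metric.isOpen_ball, hgd, hSc, hSU, ?_, le_max_right _ _, ?_⟩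
  · intro M hM hell hbd
    set A := Matrix.toEuclideanCLM (𝕜 := ℝ) M with hA
    have hsa : IsSelfAdjoint A := by
      rw [IsSelfAdjoint, hA, ← map_star, Matrix.star_eq_conjTranspose,
        Matrix.conjTranspose_eq_transpose_of_trivial, hM]
    have hsa' : ∀ x y, inner ℝ (A x) y = inner ℝ x (A y) := fun x y => by
      have := ContinuousLinearMap.isSelfAdjoint_iff_isSymmetric.1 hsa x y
      exact this
    have hAS : A ∈ S := by
      rw [hS, mem_closedBall_iff_norm]
      refine norm_le_of_abs_inner_self_le (fun x y => ?_) (by linarith) fun x => ?_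
      · simp [inner_sub_left, inner_sub_right, hsa', inner_smul_left, inner_smul_right]
      · have e1 : inner ℝ ((A - c • (1 : 𝔼 →L[ℝ] 𝔼)) x) x
            = (∑ i, ∑ j, M i j * x i * x j) - c * ‖x‖ ^ 2 := by
          rw [← inner_toEuclideanCLM, ← hA]
          simp [inner_sub_left, inner_smul_left]
        have e2 := hell x
        have e3 := (abs_le.1 (quadForm_le_of_abs_le hbd x)).2
        rw [e1, abs_le]
        have e4 : K * d * ‖x‖ ^ 2 ≤ |K| * d * ‖x‖ ^ 2 := by
          gcongr; exact le_abs_self K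
        constructor
        · nlinarith
        · rw [hc]; rw [hc] at *; nlinarith [sq_nonneg ‖x‖]
    refine ⟨hAS, fun i j => ?_⟩
    have hz := hmem A (hSU hAS)
    have hgs : IsSelfAdjoint (g A) := by
      refine IsSelfAdjoint.smul (by simp [IsSelfAdjoint]) (isSelfAdjoint_sqrtOneAdd ?_)
      exact (IsSelfAdjoint.smul (by simp [IsSelfAdjoint]) hsa).sub (IsSelfAdjoint.one _)
    have hgg : g A * g A = A := by
      rw [hg]; simp only
      rw [smul_mul_smul_comm, Real.mul_self_sqrt hc0.le, sqrtOneAdd_mul_self hz]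
      rw [add_sub_cancel, smul_smul, mul_inv_cancel₀ hc0.ne', one_smul]
    have hsym : ∀ a i, g A (𝐞 a) i = g A (𝐞 i) a := by
      intro a i
      have := ContinuousLinearMap.isSelfAdjoint_iff_isSymmetric.1 hgs
        (𝐞 a) (𝐞 i)
      simpa [EuclideanSpace.inner_single_left, EuclideanSpace.inner_single_right] using this
    have h1 : A (𝐞 j) i = M i j := by
      rw [hA, toEuclideanCLM_apply_coord]; simp
    have h2 : A (𝐞 j) = g A (g A (𝐞 j)) := by
      conv_lhs => rw [← hgg]
      rfl
    rw [← h1, h2, clm_eq_sum (g A) (g A (𝐞 j))]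
    simp only [WithLp.ofLp_sum, Finset.sum_apply, PiLp.smul_apply, smul_eq_mul]
    refine Finset.sum_congr rfl fun a _ => ?_
    rw [hsym a j]; ring
  · intro A hA A' hA'
    have hcv : Convex ℝ S := convex_closedBall _ _
    refine hcv.norm_image_sub_le_of_norm_fderiv_le (𝕜 := ℝ) (f := g) (fun B hB => ?_) (fun B hB => ?_) hA' hA
    · exact (hgd.differentiableOn (by simp)).differentiableAt (Metric.isOpen_ball.mem_nhds (hSU hB))
    · exact (hL B hB).trans (le_max_left _ _)

end MatrixSqrt

section TimeUnif

variable {E F G : Type*} [NormedAddCommGroup E] [NormedSpace ℝ E] [NormedAddCommGroup F]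
    [NormedSpace ℝ F] [NormedAddCommGroup G] [NormedSpace ℝ G]

lemma TimeUnif.add {f g : ℝ → E → F} (hf : TimeUnif f) (hg : TimeUnif g) :
    TimeUnif (fun t x => f t x + g t x) := by
  intro η hη
  obtain ⟨δ, hδ0, hδ⟩ := hf (η / 2) (by positivity)
  obtain ⟨δ', hδ0', hδ'⟩ := hg (η / 2) (by positivity)
  refine ⟨min δ δ', lt_min hδ0 hδ0', fun t t' h => ?_⟩
  have := (hδ t t' (h.trans (min_le_left _ _))).add (hδ' t t' (h.trans (min_le_right _ _)))
  rw [add_halves] at this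
  simpa only [add_sub_add_comm] using this

lemma TimeUnif.const (c : F) : TimeUnif (fun (_ : ℝ) (_ : E) => c) := by
  intro η hη
  refine ⟨1, one_pos, fun t t' _ => ?_⟩
  simp only [sub_self]
  exact ⟨by fun_prop, fun x => by simp [hη.le]⟩

lemma TimeUnif.sum {ι : Type*} {s : Finset ι} {f : ι → ℝ → E → F} (hf : ∀ i ∈ s, TimeUnif (f i)) :
    TimeUnif (fun t x => ∑ i ∈ s, f i t x) := by
  classical
  induction s using Finset.induction_on with
  | empty => simpa using TimeUnif.const (0 : F)
  | insert i s hi ih =>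
    simp only [Finset.sum_insert hi]
    exact (hf i (Finset.mem_insert_self _ _)).add
      (ih fun j hj => hf j (Finset.mem_insert_of_mem hj))

lemma TimeUnif.clm {f : ℝ → E → F} (hf : TimeUnif f) (L : F →L[ℝ] G) :
    TimeUnif (fun t x => L (f t x)) := by
  intro η hη
  obtain ⟨δ, hδ0, hδ⟩ := hf (η / (‖L‖ + 1)) (by positivity)
  refine ⟨δ, hδ0, fun t t' h => ?_⟩
  obtain ⟨h1, h2⟩ := hδ t t' h
  simp only [← map_sub]
  have key : ∀ r : ℝ, 0 ≤ r → r ≤ η / (‖L‖ + 1) → ‖L‖ * r ≤ η := by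
    intro r hr0 hr
    rw [le_div_iff₀ (by positivity)] at hr
    nlinarith
  refine ⟨L.differentiable.comp h1, fun x => ⟨?_, ?_⟩⟩
  · exact (L.le_opNorm _).trans (key _ (norm_nonneg _) (h2 x).1)
  · have := (L.hasFDerivAt.comp x (h1 x).hasFDerivAt).fderiv
    simp only [Function.comp_def] at this
    rw [this]
    exact (L.opNorm_comp_le _).trans (key _ (norm_nonneg _) (h2 x).2)

lemma TimeUnif.smul_const {f : ℝ → E → ℝ} (hf : TimeUnif f) (v : F) :
    TimeUnif (fun t x => f t x • v) :=
  hf.clm (ContinuousLinearMap.toSpanSingleton ℝ v)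

lemma SmoothBdd.smul_const {Λ : Type*} {f : Λ → E → ℝ} (hf : SmoothBdd f) (v : F) :
    SmoothBdd (fun t x => f t x • v) :=
  hf.clm (ContinuousLinearMap.toSpanSingleton ℝ v)

end TimeUnif

section Existence

variable {d m : ℕ}

local notation "𝔼" => EuclideanSpace ℝ (Fin d)
local notation "𝕍" => EuclideanSpace ℝ (Fin m)

/-- The elementary operator sending the `l`-th coordinate to the `k`-th one. -/
noncomputable def unitOp (k l : Fin m) : 𝕍 →L[ℝ] 𝕍 :=
  (ContinuousLinearMap.toSpanSingleton ℝ (𝐞 k)).comp (EuclideanSpace.proj l)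

noncomputable def matOp (M : Matrix (Fin m) (Fin m) ℝ) : 𝕍 →L[ℝ] 𝕍 :=
  ∑ k, ∑ l, M k l • unitOp k l

lemma matOp_apply (M : Matrix (Fin m) (Fin m) ℝ) (v : 𝕍) (k : Fin m) :
    matOp M v k = ∑ l, M k l * v l := by
  simp only [matOp, unitOp, sum_apply, FunLike.coe_smul, Pi.smul_apply,
    ContinuousLinearMap.comp_apply, ContinuousLinearMap.toSpanSingleton_apply,
    WithLp.ofLp_sum, Finset.sum_apply, PiLp.smul_apply, smul_eq_mul]
  rw [Finset.sum_eq_single k]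
  · simp
  · intro b _ hb
    simp [Ne.symm hb]
  · simp

lemma matOp_eq_toEuclideanCLM (M : Matrix (Fin m) (Fin m) ℝ) :
    matOp M = Matrix.toEuclideanCLM (𝕜 := ℝ) M := by
  ext v k
  rw [matOp_apply, toEuclideanCLM_apply_coord]

/-- Second derivative evaluated at coordinate directions. -/
noncomputable def evSnd (V : Type) [NormedAddCommGroup V] [NormedSpace ℝ V] (i j : Fin d) :
    (𝔼 →L[ℝ] 𝔼 →L[ℝ] V) →L[ℝ] V :=
  (ContinuousLinearMap.apply ℝ V (𝐞 j)).comp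
    (ContinuousLinearMap.apply ℝ (𝔼 →L[ℝ] V) (𝐞 i))

noncomputable def diffusionCoef (V : Type) [NormedAddCommGroup V] [NormedSpace ℝ V]
    (q : Matrix (Fin d) (Fin d) ℝ) : (𝔼 →L[ℝ] 𝔼 →L[ℝ] V) →L[ℝ] V :=
  ∑ i, ∑ j, q i j • evSnd V i j

noncomputable def driftCoef (B : Fin d → Matrix (Fin m) (Fin m) ℝ) : (𝔼 →L[ℝ] 𝕍) →L[ℝ] 𝕍 :=
  ∑ i, ∑ k, ∑ l, B i k l •
    (unitOp k l).comp (ContinuousLinearMap.apply ℝ 𝕍 (𝐞 i))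

lemma driftCoef_apply (B : Fin d → Matrix (Fin m) (Fin m) ℝ) (L : 𝔼 →L[ℝ] 𝕍) :
    driftCoef B L = ∑ i, matOp (B i) (L (𝐞 i)) := by
  simp [driftCoef, matOp, sum_apply]

lemma diffusionCoef_apply {V : Type} [NormedAddCommGroup V] [NormedSpace ℝ V]
    (q : Matrix (Fin d) (Fin d) ℝ) (L : 𝔼 →L[ℝ] 𝔼 →L[ℝ] V) :
    diffusionCoef V q L =
      ∑ i, ∑ j, q i j • L (𝐞 i) (𝐞 j) := by
  simp [diffusionCoef, evSnd, sum_apply]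

lemma bilin_eq_sum {V : Type} [NormedAddCommGroup V] [NormedSpace ℝ V]
    (L : 𝔼 →L[ℝ] 𝔼 →L[ℝ] V) (v : 𝔼) :
    L v v = ∑ i, ∑ j, (v i * v j) • L (𝐞 i) (𝐞 j) := by
  rw [clm_eq_sum L v, sum_apply]
  refine Finset.sum_congr rfl fun i _ => ?_
  rw [FunLike.coe_smul, Pi.smul_apply, clm_eq_sum (L _) v, Finset.smul_sum]
  simp [smul_smul]

lemma sum_bilin_eq_diffusionCoef {V A : Type} [Fintype A] [NormedAddCommGroup V] [NormedSpace ℝ V]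
    {q : Matrix (Fin d) (Fin d) ℝ} {s : A → 𝔼} (hs : ∀ i j, ∑ a, s a i * s a j = q i j)
    (L : 𝔼 →L[ℝ] 𝔼 →L[ℝ] V) : ∑ a, L (s a) (s a) = diffusionCoef V q L := by
  simp_rw [bilin_eq_sum L (s _), diffusionCoef_apply, ← hs, Finset.sum_smul]
  rw [Finset.sum_comm]
  refine Finset.sum_congr rfl fun i _ => ?_
  rw [Finset.sum_comm]

theorem exists_approxSol_of_elliptic (hd : 1 ≤ d) {ν : ℝ} (hν : 0 < ν)
    {q : ℝ → 𝔼 → Matrix (Fin d) (Fin d) ℝ} {B : Fin d → ℝ → 𝔼 → Matrix (Fin m) (Fin m) ℝ}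
    {C : ℝ → 𝔼 → Matrix (Fin m) (Fin m) ℝ}
    (hq : ∀ i j, SmoothBdd (fun t x => q t x i j)) (hqt : ∀ i j, TimeUnif (fun t x => q t x i j))
    (hB : ∀ i k l, SmoothBdd (fun t x => B i t x k l))
    (hBt : ∀ i k l, TimeUnif (fun t x => B i t x k l))
    (hC : ∀ k l, SmoothBdd (fun t x => C t x k l)) (hCt : ∀ k l, TimeUnif (fun t x => C t x k l))
    (hsymm : ∀ t x, (q t x).IsSymm)
    (hell : ∀ t x (z : 𝔼), ν * ‖z‖ ^ 2 ≤ ∑ i, ∑ j, q t x i j * z i * z j)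
    {f : 𝔼 → 𝕍} (hf : SmoothBdd (fun _ : Unit => f)) {s T : ℝ} (hsT : s < T) {η : ℝ} (hη : 0 < η) :
    ∃ w, ApproxSol (fun t x => diffusionCoef 𝕍 (q t x)) (fun t x => driftCoef (fun i => B i t x))
      (fun t x => matOp (C t x)) f s T η w := by
  have hne : Nonempty (Fin d) := ⟨⟨0, hd⟩⟩
  have hd0 : (0:ℝ) < d := by exact_mod_cast hd
  have hP : SmoothBdd (fun t x => diffusionCoef 𝕍 (q t x)) :=
    SmoothBdd.sum fun i _ => SmoothBdd.sum fun j _ => (hq i j).smul_const _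
  have hPt : TimeUnif (fun t x => diffusionCoef 𝕍 (q t x)) :=
    TimeUnif.sum fun i _ => TimeUnif.sum fun j _ => (hqt i j).smul_const _
  have hQ : SmoothBdd (fun t x => driftCoef (d := d) (fun i => B i t x)) :=
    SmoothBdd.sum fun i _ => SmoothBdd.sum fun j _ => SmoothBdd.sum fun l _ =>
      (hB i j l).smul_const _
  have hQt : TimeUnif (fun t x => driftCoef (d := d) (fun i => B i t x)) :=
    TimeUnif.sum fun i _ => TimeUnif.sum fun j _ => TimeUnif.sum fun l _ =>
      (hBt i j l).smul_const _
  have hmB : ∀ i, SmoothBdd (fun t x => matOp (B i t x)) := fun i =>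
    SmoothBdd.sum fun j _ => SmoothBdd.sum fun l _ => (hB i j l).smul_const _
  have hR : SmoothBdd (fun t x => matOp (C t x)) :=
    SmoothBdd.sum fun j _ => SmoothBdd.sum fun l _ => (hC j l).smul_const _
  have hRt : TimeUnif (fun t x => matOp (C t x)) :=
    TimeUnif.sum fun j _ => TimeUnif.sum fun l _ => (hCt j l).smul_const _
  set c0 : ℝ := ν / 2 with hc0
  have hc0p : 0 < c0 := by positivity
  choose K0 hK00 hK0 using fun i j => (hq i j).bound_zero
  set q' : ℝ → 𝔼 → Matrix (Fin d) (Fin d) ℝ := fun t x => q t x - c0 • 1 with hq'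
  set K : ℝ := (∑ i, ∑ j, K0 i j) + c0 with hK
  have hq'b : ∀ t x i j, |q' t x i j| ≤ K := by
    intro t x i j
    have h1 : |q t x i j| ≤ ∑ i, ∑ j, K0 i j := by
      refine (hK0 i j t x).trans ?_
      refine (Finset.single_le_sum (f := fun j => K0 i j) (fun j _ => hK00 i j)
        (Finset.mem_univ j)).trans ?_
      exact Finset.single_le_sum (f := fun i => ∑ j, K0 i j)
        (fun i _ => Finset.sum_nonneg fun j _ => hK00 i j) (Finset.mem_univ i)
    have h2 : |c0 * (1 : Matrix (Fin d) (Fin d) ℝ) i j| ≤ c0 := by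
      rw [Matrix.one_apply]; split_ifs <;> simp [abs_of_pos hc0p, hc0p.le]
    exact (abs_sub _ _).trans (add_le_add h1 h2)
  have hq's : ∀ t x, (q' t x).IsSymm := fun t x =>
    (hsymm t x).sub (Matrix.isSymm_one.smul c0)
  have hq'e : ∀ t x (z : 𝔼), c0 * ‖z‖ ^ 2 ≤ ∑ i, ∑ j, q' t x i j * z i * z j := by
    intro t x z
    have h1 : ∑ i, ∑ j, q' t x i j * z i * z j = (∑ i, ∑ j, q t x i j * z i * z j) - c0 * ‖z‖ ^ 2 := by
      rw [EuclideanSpace.real_norm_sq_eq, Finset.mul_sum, ← Finset.sum_sub_distrib]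
      refine Finset.sum_congr rfl fun i _ => ?_
      simp only [hq', Matrix.sub_apply, Matrix.smul_apply, Matrix.one_apply, smul_eq_mul, sub_mul,
        Finset.sum_sub_distrib]
      simp [pow_two, mul_assoc]
    rw [h1]
    have := hell t x z
    rw [hc0]; linarith
  obtain ⟨g, U, S, -, hUo, hg, hSc, hSU, hgS, -, -⟩ := exists_smooth_matrixSqrt hd hc0p K
  set Aq : ℝ → 𝔼 → (𝔼 →L[ℝ] 𝔼) := fun t x => matOp (q' t x) with hAq
  have hAqs : SmoothBdd Aq := by
    refine SmoothBdd.sum fun j _ => SmoothBdd.sum fun l _ => SmoothBdd.smul_const ?_ _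
    exact (hq j l).sub (SmoothBdd.const' (c0 * (1 : Matrix (Fin d) (Fin d) ℝ) j l))
  have hAqS : ∀ t x, Aq t x ∈ S := fun t x => by
    rw [hAq]; simp only; rw [matOp_eq_toEuclideanCLM]
    exact (hgS _ (hq's t x) (hq'e t x) (hq'b t x)).1
  have hroot : SmoothBdd (fun t x => g (Aq t x)) := hAqs.comp_left hUo hg hSc hSU hAqS
  have hrootsq : ∀ t x i j, ∑ a, g (Aq t x) (𝐞 a) i *
      g (Aq t x) (𝐞 a) j = q' t x i j := fun t x i j => by
    rw [hAq]; simp only; rw [matOp_eq_toEuclideanCLM]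
    exact (hgS _ (hq's t x) (hq'e t x) (hq'b t x)).2 i j
  set α : ℝ := √(4 * d) with hα
  have hα2 : α * α = 4 * d := Real.mul_self_sqrt (by positivity)
  have hr2 : √c0 * √c0 = c0 := Real.mul_self_sqrt hc0p.le
  have hr0 : √c0 ≠ 0 := (Real.sqrt_pos.2 hc0p).ne'
  let sg : Bool → ℝ := fun b => if b then 1 else -1
  have hsg : ∀ b, sg (!b) = - sg b := fun b => by cases b <;> simp [sg]
  have hsg2 : ∀ b, sg b * sg b = 1 := fun b => by cases b <;> simp [sg]
  let D : JumpData (ℝ × Ioc (0:ℝ) 1) ((Fin d ⊕ Fin d) × Bool) 𝔼 𝕍 :=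
    { h := fun a => a.2
      σ := fun i a x => sg i.2 • Sum.elim (fun c => α • g (Aq a.1 x) (𝐞 c))
        (fun c => (α * √c0) • 𝐞 c) i.1
      M := fun i a x => sg i.2 • Sum.elim (fun _ => (0 : 𝕍 →L[ℝ] 𝕍))
        (fun c => (α / (2 * √c0)) • matOp (B c a.1 x)) i.1
      N := fun _ a x => matOp (C a.1 x)
      inv := Equiv.prodCongr (Equiv.refl _) Equiv.boolNot }
  have hD : D.Good :=
    { h_pos := fun a => a.2.2.1
      h_le := fun a => a.2.2.2
      σ_odd := fun i => by funext a x; simp [D, hsg]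
      M_odd := fun i => by funext a x; simp [D, hsg]
      σ_sb := by
        rintro ⟨i | i, b⟩
        · exact (((hroot.clm (ContinuousLinearMap.apply ℝ 𝔼 (𝐞 i))).const_smul
            α).const_smul (sg b)).reindex Prod.fst
        · exact SmoothBdd.const' (sg b • (α * √c0) • 𝐞 i)
      M_sb := by
        rintro ⟨i | i, b⟩
        · exact SmoothBdd.const' (sg b • (0 : 𝕍 →L[ℝ] 𝕍))
        · exact (((hmB i).const_smul (α / (2 * √c0))).const_smul (sg b)).reindex Prod.fst
      N_sb := fun i => hR.reindex Prod.fst }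
  refine exists_approxSol D hD (fun a => rfl) hP hQ hR hPt hQt hRt ?_ hf hsT hη
  rintro ⟨t, h⟩ w
  funext x
  have hcard : (Fintype.card ((Fin d ⊕ Fin d) × Bool) : ℝ) = 4 * d := by
    simp [Fintype.card_prod, Fintype.card_sum]; ring
  have e1 : ∀ i : Fin d, ∀ b : Bool, (1 / 2 : ℝ) • fderiv ℝ (fderiv ℝ w) x (D.σ (Sum.inl i, b) (t, h) x)
      (D.σ (Sum.inl i, b) (t, h) x) + D.M (Sum.inl i, b) (t, h) x (fderiv ℝ w x (D.σ (Sum.inl i, b) (t, h) x))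
      + D.N (Sum.inl i, b) (t, h) x (w x) =
      (2 * d : ℝ) • fderiv ℝ (fderiv ℝ w) x (g (Aq t x) (𝐞 i))
        (g (Aq t x) (𝐞 i)) + matOp (C t x) (w x) := by
    intro i b
    simp only [D, Sum.elim_inl, smul_zero, zero_apply, add_zero, map_smul, FunLike.coe_smul,
      Pi.smul_apply, smul_smul]
    congr 2
    linear_combination (1 / 2) * α * α * hsg2 b + (1 / 2) * hα2
  have e2 : ∀ i : Fin d, ∀ b : Bool, (1 / 2 : ℝ) • fderiv ℝ (fderiv ℝ w) x (D.σ (Sum.inr i, b) (t, h) x)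
      (D.σ (Sum.inr i, b) (t, h) x) + D.M (Sum.inr i, b) (t, h) x (fderiv ℝ w x (D.σ (Sum.inr i, b) (t, h) x))
      + D.N (Sum.inr i, b) (t, h) x (w x) =
      (2 * d * c0 : ℝ) • fderiv ℝ (fderiv ℝ w) x (𝐞 i) (𝐞 i)
        + (2 * d : ℝ) • matOp (B i t x) (fderiv ℝ w x (𝐞 i))
        + matOp (C t x) (w x) := by
    intro i b
    simp only [D, Sum.elim_inr, map_smul, FunLike.coe_smul,
      Pi.smul_apply, smul_smul]
    congr 3
    · linear_combination (1 / 2) * α * α * √c0 * √c0 * hsg2 b + (1 / 2) * √c0 * √c0 * hα2 + 2 * d * hr2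
    · have : α / (2 * √c0) * (α * √c0) = α * α / 2 := by field_simp
      have h3 : sg b * (α / (2 * √c0)) * (sg b * (α * √c0)) = (sg b * sg b) * (α * α / 2) := by
        rw [← this]; ring
      first
        | (rw [h3, hsg2, hα2]; ring)
        | (linear_combination h3 + (α * α / 2) * hsg2 b + (1/2) * hα2)
  rw [JumpData.gen, hcard, Fintype.sum_prod_type, Fintype.sum_sum_type]
  simp only [e1, e2, Fintype.sum_bool]
  rw [secondOrder, driftCoef_apply]
  have e3 : diffusionCoef 𝕍 (q t x) (fderiv ℝ (fderiv ℝ w) x) =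
      (∑ a, fderiv ℝ (fderiv ℝ w) x (g (Aq t x) (𝐞 a))
        (g (Aq t x) (𝐞 a))) +
      c0 • ∑ i, fderiv ℝ (fderiv ℝ w) x (𝐞 i) (𝐞 i) := by
    rw [sum_bilin_eq_diffusionCoef (hrootsq t x), diffusionCoef_apply, diffusionCoef_apply,
      Finset.smul_sum, ← Finset.sum_add_distrib]
    refine Finset.sum_congr rfl fun i _ => ?_
    simp [hq', sub_smul, Finset.sum_sub_distrib, Matrix.one_apply, ite_smul, mul_ite]
  rw [e3]
  simp only [Finset.sum_add_distrib, Finset.sum_const, Finset.card_univ, Fintype.card_fin, ← Finset.smul_sum,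
    ← Nat.cast_smul_eq_nsmul ℝ]
  match_scalars <;> field_simp <;> ring

end Existence

section BernsteinAlgebra

lemma sum_bilin_le_sqrt {α β : Type*} [Fintype α] [Fintype β] (M : α → β → ℝ) (u : α → ℝ)
    (v : β → ℝ) : ∑ a, ∑ b, M a b * u a * v b ≤
      √(∑ a, ∑ b, M a b ^ 2) * √(∑ a, u a ^ 2) * √(∑ b, v b ^ 2) := by
  have h1 : ∑ a, ∑ b, M a b * u a * v b = ∑ p : α × β, M p.1 p.2 * (u p.1 * v p.2) := by
    rw [Fintype.sum_prod_type]; simp only [mul_assoc]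
  have h2 := Real.sum_mul_le_sqrt_mul_sqrt Finset.univ (fun p : α × β => M p.1 p.2)
    (fun p => u p.1 * v p.2)
  rw [h1]
  refine h2.trans (le_of_eq ?_)
  have h3 : ∑ p : α × β, (u p.1 * v p.2) ^ 2 = (∑ a, u a ^ 2) * ∑ b, v b ^ 2 := by
    rw [Fintype.sum_prod_type, Finset.sum_mul_sum]
    simp only [mul_pow]
  rw [h3, Fintype.sum_prod_type, Real.sqrt_mul (Finset.sum_nonneg fun _ _ => sq_nonneg _),
    mul_assoc]

lemma sum_abs_le_sqrt_card {α : Type*} [Fintype α] (u : α → ℝ) :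
    ∑ a, |u a| ≤ √(Fintype.card α) * √(∑ a, u a ^ 2) := by
  have := Real.sum_mul_le_sqrt_mul_sqrt Finset.univ (fun _ : α => (1:ℝ)) (fun a => |u a|)
  simpa using this

lemma sum_drift_le {d m : ℕ} {B : Fin d → Fin m → Fin m → ℝ} {c : ℝ} (hc : 0 ≤ c)
    (hB : ∀ i k l, |B i k l| ≤ c) (a : Fin m → ℝ) (Z : Fin d → Fin m → ℝ) :
    ∑ i, ∑ k, ∑ l, B i k l * a k * Z i l ≤
      √d * m * c * (√(∑ k, a k ^ 2) * √(∑ i, ∑ k, Z i k ^ 2)) := by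
  have h1 : ∑ i, ∑ k, ∑ l, B i k l * a k * Z i l ≤ c * ((∑ k, |a k|) * ∑ i, ∑ l, |Z i l|) := by
    have : c * ((∑ k, |a k|) * ∑ i, ∑ l, |Z i l|) = ∑ i, ∑ k, ∑ l, c * (|a k| * |Z i l|) := by
      simp only [← Finset.mul_sum, ← Finset.sum_mul]
    rw [this]
    refine Finset.sum_le_sum fun i _ => Finset.sum_le_sum fun k _ => Finset.sum_le_sum fun l _ => ?_
    refine (le_abs_self _).trans ?_
    rw [mul_assoc, abs_mul, abs_mul]
    exact mul_le_mul_of_nonneg_right (hB i k l) (by positivity)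
  have h2 := sum_abs_le_sqrt_card a
  have h3 := sum_abs_le_sqrt_card (fun p : Fin d × Fin m => Z p.1 p.2)
  simp only [Fintype.sum_prod_type, Fintype.card_prod, Fintype.card_fin, Nat.cast_mul] at h2 h3
  refine h1.trans ?_
  have h4 : (∑ k, |a k|) * ∑ i, ∑ l, |Z i l| ≤
      (√m * √(∑ k, a k ^ 2)) * (√(d * m) * √(∑ i, ∑ k, Z i k ^ 2)) :=
    mul_le_mul h2 h3 (by positivity) (by positivity)
  refine (mul_le_mul_of_nonneg_left h4 hc).trans (le_of_eq ?_)
  rw [Real.sqrt_mul (by positivity)]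
  have : √(m:ℝ) * √(m:ℝ) = m := Real.mul_self_sqrt (by positivity)
  linear_combination (c * √(d:ℝ) * √(∑ k, a k ^ 2) * √(∑ i, ∑ k, Z i k ^ 2)) * this

/-- The quadratic form of the Bernstein method; linear in the coefficients. -/
noncomputable def bernsteinForm {d m : ℕ} (μ : ℝ) (q : Fin d → Fin d → ℝ)
    (B : Fin d → Fin m → Fin m → ℝ) (C : Fin m → Fin m → ℝ)
    (Dq : Fin d → Fin d → Fin d → ℝ) (DB : Fin d → Fin d → Fin m → Fin m → ℝ)
    (DC : Fin d → Fin m → Fin m → ℝ)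
    (a : Fin m → ℝ) (Z : Fin d → Fin m → ℝ) (Y : Fin d → Fin d → Fin m → ℝ) : ℝ :=
  - μ * (∑ i, ∑ j, q i j * (∑ k, Z i k * Z j k) + ∑ i, ∑ j, q i j * (∑ l, ∑ k, Y i l k * Y j l k))
  + ∑ i, ∑ k, ∑ l, B i k l * a k * Z i l
  + ∑ k, ∑ l, C k l * a k * a l
  + ∑ i, ∑ j, ∑ l, ∑ k, Z l k * Dq l i j * Y i j k
  + ∑ l, ∑ i, ∑ k, ∑ k', DB l i k k' * Z l k * Z i k'
  + ∑ l, ∑ i, ∑ k, ∑ k', B i k k' * Z l k * Y i l k'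
  + ∑ l, ∑ k, ∑ k', DC l k k' * Z l k * a k'
  + ∑ l, ∑ k, ∑ k', C k k' * Z l k * Z l k'

lemma sqrt_mul_self_sum {α : Type*} [Fintype α] (u : α → ℝ) :
    √(∑ a, u a ^ 2) ^ 2 = ∑ a, u a ^ 2 :=
  Real.sq_sqrt (Finset.sum_nonneg fun _ _ => sq_nonneg _)

lemma sum_diffusion_ge {d : ℕ} {ι : Type*} [Fintype ι] {q : Fin d → Fin d → ℝ} {lam : ℝ}
    (hq : ∀ w : Fin d → ℝ, lam * ∑ k, (w k) ^ 2 ≤ ∑ k, ∑ l, q k l * w k * w l) (Z : Fin d → ι → ℝ) :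
    lam * ∑ i, ∑ k, Z i k ^ 2 ≤ ∑ i, ∑ j, q i j * (∑ k, Z i k * Z j k) := by
  have h : ∑ i, ∑ j, q i j * (∑ k, Z i k * Z j k) = ∑ k, ∑ i, ∑ j, q i j * Z i k * Z j k := by
    simp only [Finset.mul_sum]
    rw [Finset.sum_comm' (t' := Finset.univ) (s' := fun _ => Finset.univ) (by simp)]
    conv_rhs => rw [Finset.sum_comm]
    conv_lhs => rw [Finset.sum_comm]
    refine Finset.sum_congr rfl fun i _ => ?_
    rw [Finset.sum_comm]
    simp only [mul_assoc]
  rw [h, Finset.sum_comm (f := fun i k => Z i k ^ 2), Finset.mul_sum]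
  exact Finset.sum_le_sum fun k _ => hq _

lemma sum_pair_le {d : ℕ} {ι : Type*} [Fintype ι] {S : Fin d → Fin d → ℝ} {c : ℝ}
    (hS : ∀ w : Fin d → ℝ, ∑ k, ∑ l, S k l * w k * w l ≤ c * ∑ k, (w k) ^ 2) (Z : Fin d → ι → ℝ) :
    ∑ i, ∑ j, S i j * (∑ k, Z i k * Z j k) ≤ c * ∑ i, ∑ k, Z i k ^ 2 := by
  have := sum_diffusion_ge (q := fun i j => - S i j) (lam := -c) (fun w => by
    simp only [neg_mul, Finset.sum_neg_distrib]; exact neg_le_neg (hS w)) Z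
  simp only [neg_mul, Finset.sum_neg_distrib] at this
  linarith

variable {d m : ℕ}

set_option maxHeartbeats 1000000 in
/-- Pointwise upper bound for the Bernstein form, with a weight on the mixed terms. -/
theorem bernsteinForm_le_weighted {θ : ℝ} (hθ : 0 < θ) {μ γ lam ξ k ζ nS nBt nC LamDb LamC : ℝ} (hμ : 0 < μ) (hμγ : 1 / (4 * μ) ≤ γ)
    (hlam : 0 < lam) (hξ : 0 ≤ ξ) (hk : 0 ≤ k) (hζ : 0 ≤ ζ)
    {q : Fin d → Fin d → ℝ} {B : Fin d → Fin m → Fin m → ℝ} {C : Fin m → Fin m → ℝ}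
    {Dq : Fin d → Fin d → Fin d → ℝ} {DB : Fin d → Fin d → Fin m → Fin m → ℝ}
    {DC : Fin d → Fin m → Fin m → ℝ} {Db S : Fin d → Fin d → ℝ}
    {DBt : Fin d → Fin d → Fin m → Fin m → ℝ}
    (hq : ∀ w : Fin d → ℝ, lam * ∑ k, (w k) ^ 2 ≤ ∑ k, ∑ l, q k l * w k * w l)
    (hB : ∀ i k l, |B i k l| ≤ ξ * lam + ζ)
    (hDq : ∀ i j, √(∑ l, Dq l i j ^ 2) ≤ k * lam)
    (hDB : ∀ l i k k', DB l i k k' = (if k = k' then Db i l + S l i else 0) + DBt i l k k')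
    (hDb : ∀ w : Fin d → ℝ, (∑ k, ∑ l, Db k l * w k * w l) ≤ LamDb * ∑ k, (w k) ^ 2)
    (hC : ∀ w : Fin m → ℝ, (∑ k, ∑ l, C k l * w k * w l) ≤ LamC * ∑ k, (w k) ^ 2)
    (hS : √(∑ l, ∑ i, S l i ^ 2) ≤ nS)
    (hBt : √(∑ i, ∑ l, ∑ k, ∑ k', DBt i l k k' ^ 2) ≤ nBt)
    (hDC : √(∑ l, ∑ k, ∑ k', DC l k k' ^ 2) ≤ nC)
    (a : Fin m → ℝ) (Z : Fin d → Fin m → ℝ) (Y : Fin d → Fin d → Fin m → ℝ) :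
    bernsteinForm μ q B C Dq DB DC a Z Y ≤
      (LamC + θ / 2 * (√d * m * (ξ * lam + ζ) + nC)) * ∑ k, a k ^ 2 +
      (nS + nBt + LamDb + LamC + (√d * m * (ξ * lam + ζ) + nC) / (2 * θ)
        + γ * (√d * m * ξ + d * k) ^ 2 * lam + √d * m * ζ * (√d * m * ξ + d * k) / (2 * μ)
          + (√d * m * ζ) ^ 2 / (4 * μ * lam)) * ∑ i, ∑ k, Z i k ^ 2 := by
  set nA := √(∑ k, a k ^ 2) with hnA
  set nZ := √(∑ i, ∑ k, Z i k ^ 2) with hnZ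
  set nY := √(∑ i, ∑ l, ∑ k, Y i l k ^ 2) with hnY
  have hA2 : nA ^ 2 = ∑ k, a k ^ 2 := Real.sq_sqrt (by positivity)
  have hZ2 : nZ ^ 2 = ∑ i, ∑ k, Z i k ^ 2 := Real.sq_sqrt (by positivity)
  have hY2 : nY ^ 2 = ∑ i, ∑ l, ∑ k, Y i l k ^ 2 := Real.sq_sqrt (by positivity)
  have hA0 : 0 ≤ nA := Real.sqrt_nonneg _
  have hZ0 : 0 ≤ nZ := Real.sqrt_nonneg _
  have hY0 : 0 ≤ nY := Real.sqrt_nonneg _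
  set e : ℝ := √d * m with he
  have he0 : 0 ≤ e := by positivity
  have hc : 0 ≤ ξ * lam + ζ := by positivity
  have t1 : 0 ≤ ∑ i, ∑ j, q i j * (∑ k, Z i k * Z j k) :=
    le_trans (by positivity) (sum_diffusion_ge hq Z)
  have t2 : lam * nY ^ 2 ≤ ∑ i, ∑ j, q i j * (∑ l, ∑ k, Y i l k * Y j l k) := by
    have := sum_diffusion_ge hq (fun i (p : Fin d × Fin m) => Y i p.1 p.2)
    simp only [Fintype.sum_prod_type] at this
    rwa [hY2]
  have t3 : ∑ i, ∑ k, ∑ l, B i k l * a k * Z i l ≤ e * (ξ * lam + ζ) * (nA * nZ) :=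
    sum_drift_le hc hB a Z
  have t4 := hC a
  have t5 : ∑ i, ∑ j, ∑ l, ∑ k, Z l k * Dq l i j * Y i j k ≤ d * (k * lam) * (nZ * nY) := by
    have h1 : ∀ i j, ∑ l, ∑ k, Z l k * Dq l i j * Y i j k ≤ k * lam * nZ * √(∑ k, Y i j k ^ 2) := by
      intro i j
      refine (sum_bilin_le_sqrt Z (fun l => Dq l i j) (Y i j)).trans ?_
      have := mul_le_mul_of_nonneg_left (hDq i j) hZ0
      rw [← hnZ]
      refine mul_le_mul_of_nonneg_right ?_ (Real.sqrt_nonneg _)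
      linarith
    have h2 : ∑ i, ∑ j, √(∑ k, Y i j k ^ 2) ≤ d * nY := by
      have := sum_abs_le_sqrt_card (fun p : Fin d × Fin d => √(∑ k, Y p.1 p.2 k ^ 2))
      simp only [Fintype.sum_prod_type, Fintype.card_prod, Fintype.card_fin, Nat.cast_mul,
        abs_of_nonneg (Real.sqrt_nonneg _), Real.sqrt_mul_self (Nat.cast_nonneg d : (0:ℝ) ≤ d),
        sqrt_mul_self_sum] at this
      exact this
    refine (Finset.sum_le_sum fun i _ => Finset.sum_le_sum fun j _ => h1 i j).trans ?_
    simp only [← Finset.mul_sum]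
    refine (mul_le_mul_of_nonneg_left h2 (by positivity)).trans (le_of_eq (by ring))
  have t6 : ∑ l, ∑ i, ∑ k, ∑ k', DB l i k k' * Z l k * Z i k' ≤ (LamDb + nS + nBt) * nZ ^ 2 := by
    have h0 : ∑ l, ∑ i, ∑ k, ∑ k', DB l i k k' * Z l k * Z i k' =
        ∑ i, ∑ l, Db i l * (∑ k, Z i k * Z l k) + ∑ l, ∑ i, S l i * (∑ k, Z l k * Z i k)
        + ∑ l, ∑ i, ∑ k, ∑ k', DBt i l k k' * Z l k * Z i k' := by
      rw [Finset.sum_comm (f := fun i l => Db i l * (∑ k, Z i k * Z l k))]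
      simp only [← Finset.sum_add_distrib]
      refine Finset.sum_congr rfl fun l _ => Finset.sum_congr rfl fun i _ => ?_
      simp only [hDB, add_mul, Finset.sum_add_distrib, ite_mul, zero_mul, Finset.sum_ite_eq,
        Finset.mem_univ, if_true, Finset.mul_sum]
      congr 2
      · exact Finset.sum_congr rfl fun k _ => by ring
      · exact Finset.sum_congr rfl fun k _ => by ring
    have h1 := sum_pair_le hDb Z
    have h2 : ∑ l, ∑ i, S l i * (∑ k, Z l k * Z i k) ≤ nS * ∑ i, ∑ k, Z i k ^ 2 := by
      refine sum_pair_le (fun w => (sum_bilin_le_sqrt S w w).trans ?_) Z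
      rw [mul_assoc, Real.mul_self_sqrt (by positivity)]
      exact mul_le_mul_of_nonneg_right hS (by positivity)
    have h3 : ∑ l, ∑ i, ∑ k, ∑ k', DBt i l k k' * Z l k * Z i k' ≤ nBt * nZ ^ 2 := by
      have := sum_bilin_le_sqrt (fun (p r : Fin d × Fin m) => DBt r.1 p.1 p.2 r.2)
        (fun p => Z p.1 p.2) (fun p => Z p.1 p.2)
      simp only [Fintype.sum_prod_type] at this
      have e1 : ∑ l, ∑ i, ∑ k, ∑ k', DBt i l k k' * Z l k * Z i k' =
          ∑ l, ∑ k, ∑ i, ∑ k', DBt i l k k' * Z l k * Z i k' :=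
        Finset.sum_congr rfl fun l _ => Finset.sum_comm
      have e2 : ∑ l, ∑ k, ∑ i, ∑ k', DBt i l k k' ^ 2 = ∑ i, ∑ l, ∑ k, ∑ k', DBt i l k k' ^ 2 := by
        rw [Finset.sum_comm (s := Finset.univ) (t := Finset.univ) (f := fun i l => ∑ k, ∑ k', DBt i l k k' ^ 2)]
        exact Finset.sum_congr rfl fun l _ => Finset.sum_comm
      rw [e1]
      refine this.trans ?_
      rw [e2, mul_assoc, ← hnZ, ← pow_two]
      exact mul_le_mul_of_nonneg_right hBt (by positivity)
    rw [h0]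
    rw [← hZ2] at h1 h2
    linarith
  have t7 : ∑ l, ∑ i, ∑ k, ∑ k', B i k k' * Z l k * Y i l k' ≤ e * (ξ * lam + ζ) * (nZ * nY) := by
    refine (Finset.sum_le_sum fun l _ => sum_drift_le hc hB (Z l) (fun i k => Y i l k)).trans ?_
    rw [← Finset.mul_sum]
    refine mul_le_mul_of_nonneg_left ?_ (by positivity)
    refine (Real.sum_mul_le_sqrt_mul_sqrt Finset.univ _ _).trans (le_of_eq ?_)
    have e1 : ∀ l, √(∑ i, ∑ k, Y i l k ^ 2) ^ 2 = ∑ i, ∑ k, Y i l k ^ 2 := fun l =>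
      Real.sq_sqrt (by positivity)
    simp only [sqrt_mul_self_sum, e1]
    rw [Finset.sum_comm (f := fun l i => ∑ k, Y i l k ^ 2)]
  have t8 : ∑ l, ∑ k, ∑ k', DC l k k' * Z l k * a k' ≤ nC * (nZ * nA) := by
    have := sum_bilin_le_sqrt (fun (p : Fin d × Fin m) k' => DC p.1 p.2 k') (fun p => Z p.1 p.2) a
    simp only [Fintype.sum_prod_type] at this
    refine this.trans ?_
    rw [mul_assoc]
    exact mul_le_mul_of_nonneg_right hDC (by positivity)
  have t9 : ∑ l, ∑ k, ∑ k', C k k' * Z l k * Z l k' ≤ LamC * nZ ^ 2 := by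
    refine (Finset.sum_le_sum fun l _ => hC (Z l)).trans (le_of_eq ?_)
    rw [hZ2, Finset.mul_sum]
  have hAZ : nA * nZ ≤ θ / 2 * nA ^ 2 + 1 / (2 * θ) * nZ ^ 2 := by
    have h : θ / 2 * nA ^ 2 + 1 / (2 * θ) * nZ ^ 2 - nA * nZ = (θ * nA - nZ) ^ 2 / (2 * θ) := by
      field_simp; ring
    have h2 : 0 ≤ (θ * nA - nZ) ^ 2 / (2 * θ) := by positivity
    linarith
  have hnC : 0 ≤ nC := (Real.sqrt_nonneg _).trans hDC
  set A : ℝ := e * ξ + d * k with hA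
  have hyoung : - μ * (lam * nY ^ 2) + (lam * A + e * ζ) * (nZ * nY) ≤
      (lam * A + e * ζ) ^ 2 / (4 * μ * lam) * nZ ^ 2 := by
    have : (lam * A + e * ζ) ^ 2 / (4 * μ * lam) * nZ ^ 2 - (- μ * (lam * nY ^ 2) + (lam * A + e * ζ) * (nZ * nY))
        = ((lam * A + e * ζ) * nZ - 2 * μ * lam * nY) ^ 2 / (4 * μ * lam) := by
      field_simp; ring
    have h2 : 0 ≤ ((lam * A + e * ζ) * nZ - 2 * μ * lam * nY) ^ 2 / (4 * μ * lam) := by positivity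
    linarith
  have hsq : (lam * A + e * ζ) ^ 2 / (4 * μ * lam) ≤
      γ * A ^ 2 * lam + e * ζ * A / (2 * μ) + (e * ζ) ^ 2 / (4 * μ * lam) := by
    have h1 : (lam * A + e * ζ) ^ 2 / (4 * μ * lam) = 1 / (4 * μ) * (A ^ 2 * lam) + e * ζ * A / (2 * μ)
        + (e * ζ) ^ 2 / (4 * μ * lam) := by field_simp; ring
    have h2 : 1 / (4 * μ) * (A ^ 2 * lam) ≤ γ * (A ^ 2 * lam) :=
      mul_le_mul_of_nonneg_right hμγ (by positivity)
    linarith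
  have hsq' := mul_le_mul_of_nonneg_right hsq (sq_nonneg nZ)
  have t3' := mul_le_mul_of_nonneg_left hAZ (show 0 ≤ e * (ξ * lam + ζ) by positivity)
  have t8' := mul_le_mul_of_nonneg_left hAZ hnC
  have t2' := mul_le_mul_of_nonneg_left t2 hμ.le
  have t1' := mul_nonneg hμ.le t1
  have t57 : d * (k * lam) * (nZ * nY) + e * (ξ * lam + ζ) * (nZ * nY)
      = (lam * A + e * ζ) * (nZ * nY) := by rw [hA]; ring
  have h4 : (e * (ξ * lam + ζ) + nC) / (2 * θ) = (e * (ξ * lam + ζ) + nC) * (1 / (2 * θ)) := by ring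
  rw [bernsteinForm, ← hA2, ← hZ2, h4]
  rw [← hA2] at t4
  linarith


/-- Pointwise upper bound for the Bernstein form. -/
theorem bernsteinForm_le {μ γ lam ξ k ζ nS nBt nC LamDb LamC : ℝ} (hμ : 0 < μ) (hμγ : 1 / (4 * μ) ≤ γ)
    (hlam : 0 < lam) (hξ : 0 ≤ ξ) (hk : 0 ≤ k) (hζ : 0 ≤ ζ)
    {q : Fin d → Fin d → ℝ} {B : Fin d → Fin m → Fin m → ℝ} {C : Fin m → Fin m → ℝ}
    {Dq : Fin d → Fin d → Fin d → ℝ} {DB : Fin d → Fin d → Fin m → Fin m → ℝ}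
    {DC : Fin d → Fin m → Fin m → ℝ} {Db S : Fin d → Fin d → ℝ}
    {DBt : Fin d → Fin d → Fin m → Fin m → ℝ}
    (hq : ∀ w : Fin d → ℝ, lam * ∑ k, (w k) ^ 2 ≤ ∑ k, ∑ l, q k l * w k * w l)
    (hB : ∀ i k l, |B i k l| ≤ ξ * lam + ζ)
    (hDq : ∀ i j, √(∑ l, Dq l i j ^ 2) ≤ k * lam)
    (hDB : ∀ l i k k', DB l i k k' = (if k = k' then Db i l + S l i else 0) + DBt i l k k')
    (hDb : ∀ w : Fin d → ℝ, (∑ k, ∑ l, Db k l * w k * w l) ≤ LamDb * ∑ k, (w k) ^ 2)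
    (hC : ∀ w : Fin m → ℝ, (∑ k, ∑ l, C k l * w k * w l) ≤ LamC * ∑ k, (w k) ^ 2)
    (hS : √(∑ l, ∑ i, S l i ^ 2) ≤ nS)
    (hBt : √(∑ i, ∑ l, ∑ k, ∑ k', DBt i l k k' ^ 2) ≤ nBt)
    (hDC : √(∑ l, ∑ k, ∑ k', DC l k k' ^ 2) ≤ nC)
    (a : Fin m → ℝ) (Z : Fin d → Fin m → ℝ) (Y : Fin d → Fin d → Fin m → ℝ) :
    bernsteinForm μ q B C Dq DB DC a Z Y ≤
      (1 / 2 * (√d * m * ξ * lam) + 1 / 2 * nC + LamC + 1 / 2 * (√d * m) * ζ) * ∑ k, a k ^ 2 +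
      (nS + nBt + LamDb + LamC + (γ * (√d * m * ξ + d * k) ^ 2 + 1 / 2 * (√d * m * ξ)) * lam
        + 1 / 2 * nC + (1 / 2 * (√d * m) * ζ + √d * m * ζ * (√d * m * ξ + d * k) / (2 * μ)
          + (√d * m * ζ) ^ 2 / (4 * μ * lam))) * ∑ i, ∑ k, Z i k ^ 2 := by
  refine (bernsteinForm_le_weighted one_pos hμ hμγ hlam hξ hk hζ hq hB hDq hDB hDb hC hS hBt hDC
    a Z Y).trans (le_of_eq ?_)
  ring

end BernsteinAlgebra

section MaximumPrinciple

/-- First-touching-time principle on a compact set. -/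
theorem neg_of_touching {X : Type*} [TopologicalSpace X] {K : Set X} (hK : IsCompact K)
    {s T : ℝ} {Ψ : ℝ → X → ℝ}
    (hc : ContinuousOn (fun p : ℝ × X => Ψ p.1 p.2) (Icc s T ×ˢ K)) (h0 : ∀ x ∈ K, Ψ s x < 0)
    (htouch : ∀ t ∈ Ioc s T, ∀ x ∈ K, Ψ t x = 0 → (∀ y ∈ K, Ψ t y ≤ 0) →
      (∀ ℓ, HasDerivWithinAt (fun τ => Ψ τ x) ℓ (Iic t) t → 0 ≤ ℓ) → False) :
    ∀ t ∈ Icc s T, ∀ x ∈ K, Ψ t x < 0 := by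
  by_contra! hcon
  obtain ⟨t1, ht1, x1, hx1, h1⟩ := hcon
  have hcpt : IsCompact (Icc s T ×ˢ K) := isCompact_Icc.prod hK
  obtain ⟨u, hu, huS⟩ := (continuousOn_iff_isClosed.1 hc) (Ici 0) isClosed_Ici
  have hS : IsCompact ((Icc s T ×ˢ K) ∩ u) := hcpt.inter_right hu
  have memS : ∀ p : ℝ × X, p ∈ (Icc s T ×ˢ K) ∩ u ↔ (p ∈ Icc s T ×ˢ K ∧ 0 ≤ Ψ p.1 p.2) := by
    intro p
    rw [inter_comm, ← huS]
    simp [and_comm]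
  obtain ⟨⟨t0, x0⟩, hp0, hmin⟩ := hS.exists_isMinOn ⟨(t1, x1), (memS _).2 ⟨⟨ht1, hx1⟩, h1⟩⟩
    continuous_fst.continuousOn
  obtain ⟨⟨ht0, hx0⟩, hΨ0⟩ := (memS _).1 hp0
  simp only at ht0 hx0 hΨ0
  have hbefore : ∀ τ ∈ Icc s T, τ < t0 → ∀ y ∈ K, Ψ τ y < 0 := by
    intro τ hτ hlt y hy
    by_contra! h
    exact absurd (hmin ((memS (τ, y)).2 ⟨⟨hτ, hy⟩, h⟩)) (not_le.2 hlt)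
  have hst : s < t0 := by
    rcases eq_or_lt_of_le ht0.1 with h | h
    · exact absurd (h0 x0 hx0) (by rw [h]; exact not_lt.2 hΨ0)
    · exact h
  have hle : ∀ y ∈ K, Ψ t0 y ≤ 0 := by
    intro y hy
    have hcy : ContinuousWithinAt (fun τ => Ψ τ y) (Icc s T) t0 :=
      (hc (t0, y) ⟨ht0, hy⟩).comp (f := fun τ : ℝ => (τ, y)) (by fun_prop)
        (fun τ hτ => ⟨hτ, hy⟩)
    have hcy' : Tendsto (fun τ => Ψ τ y) (𝓝[Ioo s t0] t0) (𝓝 (Ψ t0 y)) :=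
      hcy.mono fun τ hτ => ⟨hτ.1.le, hτ.2.le.trans ht0.2⟩
    have hne : (𝓝[Ioo s t0] t0).NeBot := by
      rw [nhdsWithin_Ioo_eq_nhdsLT hst]; infer_instance
    exact le_of_tendsto hcy' (eventually_nhdsWithin_of_forall fun τ hτ =>
      (hbefore τ ⟨hτ.1.le, hτ.2.le.trans ht0.2⟩ hτ.2 y hy).le)
  have heq : Ψ t0 x0 = 0 := le_antisymm (hle x0 hx0) hΨ0
  refine htouch t0 ⟨hst, ht0.2⟩ x0 hx0 heq hle fun ℓ hℓ => ?_
  have h2 := (hasDerivWithinAt_iff_tendsto_slope' (s := Iio t0) (by simp)).1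
    (hℓ.mono Iio_subset_Iic_self)
  refine ge_of_tendsto h2 ?_
  filter_upwards [Ioo_mem_nhdsLT hst] with τ hτ
  rw [slope_def_field, heq]
  have := hbefore τ ⟨hτ.1.le, hτ.2.le.trans ht0.2⟩ hτ.2 x0 hx0
  exact div_nonneg_of_nonpos (by linarith) (by linarith [hτ.2])

variable {F G : Type*} [NormedAddCommGroup F] [NormedSpace ℝ F]
  [NormedAddCommGroup G] [NormedSpace ℝ G]

/-- `g` is differentiable, with first and second derivative `a` and `b` at `0`. -/
def HasJet2 (g : ℝ → F) (a b : F) : Prop :=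
  ∃ g' : ℝ → F, (∀ τ, HasDerivAt g (g' τ) τ) ∧ g' 0 = a ∧ HasDerivAt g' b 0

lemma HasJet2.hasDerivAt {g : ℝ → F} {a b : F} (h : HasJet2 g a b) : HasDerivAt g a 0 := by
  obtain ⟨g', h1, h2, -⟩ := h
  exact h2 ▸ h1 0

lemma HasJet2.add {g h : ℝ → F} {a b a' b' : F} (hg : HasJet2 g a b) (hh : HasJet2 h a' b') :
    HasJet2 (fun τ => g τ + h τ) (a + a') (b + b') := by
  obtain ⟨g', h1, h2, h3⟩ := hg
  obtain ⟨h', k1, k2, k3⟩ := hh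
  exact ⟨fun τ => g' τ + h' τ, fun τ => (h1 τ).add (k1 τ), by simp [h2, k2], h3.add k3⟩

lemma HasJet2.const (c : F) : HasJet2 (fun _ => c) 0 0 :=
  ⟨fun _ => 0, fun τ => hasDerivAt_const τ c, rfl, hasDerivAt_const 0 0⟩

lemma HasJet2.clm {g : ℝ → F} {a b : F} (hg : HasJet2 g a b) (L : F →L[ℝ] G) :
    HasJet2 (fun τ => L (g τ)) (L a) (L b) := by
  obtain ⟨g', h1, h2, h3⟩ := hg
  exact ⟨fun τ => L (g' τ), fun τ => L.hasFDerivAt.comp_hasDerivAt τ (h1 τ), by simp [h2],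
    L.hasFDerivAt.comp_hasDerivAt 0 h3⟩

lemma HasJet2.const_mul {g : ℝ → ℝ} {a b : ℝ} (hg : HasJet2 g a b) (c : ℝ) :
    HasJet2 (fun τ => c * g τ) (c * a) (c * b) := by
  simpa using hg.clm (c • ContinuousLinearMap.id ℝ ℝ)

lemma HasJet2.sub {g h : ℝ → F} {a b a' b' : F} (hg : HasJet2 g a b) (hh : HasJet2 h a' b') :
    HasJet2 (fun τ => g τ - h τ) (a - a') (b - b') := by
  obtain ⟨g', h1, h2, h3⟩ := hg
  obtain ⟨h', k1, k2, k3⟩ := hh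
  exact ⟨fun τ => g' τ - h' τ, fun τ => (h1 τ).sub (k1 τ), by simp [h2, k2], h3.sub k3⟩

lemma HasJet2.sum {ι : Type*} (S : Finset ι) {g : ι → ℝ → F} {a b : ι → F}
    (hg : ∀ i ∈ S, HasJet2 (g i) (a i) (b i)) :
    HasJet2 (fun τ => ∑ i ∈ S, g i τ) (∑ i ∈ S, a i) (∑ i ∈ S, b i) := by
  classical
  induction S using Finset.induction_on with
  | empty => simpa using HasJet2.const (0 : F)
  | insert i S hi ih =>
    simp only [Finset.sum_insert hi]
    exact (hg i (by simp)).add (ih fun j hj => hg j (by simp [hj]))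

lemma HasJet2.sq {g : ℝ → ℝ} {a b : ℝ} (hg : HasJet2 g a b) :
    HasJet2 (fun τ => g τ ^ 2) (2 * (g 0 * a)) (2 * (a ^ 2 + g 0 * b)) := by
  obtain ⟨g', h1, h2, h3⟩ := hg
  refine ⟨fun τ => 2 * (g τ * g' τ), fun τ => ?_, by simp [h2], ?_⟩
  · have := (h1 τ).pow 2
    refine this.congr_deriv ?_
    simp; ring
  · refine (((h1 0).mul h3).const_mul 2).congr_deriv ?_
    rw [h2]; ring

/-- Composition with a function of one real variable. -/
lemma HasJet2.comp {g : ℝ → ℝ} {a b c : ℝ} {Θ Θ' : ℝ → ℝ} (hg : HasJet2 g a b)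
    (hΘ : ∀ τ, HasDerivAt Θ (Θ' (g τ)) (g τ)) (hΘ' : HasDerivAt Θ' c (g 0)) :
    HasJet2 (fun τ => Θ (g τ)) (Θ' (g 0) * a) (c * a ^ 2 + Θ' (g 0) * b) := by
  obtain ⟨g', h1, h2, h3⟩ := hg
  refine ⟨fun τ => Θ' (g τ) * g' τ, fun τ => (hΘ τ).comp τ (h1 τ), by simp [h2], ?_⟩
  refine ((hΘ'.comp 0 (h1 0)).mul h3).congr_deriv ?_
  simp only [Function.comp, h2]; ring

/-- Jets of a `C²` function along lines. -/
lemma hasJet2_line {E : Type*} [NormedAddCommGroup E] [NormedSpace ℝ E] {f : E → F}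
    (hf : ContDiff ℝ 2 f) (x v : E) :
    HasJet2 (fun τ : ℝ => f (x + τ • v)) (fderiv ℝ f x v) (fderiv ℝ (fderiv ℝ f) x v v) := by
  have hline : ∀ τ : ℝ, HasDerivAt (fun τ : ℝ => x + τ • v) v τ := fun τ => by
    simpa using ((hasDerivAt_id τ).smul_const v).const_add x
  refine ⟨fun τ => fderiv ℝ f (x + τ • v) v, fun τ => ?_, by simp, ?_⟩
  · exact ((hf.differentiable (by norm_num)) _).hasFDerivAt.comp_hasDerivAt τ (hline τ)
  · have h1 : DifferentiableAt ℝ (fderiv ℝ f) (x + (0:ℝ) • v) :=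
      ((hf.fderiv_right (m := 1) (by norm_num)).differentiable (by norm_num)) _
    have h2 : HasDerivAt (fun τ : ℝ => fderiv ℝ f (x + τ • v))
        (fderiv ℝ (fderiv ℝ f) (x + (0:ℝ) • v) v) 0 :=
      HasFDerivAt.comp_hasDerivAt (l := fderiv ℝ f) (f := fun τ : ℝ => x + τ • v) 0
        h1.hasFDerivAt (hline 0)
    have h3 := (ContinuousLinearMap.apply ℝ F v).hasFDerivAt.comp_hasDerivAt 0 h2
    simpa [Function.comp_def] using h3

lemma HasJet2.nonpos_of_isLocalMax {g : ℝ → ℝ} {a b : ℝ} (hg : HasJet2 g a b)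
    (hmax : IsLocalMax g 0) : a = 0 ∧ b ≤ 0 := by
  have ha : a = 0 := hmax.hasDerivAt_eq_zero hg.hasDerivAt
  obtain ⟨g', h1, h2, h3⟩ := hg
  refine ⟨ha, ?_⟩
  by_contra! hb
  have hd : deriv g = g' := funext fun τ => (h1 τ).deriv
  have hmin : IsLocalMin g 0 := isLocalMin_of_deriv_deriv_pos (by rw [hd, h3.deriv]; exact hb)
    (by rw [hd, h2, ha]) (h1 0).continuousAt
  have hconst : ∀ᶠ τ in 𝓝 (0:ℝ), g τ = g 0 := by
    filter_upwards [hmin, hmax] with τ k1 k2 using le_antisymm k2 k1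
  have hz : g' =ᶠ[𝓝 0] fun _ => 0 := by
    filter_upwards [hconst.eventually_nhds] with τ hτ
    have : HasDerivAt g 0 τ := (hasDerivAt_const τ (g 0)).congr_of_eventuallyEq hτ
    exact (h1 τ).unique this
  have := (hasDerivAt_const (0:ℝ) (0:ℝ)).congr_of_eventuallyEq hz
  exact absurd (h3.unique this) hb.ne'

end MaximumPrinciple

section Doubling

lemma hasJet2_norm_sq {E : Type*} [NormedAddCommGroup E] [InnerProductSpace ℝ E] (z v : E) :
    HasJet2 (fun τ : ℝ => ‖z + τ • v‖ ^ 2) (2 * inner ℝ z v) (2 * ‖v‖ ^ 2) := by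
  have h : (fun τ : ℝ => ‖z + τ • v‖ ^ 2) =
      fun τ : ℝ => ‖z‖ ^ 2 + τ * (2 * inner ℝ z v) + τ ^ 2 * ‖v‖ ^ 2 := by
    funext τ
    rw [norm_add_sq_real, inner_smul_right, norm_smul, mul_pow, Real.norm_eq_abs, sq_abs]; ring
  rw [h]
  refine ⟨fun τ => 2 * inner ℝ z v + 2 * τ * ‖v‖ ^ 2, fun τ => ?_, by simp, ?_⟩
  · have := (((hasDerivAt_id τ).mul_const (2 * inner ℝ z v)).const_add (‖z‖ ^ 2)).add
      (((hasDerivAt_id τ).pow 2).mul_const (‖v‖ ^ 2))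
    refine this.congr_deriv ?_
    simp
  · have := (((hasDerivAt_id (0:ℝ)).const_mul 2).mul_const (‖v‖ ^ 2)).const_add (2 * inner ℝ z v)
    refine this.congr_deriv ?_
    simp

variable {d : ℕ}

local notation "𝔼" => EuclideanSpace ℝ (Fin d)

/-- What is required of a doubled function at a point for the comparison argument. -/
def DoublingIneq (q : Matrix (Fin d) (Fin d) ℝ) (bh : 𝔼) (H : ℝ → 𝔼 → 𝔼 → ℝ)
    (t : ℝ) (x y : 𝔼) (c e : ℝ) : Prop :=
  ∃ (σ σ' : Fin d → 𝔼) (a0 a2 : Fin d → ℝ) (a1 ℓ : ℝ),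
    (∀ i j, ∑ a, σ a i * σ a j = q i j) ∧ ∑ a, ‖σ a - σ' a‖ ^ 2 ≤ c ^ 2 ∧
    HasDerivWithinAt (fun τ => H τ x y) ℓ (Iic t) t ∧
    (∀ a, HasJet2 (fun τ : ℝ => H t (x + τ • σ a) (y + τ • σ' a)) (a0 a) (a2 a)) ∧
    HasDerivAt (fun τ : ℝ => H t (x + τ • bh) (y + τ • bh)) a1 0 ∧
    ℓ ≤ ∑ a, a2 a + a1 + e

lemma not_touching {q : Matrix (Fin d) (Fin d) ℝ} {bh : 𝔼} {H : ℝ → 𝔼 → 𝔼 → ℝ}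
    {φ : 𝔼 → ℝ} (hφ : ContDiff ℝ 2 φ) {lam K δ ε ζ s t R c e : ℝ} {x y : 𝔼} (hlam : 0 < lam)
    (hδ : 0 < δ) (hε : 0 < ε)
    (hlyap : ∑ i, ∑ j, q i j * fderiv ℝ (fderiv ℝ φ) x (𝐞 i)
      (𝐞 j) + fderiv ℝ φ x bh ≤ lam * φ x + K)
    (hx : x ∈ Metric.ball (0 : 𝔼) R) (hy : y ∈ Metric.ball (0 : 𝔼) R)
    (hH : DoublingIneq q bh H t x y c e) (hce : c ^ 2 / ε + e < ζ)
    {Ψ : ℝ → 𝔼 × 𝔼 → ℝ}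
    (hΨ : Ψ = fun t p => H t p.1 p.2 - ‖p.1 - p.2‖ ^ 2 / (2 * ε)
      - δ * Real.exp (lam * (t - s)) * (φ p.1 + K / lam) - ζ * (1 + (t - s)))
    (h0 : Ψ t (x, y) = 0)
    (hmax : ∀ p ∈ Metric.closedBall (0 : 𝔼) R ×ˢ Metric.closedBall (0 : 𝔼) R, Ψ t p ≤ 0)
    (htime : ∀ ℓ, HasDerivWithinAt (fun τ => Ψ τ (x, y)) ℓ (Iic t) t → 0 ≤ ℓ) : False := by
  obtain ⟨σ, σ', a0, a2, a1, ℓ, hσ, hσσ, hℓ, hjet, h1, hineq⟩ := hH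
  set m := δ * Real.exp (lam * (t - s)) with hm
  have hm0 : 0 < m := by positivity
  have hloc : ∀ v v' : 𝔼, IsLocalMax (fun τ : ℝ => Ψ t (x + τ • v, y + τ • v')) 0 := by
    intro v v'
    have c1 : ∀ᶠ τ : ℝ in 𝓝 0, x + τ • v ∈ Metric.ball (0 : 𝔼) R :=
      (show Continuous fun τ : ℝ => x + τ • v by fun_prop).continuousAt.eventually_mem
        (Metric.isOpen_ball.mem_nhds (by simpa using hx))
    have c2 : ∀ᶠ τ : ℝ in 𝓝 0, y + τ • v' ∈ Metric.ball (0 : 𝔼) R :=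
      (show Continuous fun τ : ℝ => y + τ • v' by fun_prop).continuousAt.eventually_mem
        (Metric.isOpen_ball.mem_nhds (by simpa using hy))
    filter_upwards [c1, c2] with τ k1 k2
    simp only [zero_smul, add_zero, h0]
    exact hmax _ ⟨Metric.ball_subset_closedBall k1, Metric.ball_subset_closedBall k2⟩
  have hsub : ∀ (v v' : 𝔼) (τ : ℝ), (x + τ • v) - (y + τ • v') = (x - y) + τ • (v - v') := by
    intro v v' τ; module
  have hsecond : ∀ a, a2 a ≤ ‖σ a - σ' a‖ ^ 2 / ε + m * fderiv ℝ (fderiv ℝ φ) x (σ a) (σ a) := by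
    intro a
    have j1 := (((hjet a).sub ((hasJet2_norm_sq (x - y) (σ a - σ' a)).const_mul (1 / (2 * ε)))).sub
      (((hasJet2_line hφ x (σ a)).add (HasJet2.const (K / lam))).const_mul m)).sub
      (HasJet2.const (ζ * (1 + (t - s))))
    have j2 : IsLocalMax (fun τ : ℝ => H t (x + τ • σ a) (y + τ • σ' a)
        - 1 / (2 * ε) * ‖x - y + τ • (σ a - σ' a)‖ ^ 2
        - m * (φ (x + τ • σ a) + K / lam) - ζ * (1 + (t - s))) 0 := by
      have := hloc (σ a) (σ' a)
      simp only [hΨ, hsub] at this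
      convert this using 3
      ring
    have := (j1.nonpos_of_isLocalMax j2).2
    have e1 : 1 / (2 * ε) * (2 * ‖σ a - σ' a‖ ^ 2) = ‖σ a - σ' a‖ ^ 2 / ε := by field_simp
    rw [e1] at this
    linarith
  have hfirst : a1 = m * fderiv ℝ φ x bh := by
    have j1 := h1.sub ((((hasJet2_line hφ x bh).add (HasJet2.const (K / lam))).const_mul m).hasDerivAt)
    have j2 : IsLocalMax (fun τ : ℝ => H t (x + τ • bh) (y + τ • bh)
        - m * (φ (x + τ • bh) + K / lam)) 0 := by
      have := hloc bh bh
      simp only [hΨ, hsub, sub_self, smul_zero, add_zero] at this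
      filter_upwards [this] with τ hτ
      simp only [zero_smul, add_zero] at hτ ⊢
      linarith
    have := j2.hasDerivAt_eq_zero j1
    linarith
  have hbil : ∑ a, fderiv ℝ (fderiv ℝ φ) x (σ a) (σ a) =
      ∑ i, ∑ j, q i j * fderiv ℝ (fderiv ℝ φ) x (𝐞 i)
        (𝐞 j) := by
    have := sum_bilin_eq_diffusionCoef (V := ℝ) (q := q) (s := σ) hσ (fderiv ℝ (fderiv ℝ φ) x)
    rw [this, diffusionCoef_apply]
    simp
  have hℓ0 : 0 ≤ ℓ - m * lam * (φ x + K / lam) - ζ := by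
    refine htime _ ?_
    rw [hΨ]
    have hexp : HasDerivWithinAt (fun τ => δ * Real.exp (lam * (τ - s))) (m * lam) (Iic t) t := by
      have := ((((hasDerivAt_id t).sub_const s).const_mul lam).exp.const_mul δ).hasDerivWithinAt
        (s := Iic t)
      refine this.congr_deriv ?_
      simp [hm]; ring
    have hlin : HasDerivWithinAt (fun τ => ζ * (1 + (τ - s))) ζ (Iic t) t := by
      have := ((((hasDerivAt_id t).sub_const s).const_add 1).const_mul ζ).hasDerivWithinAt
        (s := Iic t)
      refine this.congr_deriv ?_
      simp
    exact ((hℓ.sub_const _).sub (hexp.mul_const _)).sub hlin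
  have hsum : ∑ a, a2 a ≤ (∑ a, ‖σ a - σ' a‖ ^ 2) / ε
      + m * ∑ a, fderiv ℝ (fderiv ℝ φ) x (σ a) (σ a) := by
    refine (Finset.sum_le_sum fun a _ => hsecond a).trans (le_of_eq ?_)
    rw [Finset.sum_add_distrib, Finset.sum_div, Finset.mul_sum]
  have hdiv : (∑ a, ‖σ a - σ' a‖ ^ 2) / ε ≤ c ^ 2 / ε := div_le_div_of_nonneg_right hσσ hε.le
  have hlyap' := mul_le_mul_of_nonneg_left hlyap hm0.le
  have e2 : m * lam * (φ x + K / lam) = m * (lam * φ x + K) := by field_simp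
  rw [hbil] at hsum
  rw [mul_add] at hlyap'
  linarith

lemma mul_div_add_one_le {L c : ℝ} (hc : 0 ≤ c) : L ^ 2 * (c / (L ^ 2 + 1)) ≤ c := by
  have h1 : L ^ 2 / (L ^ 2 + 1) ≤ 1 := by rw [div_le_one (by positivity)]; linarith
  have h2 := mul_le_mul_of_nonneg_left h1 hc
  have h3 : L ^ 2 * (c / (L ^ 2 + 1)) = c * (L ^ 2 / (L ^ 2 + 1)) := by ring
  linarith

lemma doubling_error_lt {L η n ε ζ : ℝ} (hε : 0 < ε) (hζ : 0 < ζ) (hη : 0 < η) (hη1 : η ≤ 1)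
    (hηκ : η ≤ ε * ζ / (16 * (L ^ 2 + 1))) (hn : n ^ 2 / (2 * ε) ≤ 2 * (ζ / (64 * (L ^ 2 + 1)))) :
    (L * (η + n)) ^ 2 / ε + ζ / 4 < ζ := by
  have h1 : (L * (η + n)) ^ 2 / ε ≤ 2 * (L ^ 2 * η ^ 2) / ε + 4 * (L ^ 2 * (n ^ 2 / (2 * ε))) := by
    have : 2 * (L ^ 2 * η ^ 2) / ε + 4 * (L ^ 2 * (n ^ 2 / (2 * ε))) =
        (2 * L ^ 2 * η ^ 2 + 2 * L ^ 2 * n ^ 2) / ε := by field_simp; ring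
    rw [this]
    refine div_le_div_of_nonneg_right ?_ hε.le
    linarith [mul_nonneg (sq_nonneg L) (sq_nonneg (η - n))]
  have h2 : 2 * (L ^ 2 * η ^ 2) / ε ≤ ζ / 8 := by
    rw [div_le_iff₀ hε]
    have a1 : η ^ 2 ≤ η := by nlinarith
    have a2 := mul_le_mul_of_nonneg_left (a1.trans hηκ) (sq_nonneg L)
    have a3 : ε * ζ / (16 * (L ^ 2 + 1)) = (ε * ζ / 16) / (L ^ 2 + 1) := by field_simp
    rw [a3] at a2
    have a4 := mul_div_add_one_le (L := L) (show 0 ≤ ε * ζ / 16 by positivity)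
    linarith
  have h3 : 4 * (L ^ 2 * (n ^ 2 / (2 * ε))) ≤ ζ / 8 := by
    have a2 := mul_le_mul_of_nonneg_left hn (sq_nonneg L)
    have a3 : L ^ 2 * (2 * (ζ / (64 * (L ^ 2 + 1)))) = L ^ 2 * ((ζ / 32) / (L ^ 2 + 1)) := by
      field_simp; ring
    have a4 := mul_div_add_one_le (L := L) (show 0 ≤ ζ / 32 by positivity)
    linarith
  linarith

set_option maxHeartbeats 2000000 in
/-- Comparison by doubling of variables: the parameter `η` measures the quality of the
approximation. -/
theorem doubling_comparison {s T : ℝ} (hsT : s < T)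
    {q : ℝ → 𝔼 → Matrix (Fin d) (Fin d) ℝ} {bh : ℝ → 𝔼 → 𝔼} {φ : 𝔼 → ℝ} (hφ : ContDiff ℝ 2 φ)
    (hφ_pos : ∀ x, 0 < φ x) (hφ_blowup : Tendsto φ (cocompact 𝔼) atTop)
    {lam K : ℝ} (hlam : 0 < lam) (hK : 0 ≤ K)
    (hlyap : ∀ t ∈ Icc s T, ∀ x, ∑ i, ∑ j, q t x i j * fderiv ℝ (fderiv ℝ φ) x
      (𝐞 i) (𝐞 j) + fderiv ℝ φ x (bh t x)
      ≤ lam * φ x + K) (M ρ : ℝ) {δ₀ : ℝ} (hδ₀ : 0 < δ₀) :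
    ∃ R, 0 < R ∧ ρ ≤ R ∧ ∀ (𝓗 : ℝ → Set (ℝ → 𝔼 → 𝔼 → ℝ)) (Lc : ℝ),
      (∀ η, ∀ H ∈ 𝓗 η, ContinuousOn (fun p : ℝ × 𝔼 × 𝔼 => H p.1 p.2.1 p.2.2)
        (Icc s T ×ˢ univ)) →
      (∀ η, ∀ H ∈ 𝓗 η, ∀ t ∈ Icc s T, ∀ x ∈ Metric.closedBall (0 : 𝔼) R,
        ∀ y ∈ Metric.closedBall (0 : 𝔼) R, H t x y ≤ M) →
      (∀ η, ∀ H ∈ 𝓗 η, ∀ y ∈ Metric.closedBall (0 : 𝔼) R, H s y y ≤ 0) →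
      (∀ e > 0, ∃ r > 0, ∀ η ∈ Ioc 0 r, ∀ H ∈ 𝓗 η, ∀ t ∈ Icc s T,
        ∀ x ∈ Metric.closedBall (0 : 𝔼) R, ∀ y ∈ Metric.closedBall (0 : 𝔼) R, ‖x - y‖ ≤ r →
        H t x y - H t y y ≤ e) →
      (∀ e > 0, ∃ r > 0, ∀ η ∈ Ioc 0 r, ∀ H ∈ 𝓗 η, ∀ t ∈ Ioc s T,
        ∀ x ∈ Metric.closedBall (0 : 𝔼) R, ∀ y ∈ Metric.closedBall (0 : 𝔼) R, ‖x - y‖ ≤ r →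
        0 < H t x y → DoublingIneq (q t x) (bh t x) H t x y (Lc * (η + ‖x - y‖)) e) →
      ∃ η₀ > 0, ∀ η ∈ Ioc 0 η₀, ∀ H ∈ 𝓗 η, ∀ t ∈ Icc s T, ∀ x ∈ Metric.closedBall (0 : 𝔼) ρ,
        H t x x ≤ δ₀ := by
  obtain ⟨A, hA⟩ : ∃ A, ∀ x ∈ Metric.closedBall (0 : 𝔼) ρ, φ x ≤ A := by
    obtain ⟨A, hA⟩ := (isCompact_closedBall (0 : 𝔼) ρ).bddAbove_image hφ.continuous.continuousOn
    exact ⟨A, fun x hx => hA (mem_image_of_mem _ hx)⟩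
  set M' := max M 1 with hM'
  have hM'1 : 1 ≤ M' := le_max_right _ _
  set E0 := Real.exp (lam * (T - s)) with hE0
  have hE0pos : 0 < E0 := Real.exp_pos _
  have hTs : 0 < T - s := by linarith
  set ζ := δ₀ / (2 * (1 + (T - s))) with hζ
  have hζ0 : 0 < ζ := by positivity
  set A' := max A 0 + K / lam + 1 with hA'
  have hKl : 0 ≤ K / lam := by positivity
  have hA'0 : 0 < A' := by have := le_max_right A 0; positivity
  set δ := δ₀ / (2 * (E0 * A')) with hδ
  have hδ0 : 0 < δ := by positivity
  obtain ⟨R0, hR0⟩ : ∃ R0, ∀ x : 𝔼, R0 ≤ ‖x‖ → M' / δ < φ x := by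
    have := hφ_blowup.eventually (eventually_gt_atTop (M' / δ))
    rw [← Metric.cobounded_eq_cocompact, ← comap_norm_atTop, eventually_comap,
      eventually_atTop] at this
    obtain ⟨R0, hR0⟩ := this
    exact ⟨R0, fun x hx => hR0 _ hx x rfl⟩
  set R := max R0 (max ρ 0) + 1 with hR
  have hRR0 : R0 ≤ R - 1 := by simp [hR]
  refine ⟨R, ?_, ?_, ?_⟩
  · have : 0 ≤ max R0 (max ρ 0) := (le_max_right ρ 0).trans (le_max_right _ _)
    linarith
  · have : ρ ≤ max R0 (max ρ 0) := (le_max_left ρ 0).trans (le_max_right _ _)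
    linarith
  intro 𝓗 Lc hcont hbound hstart hmod hgen
  set e := ζ / (64 * (Lc ^ 2 + 1)) with he
  have he0 : 0 < e := by positivity
  have heζ : e < ζ := by
    rw [he, div_lt_iff₀ (by positivity)]; nlinarith [sq_nonneg Lc]
  obtain ⟨r1, hr1, hmod⟩ := hmod e he0
  obtain ⟨r2, hr2, hgen⟩ := hgen (ζ / 4) (by positivity)
  obtain ⟨r3, hr3, hosc⟩ : ∃ r3 > 0, ∀ x ∈ Metric.closedBall (0 : 𝔼) R,
      ∀ y ∈ Metric.closedBall (0 : 𝔼) R, ‖x - y‖ ≤ r3 → φ y - φ x ≤ e / (δ * E0) := by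
    have hu := (isCompact_closedBall (0 : 𝔼) R).uniformContinuousOn_of_continuous
      hφ.continuous.continuousOn
    obtain ⟨r, hr, h⟩ := Metric.uniformContinuousOn_iff_le.1 hu (e / (δ * E0)) (by positivity)
    refine ⟨r, hr, fun x hx y hy hxy => ?_⟩
    have := h x hx y hy (by rwa [dist_eq_norm])
    rw [Real.dist_eq] at this
    linarith [neg_abs_le (φ x - φ y)]
  set r := min (min r1 r2) (min r3 1) with hr
  have hr0 : 0 < r := by positivity
  have hrr1 : r ≤ r1 := (min_le_left _ _).trans (min_le_left _ _)
  have hrr2 : r ≤ r2 := (min_le_left _ _).trans (min_le_right _ _)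
  have hrr3 : r ≤ r3 := (min_le_right _ _).trans (min_le_left _ _)
  have hrr4 : r ≤ 1 := (min_le_right _ _).trans (min_le_right _ _)
  set ε := r ^ 2 / (4 * M') with hε
  have hε0 : 0 < ε := by positivity
  set κ := ε * ζ / (16 * (Lc ^ 2 + 1)) with hκ
  have hκ0 : 0 < κ := by positivity
  refine ⟨min r κ, by positivity, fun η hη H hH => ?_⟩
  have hηr : η ≤ r := hη.2.trans (min_le_left _ _)
  have hηκ : η ≤ κ := hη.2.trans (min_le_right _ _)
  have hη0 : 0 < η := hη.1
  set Ψ : ℝ → 𝔼 × 𝔼 → ℝ := fun t p => H t p.1 p.2 - ‖p.1 - p.2‖ ^ 2 / (2 * ε)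
      - δ * Real.exp (lam * (t - s)) * (φ p.1 + K / lam) - ζ * (1 + (t - s)) with hΨ
  have hfar : ∀ x y : 𝔼, r < ‖x - y‖ → M' < ‖x - y‖ ^ 2 / (2 * ε) := by
    intro x y h
    rw [lt_div_iff₀ (by positivity)]
    have h1 : M' * (2 * ε) = r ^ 2 / 2 := by rw [hε]; field_simp; ring
    rw [h1]
    nlinarith
  have hpen : ∀ t ∈ Icc s T, ∀ x : 𝔼, 0 ≤ δ * Real.exp (lam * (t - s)) * (φ x + K / lam) :=
    fun t _ x => by have := hφ_pos x; positivity
  have hneg : ∀ t ∈ Icc s T, ∀ p ∈ Metric.closedBall (0 : 𝔼) R ×ˢ Metric.closedBall (0 : 𝔼) R,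
      Ψ t p < 0 := by
    refine neg_of_touching ((isCompact_closedBall _ _).prod (isCompact_closedBall _ _)) ?_ ?_ ?_
    · have h1 : ContinuousOn (fun p : ℝ × 𝔼 × 𝔼 => H p.1 p.2.1 p.2.2)
          (Icc s T ×ˢ (Metric.closedBall (0 : 𝔼) R ×ˢ Metric.closedBall (0 : 𝔼) R)) :=
        (hcont η H hH).mono (prod_mono_right (subset_univ _))
      have h2 : Continuous (fun p : ℝ × 𝔼 × 𝔼 => ‖p.2.1 - p.2.2‖ ^ 2 / (2 * ε)
        + δ * Real.exp (lam * (p.1 - s)) * (φ p.2.1 + K / lam) + ζ * (1 + (p.1 - s))) := by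
        have := hφ.continuous
        fun_prop
      refine (h1.sub h2.continuousOn).congr fun p _ => ?_
      simp only [hΨ, Pi.sub_apply]; ring
    · rintro ⟨x, y⟩ ⟨hx, hy⟩
      simp only at hx hy
      have hp := hpen s ⟨le_rfl, hsT.le⟩ x
      simp only [hΨ, sub_self, add_zero, mul_one] at hp ⊢
      have hsq : 0 ≤ ‖x - y‖ ^ 2 / (2 * ε) := by positivity
      by_cases h : ‖x - y‖ ≤ r
      · have h1 := hmod η ⟨hη0, hηr.trans hrr1⟩ H hH s ⟨le_rfl, hsT.le⟩ x hx y hy (h.trans hrr1)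
        have h2 := hstart η H hH y hy
        linarith
      · have h1 := hbound η H hH s ⟨le_rfl, hsT.le⟩ x hx y hy
        have h2 := hfar x y (not_le.1 h)
        have h3 : M ≤ M' := le_max_left _ _
        linarith
    · rintro t ht ⟨x, y⟩ ⟨hx, hy⟩ h0 hmax htime
      simp only at hx hy
      have htI : t ∈ Icc s T := ⟨ht.1.le, ht.2⟩
      have hp := hpen t htI x
      have hζt : ζ ≤ ζ * (1 + (t - s)) := by nlinarith [ht.1]
      have hMb := hbound η H hH t htI x hx y hy
      have hMM : M ≤ M' := le_max_left _ _
      have hsq : 0 ≤ ‖x - y‖ ^ 2 / (2 * ε) := by positivity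
      have h0' : H t x y = ‖x - y‖ ^ 2 / (2 * ε)
        + δ * Real.exp (lam * (t - s)) * (φ x + K / lam) + ζ * (1 + (t - s)) := by
        simp only [hΨ] at h0; linarith
      have hxy : ‖x - y‖ ≤ r := by
        by_contra! h
        have := hfar x y h
        linarith
      have hexp1 : 1 ≤ Real.exp (lam * (t - s)) :=
        Real.one_le_exp (mul_nonneg hlam.le (by linarith [ht.1]))
      have hexp2 : Real.exp (lam * (t - s)) ≤ E0 :=
        Real.exp_le_exp.2 (mul_le_mul_of_nonneg_left (by linarith [ht.2]) hlam.le)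
      have hxR : ‖x‖ < R - 1 := by
        by_contra! h
        have h1 := hR0 x (hRR0.trans h)
        rw [div_lt_iff₀ hδ0] at h1
        have h2 : δ * φ x ≤ δ * Real.exp (lam * (t - s)) * (φ x + K / lam) := by
          have h3 : δ * φ x * 1 ≤ δ * φ x * Real.exp (lam * (t - s)) :=
            mul_le_mul_of_nonneg_left hexp1 (mul_pos hδ0 (hφ_pos x)).le
          have h4 : 0 ≤ δ * Real.exp (lam * (t - s)) * (K / lam) := by positivity
          linarith
        linarith
      have hyR : ‖y‖ < R := by
        have := norm_sub_norm_le y x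
        rw [norm_sub_rev] at this
        linarith
      have hyy := hmax (y, y) ⟨hy, hy⟩
      simp only [hΨ, sub_self, norm_zero] at hyy
      have hyy' : H t y y ≤ δ * Real.exp (lam * (t - s)) * (φ y + K / lam) + ζ * (1 + (t - s)) := by
        have : (0:ℝ) ^ 2 / (2 * ε) = 0 := by simp
        linarith
      have hm1 := hmod η ⟨hη0, hηr.trans hrr1⟩ H hH t htI x hx y hy (hxy.trans hrr1)
      have hosc' := hosc x hx y hy (hxy.trans hrr3)
      have hosc2 : δ * Real.exp (lam * (t - s)) * (φ y - φ x) ≤ e := by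
        have h1 : δ * Real.exp (lam * (t - s)) * (φ y - φ x) ≤
            δ * Real.exp (lam * (t - s)) * (e / (δ * E0)) :=
          mul_le_mul_of_nonneg_left hosc' (by positivity)
        have h2 : δ * Real.exp (lam * (t - s)) * (e / (δ * E0)) ≤ δ * E0 * (e / (δ * E0)) := by
          gcongr
        have h3 : δ * E0 * (e / (δ * E0)) = e := by field_simp
        linarith
      have hclose : ‖x - y‖ ^ 2 / (2 * ε) ≤ 2 * e := by
        rw [mul_sub] at hosc2
        linarith
      refine not_touching hφ hlam hδ0 hε0 (hlyap t htI x) (by simpa using hxR.trans (by linarith))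
        (by simpa using hyR)
        (hgen η ⟨hη0, hηr.trans hrr2⟩ H hH t ht x hx y hy (hxy.trans hrr2)
          (by rw [h0']; linarith)) ?_ hΨ h0 hmax htime
      exact doubling_error_lt hε0 hζ0 hη0 (hηr.trans hrr4) hηκ hclose
  intro t ht x hx
  have hxR : x ∈ Metric.closedBall (0 : 𝔼) R := by
    refine Metric.closedBall_subset_closedBall ?_ hx
    have : ρ ≤ max R0 (max ρ 0) := (le_max_left ρ 0).trans (le_max_right _ _)
    linarith
  have h1 := hneg t ht (x, x) ⟨hxR, hxR⟩
  simp only [hΨ, sub_self, norm_zero] at h1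
  have hz : (0:ℝ) ^ 2 / (2 * ε) = 0 := by simp
  have hexp2 : Real.exp (lam * (t - s)) ≤ E0 :=
    Real.exp_le_exp.2 (mul_le_mul_of_nonneg_left (by linarith [ht.2]) hlam.le)
  have h2 : δ * Real.exp (lam * (t - s)) * (φ x + K / lam) ≤ δ * E0 * A' := by
    have h3 : φ x + K / lam ≤ A' := by
      have := hA x hx
      have h4 := le_max_left A 0
      linarith
    have := hφ_pos x
    gcongr
  have h3 : δ * E0 * A' = δ₀ / 2 := by rw [hδ]; field_simp
  have h4 : ζ * (1 + (t - s)) ≤ δ₀ / 2 := by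
    have h5 : ζ * (1 + (t - s)) ≤ ζ * (1 + (T - s)) :=
      mul_le_mul_of_nonneg_left (by linarith [ht.2]) hζ0.le
    have h6 : ζ * (1 + (T - s)) = δ₀ / 2 := by rw [hζ]; field_simp
    linarith
  linarith

end Doubling

section BernsteinIdentity

variable {d m : ℕ}

local notation "𝔼" => EuclideanSpace ℝ (Fin d)
local notation "𝕍" => EuclideanSpace ℝ (Fin m)

lemma fderiv_eq_sum_pd (h : 𝔼 → ℝ) (x v : 𝔼) : fderiv ℝ h x v = ∑ i, v i * pd h x i := by
  rw [clm_eq_sum (fderiv ℝ h x) v]; rfl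

lemma ContDiff.pd_infty {h : 𝔼 → ℝ} (hh : ContDiff ℝ ∞ h) (i : Fin d) :
    ContDiff ℝ ∞ (fun y => pd h y i) :=
  (hh.fderiv_right (m := ∞) (by simp)).clm_apply contDiff_const

lemma fderiv_fderiv_apply {h : 𝔼 → ℝ} (hh : ContDiff ℝ 2 h) (x v w : 𝔼) :
    fderiv ℝ (fun y => fderiv ℝ h y w) x v = fderiv ℝ (fderiv ℝ h) x v w := by
  have h1 : DifferentiableAt ℝ (fderiv ℝ h) x :=
    ((hh.fderiv_right (m := 1) (by norm_num)).differentiable (by norm_num)) x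
  have := (ContinuousLinearMap.apply ℝ ℝ w).hasFDerivAt.comp x h1.hasFDerivAt
  have h2 : HasFDerivAt (fun y => fderiv ℝ h y w)
    ((ContinuousLinearMap.apply ℝ ℝ w).comp (fderiv ℝ (fderiv ℝ h) x)) x := this
  rw [h2.fderiv]; rfl

lemma pd_pd_eq {h : 𝔼 → ℝ} (hh : ContDiff ℝ 2 h) (x : 𝔼) (i j : Fin d) :
    pd (fun y => pd h y j) x i =
      fderiv ℝ (fderiv ℝ h) x (𝐞 i) (𝐞 j) :=
  fderiv_fderiv_apply hh x _ _

lemma pd_comm {h : 𝔼 → ℝ} (hh : ContDiff ℝ 2 h) (x : 𝔼) (i j : Fin d) :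
    pd (fun y => pd h y j) x i = pd (fun y => pd h y i) x j := by
  rw [pd_pd_eq hh, pd_pd_eq hh]
  exact (hh.contDiffAt.isSymmSndFDerivAt (by simp)) _ _

/-- Jets along lines in coordinates. -/
lemma hasJet2_line_pd {h : 𝔼 → ℝ} (hh : ContDiff ℝ 2 h) (x v : 𝔼) :
    HasJet2 (fun τ : ℝ => h (x + τ • v)) (∑ i, v i * pd h x i)
      (∑ i, ∑ j, v i * v j * pd (fun y => pd h y j) x i) := by
  have h1 := hasJet2_line hh x v
  rw [fderiv_eq_sum_pd] at h1
  convert h1 using 1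
  rw [bilin_eq_sum (fderiv ℝ (fderiv ℝ h) x) v]
  simp only [pd_pd_eq hh, smul_eq_mul]

lemma sum_quad_eq {ι : Type*} [Fintype ι] {q : Matrix (Fin d) (Fin d) ℝ} {σ : ι → 𝔼}
    (hσ : ∀ i j, ∑ a, σ a i * σ a j = q i j) (M : Fin d → Fin d → ℝ) :
    ∑ a, ∑ i, ∑ j, σ a i * σ a j * M i j = ∑ i, ∑ j, q i j * M i j := by
  rw [Finset.sum_comm]
  refine Finset.sum_congr rfl fun i _ => ?_
  rw [Finset.sum_comm]
  refine Finset.sum_congr rfl fun j _ => ?_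
  rw [← hσ, Finset.sum_mul]

/-- The coordinate form of a second order operator. -/
noncomputable def coordOp (q : 𝔼 → Fin d → Fin d → ℝ) (B : Fin d → 𝔼 → Fin m → Fin m → ℝ)
    (C : 𝔼 → Fin m → Fin m → ℝ) (h : Fin m → 𝔼 → ℝ) (k : Fin m) (x : 𝔼) : ℝ :=
  ∑ i, ∑ j, q x i j * pd (fun y => pd (h k) y j) x i + ∑ i, ∑ l, B i x k l * pd (h l) x i
    + ∑ l, C x k l * h l x

lemma pd_mul {f g : 𝔼 → ℝ} {x : 𝔼} (hf : DifferentiableAt ℝ f x) (hg : DifferentiableAt ℝ g x)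
    (l : Fin d) : pd (fun y => f y * g y) x l = pd f x l * g x + f x * pd g x l := by
  have := hf.hasFDerivAt.fun_mul hg.hasFDerivAt
  simp only [pd, this.fderiv]
  simp; ring

lemma pd_add {f g : 𝔼 → ℝ} {x : 𝔼} (hf : DifferentiableAt ℝ f x) (hg : DifferentiableAt ℝ g x)
    (l : Fin d) : pd (fun y => f y + g y) x l = pd f x l + pd g x l := by
  have := hf.hasFDerivAt.fun_add hg.hasFDerivAt
  simp only [pd, this.fderiv]
  simp

lemma pd_sum {ι : Type*} (S : Finset ι) {f : ι → 𝔼 → ℝ} {x : 𝔼}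
    (hf : ∀ i ∈ S, DifferentiableAt ℝ (f i) x) (l : Fin d) :
    pd (fun y => ∑ i ∈ S, f i y) x l = ∑ i ∈ S, pd (f i) x l := by
  have := HasFDerivAt.fun_sum (u := S) (fun i hi => (hf i hi).hasFDerivAt)
  simp only [pd, this.fderiv]
  simp

variable {q : EuclideanSpace ℝ (Fin d) → Fin d → Fin d → ℝ}
  {B : Fin d → EuclideanSpace ℝ (Fin d) → Fin m → Fin m → ℝ}
  {C : EuclideanSpace ℝ (Fin d) → Fin m → Fin m → ℝ} {h : Fin m → EuclideanSpace ℝ (Fin d) → ℝ}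

lemma pd_coordOp {x : 𝔼} (hq : ∀ i j, DifferentiableAt ℝ (fun y => q y i j) x)
    (hB : ∀ i k l, DifferentiableAt ℝ (fun y => B i y k l) x)
    (hC : ∀ k l, DifferentiableAt ℝ (fun y => C y k l) x)
    (hh : ∀ k, ContDiff ℝ ∞ (h k)) (k : Fin m) (l : Fin d) :
    pd (coordOp q B C h k) x l =
      ∑ i, ∑ j, (pd (fun y => q y i j) x l * pd (fun y => pd (h k) y j) x i
        + q x i j * pd (fun y => pd (fun z => pd (h k) z l) y j) x i)
      + ∑ i, ∑ k', (pd (fun y => B i y k k') x l * pd (h k') x i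
        + B i x k k' * pd (fun y => pd (h k') y l) x i)
      + ∑ k', (pd (fun y => C y k k') x l * h k' x + C x k k' * pd (h k') x l) := by
  have d0 : ∀ k, DifferentiableAt ℝ (h k) x := fun k => (hh k).differentiable (by simp) x
  have d1 : ∀ k i, DifferentiableAt ℝ (fun y => pd (h k) y i) x :=
    fun k i => ((hh k).pd_infty i).differentiable (by simp) x
  have d2 : ∀ k i j, DifferentiableAt ℝ (fun y => pd (fun z => pd (h k) z j) y i) x :=
    fun k i j => (((hh k).pd_infty j).pd_infty i).differentiable (by simp) x
  have c2 : ∀ {g : 𝔼 → ℝ}, ContDiff ℝ ∞ g → ContDiff ℝ 2 g := fun hg => hg.of_le (by exact ofNat_le_infty 2)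
  have e1 : DifferentiableAt ℝ (fun y => ∑ i, ∑ j, q y i j * pd (fun z => pd (h k) z j) y i) x :=
    DifferentiableAt.fun_sum fun i _ => DifferentiableAt.fun_sum fun j _ => (hq i j).fun_mul (d2 k i j)
  have e2 : DifferentiableAt ℝ (fun y => ∑ i, ∑ l, B i y k l * pd (h l) y i) x :=
    DifferentiableAt.fun_sum fun i _ => DifferentiableAt.fun_sum fun j _ => (hB i k j).fun_mul (d1 j i)
  have e3 : DifferentiableAt ℝ (fun y => ∑ l, C y k l * h l y) x :=
    DifferentiableAt.fun_sum fun j _ => (hC k j).fun_mul (d0 j)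
  unfold coordOp
  rw [pd_add (e1.fun_add e2) e3, pd_add e1 e2, pd_sum _ (fun i _ => DifferentiableAt.fun_sum fun j _ => (hq i j).fun_mul (d2 k i j)),
    pd_sum _ (fun i _ => DifferentiableAt.fun_sum fun j _ => (hB i k j).fun_mul (d1 j i)),
    pd_sum _ (fun j _ => (hC k j).fun_mul (d0 j))]
  congr 1
  · congr 1
    · refine Finset.sum_congr rfl fun i _ => ?_
      rw [pd_sum _ (fun j _ => (hq i j).fun_mul (d2 k i j))]
      refine Finset.sum_congr rfl fun j _ => ?_
      rw [pd_mul (hq i j) (d2 k i j), pd_comm (c2 ((hh k).pd_infty j)) x l i]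
      congr 3
      funext y
      exact pd_comm (c2 (hh k)) y l j
    · refine Finset.sum_congr rfl fun i _ => ?_
      rw [pd_sum _ (fun j _ => (hB i k j).fun_mul (d1 j i))]
      refine Finset.sum_congr rfl fun j _ => ?_
      rw [pd_mul (hB i k j) (d1 j i), pd_comm (c2 (hh j)) x l i]
  · refine Finset.sum_congr rfl fun j _ => ?_
    rw [pd_mul (hC k j) (d0 j)]

/-- The Bernstein identity. -/
theorem bernstein_identity {x : 𝔼} (hq : ∀ i j, DifferentiableAt ℝ (fun y => q y i j) x)
    (hB : ∀ i k l, DifferentiableAt ℝ (fun y => B i y k l) x)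
    (hC : ∀ k l, DifferentiableAt ℝ (fun y => C y k l) x)
    (hh : ∀ k, ContDiff ℝ ∞ (h k)) (μ : ℝ) (bb : Fin d → ℝ) :
    ∑ k, h k x * coordOp q B C h k x + ∑ l, ∑ k, pd (h k) x l * pd (coordOp q B C h k) x l =
      (∑ k, h k x * ∑ i, ∑ j, q x i j * pd (fun y => pd (h k) y j) x i
        + ∑ l, ∑ k, pd (h k) x l *
          ∑ i, ∑ j, q x i j * pd (fun y => pd (fun z => pd (h k) z l) y j) x i)
      + (∑ k, h k x * ∑ i, bb i * pd (h k) x i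
        + ∑ l, ∑ k, pd (h k) x l * ∑ i, bb i * pd (fun y => pd (h k) y l) x i)
      + μ * (∑ i, ∑ j, q x i j * (∑ k, pd (h k) x i * pd (h k) x j)
        + ∑ i, ∑ j, q x i j * (∑ l, ∑ k, pd (fun y => pd (h k) y l) x i
          * pd (fun y => pd (h k) y l) x j))
      + bernsteinForm μ (q x) (fun i k l => B i x k l - bb i * (if k = l then 1 else 0)) (C x)
        (fun l i j => pd (fun y => q y i j) x l) (fun l i k k' => pd (fun y => B i y k k') x l)
        (fun l k k' => pd (fun y => C y k k') x l)
        (fun k => h k x) (fun i k => pd (h k) x i) (fun i l k => pd (fun y => pd (h k) y l) x i) := by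
  simp only [pd_coordOp hq hB hC hh]
  unfold coordOp bernsteinForm
  have u1 : ∑ i, ∑ k, ∑ l, (B i x k l - bb i * (if k = l then 1 else 0)) * h k x * pd (h l) x i =
      ∑ k, h k x * (∑ i, ∑ l, B i x k l * pd (h l) x i) - ∑ k, h k x * ∑ i, bb i * pd (h k) x i := by
    rw [← Finset.sum_sub_distrib, Finset.sum_comm]
    refine Finset.sum_congr rfl fun k _ => ?_
    rw [← mul_sub, ← Finset.sum_sub_distrib, Finset.mul_sum]
    refine Finset.sum_congr rfl fun i _ => ?_
    simp only [sub_mul, Finset.sum_sub_distrib, mul_ite, mul_one, mul_zero, ite_mul, zero_mul,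
      Finset.sum_ite_eq, Finset.mem_univ, if_true, mul_sub, Finset.mul_sum]
    congr 1
    · exact Finset.sum_congr rfl fun _ _ => by ring
    · ring
  have u2 : ∑ l, ∑ i, ∑ k, ∑ k', (B i x k k' - bb i * (if k = k' then 1 else 0)) * pd (h k) x l
        * pd (fun y => pd (h k') y l) x i =
      ∑ l, ∑ k, pd (h k) x l * (∑ i, ∑ k', B i x k k' * pd (fun y => pd (h k') y l) x i)
        - ∑ l, ∑ k, pd (h k) x l * ∑ i, bb i * pd (fun y => pd (h k) y l) x i := by
    rw [← Finset.sum_sub_distrib]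
    refine Finset.sum_congr rfl fun l _ => ?_
    rw [← Finset.sum_sub_distrib, Finset.sum_comm]
    refine Finset.sum_congr rfl fun k _ => ?_
    rw [← mul_sub, ← Finset.sum_sub_distrib, Finset.mul_sum]
    refine Finset.sum_congr rfl fun i _ => ?_
    simp only [sub_mul, Finset.sum_sub_distrib, mul_ite, mul_one, mul_zero, ite_mul, zero_mul,
      Finset.sum_ite_eq, Finset.mem_univ, if_true, mul_sub, Finset.mul_sum]
    congr 1
    · exact Finset.sum_congr rfl fun _ _ => by ring
    · ring
  have u3 : ∑ k, ∑ l, C x k l * h k x * h l x = ∑ k, h k x * ∑ l, C x k l * h l x :=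
    Finset.sum_congr rfl fun k _ => by
      rw [Finset.mul_sum]; exact Finset.sum_congr rfl fun _ _ => by ring
  have u4 : ∑ i, ∑ j, ∑ l, ∑ k, pd (h k) x l * pd (fun y => q y i j) x l
        * pd (fun y => pd (h k) y j) x i =
      ∑ l, ∑ k, pd (h k) x l * ∑ i, ∑ j, pd (fun y => q y i j) x l * pd (fun y => pd (h k) y j) x i := by
    simp only [Finset.mul_sum, ← mul_assoc]
    simp_rw [Finset.sum_comm (s := (Finset.univ : Finset (Fin m)))]
    rw [Finset.sum_comm' (s' := fun _ => Finset.univ) (t' := Finset.univ) (by simp)]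
    refine (Finset.sum_congr rfl fun j _ => Finset.sum_comm).trans ?_
    rw [Finset.sum_comm]
    exact Finset.sum_congr rfl fun l _ => Finset.sum_comm
  have u5 : ∑ l, ∑ i, ∑ k, ∑ k', pd (fun y => B i y k k') x l * pd (h k) x l * pd (h k') x i =
      ∑ l, ∑ k, pd (h k) x l * ∑ i, ∑ k', pd (fun y => B i y k k') x l * pd (h k') x i := by
    refine Finset.sum_congr rfl fun l _ => ?_
    rw [Finset.sum_comm]
    refine Finset.sum_congr rfl fun k _ => ?_
    simp only [Finset.mul_sum]
    exact Finset.sum_congr rfl fun _ _ => Finset.sum_congr rfl fun _ _ => by ring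
  have u6 : ∑ l, ∑ k, ∑ k', pd (fun y => C y k k') x l * pd (h k) x l * h k' x =
      ∑ l, ∑ k, pd (h k) x l * ∑ k', pd (fun y => C y k k') x l * h k' x := by
    refine Finset.sum_congr rfl fun l _ => Finset.sum_congr rfl fun k _ => ?_
    simp only [Finset.mul_sum]
    exact Finset.sum_congr rfl fun _ _ => by ring
  have u7 : ∑ l, ∑ k, ∑ k', C x k k' * pd (h k) x l * pd (h k') x l =
      ∑ l, ∑ k, pd (h k) x l * ∑ k', C x k k' * pd (h k') x l := by
    refine Finset.sum_congr rfl fun l _ => Finset.sum_congr rfl fun k _ => ?_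
    simp only [Finset.mul_sum]
    exact Finset.sum_congr rfl fun _ _ => by ring
  rw [u1, u2, u3, u4, u5, u6, u7]
  simp only [Finset.sum_add_distrib, mul_add]
  ring

lemma hasFDerivAt_coord {f : 𝔼 → 𝕍} {x : 𝔼} (hf : DifferentiableAt ℝ f x) (k : Fin m) :
    HasFDerivAt (fun y => f y k) ((EuclideanSpace.proj k).comp (fderiv ℝ f x)) x :=
  (EuclideanSpace.proj k : 𝕍 →L[ℝ] ℝ).hasFDerivAt.comp x hf.hasFDerivAt

lemma pd_coord {f : 𝔼 → 𝕍} {x : 𝔼} (hf : DifferentiableAt ℝ f x) (k : Fin m) (l : Fin d) :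
    pd (fun y => f y k) x l = fderiv ℝ f x (𝐞 l) k := by
  rw [pd, (hasFDerivAt_coord hf k).fderiv]; rfl

lemma contDiff_coord {f : 𝔼 → 𝕍} {n : WithTop ℕ∞} (hf : ContDiff ℝ n f) (k : Fin m) :
    ContDiff ℝ n (fun y => f y k) :=
  (EuclideanSpace.proj k : 𝕍 →L[ℝ] ℝ).contDiff.comp hf

lemma euclidean_sum_apply {ι : Type*} (S : Finset ι) (f : ι → 𝕍) (k : Fin m) :
    (∑ i ∈ S, f i) k = ∑ i ∈ S, f i k :=
  map_sum (EuclideanSpace.proj k : 𝕍 →L[ℝ] ℝ) f S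

lemma secondOrder_coord {q : 𝔼 → Matrix (Fin d) (Fin d) ℝ} {B : Fin d → 𝔼 → Matrix (Fin m) (Fin m) ℝ}
    {C : 𝔼 → Matrix (Fin m) (Fin m) ℝ} {w : 𝔼 → 𝕍} (hw : ContDiff ℝ ∞ w) (x : 𝔼) (k : Fin m) :
    secondOrder (fun x => diffusionCoef 𝕍 (q x)) (fun x => driftCoef (fun i => B i x))
      (fun x => matOp (C x)) w x k = coordOp q B C (fun k y => w y k) k x := by
  have hw1 : Differentiable ℝ w := hw.differentiable (by simp)
  have hw2 : ContDiff ℝ ∞ (fderiv ℝ w) := hw.fderiv_right (by simp)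
  have hpd : ∀ j, (fun y => pd (fun z => w z k) y j) =
      fun y => fderiv ℝ w y (𝐞 j) k :=
    fun j => funext fun y => pd_coord (hw1 y) k j
  have h2 : ∀ i j, pd (fun y => pd (fun z => w z k) y j) x i =
      fderiv ℝ (fderiv ℝ w) x (𝐞 i) (𝐞 j) k := by
    intro i j
    have hd : DifferentiableAt ℝ (fun y => fderiv ℝ w y (𝐞 j)) x :=
      ((hw2.differentiable (by simp)) x).clm_apply (differentiableAt_const _)
    rw [hpd j, pd_coord hd, fderiv_clm_apply ((hw2.differentiable (by simp)) x)
      (differentiableAt_const _)]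
    simp
  unfold secondOrder coordOp
  simp only [diffusionCoef_apply, driftCoef_apply, PiLp.add_apply, euclidean_sum_apply,
    matOp_apply, PiLp.smul_apply, smul_eq_mul, h2]
  congr 2
  exact Finset.sum_congr rfl fun i _ => Finset.sum_congr rfl fun l _ => by
    rw [pd_coord (hw1 x)]

/-- Value and gradient energy. -/
noncomputable def energy (w : 𝔼 → 𝕍) (y : 𝔼) : ℝ :=
  ∑ k, w y k ^ 2 + ∑ l, ∑ k, pd (fun z => w z k) y l ^ 2

lemma energy_nonneg (w : 𝔼 → 𝕍) (y : 𝔼) : 0 ≤ energy w y := by unfold energy; positivity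

lemma add_sum_mul_sq_le {α β : Type*} [Fintype α] [Fintype β] (u p : α → ℝ) (v r : β → ℝ) :
    (∑ k, u k * p k + ∑ k, v k * r k) ^ 2 ≤
      (∑ k, u k ^ 2 + ∑ k, v k ^ 2) * (∑ k, p k ^ 2 + ∑ k, r k ^ 2) := by
  have := Finset.sum_mul_sq_le_sq_mul_sq (Finset.univ : Finset (α ⊕ β)) (Sum.elim u v) (Sum.elim p r)
  simpa [Fintype.sum_sum_type] using this

lemma sum_sq_line {ι : Type*} [Fintype ι] {q : Matrix (Fin d) (Fin d) ℝ} {σ : ι → 𝔼}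
    (hσ : ∀ i j, ∑ a, σ a i * σ a j = q i j) (z : Fin d → ℝ) :
    ∑ a, (∑ i, σ a i * z i) ^ 2 = ∑ i, ∑ j, q i j * (z i * z j) := by
  rw [← sum_quad_eq hσ]
  refine Finset.sum_congr rfl fun a _ => ?_
  rw [pow_two, Finset.sum_mul_sum]
  exact Finset.sum_congr rfl fun i _ => Finset.sum_congr rfl fun j _ => by ring

lemma sum_sum_quad {ι : Type*} [Fintype ι] (q : Matrix (Fin d) (Fin d) ℝ) (z : ι → Fin d → ℝ) :
    ∑ k, ∑ i, ∑ j, q i j * (z k i * z k j) = ∑ i, ∑ j, q i j * ∑ k, z k i * z k j := by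
  simp only [Finset.mul_sum]
  rw [Finset.sum_comm]
  exact Finset.sum_congr rfl fun i _ => Finset.sum_comm

/-- The Bernstein form attached to coefficient functions and to a vector field at a point. -/
noncomputable def bernsteinAt (μ : ℝ) (q : 𝔼 → Matrix (Fin d) (Fin d) ℝ)
    (B : Fin d → 𝔼 → Matrix (Fin m) (Fin m) ℝ) (C : 𝔼 → Matrix (Fin m) (Fin m) ℝ) (bb : 𝔼) (x : 𝔼)
    (a : Fin m → ℝ) (Z : Fin d → Fin m → ℝ) (Y : Fin d → Fin d → Fin m → ℝ) : ℝ :=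
  bernsteinForm μ (q x) (fun i k l => B i x k l - bb i * (if k = l then 1 else 0)) (C x)
    (fun l i j => pd (fun y => q y i j) x l) (fun l i k k' => pd (fun y => B i y k k') x l)
    (fun l k k' => pd (fun y => C y k k') x l) a Z Y

theorem ApproxSol.energy_ineq {q : ℝ → 𝔼 → Matrix (Fin d) (Fin d) ℝ}
    {B : Fin d → ℝ → 𝔼 → Matrix (Fin m) (Fin m) ℝ} {C : ℝ → 𝔼 → Matrix (Fin m) (Fin m) ℝ}
    {f : 𝔼 → 𝕍} {s T η : ℝ} {w : ℝ → 𝔼 → 𝕍}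
    (hw : ApproxSol (fun t x => diffusionCoef 𝕍 (q t x)) (fun t x => driftCoef (fun i => B i t x))
      (fun t x => matOp (C t x)) f s T η w) {t : ℝ} (ht : t ∈ Ioc s T) (x : 𝔼)
    (hq : ∀ i j, DifferentiableAt ℝ (fun y => q t y i j) x)
    (hB : ∀ i k l, DifferentiableAt ℝ (fun y => B i t y k l) x)
    (hC : ∀ k l, DifferentiableAt ℝ (fun y => C t y k l) x) {μ Kq : ℝ} (bb : 𝔼)
    (hKq : ∀ a Z Y, bernsteinAt μ (q t) (fun i => B i t) (C t) bb x a Z Y ≤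
      Kq * (∑ k, a k ^ 2 + ∑ i, ∑ k, Z i k ^ 2)) :
    ∃ ℓ f1, HasDerivWithinAt (fun τ => energy (w τ) x) ℓ (Iic t) t ∧
      HasDerivAt (fun τ : ℝ => energy (w t) (x + τ • bb)) f1 0 ∧
      ∀ σ : Fin d → 𝔼, (∀ i j, ∑ a, σ a i * σ a j = q t x i j) → ∃ F1 F2 S : Fin d → ℝ,
        (∀ a, HasJet2 (fun τ : ℝ => energy (w t) (x + τ • σ a)) (F1 a) (F2 a)) ∧ (∀ a, 0 ≤ S a) ∧
        (∀ a, F1 a ^ 2 ≤ 4 * energy (w t) x * S a) ∧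
        ℓ ≤ ∑ a, (F2 a - 2 * (1 - μ) * S a) + f1 + (2 * Kq + 1) * energy (w t) x
          + (1 + d) * η ^ 2 := by
  obtain ⟨g, hg, hgt, hgt', hres, hresb⟩ := hw.deriv t ht
  have hws : ∀ τ, ContDiff ℝ ∞ (w τ) := fun τ => hw.smoothBdd.smooth τ
  have hwd : ∀ τ, Differentiable ℝ (w τ) := fun τ => (hws τ).differentiable (by simp)
  have hgd : Differentiable ℝ g := hg.differentiable (by simp)
  set h : Fin m → 𝔼 → ℝ := fun k y => w t y k with hh
  have hhs : ∀ k, ContDiff ℝ ∞ (h k) := fun k => contDiff_coord (hws t) k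
  have hh2 : ∀ k, ContDiff ℝ 2 (h k) := fun k => (hhs k).of_le (ofNat_le_infty 2)
  have hz2 : ∀ k l, ContDiff ℝ 2 (fun y => pd (h k) y l) :=
    fun k l => ((hhs k).pd_infty l).of_le (ofNat_le_infty 2)
  set r : 𝔼 → 𝕍 := fun x => g x - secondOrder (fun x => diffusionCoef 𝕍 (q t x))
    (fun x => driftCoef (fun i => B i t x)) (fun x => matOp (C t x)) (w t) x with hr
  set G : Fin m → 𝔼 → ℝ := coordOp (q t) (fun i => B i t) (C t) h with hG
  have hrk : ∀ k y, r y k = g y k - G k y := by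
    intro k y
    rw [hr, hG, ← secondOrder_coord (hws t)]; rfl
  have hgk : ∀ k, (fun y => g y k) = fun y => G k y + r y k := fun k => by
    funext y; rw [hrk]; ring
  have hGd : ∀ k, DifferentiableAt ℝ (G k) x := by
    intro k
    have : G k = fun y => g y k - r y k := by funext y; rw [hrk]; ring
    rw [this]
    exact (hasFDerivAt_coord (hgd x) k).differentiableAt.fun_sub
      (hasFDerivAt_coord (hres x) k).differentiableAt
  have hpdg : ∀ k l, pd (fun y => g y k) x l = pd (G k) x l + pd (fun y => r y k) x l := by
    intro k l
    rw [hgk k, pd_add (hGd k) (hasFDerivAt_coord (hres x) k).differentiableAt]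
  -- time derivative
  have ht1 : ∀ k, HasDerivWithinAt (fun τ => w τ x k) (g x k) (Iic t) t := fun k =>
    (EuclideanSpace.proj k : 𝕍 →L[ℝ] ℝ).hasFDerivAt.comp_hasDerivWithinAt t
      (hgt x)
  have ht2 : ∀ l k, HasDerivWithinAt (fun τ => pd (fun z => w τ z k) x l)
      (pd (fun y => g y k) x l) (Iic t) t := by
    intro l k
    simp only [pd_coord (hwd _ x), pd_coord (hgd x)]
    exact ((EuclideanSpace.proj k : 𝕍 →L[ℝ] ℝ).comp
      (ContinuousLinearMap.apply ℝ 𝕍 (𝐞 l))).hasFDerivAt.comp_hasDerivWithinAt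
        t (hgt' x)
  have hsq : ∀ {u : ℝ → ℝ} {u' : ℝ}, HasDerivWithinAt u u' (Iic t) t →
      HasDerivWithinAt (fun τ => u τ ^ 2) (2 * (u t * u')) (Iic t) t := by
    intro u u' hu
    refine (hu.fun_pow 2).congr_deriv ?_
    simp; ring
  refine ⟨∑ k, 2 * (h k x * g x k) + ∑ l, ∑ k, 2 * (pd (h k) x l * pd (fun y => g y k) x l),
    ∑ k, 2 * (h k x * ∑ i, bb i * pd (h k) x i)
      + ∑ l, ∑ k, 2 * (pd (h k) x l * ∑ i, bb i * pd (fun y => pd (h k) y l) x i), ?_, ?_, ?_⟩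
  · exact (HasDerivWithinAt.fun_sum fun k _ => hsq (ht1 k)).add
      (HasDerivWithinAt.fun_sum fun l _ => HasDerivWithinAt.fun_sum fun k _ => hsq (ht2 l k))
  · have j := (HasJet2.sum Finset.univ fun k _ => (hasJet2_line_pd (hh2 k) x bb).sq).add
      (HasJet2.sum Finset.univ fun l _ => HasJet2.sum Finset.univ fun k _ =>
        (hasJet2_line_pd (hz2 k l) x bb).sq)
    have := j.hasDerivAt
    simp only [zero_smul, add_zero] at this
    exact this
  intro σ hσ
  have j := fun a => (HasJet2.sum Finset.univ fun k _ => (hasJet2_line_pd (hh2 k) x (σ a)).sq).add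
      (HasJet2.sum Finset.univ fun l _ => HasJet2.sum Finset.univ fun k _ =>
        (hasJet2_line_pd (hz2 k l) x (σ a)).sq)
  simp only [zero_smul, add_zero] at j
  refine ⟨_, _, fun a => ∑ k, (∑ i, σ a i * pd (h k) x i) ^ 2
      + ∑ l, ∑ k, (∑ i, σ a i * pd (fun y => pd (h k) y l) x i) ^ 2, j, fun a => by positivity, ?_, ?_⟩
  · intro a
    have := add_sum_mul_sq_le (fun k => h k x) (fun k => ∑ i, σ a i * pd (h k) x i)
      (fun p : Fin d × Fin m => pd (h p.2) x p.1)
      (fun p => ∑ i, σ a i * pd (fun y => pd (h p.2) y p.1) x i)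
    simp only [Fintype.sum_prod_type] at this
    simp only [← Finset.mul_sum]
    unfold energy
    nlinarith
  · have hid := bernstein_identity (q := q t) (B := fun i => B i t) (C := C t) hq hB hC hhs μ bb
    have hK := hKq (fun k => h k x) (fun i k => pd (h k) x i)
      (fun i l k => pd (fun y => pd (h k) y l) x i)
    rw [bernsteinAt] at hK
    -- residual
    have hres1 : ∑ k, 2 * (h k x * r x k) ≤ ∑ k, h k x ^ 2 + η ^ 2 := by
      have h1 : ∑ k, r x k ^ 2 ≤ η ^ 2 := by
        rw [← EuclideanSpace.real_norm_sq_eq]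
        exact pow_le_pow_left₀ (norm_nonneg _) (hresb x).1 2
      have h2 : ∑ k, 2 * (h k x * r x k) ≤ ∑ k, (h k x ^ 2 + r x k ^ 2) :=
        Finset.sum_le_sum fun k _ => by nlinarith [sq_nonneg (h k x - r x k)]
      rw [Finset.sum_add_distrib] at h2
      linarith
    have hres2 : ∑ l, ∑ k, 2 * (pd (h k) x l * pd (fun y => r y k) x l) ≤
        ∑ l, ∑ k, pd (h k) x l ^ 2 + d * η ^ 2 := by
      have h1 : ∀ l, ∑ k, 2 * (pd (h k) x l * pd (fun y => r y k) x l) ≤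
          ∑ k, pd (h k) x l ^ 2 + η ^ 2 := by
        intro l
        have h1 : ∑ k, pd (fun y => r y k) x l ^ 2 ≤ η ^ 2 := by
          simp only [pd_coord (hres x)]
          rw [← EuclideanSpace.real_norm_sq_eq]
          refine pow_le_pow_left₀ (norm_nonneg _) ?_ 2
          refine ((fderiv ℝ r x).le_opNorm _).trans ?_
          simpa using (hresb x).2
        have h2 : ∑ k, 2 * (pd (h k) x l * pd (fun y => r y k) x l) ≤
            ∑ k, (pd (h k) x l ^ 2 + pd (fun y => r y k) x l ^ 2) :=
          Finset.sum_le_sum fun k _ => by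
            nlinarith [sq_nonneg (pd (h k) x l - pd (fun y => r y k) x l)]
        rw [Finset.sum_add_distrib] at h2
        linarith
      refine (Finset.sum_le_sum fun l _ => h1 l).trans (le_of_eq ?_)
      rw [Finset.sum_add_distrib]; simp
    have hS1 : ∑ a, ∑ k, (∑ i, σ a i * pd (h k) x i) ^ 2 =
        ∑ i, ∑ j, q t x i j * (∑ k, pd (h k) x i * pd (h k) x j) := by
      rw [Finset.sum_comm, ← sum_sum_quad]
      exact Finset.sum_congr rfl fun k _ => sum_sq_line hσ _
    have hS2 : ∑ a, ∑ l, ∑ k, (∑ i, σ a i * pd (fun y => pd (h k) y l) x i) ^ 2 =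
        ∑ i, ∑ j, q t x i j * (∑ l, ∑ k, pd (fun y => pd (h k) y l) x i
          * pd (fun y => pd (h k) y l) x j) := by
      have e1 := sum_sum_quad (q t x) (fun (p : Fin d × Fin m) i => pd (fun y => pd (h p.2) y p.1) x i)
      simp only [Fintype.sum_prod_type] at e1
      rw [← e1, Finset.sum_comm]
      refine Finset.sum_congr rfl fun l _ => ?_
      rw [Finset.sum_comm]
      exact Finset.sum_congr rfl fun k _ => sum_sq_line hσ _
    have hT1 : ∑ a, ∑ k, h k x * ∑ i, ∑ j, σ a i * σ a j * pd (fun y => pd (h k) y j) x i =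
        ∑ k, h k x * ∑ i, ∑ j, q t x i j * pd (fun y => pd (h k) y j) x i := by
      rw [Finset.sum_comm]
      refine Finset.sum_congr rfl fun k _ => ?_
      rw [← Finset.mul_sum, sum_quad_eq hσ (fun i j => pd (fun y => pd (h k) y j) x i)]
    have hT2 : ∑ a, ∑ l, ∑ k, pd (h k) x l *
          ∑ i, ∑ j, σ a i * σ a j * pd (fun y => pd (fun z => pd (h k) z l) y j) x i =
        ∑ l, ∑ k, pd (h k) x l *
          ∑ i, ∑ j, q t x i j * pd (fun y => pd (fun z => pd (h k) z l) y j) x i := by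
      rw [Finset.sum_comm]
      refine Finset.sum_congr rfl fun l _ => ?_
      rw [Finset.sum_comm]
      refine Finset.sum_congr rfl fun k _ => ?_
      rw [← Finset.mul_sum, sum_quad_eq hσ (fun i j => pd (fun y => pd (fun z => pd (h k) z l) y j) x i)]
    have hgx : ∀ k, g x k = G k x + r x k := fun k => congrFun (hgk k) x
    have hen : energy (w t) x = ∑ k, h k x ^ 2 + ∑ l, ∑ k, pd (h k) x l ^ 2 := rfl
    simp only [hpdg, hgx, mul_add, Finset.sum_add_distrib, Finset.sum_sub_distrib, ← Finset.mul_sum]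
      at hres1 hres2 ⊢
    rw [hS1, hS2, hT1, hT2, hen]
    linarith

end BernsteinIdentity

section Kernel

variable {d : ℕ}

local notation "𝔼" => EuclideanSpace ℝ (Fin d)

/-- A smooth probability density supported in the closed ball of radius `κ`. -/
structure IsKernel {d : ℕ} (ρ : EuclideanSpace ℝ (Fin d) → ℝ) (κ : ℝ) : Prop where
  smooth : ContDiff ℝ ∞ ρ
  nonneg : ∀ z, 0 ≤ ρ z
  integral_eq : ∫ z, ρ z = 1
  supp : ∀ z, κ < ‖z‖ → ρ z = 0

lemma exists_isKernel {κ : ℝ} (hκ : 0 < κ) : ∃ ρ : 𝔼 → ℝ, IsKernel ρ κ := by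
  let f : ContDiffBump (0 : 𝔼) := ⟨κ / 2, κ, by positivity, by linarith⟩
  refine ⟨f.normed volume, f.contDiff_normed, fun z => f.nonneg_normed z, f.integral_normed, ?_⟩
  intro z hz
  have : z ∉ Function.support (f.normed volume) := by
    rw [f.support_normed_eq]
    simpa [f] using hz.le
  simpa using this

namespace IsKernel

variable {ρ : EuclideanSpace ℝ (Fin d) → ℝ} {κ : ℝ}

lemma hasCompactSupport (hρ : IsKernel ρ κ) : HasCompactSupport ρ :=
  HasCompactSupport.intro (isCompact_closedBall (0 : 𝔼) κ)
    fun z hz => hρ.supp z (by simpa using hz)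

lemma integrable (hρ : IsKernel ρ κ) : Integrable ρ volume :=
  hρ.smooth.continuous.integrable_of_hasCompactSupport hρ.hasCompactSupport

lemma integrable_smul (hρ : IsKernel ρ κ) {F : Type} [NormedAddCommGroup F] [NormedSpace ℝ F]
    {g : 𝔼 → F} (hg : Continuous g) (x : 𝔼) :
    Integrable (fun z => ρ z • g (x - z)) volume :=
  (hρ.smooth.continuous.smul (hg.comp (continuous_const.sub continuous_id))).integrable_of_hasCompactSupport
    hρ.hasCompactSupport.smul_right

lemma integral_mul_le (hρ : IsKernel ρ κ) {h : 𝔼 → ℝ} {K : ℝ}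
    (hintg : Integrable (fun z => ρ z * h z) volume) (hh : ∀ z, ‖z‖ ≤ κ → h z ≤ K) :
    ∫ z, ρ z * h z ≤ K := by
  have h1 : ∫ z, ρ z * h z ≤ ∫ z, ρ z * K := by
    refine integral_mono hintg (hρ.integrable.mul_const K) fun z => ?_
    rcases le_or_gt ‖z‖ κ with hz | hz
    · exact mul_le_mul_of_nonneg_left (hh z hz) (hρ.nonneg z)
    · simp [hρ.supp z hz]
  rwa [integral_mul_const, hρ.integral_eq, one_mul] at h1

lemma clm_integral_le (hρ : IsKernel ρ κ) {F : Type} [NormedAddCommGroup F] [NormedSpace ℝ F] [CompleteSpace F]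
    {G : 𝔼 → F} (hG : Integrable (fun z => ρ z • G z) volume)
    (L : F →L[ℝ] ℝ) {K : ℝ} (h : ∀ z, ‖z‖ ≤ κ → L (G z) ≤ K) : L (∫ z, ρ z • G z) ≤ K := by
  rw [← L.integral_comp_comm hG]
  have hG' := L.integrable_comp hG
  simp only [map_smul, smul_eq_mul] at hG' ⊢
  exact hρ.integral_mul_le hG' h

lemma clm_mollify_le (hρ : IsKernel ρ κ) {F : Type} [NormedAddCommGroup F] [NormedSpace ℝ F] [CompleteSpace F]
    {g : 𝔼 → F} (hg : Continuous g) (x : 𝔼)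
    (L : F →L[ℝ] ℝ) {K : ℝ} (h : ∀ z, ‖z‖ ≤ κ → L (g (x - z)) ≤ K) : L (mollify volume ρ g x) ≤ K :=
  hρ.clm_integral_le (hρ.integrable_smul hg x) L h

lemma norm_mollify_sub_le (hρ : IsKernel ρ κ) {F : Type} [NormedAddCommGroup F] [NormedSpace ℝ F] [CompleteSpace F]
    {g : 𝔼 → F} (hg : Continuous g) (x : 𝔼) (c : F)
    {K : ℝ} (h : ∀ z, ‖z‖ ≤ κ → ‖g (x - z) - c‖ ≤ K) : ‖mollify volume ρ g x - c‖ ≤ K := by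
  have h1 : mollify volume ρ g x - c = ∫ z, ρ z • (g (x - z) - c) := by
    simp only [smul_sub]
    rw [integral_sub (hρ.integrable_smul hg x) (hρ.integrable.smul_const c), integral_smul_const,
      hρ.integral_eq, one_smul]
    rfl
  have h2 := hρ.integrable_smul (hg.sub (continuous_const (y := c))) x
  rw [h1]
  refine (norm_integral_le_integral_norm _).trans ?_
  have h3 := h2.norm
  simp only [norm_smul, Real.norm_eq_abs, abs_of_nonneg (hρ.nonneg _)] at h3 ⊢
  exact hρ.integral_mul_le h3 h

end IsKernel

lemma le_fderiv_inner_of_monotone {g : 𝔼 → 𝔼} {x w : 𝔼} (hg : DifferentiableAt ℝ g x) {c δ : ℝ}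
    (hδ : 0 < δ) (h : ∀ y, ‖y - x‖ < δ → c * ‖y - x‖ ^ 2 ≤ inner ℝ (g y - g x) (y - x)) :
    c * ‖w‖ ^ 2 ≤ inner ℝ (fderiv ℝ g x w) w := by
  have h0 : HasDerivAt (fun τ : ℝ => g (x + τ • w)) (fderiv ℝ g x w) 0 := by
    have h1 : HasDerivAt (fun τ : ℝ => x + τ • w) w 0 := by
      simpa using ((hasDerivAt_id (0:ℝ)).smul_const w).const_add x
    have h2 : HasFDerivAt g (fderiv ℝ g x) (x + (0:ℝ) • w) := by simpa using hg.hasFDerivAt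
    exact h2.comp_hasDerivAt 0 h1
  have h1 := h0.inner ℝ (hasDerivAt_const (0:ℝ) w)
  simp only [inner_zero_right, zero_add] at h1
  have h2 := (hasDerivAt_iff_tendsto_slope_zero.1 h1).mono_left
    (nhdsWithin_mono 0 (fun y (hy : y ∈ Ioi (0:ℝ)) => ne_of_gt hy))
  refine ge_of_tendsto h2 ?_
  have h3 : ∀ᶠ τ : ℝ in 𝓝[>] 0, ‖τ • w‖ < δ := by
    have : Tendsto (fun τ : ℝ => ‖τ • w‖) (𝓝[>] 0) (𝓝 ‖(0:ℝ) • w‖) :=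
      (Continuous.tendsto (by fun_prop) 0).mono_left nhdsWithin_le_nhds
    rw [zero_smul, norm_zero] at this
    exact this.eventually (gt_mem_nhds hδ)
  filter_upwards [h3, self_mem_nhdsWithin] with τ hτ hτ0
  have hτ0 : 0 < τ := hτ0
  have h4 := h (x + τ • w) (by simpa using hτ)
  simp only [add_sub_cancel_left, norm_smul, inner_smul_right, Real.norm_eq_abs, abs_of_pos hτ0] at h4
  simp only [zero_add, zero_smul, add_zero, smul_eq_mul, ← inner_sub_left]
  rw [le_inv_mul_iff₀ hτ0]
  have : τ * (τ * (c * ‖w‖ ^ 2)) ≤ τ * inner ℝ (g (x + τ • w) - g x) w := by linarith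
  exact le_of_mul_le_mul_left this hτ0

/-- A bounded radial monotone field vanishing on a ball of radius `r`. -/
noncomputable def radialField (r L : ℝ) (x : 𝔼) : 𝔼 := (max 0 (min (‖x‖ - r) L) / max r ‖x‖) • x

lemma radialField_coef_mul {r L : ℝ} (hr : 0 < r) (hL : 0 ≤ L) (x : 𝔼) :
    max 0 (min (‖x‖ - r) L) / max r ‖x‖ * ‖x‖ = max 0 (min (‖x‖ - r) L) := by
  rcases le_or_gt ‖x‖ r with h | h
  · have : max 0 (min (‖x‖ - r) L) = 0 := max_eq_left (min_le_of_left_le (by linarith))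
    simp [this]
  · rw [max_eq_right h.le, div_mul_cancel₀]
    linarith

lemma norm_radialField_le {r L : ℝ} (hr : 0 < r) (hL : 0 ≤ L) (x : 𝔼) : ‖radialField r L x‖ ≤ L := by
  rw [radialField, norm_smul, Real.norm_eq_abs, abs_of_nonneg (by positivity),
    radialField_coef_mul hr hL]
  exact max_le hL (min_le_right _ _)

lemma radialField_eq_zero {r L : ℝ} {x : 𝔼} (hx : ‖x‖ ≤ r) : radialField r L x = 0 := by
  have : max 0 (min (‖x‖ - r) L) = 0 := max_eq_left (min_le_of_left_le (by linarith))
  simp [radialField, this]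

lemma continuous_radialField {r L : ℝ} (hr : 0 < r) : Continuous (radialField r L : 𝔼 → 𝔼) := by
  unfold radialField
  have h : ∀ x : 𝔼, max r ‖x‖ ≠ 0 := fun x => (lt_max_of_lt_left hr).ne'
  fun_prop (disch := exact h _)

lemma radialField_inner_ge {r L c : ℝ} (hr : 0 < r) (hL : 0 ≤ L) (hc : 0 ≤ c) (hc1 : c ≤ 1) (x y : 𝔼)
    (hx : c ≤ max 0 (min (‖x‖ - r) L) / max r ‖x‖) (hy : c ≤ max 0 (min (‖y‖ - r) L) / max r ‖y‖)
    (hxy : c * (‖x‖ - ‖y‖) ^ 2 ≤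
      (max 0 (min (‖x‖ - r) L) - max 0 (min (‖y‖ - r) L)) * (‖x‖ - ‖y‖)) :
    c * ‖x - y‖ ^ 2 ≤ inner ℝ (radialField r L x - radialField r L y) (x - y) := by
  have ex := radialField_coef_mul hr hL x
  have ey := radialField_coef_mul hr hL y
  unfold radialField
  set α := max 0 (min (‖x‖ - r) L) / max r ‖x‖
  set β := max 0 (min (‖y‖ - r) L) / max r ‖y‖
  rw [← ex, ← ey] at hxy
  have h1 : inner ℝ (α • x - β • y) (x - y) = α * ‖x‖ ^ 2 + β * ‖y‖ ^ 2 - (α + β) * inner ℝ x y := by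
    simp only [inner_sub_left, inner_sub_right, real_inner_smul_left, real_inner_self_eq_norm_sq,
      real_inner_comm x y]
    ring
  have h2 : ‖x - y‖ ^ 2 = ‖x‖ ^ 2 - 2 * inner ℝ x y + ‖y‖ ^ 2 := norm_sub_sq_real x y
  have h3 := real_inner_le_norm x y
  rw [h1, h2]
  nlinarith [mul_nonneg (sub_nonneg.2 hx) (sub_nonneg.2 h3), mul_nonneg (sub_nonneg.2 hy) (sub_nonneg.2 h3)]

lemma radialField_monotone {r L : ℝ} (hr : 0 < r) (hL : 0 ≤ L) (x y : 𝔼) :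
    0 ≤ inner ℝ (radialField r L x - radialField r L y) (x - y) := by
  have := radialField_inner_ge hr hL le_rfl zero_le_one x y (by positivity) (by positivity) (by
    rw [zero_mul]
    rcases le_total ‖x‖ ‖y‖ with h | h
    · refine mul_nonneg_of_nonpos_of_nonpos (sub_nonpos.2 ?_) (by linarith)
      gcongr
    · refine mul_nonneg (sub_nonneg.2 ?_) (by linarith)
      gcongr)
  simpa using this

/-- A smooth bounded monotone field which vanishes on a ball and is strongly monotone on an
annulus outside of it. -/
lemma exists_monotone_field (R : ℝ) (hR : 0 ≤ R) : ∃ g : 𝔼 → 𝔼, SmoothBdd (fun _ : ℝ => g) ∧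
    (∀ x, ‖x‖ ≤ R → g x = 0) ∧ (∀ x w, 0 ≤ inner ℝ (fderiv ℝ g x w) w) ∧
    ∃ c > 0, ∀ x, R + 1 ≤ ‖x‖ → ‖x‖ ≤ R + 4 → ∀ w, c * ‖w‖ ^ 2 ≤ inner ℝ (fderiv ℝ g x w) w := by
  obtain ⟨ρ, hρ⟩ := exists_isKernel (d := d) (κ := 1 / 4) (by norm_num)
  have hr : 0 < R + 1 / 2 := by linarith
  set G : 𝔼 → 𝔼 := radialField (R + 1 / 2) 5 with hG
  have hGc : Continuous G := continuous_radialField hr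
  have hS : SmoothBdd (fun _ : ℝ => mollify volume ρ G) :=
    SmoothBdd.mollify hρ.smooth hρ.hasCompactSupport (fun _ => hGc)
      (fun _ x => norm_radialField_le hr (by norm_num) x)
  have hmono : ∀ x y : 𝔼, ∀ c : ℝ, (∀ z, ‖z‖ ≤ 1 / 4 → c * ‖y - x‖ ^ 2 ≤
      inner ℝ (G (y - z) - G (x - z)) (y - x)) →
      c * ‖y - x‖ ^ 2 ≤ inner ℝ (mollify volume ρ G y - mollify volume ρ G x) (y - x) := by
    intro x y c h
    have h1 : mollify volume ρ G y - mollify volume ρ G x =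
        ∫ z, ρ z • (G (y - z) - G (x - z)) := by
      simp only [smul_sub]
      rw [integral_sub (hρ.integrable_smul hGc y) (hρ.integrable_smul hGc x)]
      rfl
    have hintg : Integrable (fun z => ρ z • (G (y - z) - G (x - z))) volume := by
      simp only [smul_sub]
      exact (hρ.integrable_smul hGc y).sub (hρ.integrable_smul hGc x)
    have h2 := hρ.clm_integral_le hintg (-(innerSL ℝ (y - x))) (K := - (c * ‖y - x‖ ^ 2)) (fun z hz => by
      have := h z hz
      rw [real_inner_comm] at this
      simpa only [neg_apply, innerSL_apply_apply, neg_le_neg_iff] using this)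
    rw [h1, real_inner_comm]
    simpa only [neg_apply, innerSL_apply_apply, neg_le_neg_iff] using h2
  refine ⟨mollify volume ρ G, hS, ?_, ?_, ?_⟩
  · intro x hx
    have := hρ.norm_mollify_sub_le hGc x 0 (K := 0) (fun z hz => by
      rw [hG, radialField_eq_zero]
      · simp
      · exact (norm_sub_le _ _).trans (by linarith))
    simpa using this
  · intro x w
    have := le_fderiv_inner_of_monotone (w := w) (hS.differentiable 0 x) (c := 0) one_pos (fun y _ =>
      hmono x y 0 fun z _ => by
        have := radialField_monotone hr (show (0:ℝ) ≤ 5 by norm_num) (y - z) (x - z)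
        simpa only [zero_mul, sub_sub_sub_cancel_right] using this)
    simpa using this
  · have hq : ∀ y : 𝔼, R + 3 / 4 - 1 / 8 ≤ ‖y‖ → ‖y‖ ≤ R + 5 →
        max 0 (min (‖y‖ - (R + 1 / 2)) 5) = ‖y‖ - (R + 1 / 2) ∧
        1 / 8 / (R + 5) ≤ max 0 (min (‖y‖ - (R + 1 / 2)) 5) / max (R + 1 / 2) ‖y‖ := by
      intro y h1 h2
      have e1 : max 0 (min (‖y‖ - (R + 1 / 2)) 5) = ‖y‖ - (R + 1 / 2) := by
        rw [min_eq_left (by linarith), max_eq_right (by linarith)]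
      refine ⟨e1, ?_⟩
      rw [e1, max_eq_right (by linarith)]
      exact div_le_div₀ (by linarith) (by linarith) (by linarith) h2
    refine ⟨1 / 8 / (R + 5), by positivity, fun x hx1 hx2 w => ?_⟩
    refine le_fderiv_inner_of_monotone (hS.differentiable 0 x) (δ := 1 / 8) (by norm_num) fun y hy =>
      hmono x y _ fun z hz => ?_
    have b1 : ‖x‖ - ‖z‖ ≤ ‖x - z‖ := norm_sub_norm_le _ _
    have b2 : ‖x - z‖ ≤ ‖x‖ + ‖z‖ := norm_sub_le _ _
    have b3 : ‖y - z‖ ≤ ‖x - z‖ + ‖y - x‖ := by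
      have : y - z = (x - z) + (y - x) := by abel
      rw [this]; exact norm_add_le _ _
    have b4 : ‖x - z‖ ≤ ‖y - z‖ + ‖y - x‖ := by
      have : x - z = (y - z) - (y - x) := by abel
      rw [this]; exact norm_sub_le _ _
    obtain ⟨e1, f1⟩ := hq (x - z) (by linarith) (by linarith)
    obtain ⟨e2, f2⟩ := hq (y - z) (by linarith) (by linarith)
    have h8 : 1 / 8 / (R + 5) ≤ 1 := by
      rw [div_le_one (by linarith)]; linarith
    have := radialField_inner_ge hr (show (0:ℝ) ≤ 5 by norm_num) (by positivity) h8 (y - z) (x - z)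
      f2 f1 (by
        rw [e1, e2]
        nlinarith [sq_nonneg (‖y - z‖ - ‖x - z‖)])
    simpa only [sub_sub_sub_cancel_right] using this

end Kernel

section CoefSpace

variable {d m : ℕ}

local notation "𝔼" => EuclideanSpace ℝ (Fin d)

/-- The space of values of the coefficients of a second order operator. -/
abbrev CoefSpace (d m : ℕ) : Type :=
  (Fin d → Fin d → ℝ) × (Fin d → Fin m → Fin m → ℝ) × (Fin m → Fin m → ℝ)

/-- The Bernstein form as a linear functional of the coefficients and their differential. -/
noncomputable def coefForm (μ : ℝ) (a : Fin m → ℝ) (Z : Fin d → Fin m → ℝ)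
    (Y : Fin d → Fin d → Fin m → ℝ) : CoefSpace d m × (𝔼 →L[ℝ] CoefSpace d m) →ₗ[ℝ] ℝ where
  toFun X := bernsteinForm μ X.1.1 X.1.2.1 X.1.2.2
    (fun l i j => (X.2 (𝐞 l)).1 i j)
    (fun l i k k' => (X.2 (𝐞 l)).2.1 i k k')
    (fun l k k' => (X.2 (𝐞 l)).2.2 k k') a Z Y
  map_add' X X' := by
    simp only [bernsteinForm, Prod.fst_add, Prod.snd_add, Pi.add_apply, add_apply,
      add_mul, mul_add, Finset.sum_add_distrib]
    ring
  map_smul' c X := by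
    simp only [bernsteinForm, Prod.smul_fst, Prod.smul_snd, Pi.smul_apply, FunLike.coe_smul,
      smul_eq_mul, RingHom.id_apply, mul_add, mul_assoc, mul_left_comm _ c, ← Finset.mul_sum]

/-- The coefficients of a scalar drift. -/
noncomputable def scalarDrift : 𝔼 →L[ℝ] CoefSpace d m :=
  LinearMap.toContinuousLinearMap
    { toFun := fun b => (0, fun i k l => b i * (if k = l then 1 else 0), 0)
      map_add' := fun b b' => by ext <;> simp [add_mul] <;> split_ifs <;> simp
      map_smul' := fun c b => by ext <;> simp [mul_assoc] }

lemma scalarDrift_apply (b : 𝔼) : (scalarDrift b : CoefSpace d m) =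
    (0, fun i k l => b i * (if k = l then 1 else 0), 0) := rfl

lemma coefForm_apply (μ : ℝ) (a : Fin m → ℝ) (Z : Fin d → Fin m → ℝ)
    (Y : Fin d → Fin d → Fin m → ℝ) (X : CoefSpace d m) (X' : 𝔼 →L[ℝ] CoefSpace d m) (b : 𝔼) :
    coefForm μ a Z Y (X - scalarDrift b, X') = bernsteinForm μ X.1
      (fun i k l => X.2.1 i k l - b i * (if k = l then 1 else 0)) X.2.2
      (fun l i j => (X' (𝐞 l)).1 i j)
      (fun l i k k' => (X' (𝐞 l)).2.1 i k k')
      (fun l k k' => (X' (𝐞 l)).2.2 k k') a Z Y := by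
  change bernsteinForm _ _ _ _ _ _ _ _ _ _ = _
  rw [scalarDrift_apply]
  congr 1 <;> simp <;> rfl

lemma pd_clm {F G : Type*} [NormedAddCommGroup F] [NormedSpace ℝ F] [NormedAddCommGroup G]
    [NormedSpace ℝ G] (L : F →L[ℝ] G) {f : 𝔼 → F} {x : 𝔼} (hf : DifferentiableAt ℝ f x) (l : Fin d) :
    pd (fun y => L (f y)) x l = L (fderiv ℝ f x (𝐞 l)) := by
  have h : HasFDerivAt (fun y => L (f y)) (L.comp (fderiv ℝ f x)) x :=
    L.hasFDerivAt.comp x hf.hasFDerivAt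
  rw [pd, h.fderiv]; rfl

/-- Coordinates of the coefficient space. -/
noncomputable def coefQ (i j : Fin d) : CoefSpace d m →L[ℝ] ℝ :=
  ((ContinuousLinearMap.proj j).comp (ContinuousLinearMap.proj (R := ℝ) (φ := fun _ : Fin d => Fin d → ℝ) i)).comp
    (ContinuousLinearMap.fst ℝ _ _)

noncomputable def coefB (i : Fin d) (k l : Fin m) : CoefSpace d m →L[ℝ] ℝ :=
  (((ContinuousLinearMap.proj l).comp (ContinuousLinearMap.proj (R := ℝ) (φ := fun _ : Fin m => Fin m → ℝ) k)).comp
    (ContinuousLinearMap.proj (R := ℝ) (φ := fun _ : Fin d => Fin m → Fin m → ℝ) i)).comp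
    ((ContinuousLinearMap.fst ℝ _ _).comp (ContinuousLinearMap.snd ℝ _ _))

noncomputable def coefC (k l : Fin m) : CoefSpace d m →L[ℝ] ℝ :=
  ((ContinuousLinearMap.proj l).comp (ContinuousLinearMap.proj (R := ℝ) (φ := fun _ : Fin m => Fin m → ℝ) k)).comp
    ((ContinuousLinearMap.snd ℝ _ _).comp (ContinuousLinearMap.snd ℝ _ _))

lemma coefQ_apply (i j : Fin d) (X : CoefSpace d m) : coefQ i j X = X.1 i j := rfl
lemma coefB_apply (i : Fin d) (k l : Fin m) (X : CoefSpace d m) : coefB i k l X = X.2.1 i k l := rfl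
lemma coefC_apply (k l : Fin m) (X : CoefSpace d m) : coefC k l X = X.2.2 k l := rfl

lemma abs_coefQ_le (i j : Fin d) (X : CoefSpace d m) : |X.1 i j| ≤ ‖X‖ :=
  ((norm_le_pi_norm (X.1 i) j).trans (norm_le_pi_norm X.1 i)).trans (norm_fst_le X)

lemma abs_coefB_le (i : Fin d) (k l : Fin m) (X : CoefSpace d m) : |X.2.1 i k l| ≤ ‖X‖ :=
  (((norm_le_pi_norm (X.2.1 i k) l).trans (norm_le_pi_norm (X.2.1 i) k)).trans
    (norm_le_pi_norm X.2.1 i)).trans ((norm_fst_le X.2).trans (norm_snd_le X))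

lemma abs_coefC_le (k l : Fin m) (X : CoefSpace d m) : |X.2.2 k l| ≤ ‖X‖ :=
  ((norm_le_pi_norm (X.2.2 k) l).trans (norm_le_pi_norm X.2.2 k)).trans
    ((norm_snd_le X.2).trans (norm_snd_le X))

lemma bernsteinAt_eq_coefForm (μ : ℝ) {Φ : 𝔼 → CoefSpace d m} {x : 𝔼} (hΦ : DifferentiableAt ℝ Φ x)
    (bb : 𝔼) (a : Fin m → ℝ) (Z : Fin d → Fin m → ℝ) (Y : Fin d → Fin d → Fin m → ℝ) :
    bernsteinAt μ (fun y => (Φ y).1) (fun i y => (Φ y).2.1 i) (fun y => (Φ y).2.2) bb x a Z Y =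
      coefForm μ a Z Y (Φ x - scalarDrift bb, fderiv ℝ Φ x) := by
  rw [coefForm_apply]
  unfold bernsteinAt
  congr 1
  · funext l i j; exact pd_clm (coefQ i j) hΦ l
  · funext l i k k'; exact pd_clm (coefB i k k') hΦ l
  · funext l k k'; exact pd_clm (coefC k k') hΦ l

lemma coefForm_scalarDrift_ge (μ : ℝ) (a : Fin m → ℝ) (Z : Fin d → Fin m → ℝ)
    (Y : Fin d → Fin d → Fin m → ℝ) (A : 𝔼 →L[ℝ] 𝔼) {c : ℝ}
    (hA : ∀ w, c * ‖w‖ ^ 2 ≤ inner ℝ (A w) w) :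
    c * ∑ i, ∑ k, Z i k ^ 2 ≤ coefForm μ a Z Y (0, (scalarDrift (d := d) (m := m)).comp A) := by
  have h1 : coefForm μ a Z Y (0, (scalarDrift (d := d) (m := m)).comp A) =
      ∑ l, ∑ i, (A (𝐞 l)) i * ∑ k, Z l k * Z i k := by
    change bernsteinForm _ _ _ _ _ _ _ _ _ _ = _
    unfold bernsteinForm
    simp only [ContinuousLinearMap.comp_apply, scalarDrift_apply, Prod.fst_zero, Prod.snd_zero,
      Pi.zero_apply, zero_mul, Finset.sum_const_zero, mul_zero, add_zero, zero_add, mul_ite, mul_one,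
      ite_mul, Finset.sum_ite_eq, Finset.mem_univ, if_true, Finset.mul_sum, mul_assoc]
  rw [h1]
  refine sum_diffusion_ge (fun w => ?_) Z
  have h2 := hA (WithLp.toLp 2 w)
  rw [EuclideanSpace.real_norm_sq_eq] at h2
  refine h2.trans (le_of_eq ?_)
  rw [clm_eq_sum A, sum_inner]
  refine Finset.sum_congr rfl fun l _ => ?_
  rw [real_inner_smul_left, PiLp.inner_apply, Finset.mul_sum]
  refine Finset.sum_congr rfl fun i _ => ?_
  simp; ring

/-- Crude bound for the Bernstein form: only the quadratic form of the zero order term enters the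
coefficient of `|a|²`. -/
lemma exists_coefForm_le {μ ν : ℝ} (hμ : 0 < μ) (hν : 0 < ν) (H : ℝ) {K : ℝ} (hK : 0 ≤ K) :
    ∃ K3 : ℝ, 0 ≤ K3 ∧ ∀ (X : CoefSpace d m) (X' : 𝔼 →L[ℝ] CoefSpace d m), ‖X‖ ≤ K → ‖X'‖ ≤ K →
      (∀ w : Fin d → ℝ, ν * ∑ k, (w k) ^ 2 ≤ ∑ k, ∑ l, X.1 k l * w k * w l) →
      (∀ w : Fin m → ℝ, (∑ k, ∑ l, X.2.2 k l * w k * w l) ≤ H * ∑ k, (w k) ^ 2) →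
      ∀ a Z Y, coefForm μ a Z Y (X, X') ≤ (H + 1) * ∑ k, a k ^ 2 + K3 * ∑ i, ∑ k, Z i k ^ 2 := by
  set nC := √(∑ _l : Fin d, ∑ _k : Fin m, ∑ _k' : Fin m, K ^ 2) with hnC
  set nBt := √(∑ _i : Fin d, ∑ _l : Fin d, ∑ _k : Fin m, ∑ _k' : Fin m, K ^ 2) with hnBt
  set k0 := √(∑ _l : Fin d, K ^ 2) / ν with hk0
  set P := √d * m * (0 * ν + K) + nC with hP
  have hP0 : 0 ≤ P := by positivity
  set θ : ℝ := 2 / (P + 1) with hθ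
  have hθ0 : 0 < θ := by positivity
  refine ⟨|0 + nBt + 0 + H + P / (2 * θ) + 1 / (4 * μ) * (√d * m * 0 + d * k0) ^ 2 * ν
    + √d * m * K * (√d * m * 0 + d * k0) / (2 * μ) + (√d * m * K) ^ 2 / (4 * μ * ν)|, abs_nonneg _, ?_⟩
  intro X X' hX hX' hell hC a Z Y
  have hX'l : ∀ l : Fin d, ‖X' (𝐞 l)‖ ≤ K := fun l =>
    (X'.le_opNorm _).trans (by simpa using hX')
  have sqle : ∀ {u : ℝ}, |u| ≤ K → u ^ 2 ≤ K ^ 2 := fun h => sq_le_sq' (abs_le.1 h).1 (abs_le.1 h).2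
  have key := bernsteinForm_le_weighted hθ0 hμ le_rfl hν (ξ := 0) le_rfl (k := k0) (by positivity)
    hK (q := X.1) (B := X.2.1) (C := X.2.2)
    (Dq := fun l i j => (X' (𝐞 l)).1 i j)
    (DB := fun l i k k' => (X' (𝐞 l)).2.1 i k k')
    (DC := fun l k k' => (X' (𝐞 l)).2.2 k k') (Db := 0) (S := 0)
    (DBt := fun i l k k' => (X' (𝐞 l)).2.1 i k k') (nS := 0) (nBt := nBt)
    (nC := nC) (LamDb := 0) (LamC := H) hell
    (fun i k l => by simpa using (abs_coefB_le i k l X).trans hX)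
    (fun i j => by
      rw [hk0, div_mul_cancel₀ _ hν.ne']
      exact Real.sqrt_le_sqrt (Finset.sum_le_sum fun l _ => sqle ((abs_coefQ_le i j _).trans (hX'l l))))
    (by simp) (by simp) hC (by simp)
    (Real.sqrt_le_sqrt (Finset.sum_le_sum fun i _ => Finset.sum_le_sum fun l _ =>
      Finset.sum_le_sum fun k _ => Finset.sum_le_sum fun k' _ =>
        sqle ((abs_coefB_le i k k' _).trans (hX'l l))))
    (Real.sqrt_le_sqrt (Finset.sum_le_sum fun l _ =>
      Finset.sum_le_sum fun k _ => Finset.sum_le_sum fun k' _ =>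
        sqle ((abs_coefC_le k k' _).trans (hX'l l)))) a Z Y
  change bernsteinForm _ _ _ _ _ _ _ _ _ _ ≤ _
  refine key.trans (add_le_add ?_ ?_)
  · refine mul_le_mul_of_nonneg_right ?_ (by positivity)
    have : θ / 2 * P ≤ 1 := by
      rw [hθ, show 2 / (P + 1) / 2 * P = P / (P + 1) by field_simp, div_le_one (by positivity)]
      linarith
    linarith
  · exact mul_le_mul_of_nonneg_right (le_abs_self _) (by positivity)

/-- Continuous map which is the identity on a ball and vanishes outside of a larger one. -/
noncomputable def cutProj (R : ℝ) (x : 𝔼) : 𝔼 := max 0 (min 1 (R + 3 - ‖x‖)) • x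

lemma continuous_cutProj (R : ℝ) : Continuous (cutProj R : 𝔼 → 𝔼) := by
  unfold cutProj; fun_prop

lemma cutProj_of_le {R : ℝ} {x : 𝔼} (hx : ‖x‖ ≤ R + 2) : cutProj R x = x := by
  rw [cutProj, min_eq_left (by linarith), max_eq_right zero_le_one, one_smul]

lemma cutProj_of_ge {R : ℝ} {x : 𝔼} (hx : R + 3 ≤ ‖x‖) : cutProj R x = 0 := by
  rw [cutProj, max_eq_left (min_le_of_right_le (by linarith)), zero_smul]

lemma norm_cutProj_le {R : ℝ} (hR : 0 < R) (x : 𝔼) : ‖cutProj R x‖ ≤ R + 3 := by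
  rcases le_or_gt (R + 3) ‖x‖ with h | h
  · rw [cutProj_of_ge h, norm_zero]; positivity
  · rw [cutProj, norm_smul, Real.norm_eq_abs, abs_of_nonneg (le_max_left _ _)]
    have : max 0 (min 1 (R + 3 - ‖x‖)) ≤ 1 := max_le zero_le_one (min_le_left _ _)
    nlinarith [norm_nonneg x]

/-- Coefficients, uniformly continuous on balls uniformly in time, which are elliptic and satisfy a
local Bernstein type inequality with constant `K`. -/
structure CoefData (Φ : ℝ → EuclideanSpace ℝ (Fin d) → CoefSpace d m)
    (bh : ℝ → EuclideanSpace ℝ (Fin d) → EuclideanSpace ℝ (Fin d)) (μ ν H K : ℝ) : Prop where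
  bdd : ∀ r : ℝ, ∃ A : ℝ, ∀ t x, ‖x‖ ≤ r → ‖Φ t x‖ ≤ A
  bh_bdd : ∀ r : ℝ, ∃ A : ℝ, ∀ t x, ‖x‖ ≤ r → ‖bh t x‖ ≤ A
  unif_time : ∀ r : ℝ, ∀ η > 0, ∃ δ > 0, ∀ t t' x, |t - t'| ≤ δ → ‖x‖ ≤ r → ‖Φ t x - Φ t' x‖ ≤ η
  unif_space : ∀ r : ℝ, ∀ η > 0, ∃ δ > 0, ∀ t x y, ‖x‖ ≤ r → ‖y‖ ≤ r → ‖x - y‖ ≤ δ →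
    ‖Φ t x - Φ t y‖ ≤ η
  diff : ∀ t, Differentiable ℝ (Φ t)
  fderiv_bdd : ∀ t r, ∃ A : ℝ, ∀ x, ‖x‖ ≤ r → ‖fderiv ℝ (Φ t) x‖ ≤ A
  symm : ∀ t x i j, (Φ t x).1 i j = (Φ t x).1 j i
  ell : ∀ t x (w : Fin d → ℝ), ν * ∑ k, (w k) ^ 2 ≤ ∑ k, ∑ l, (Φ t x).1 k l * w k * w l
  pot : ∀ t x (w : Fin m → ℝ), (∑ k, ∑ l, (Φ t x).2.2 k l * w k * w l) ≤ H * ∑ k, (w k) ^ 2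
  loc : ∀ r : ℝ, ∃ δ > 0, ∀ t x y, ‖x‖ ≤ r → ‖y‖ ≤ r → ‖x - y‖ ≤ δ → ∀ a Z Y,
    coefForm μ a Z Y (Φ t y - scalarDrift (bh t x), fderiv ℝ (Φ t) y) ≤
      K * (∑ k, a k ^ 2 + ∑ i, ∑ k, Z i k ^ 2)

namespace CoefData

variable {Φ : ℝ → EuclideanSpace ℝ (Fin d) → CoefSpace d m}
  {bh : ℝ → EuclideanSpace ℝ (Fin d) → EuclideanSpace ℝ (Fin d)} {μ ν H K R κ : ℝ}
  {ρ : EuclideanSpace ℝ (Fin d) → ℝ}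

lemma continuous_cut (h : CoefData Φ bh μ ν H K) (R : ℝ) (t : ℝ) :
    Continuous (fun x => Φ t (cutProj R x)) :=
  (h.diff t).continuous.comp (continuous_cutProj R)

lemma smoothBdd_mollify (h : CoefData Φ bh μ ν H K) (hR : 0 < R) (hρ : IsKernel ρ κ) :
    SmoothBdd (fun t => mollify volume ρ (fun x => Φ t (cutProj R x))) := by
  obtain ⟨A, hA⟩ := h.bdd (R + 3)
  exact SmoothBdd.mollify hρ.smooth hρ.hasCompactSupport (h.continuous_cut R)
    (fun t x => hA t _ (norm_cutProj_le hR x))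

lemma timeUnif_mollify (h : CoefData Φ bh μ ν H K) (hR : 0 < R) (hρ : IsKernel ρ κ) :
    TimeUnif (fun t => mollify volume ρ (fun x => Φ t (cutProj R x))) := by
  intro η hη
  obtain ⟨c, hc0, hc⟩ := exists_norm_fderiv_mollify_sub_le (μ := volume) (F := CoefSpace d m)
    hρ.smooth hρ.hasCompactSupport
  obtain ⟨δ, hδ, hδ'⟩ := h.unif_time (R + 3) (η / (c + 1)) (by positivity)
  have hs := h.smoothBdd_mollify hR hρ
  refine ⟨δ, hδ, fun t t' htt => ⟨(hs.differentiable t).sub (hs.differentiable t'), fun x => ?_⟩⟩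
  have key := hc _ _ (h.continuous_cut R t) (h.continuous_cut R t') (η / (c + 1))
    (fun x => hδ' t t' _ htt (norm_cutProj_le hR x)) x
  have hle : c * (η / (c + 1)) ≤ η := by
    rw [mul_div_assoc', div_le_iff₀ (by positivity)]; nlinarith
  refine ⟨key.1.trans hle, ?_⟩
  rw [fderiv_fun_sub (hs.differentiable t x) (hs.differentiable t' x)]
  exact key.2.trans hle

lemma symm_mollify (h : CoefData Φ bh μ ν H K) (hρ : IsKernel ρ κ) (t : ℝ) (x : 𝔼) (i j : Fin d) :
    (mollify volume ρ (fun x => Φ t (cutProj R x)) x).1 i j =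
      (mollify volume ρ (fun x => Φ t (cutProj R x)) x).1 j i := by
  refine le_antisymm ?_ ?_ <;> rw [← sub_nonpos]
  · exact hρ.clm_mollify_le (h.continuous_cut R t) x (coefQ i j - coefQ j i) (K := 0)
      (fun z _ => by simp [coefQ_apply, h.symm t _ i j])
  · exact hρ.clm_mollify_le (h.continuous_cut R t) x (coefQ j i - coefQ i j) (K := 0)
      (fun z _ => by simp [coefQ_apply, h.symm t _ i j])

lemma ell_mollify (h : CoefData Φ bh μ ν H K) (hρ : IsKernel ρ κ) (t : ℝ) (x : 𝔼) (w : Fin d → ℝ) :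
    ν * ∑ k, (w k) ^ 2 ≤
      ∑ k, ∑ l, (mollify volume ρ (fun x => Φ t (cutProj R x)) x).1 k l * w k * w l := by
  have key := hρ.clm_mollify_le (h.continuous_cut R t) x
    (-∑ k, ∑ l, (w k * w l) • (coefQ k l : CoefSpace d m →L[ℝ] ℝ)) (K := - (ν * ∑ k, (w k) ^ 2))
    (fun z _ => by
      have := h.ell t (cutProj R (x - z)) w
      simp only [neg_apply, sum_apply, FunLike.coe_smul, Pi.smul_apply, coefQ_apply, smul_eq_mul]
      refine neg_le_neg (this.trans (le_of_eq ?_))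
      exact Finset.sum_congr rfl fun k _ => Finset.sum_congr rfl fun l _ => by ring)
  simp only [neg_apply, sum_apply, FunLike.coe_smul, Pi.smul_apply, coefQ_apply, smul_eq_mul] at key
  refine (neg_le_neg_iff.1 key).trans (le_of_eq ?_)
  exact Finset.sum_congr rfl fun k _ => Finset.sum_congr rfl fun l _ => by ring

lemma pot_mollify (h : CoefData Φ bh μ ν H K) (hρ : IsKernel ρ κ) (t : ℝ) (x : 𝔼) (w : Fin m → ℝ) :
    (∑ k, ∑ l, (mollify volume ρ (fun x => Φ t (cutProj R x)) x).2.2 k l * w k * w l) ≤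
      H * ∑ k, (w k) ^ 2 := by
  have key := hρ.clm_mollify_le (h.continuous_cut R t) x
    (∑ k, ∑ l, (w k * w l) • (coefC k l : CoefSpace d m →L[ℝ] ℝ)) (K := H * ∑ k, (w k) ^ 2)
    (fun z _ => by
      have := h.pot t (cutProj R (x - z)) w
      simp only [sum_apply, FunLike.coe_smul, Pi.smul_apply, coefC_apply, smul_eq_mul]
      refine (le_of_eq ?_).trans this
      exact Finset.sum_congr rfl fun k _ => Finset.sum_congr rfl fun l _ => by ring)
  simp only [sum_apply, FunLike.coe_smul, Pi.smul_apply, coefC_apply, smul_eq_mul] at key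
  refine (le_of_eq ?_).trans key
  exact Finset.sum_congr rfl fun k _ => Finset.sum_congr rfl fun l _ => by ring

lemma mollify_far (hρ : IsKernel ρ κ) (hκ : κ ≤ 1 / 2) (t : ℝ) {x : 𝔼}
    (hx : R + 4 ≤ ‖x‖) : mollify volume ρ (fun x => Φ t (cutProj R x)) x = Φ t 0 ∧
      fderiv ℝ (mollify volume ρ (fun x => Φ t (cutProj R x))) x = 0 := by
  have h1 : ∀ y : 𝔼, R + 7 / 2 ≤ ‖y‖ →
      mollify volume ρ (fun x => Φ t (cutProj R x)) y = Φ t 0 := by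
    intro y hy
    have : ∀ z, ρ z • Φ t (cutProj R (y - z)) = ρ z • Φ t 0 := by
      intro z
      rcases le_or_gt ‖z‖ κ with hz | hz
      · rw [cutProj_of_ge]
        have := norm_sub_norm_le y z
        linarith
      · simp [hρ.supp z hz]
    unfold mollify
    simp only [this]
    rw [integral_smul_const, hρ.integral_eq, one_smul]
  refine ⟨h1 x (by linarith), ?_⟩
  have h2 : mollify volume ρ (fun x => Φ t (cutProj R x)) =ᶠ[𝓝 x] fun _ => Φ t 0 := by
    have : ∀ᶠ y in 𝓝 x, R + 7 / 2 < ‖y‖ :=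
      continuous_norm.continuousAt.eventually (lt_mem_nhds (by linarith))
    filter_upwards [this] with y hy using h1 y hy.le
  rw [h2.fderiv_eq]; simp

lemma mollify_near (h : CoefData Φ bh μ ν H K) (hρ : IsKernel ρ κ) (hκ : κ ≤ 1 / 2) (t : ℝ) {x : 𝔼}
    (hx : ‖x‖ ≤ R + 1) {A : ℝ} (bb : 𝔼) (a : Fin m → ℝ) (Z : Fin d → Fin m → ℝ)
    (Y : Fin d → Fin d → Fin m → ℝ)
    (hA : ∀ z, ‖z‖ ≤ κ →
      coefForm μ a Z Y (Φ t (x - z) - scalarDrift bb, fderiv ℝ (Φ t) (x - z)) ≤ A) :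
    coefForm μ a Z Y (mollify volume ρ (fun x => Φ t (cutProj R x)) x - scalarDrift bb,
      fderiv ℝ (mollify volume ρ (fun x => Φ t (cutProj R x))) x) ≤ A := by
  obtain ⟨A', hA'⟩ := h.fderiv_bdd t (R + 2)
  have hball : ∀ y ∈ Metric.ball x (κ + 1 / 4), ‖y‖ < R + 2 := by
    intro y hy
    rw [Metric.mem_ball, dist_eq_norm] at hy
    have := norm_le_norm_add_norm_sub' y x
    linarith
  have hev : ∀ y : 𝔼, ‖y‖ < R + 2 → (fun x => Φ t (cutProj R x)) =ᶠ[𝓝 y] Φ t := by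
    intro y hy
    have : ∀ᶠ z in 𝓝 y, ‖z‖ < R + 2 := continuous_norm.continuousAt.eventually (gt_mem_nhds hy)
    filter_upwards [this] with z hz
    rw [cutProj_of_le hz.le]
  obtain ⟨hintg, hder⟩ := hasFDerivAt_mollify (μ := volume) hρ.smooth.continuous
    (show (0:ℝ) < 1 / 4 by norm_num) hρ.supp (h.continuous_cut R t) (x := x) (C := A')
    (fun y hy => ((hev y (hball y hy)).differentiableAt_iff).2 (h.diff t y))
    (fun y hy => by rw [(hev y (hball y hy)).fderiv_eq]; exact hA' y (hball y hy).le)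
  rw [hder.fderiv]
  have hint0 := hρ.integrable_smul (h.continuous_cut R t) x
  have hint1 : Integrable (fun z => ρ z • (Φ t (cutProj R (x - z)) - scalarDrift bb)) volume := by
    simp only [smul_sub]
    exact hint0.sub (hρ.integrable.smul_const _)
  have e1 : mollify volume ρ (fun x => Φ t (cutProj R x)) x - scalarDrift bb =
      ∫ z, ρ z • (Φ t (cutProj R (x - z)) - scalarDrift bb) := by
    simp only [smul_sub]
    rw [integral_sub hint0 (hρ.integrable.smul_const _), integral_smul_const, hρ.integral_eq, one_smul]
    rfl
  have hpair : Integrable (fun z => ρ z • (Φ t (cutProj R (x - z)) - (scalarDrift bb : CoefSpace d m),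
      fderiv ℝ (fun x => Φ t (cutProj R x)) (x - z))) volume := hint1.prodMk hintg
  have key := hρ.clm_integral_le hpair (coefForm μ a Z Y).toContinuousLinearMap (K := A)
    (fun z hz => by
      have hxz : ‖x - z‖ < R + 2 := by have := norm_sub_le x z; linarith
      rw [(hev _ hxz).fderiv_eq, cutProj_of_le hxz.le]
      exact hA z hz)
  have e2 : ∫ z, ρ z • (Φ t (cutProj R (x - z)) - (scalarDrift bb : CoefSpace d m),
      fderiv ℝ (fun x => Φ t (cutProj R x)) (x - z)) =
      (∫ z, ρ z • (Φ t (cutProj R (x - z)) - scalarDrift bb),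
        ∫ z, ρ z • fderiv ℝ (fun x => Φ t (cutProj R x)) (x - z)) :=
    integral_pair hint1 hintg
  rw [e2, ← e1] at key
  exact key

end CoefData

/-- Smooth bounded coefficients satisfying a global Bernstein type inequality with constant `K`. -/
structure SmoothCoef (Ψ : ℝ → EuclideanSpace ℝ (Fin d) → CoefSpace d m) (μ ν H K : ℝ) : Prop where
  smooth : SmoothBdd Ψ
  time : TimeUnif Ψ
  symm : ∀ t x i j, (Ψ t x).1 i j = (Ψ t x).1 j i
  ell : ∀ t x (w : Fin d → ℝ), ν * ∑ k, (w k) ^ 2 ≤ ∑ k, ∑ l, (Ψ t x).1 k l * w k * w l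
  pot : ∀ t x (w : Fin m → ℝ), (∑ k, ∑ l, (Ψ t x).2.2 k l * w k * w l) ≤ H * ∑ k, (w k) ^ 2
  glob : ∃ A : ℝ, ∀ t x, ∃ bb : EuclideanSpace ℝ (Fin d), ‖bb‖ ≤ A ∧ ∀ a Z Y,
    coefForm μ a Z Y (Ψ t x - scalarDrift bb, fderiv ℝ (Ψ t) x) ≤
      K * (∑ k, a k ^ 2 + ∑ i, ∑ k, Z i k ^ 2)

/-- Approximation of coefficients by smooth bounded ones, keeping the Bernstein inequalities. -/
theorem CoefData.exists_smoothCoef {Φ : ℝ → 𝔼 → CoefSpace d m} {bh : ℝ → 𝔼 → 𝔼} {μ ν H K : ℝ}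
    (h : CoefData Φ bh μ ν H K) (hμ : 0 < μ) (hν : 0 < ν) :
    ∃ Kg : ℝ, 0 ≤ Kg ∧ ∀ R > 0, ∃ r > 0, ∀ η > 0, ∃ Ψ : ℝ → 𝔼 → CoefSpace d m,
      SmoothCoef Ψ μ ν H Kg ∧ (∀ t x, ‖x‖ ≤ R → ‖Ψ t x - Φ t x‖ ≤ η) ∧
      ∀ t x y, ‖x‖ ≤ R → ‖y‖ ≤ R → ‖x - y‖ ≤ r → ∀ a Z Y,
        coefForm μ a Z Y (Ψ t y - scalarDrift (bh t x), fderiv ℝ (Ψ t) y) ≤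
          K * (∑ k, a k ^ 2 + ∑ i, ∑ k, Z i k ^ 2) := by
  obtain ⟨A0, hA0⟩ := h.bdd 0
  obtain ⟨K0, hK0, hK0'⟩ := exists_coefForm_le (d := d) (m := m) hμ hν H (abs_nonneg A0)
  refine ⟨|K| + |H + 1| + K0, by positivity, fun R hR => ?_⟩
  obtain ⟨δ, hδ, hloc⟩ := h.loc (R + 2)
  refine ⟨δ / 2, by positivity, fun η hη => ?_⟩
  obtain ⟨δ', hδ', hclose⟩ := h.unif_space (R + 2) η hη
  set κ := min (1 / 2) (min (δ / 2) δ') with hκ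
  have hκ0 : 0 < κ := lt_min (by norm_num) (lt_min (by positivity) hδ')
  have hκ1 : κ ≤ 1 / 2 := min_le_left _ _
  have hκ2 : κ ≤ δ / 2 := (min_le_right _ _).trans (min_le_left _ _)
  have hκ3 : κ ≤ δ' := (min_le_right _ _).trans (min_le_right _ _)
  obtain ⟨ρ, hρ⟩ := exists_isKernel (d := d) hκ0
  set Θ : ℝ → 𝔼 → CoefSpace d m := fun t => mollify volume ρ (fun x => Φ t (cutProj R x)) with hΘ
  have hsm : SmoothBdd Θ := h.smoothBdd_mollify hR hρ
  obtain ⟨A1, hA1, hA1'⟩ := hsm.bound_zero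
  obtain ⟨A2, hA2, hA2'⟩ := hsm.fderiv.bound_zero
  obtain ⟨K3, hK3, hK3'⟩ := exists_coefForm_le (d := d) (m := m) hμ hν H (add_nonneg hA1 hA2)
  obtain ⟨g, hg, hg0, hgmon, c, hc, hgc⟩ := exists_monotone_field (d := d) R hR.le
  set N := K3 / c with hN
  have hN0 : 0 ≤ N := by positivity
  set Ψ : ℝ → 𝔼 → CoefSpace d m := fun t x => Θ t x - N • scalarDrift (g x) with hΨ
  have hgd : Differentiable ℝ g := hg.differentiable 0
  have hΨd : ∀ t x, fderiv ℝ (Ψ t) x =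
      fderiv ℝ (Θ t) x - N • (scalarDrift (m := m)).comp (fderiv ℝ g x) := by
    intro t x
    have h1 : HasFDerivAt (fun x => (scalarDrift (m := m) (g x))) ((scalarDrift (m := m)).comp (fderiv ℝ g x)) x :=
      (scalarDrift (m := m)).hasFDerivAt.comp x (hgd x).hasFDerivAt
    exact ((hsm.differentiable t x).hasFDerivAt.fun_sub (h1.fun_const_smul N)).fderiv
  have hform : ∀ t x bb a Z Y,
      coefForm μ a Z Y (Ψ t x - scalarDrift (bb - N • g x), fderiv ℝ (Ψ t) x) =
      coefForm μ a Z Y (Θ t x - scalarDrift bb, fderiv ℝ (Θ t) x)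
        - N * coefForm μ a Z Y (0, (scalarDrift (m := m)).comp (fderiv ℝ g x)) := by
    intro t x bb a Z Y
    rw [← smul_eq_mul, ← map_smul, ← map_sub, hΨd]
    congr 1
    refine Prod.ext ?_ rfl
    simp only [hΨ, map_sub, map_smul, Prod.fst_sub, Prod.smul_fst, smul_zero, sub_zero]
    abel
  have hdec : ∀ x a Z Y, 0 ≤ coefForm μ a Z Y (0, (scalarDrift (m := m)).comp (fderiv ℝ g x)) := by
    intro x a Z Y
    have := coefForm_scalarDrift_ge (m := m) μ a Z Y (fderiv ℝ g x) (c := 0)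
      (fun w => by simpa using hgmon x w)
    simpa using this
  have hgz : ∀ t x i j, (Ψ t x).1 i j = (Θ t x).1 i j := by
    intro t x i j
    simp [hΨ, scalarDrift_apply]
  have hgz2 : ∀ t x i j, (Ψ t x).2.2 i j = (Θ t x).2.2 i j := by
    intro t x i j
    simp [hΨ, scalarDrift_apply]
  have hnear : ∀ t x y, ‖y‖ ≤ R + 1 → ‖x‖ ≤ R + 2 → ‖x - y‖ ≤ δ / 2 → ∀ a Z Y,
      coefForm μ a Z Y (Ψ t y - scalarDrift (bh t x - N • g y), fderiv ℝ (Ψ t) y) ≤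
        K * (∑ k, a k ^ 2 + ∑ i, ∑ k, Z i k ^ 2) := by
    intro t x y hy hx hxy a Z Y
    rw [hform]
    have h1 := h.mollify_near hρ hκ1 t hy (bh t x) a Z Y
      (A := K * (∑ k, a k ^ 2 + ∑ i, ∑ k, Z i k ^ 2)) (fun z hz => by
        refine hloc t x (y - z) hx ?_ ?_ a Z Y
        · have := norm_sub_le y z; linarith
        · have : ‖x - (y - z)‖ ≤ ‖x - y‖ + ‖z‖ := by
            rw [show x - (y - z) = (x - y) + z by abel]; exact norm_add_le _ _
          linarith)
    have h2 := mul_nonneg hN0 (hdec y a Z Y)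
    linarith
  refine ⟨Ψ, ⟨?_, ?_, ?_, ?_, ?_, ?_⟩, ?_, ?_⟩
  · exact hsm.sub ((hg.clm scalarDrift).const_smul N)
  · intro η hη
    obtain ⟨δ, hδ, hδ'⟩ := h.timeUnif_mollify hR hρ η hη
    refine ⟨δ, hδ, fun t t' htt => ?_⟩
    simpa [hΨ] using hδ' t t' htt
  · intro t x i j
    rw [hgz, hgz]; exact h.symm_mollify hρ t x i j
  · intro t x w
    simp only [hgz]; exact h.ell_mollify hρ t x w
  · intro t x w
    simp only [hgz2]; exact h.pot_mollify hρ t x w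
  · obtain ⟨Ab, hAb⟩ := h.bh_bdd (R + 1)
    obtain ⟨Ag, hAg0, hAg⟩ := hg.bound_zero
    refine ⟨|Ab| + N * Ag, fun t x => ?_⟩
    have hNg : ‖N • g x‖ ≤ N * Ag := by
      rw [norm_smul, Real.norm_eq_abs, abs_of_nonneg hN0]
      exact mul_le_mul_of_nonneg_left (hAg 0 x) hN0
    have hS : ∀ (a : Fin m → ℝ) (Z : Fin d → Fin m → ℝ), 0 ≤ ∑ k, a k ^ 2 ∧ 0 ≤ ∑ i, ∑ k, Z i k ^ 2 :=
      fun a Z => ⟨by positivity, by positivity⟩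
    rcases le_or_gt ‖x‖ (R + 1) with hx | hx
    · refine ⟨bh t x - N • g x, (norm_sub_le _ _).trans
        (add_le_add ((hAb t x hx).trans (le_abs_self _)) hNg), fun a Z Y => (hnear t x x hx (by linarith) (by simp; positivity) a Z Y).trans ?_⟩
      refine mul_le_mul_of_nonneg_right ?_ (add_nonneg (hS a Z).1 (hS a Z).2)
      linarith [le_abs_self K, abs_nonneg (H + 1)]
    refine ⟨0 - N • g x, by rw [zero_sub, norm_neg]; linarith [abs_nonneg Ab], fun a Z Y => ?_⟩
    rw [hform, map_zero, sub_zero]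
    have hS' := hS a Z
    have hH := le_abs_self (H + 1)
    have hKa := abs_nonneg K
    have hHa := abs_nonneg (H + 1)
    rcases le_or_gt ‖x‖ (R + 4) with hx4 | hx4
    · have h1 := hK3' (Θ t x) (fderiv ℝ (Θ t) x) ((hA1' t x).trans (by linarith))
        ((hA2' t x).trans (by linarith)) (h.ell_mollify hρ t x) (h.pot_mollify hρ t x) a Z Y
      have h2 := coefForm_scalarDrift_ge (m := m) μ a Z Y (fderiv ℝ g x) (hgc x hx.le hx4)
      have h3 := mul_le_mul_of_nonneg_left h2 hN0
      rw [← mul_assoc, show N * c = K3 by rw [hN]; field_simp] at h3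
      have h4 := mul_le_mul_of_nonneg_right hH hS'.1
      have h5 := mul_nonneg (add_nonneg hKa hK0) hS'.1
      have h6 := mul_nonneg (add_nonneg (add_nonneg hKa hHa) hK0) hS'.2
      linarith
    · obtain ⟨e1, e2⟩ := mollify_far (Φ := Φ) hρ hκ1 t hx4.le
      have h1 := hK0' (Θ t x) (fderiv ℝ (Θ t) x)
        (by simp only [hΘ]; rw [e1]; exact (hA0 t 0 (by simp)).trans (le_abs_self _))
        (by simp only [hΘ]; rw [e2]; simp)
        (h.ell_mollify hρ t x) (h.pot_mollify hρ t x) a Z Y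
      have h3 := mul_nonneg hN0 (hdec x a Z Y)
      have h4 := mul_le_mul_of_nonneg_right hH hS'.1
      have h5 := mul_nonneg (add_nonneg hKa hK0) hS'.1
      have h6 := mul_nonneg (add_nonneg hKa hHa) hS'.2
      linarith
  · intro t x hx
    have : Ψ t x = Θ t x := by simp [hΨ, hg0 x hx]
    rw [this]
    refine hρ.norm_mollify_sub_le (h.continuous_cut R t) x _ fun z hz => ?_
    have hxz : ‖x - z‖ ≤ R + 2 := by have := norm_sub_le x z; linarith
    rw [cutProj_of_le hxz]
    refine hclose t _ _ hxz (by linarith) ?_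
    rw [show x - z - x = -z by abel, norm_neg]; linarith
  · intro t x y hx hy hxy a Z Y
    have := hnear t x y (by linarith) (by linarith) hxy a Z Y
    rwa [hg0 y hy, smul_zero, sub_zero] at this

end CoefSpace

section GradientEstimate

variable {d m : ℕ}

local notation "𝔼" => EuclideanSpace ℝ (Fin d)
local notation "𝕍" => EuclideanSpace ℝ (Fin m)

/-- Symmetric elliptic matrices with bounded entries. -/
structure EllMat (ν K : ℝ) (M : Fin d → Fin d → ℝ) : Prop where
  symm : ∀ i j, M i j = M j i
  ell : ∀ w : Fin d → ℝ, ν * ∑ k, (w k) ^ 2 ≤ ∑ k, ∑ l, M k l * w k * w l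
  bdd : ∀ i j, |M i j| ≤ K

theorem exists_sqrtField (hd : 1 ≤ d) {ν : ℝ} (hν : 0 < ν) (K : ℝ) :
    ∃ (σ : (Fin d → Fin d → ℝ) → Fin d → 𝔼) (L : ℝ), 0 ≤ L ∧
      (∀ M, EllMat ν K M → ∀ i j, ∑ a, σ M a i * σ M a j = M i j) ∧
      ∀ M M', EllMat ν K M → EllMat ν K M' → ∑ a, ‖σ M a - σ M' a‖ ^ 2 ≤ (L * ‖M - M'‖) ^ 2 := by
  obtain ⟨g, U, S, L, -, -, -, -, hg, hL, hLip⟩ := exists_smooth_matrixSqrt hd hν K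
  let ℓ : (Fin d → Fin d → ℝ) →ₗ[ℝ] (𝔼 →L[ℝ] 𝔼) :=
    { toFun := fun M => Matrix.toEuclideanCLM (𝕜 := ℝ) (M : Matrix (Fin d) (Fin d) ℝ)
      map_add' := fun a b => map_add (Matrix.toEuclideanCLM (𝕜 := ℝ) (n := Fin d)) a b
      map_smul' := fun c a => map_smul (Matrix.toEuclideanCLM (𝕜 := ℝ) (n := Fin d)) c a }
  have hgood : ∀ M : Fin d → Fin d → ℝ, EllMat ν K M → ℓ M ∈ S ∧
      ∀ i j, ∑ a, g (ℓ M) (𝐞 a) i * g (ℓ M) (𝐞 a) j = M i j := by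
    intro M hM
    refine hg M (Matrix.IsSymm.ext fun i j => hM.symm j i) (fun z => ?_) hM.bdd
    rw [EuclideanSpace.real_norm_sq_eq]
    exact hM.ell z
  refine ⟨fun M a => g (ℓ M) (𝐞 a), √d * (L * ‖ℓ.toContinuousLinearMap‖),
    by positivity, fun M hM => (hgood M hM).2, fun M M' hM hM' => ?_⟩
  have h1 : ∀ a, ‖g (ℓ M) (𝐞 a) - g (ℓ M') (𝐞 a)‖ ≤
      L * ‖ℓ.toContinuousLinearMap‖ * ‖M - M'‖ := by
    intro a
    rw [← sub_apply]
    refine ((g (ℓ M) - g (ℓ M')).le_opNorm _).trans ?_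
    have e : ‖(𝐞 a : 𝔼)‖ = 1 := by simp
    rw [e, mul_one, mul_assoc]
    refine (hLip _ (hgood M hM).1 _ (hgood M' hM').1).trans (mul_le_mul_of_nonneg_left ?_ hL)
    rw [← map_sub]
    exact ℓ.toContinuousLinearMap.le_opNorm (M - M')
  calc ∑ a, ‖g (ℓ M) (𝐞 a) - g (ℓ M') (𝐞 a)‖ ^ 2
      ≤ ∑ _a : Fin d, (L * ‖ℓ.toContinuousLinearMap‖ * ‖M - M'‖) ^ 2 :=
        Finset.sum_le_sum fun a _ => pow_le_pow_left₀ (norm_nonneg _) (h1 a) 2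
    _ = (√d * (L * ‖ℓ.toContinuousLinearMap‖) * ‖M - M'‖) ^ 2 := by
        rw [Finset.sum_const, Finset.card_univ, Fintype.card_fin, nsmul_eq_mul]
        rw [mul_assoc (√d : ℝ), mul_pow (√d : ℝ), Real.sq_sqrt (Nat.cast_nonneg d)]

/-- Approximate solutions for the operator with given coefficients. -/
def CoefSol (Ψ : ℝ → EuclideanSpace ℝ (Fin d) → CoefSpace d m)
    (f : EuclideanSpace ℝ (Fin d) → EuclideanSpace ℝ (Fin m)) (s T η : ℝ)
    (w : ℝ → EuclideanSpace ℝ (Fin d) → EuclideanSpace ℝ (Fin m)) : Prop :=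
  ApproxSol (fun t x => diffusionCoef (EuclideanSpace ℝ (Fin m)) (Ψ t x).1)
    (fun t x => driftCoef (fun i => (Ψ t x).2.1 i)) (fun t x => matOp (Ψ t x).2.2) f s T η w

namespace SmoothCoef

variable {Ψ : ℝ → EuclideanSpace ℝ (Fin d) → CoefSpace d m} {μ ν H K : ℝ}
  {f : EuclideanSpace ℝ (Fin d) → EuclideanSpace ℝ (Fin m)} {s T η : ℝ}
  {w : ℝ → EuclideanSpace ℝ (Fin d) → EuclideanSpace ℝ (Fin m)}

lemma exists_coefSol (h : SmoothCoef Ψ μ ν H K) (hd : 1 ≤ d) (hν : 0 < ν)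
    (hf : SmoothBdd (fun _ : Unit => f)) (hsT : s < T) (hη : 0 < η) : ∃ w, CoefSol Ψ f s T η w :=
  exists_approxSol_of_elliptic hd hν (q := fun t x => (Ψ t x).1) (B := fun i t x => (Ψ t x).2.1 i)
    (C := fun t x => (Ψ t x).2.2)
    (fun i j => h.smooth.clm (coefQ i j)) (fun i j => h.time.clm (coefQ i j))
    (fun i k l => h.smooth.clm (coefB i k l)) (fun i k l => h.time.clm (coefB i k l))
    (fun k l => h.smooth.clm (coefC k l)) (fun k l => h.time.clm (coefC k l))
    (fun t x => Matrix.IsSymm.ext fun i j => h.symm t x j i)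
    (fun t x z => by rw [EuclideanSpace.real_norm_sq_eq]; exact h.ell t x z) hf hsT hη

lemma energy_ineq (h : SmoothCoef Ψ μ ν H K) (hw : CoefSol Ψ f s T η w) {t : ℝ} (ht : t ∈ Ioc s T)
    (x bb : 𝔼) {Kq : ℝ} (hKq : ∀ a Z Y, coefForm μ a Z Y (Ψ t x - scalarDrift bb, fderiv ℝ (Ψ t) x) ≤
      Kq * (∑ k, a k ^ 2 + ∑ i, ∑ k, Z i k ^ 2)) :
    ∃ ℓ f1, HasDerivWithinAt (fun τ => energy (w τ) x) ℓ (Iic t) t ∧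
      HasDerivAt (fun τ : ℝ => energy (w t) (x + τ • bb)) f1 0 ∧
      ∀ σ : Fin d → 𝔼, (∀ i j, ∑ a, σ a i * σ a j = (Ψ t x).1 i j) → ∃ F1 F2 S : Fin d → ℝ,
        (∀ a, HasJet2 (fun τ : ℝ => energy (w t) (x + τ • σ a)) (F1 a) (F2 a)) ∧ (∀ a, 0 ≤ S a) ∧
        (∀ a, F1 a ^ 2 ≤ 4 * energy (w t) x * S a) ∧
        ℓ ≤ ∑ a, (F2 a - 2 * (1 - μ) * S a) + f1 + (2 * Kq + 1) * energy (w t) x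
          + (1 + d) * η ^ 2 := by
  have hdiff := h.smooth.differentiable t x
  exact ApproxSol.energy_ineq (q := fun t x => (Ψ t x).1) (B := fun i t x => (Ψ t x).2.1 i)
    (C := fun t x => (Ψ t x).2.2) hw ht x
    (fun i j => (coefQ i j).differentiableAt.comp x hdiff)
    (fun i k l => (coefB i k l).differentiableAt.comp x hdiff)
    (fun k l => (coefC k l).differentiableAt.comp x hdiff) bb
    (fun a Z Y => (bernsteinAt_eq_coefForm μ hdiff bb a Z Y).trans_le (hKq a Z Y))

end SmoothCoef

lemma continuous_energy {w : ℝ → 𝔼 → 𝕍} (h : Continuous (fun p : ℝ × 𝔼 => w p.1 p.2))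
    (h' : Continuous (fun p : ℝ × 𝔼 => fderiv ℝ (w p.1) p.2)) (hd : ∀ t, Differentiable ℝ (w t)) :
    Continuous (fun p : ℝ × 𝔼 => energy (w p.1) p.2) := by
  have e : (fun p : ℝ × 𝔼 => energy (w p.1) p.2) = fun p : ℝ × 𝔼 => ∑ k, w p.1 p.2 k ^ 2 +
      ∑ l, ∑ k, (fderiv ℝ (w p.1) p.2 (𝐞 l)) k ^ 2 := by
    funext p
    unfold energy
    congr 1
    refine Finset.sum_congr rfl fun l _ => Finset.sum_congr rfl fun k _ => ?_
    rw [pd_coord (hd p.1 p.2)]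
  rw [e]
  fun_prop

lemma energy_le_of_norm_le {w : 𝔼 → 𝕍} {x : 𝔼} {A : ℝ} (hd : DifferentiableAt ℝ w x) (h0 : ‖w x‖ ≤ A)
    (h1 : ‖fderiv ℝ w x‖ ≤ A) : energy w x ≤ (1 + d) * A ^ 2 := by
  have e1 : ∑ k, w x k ^ 2 ≤ A ^ 2 := by
    rw [← EuclideanSpace.real_norm_sq_eq]; exact pow_le_pow_left₀ (norm_nonneg _) h0 2
  have e2 : ∀ l, ∑ k, pd (fun z => w z k) x l ^ 2 ≤ A ^ 2 := by
    intro l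
    have : ∑ k, pd (fun z => w z k) x l ^ 2 = ‖fderiv ℝ w x (𝐞 l)‖ ^ 2 := by
      rw [EuclideanSpace.real_norm_sq_eq]
      refine Finset.sum_congr rfl fun k _ => ?_
      rw [pd_coord hd]
    rw [this]
    refine pow_le_pow_left₀ (norm_nonneg _) (((fderiv ℝ w x).le_opNorm _).trans ?_) 2
    simpa using h1
  have e3 : ∑ l, ∑ k, pd (fun z => w z k) x l ^ 2 ≤ ∑ _l : Fin d, A ^ 2 :=
    Finset.sum_le_sum fun l _ => e2 l
  unfold energy
  simp at e3
  linarith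

lemma isLocalMax_line {g : 𝔼 → ℝ} {x : 𝔼} {R : ℝ} (hx : ‖x‖ < R) (h : ∀ y, ‖y‖ ≤ R → g y ≤ g x)
    (v : 𝔼) : IsLocalMax (fun τ : ℝ => g (x + τ • v)) 0 := by
  have c1 : ∀ᶠ τ : ℝ in 𝓝 0, x + τ • v ∈ Metric.ball (0 : 𝔼) R :=
    (show Continuous fun τ : ℝ => x + τ • v by fun_prop).continuousAt.eventually_mem
      (Metric.isOpen_ball.mem_nhds (by simpa using hx))
  filter_upwards [c1] with τ k1
  simp only [zero_smul, add_zero]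
  exact h _ (by simpa using (Metric.ball_subset_closedBall k1))

lemma hasJet2_one_add_norm_sq (x v : 𝔼) :
    HasJet2 (fun τ : ℝ => 1 + ‖x + τ • v‖ ^ 2) (2 * inner ℝ x v) (2 * ‖v‖ ^ 2) := by
  have := (HasJet2.const (1:ℝ)).add (hasJet2_norm_sq x v)
  simpa using this

lemma barrier_neg {E1 D F2 f1 F ℓ Λ P η Tr Ab C n S : ℝ} (hE1 : 0 < E1) (hE1' : E1 ≤ 1) (hD : 0 < D)
    (hP : 1 ≤ P) (hη : η ^ 2 ≤ 1) (hS : 0 ≤ S)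
    (h2 : E1 * F2 ≤ D * (2 * Tr)) (h1 : E1 * f1 ≤ D * (Ab * (1 + n))) (hn : 0 ≤ n) (hTr : 0 ≤ Tr)
    (hℓ : ℓ ≤ F2 - S + f1 + Λ * F + P * η ^ 2)
    (hC : C = 2 * Tr + Ab + 1) :
    E1 * (-Λ) * F + E1 * ℓ - P - D * C * (1 + n) < 0 := by
  have h3 : E1 * ℓ ≤ E1 * (F2 - S + f1 + Λ * F + P * η ^ 2) := mul_le_mul_of_nonneg_left hℓ hE1.le
  have h4 : E1 * (P * η ^ 2) ≤ 1 * P := by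
    have h41 : E1 * η ^ 2 ≤ 1 := mul_le_one₀ hE1' (sq_nonneg η) hη
    have h42 := mul_le_mul_of_nonneg_left h41 (by linarith : (0:ℝ) ≤ P)
    linarith
  have h5 := mul_nonneg hE1.le hS
  have h6 := mul_nonneg (mul_nonneg hD.le hTr) hn
  have h7 := mul_nonneg hD.le hn
  subst hC
  nlinarith

/-- Uniform bound for the energy of approximate solutions. -/
theorem SmoothCoef.energy_le {Ψ : ℝ → 𝔼 → CoefSpace d m} {μ ν H K : ℝ} {f : 𝔼 → 𝕍} {s T η : ℝ}
    {w : ℝ → 𝔼 → 𝕍} (h : SmoothCoef Ψ μ ν H K) (hd : 1 ≤ d) (hν : 0 < ν) (hμ : μ ≤ 1) (hK : 0 ≤ K)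
    (hw : CoefSol Ψ f s T η w) (hη : 0 < η) (hη1 : η ≤ 1) {A : ℝ} (hA : ∀ x, energy f x ≤ A)
    {t : ℝ} (ht : t ∈ Icc s T) (x : 𝔼) :
    energy (w t) x ≤ Real.exp ((2 * K + 1) * (T - s)) * (A + (1 + d) * (T - s)) := by
  set Λ := 2 * K + 1 with hΛ
  obtain ⟨A1, hA1, hA1'⟩ := ApproxSol.smoothBdd hw |>.bound_zero
  obtain ⟨A2, hA2, hA2'⟩ := (ApproxSol.smoothBdd hw).fderiv.bound_zero
  have hwd : ∀ t, Differentiable ℝ (w t) := (ApproxSol.smoothBdd hw).differentiable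
  have hFb : ∀ t x, energy (w t) x ≤ (1 + d) * (A1 + A2) ^ 2 := fun t x =>
    energy_le_of_norm_le (hwd t x) ((hA1' t x).trans (by linarith)) ((hA2' t x).trans (by linarith))
  set BF := (1 + d) * (A1 + A2) ^ 2 with hBF
  obtain ⟨AΨ, hAΨ, hAΨ'⟩ := h.smooth.bound_zero
  obtain ⟨Ab, hAb⟩ := h.glob
  obtain ⟨σ, L, -, hσ, -⟩ := exists_sqrtField hd hν AΨ
  have hell : ∀ t x, EllMat ν AΨ (Ψ t x).1 := fun t x =>
    ⟨h.symm t x, h.ell t x, fun i j => (abs_coefQ_le i j _).trans (hAΨ' t x)⟩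
  have hTr : ∀ t x, ∑ a, ‖σ (Ψ t x).1 a‖ ^ 2 ≤ d * AΨ := by
    intro t x
    have : ∑ a, ‖σ (Ψ t x).1 a‖ ^ 2 = ∑ i, (Ψ t x).1 i i := by
      simp only [EuclideanSpace.real_norm_sq_eq]
      rw [Finset.sum_comm]
      refine Finset.sum_congr rfl fun i _ => ?_
      rw [← hσ _ (hell t x) i i]
      exact Finset.sum_congr rfl fun a _ => sq _
    rw [this]
    refine (Finset.sum_le_sum fun i _ => (le_abs_self _).trans ((hell t x).bdd i i)).trans ?_
    simp
  set C := 2 * (d * AΨ) + |Ab| + 1 with hC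
  have hC0 : 0 ≤ C := by positivity
  have main : ∀ δ > 0, Real.exp (-Λ * (t - s)) * energy (w t) x - A - (1 + d) * (t - s)
      - δ * Real.exp (C * (t - s)) * (1 + ‖x‖ ^ 2) < 0 := by
    intro δ hδ
    set R := max ‖x‖ (BF / δ) + |A| / δ + 1 with hR
    have hRpos : 1 ≤ R := by
      have h1 : 0 ≤ max ‖x‖ (BF / δ) := (norm_nonneg x).trans (le_max_left _ _)
      have h2 : 0 ≤ |A| / δ := by positivity
      linarith
    have hxR : ‖x‖ ≤ R := by
      have h1 := le_max_left ‖x‖ (BF / δ)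
      have h2 : 0 ≤ |A| / δ := by positivity
      linarith
    have hRδ : BF + |A| < δ * R := by
      have h1 := le_max_right ‖x‖ (BF / δ)
      have : BF / δ + |A| / δ + 1 ≤ R := by linarith
      calc BF + |A| < δ * (BF / δ + |A| / δ + 1) := by field_simp; linarith
        _ ≤ δ * R := mul_le_mul_of_nonneg_left this hδ.le
    have hΛ0 : 0 ≤ Λ := by linarith
    have hexp1 : ∀ τ ∈ Icc s T, Real.exp (-Λ * (τ - s)) ≤ 1 := fun τ hτ =>
      Real.exp_le_one_iff.2 (by nlinarith [hτ.1])
    have hexp2 : ∀ τ ∈ Icc s T, 1 ≤ Real.exp (C * (τ - s)) := fun τ hτ =>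
      Real.one_le_exp (mul_nonneg hC0 (by linarith [hτ.1]))
    refine neg_of_touching (isCompact_closedBall (0 : 𝔼) R) (s := s) (T := T)
      (Ψ := fun t x => Real.exp (-Λ * (t - s)) * energy (w t) x - A - (1 + d) * (t - s)
        - δ * Real.exp (C * (t - s)) * (1 + ‖x‖ ^ 2)) ?_ ?_ ?_ t ht x (by simpa using hxR)
    · have hc := continuous_energy (ApproxSol.cont hw) (ApproxSol.cont_fderiv hw) hwd
      refine Continuous.continuousOn ?_
      fun_prop
    · intro y _
      have e : w s = f := ApproxSol.start hw
      simp only [sub_self, mul_zero, Real.exp_zero, one_mul, e]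
      have := hA y
      have h3 : 0 < δ * 1 * (1 + ‖y‖ ^ 2) := by positivity
      linarith
    · intro τ hτ y hy h0 hmax htime
      have hτ' : τ ∈ Icc s T := ⟨hτ.1.le, hτ.2⟩
      set E1 := Real.exp (-Λ * (τ - s)) with hE1
      set D := δ * Real.exp (C * (τ - s)) with hD
      have hE1p : 0 < E1 := Real.exp_pos _
      have hDp : 0 < D := by positivity
      have hyR : ‖y‖ < R := by
        by_contra! hge
        have h1 : E1 * energy (w τ) y ≤ 1 * BF :=
          mul_le_mul (hexp1 τ hτ') (hFb τ y) (energy_nonneg _ _) zero_le_one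
        have h2 : δ * R ≤ D * (1 + ‖y‖ ^ 2) := by
          refine mul_le_mul ?_ ?_ (by linarith) hDp.le
          · have := mul_le_mul_of_nonneg_left (hexp2 τ hτ') hδ.le
            linarith
          · nlinarith
        have h3 : 0 ≤ (1 + (d:ℝ)) * (τ - s) := mul_nonneg (by positivity) (by linarith [hτ.1])
        have h4 := neg_abs_le A
        linarith
      obtain ⟨bb, hbb, hform⟩ := hAb τ y
      obtain ⟨ℓ, f1, hℓ, hf1, hjets⟩ := h.energy_ineq hw hτ y bb hform
      obtain ⟨F1, F2, S, hF, hS, -, hineq⟩ := hjets (σ (Ψ τ y).1) (hσ _ (hell τ y))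
      have hloc : ∀ v : 𝔼, IsLocalMax (fun r : ℝ => E1 * energy (w τ) (y + r • v) - A
          - (1 + d) * (τ - s) - D * (1 + ‖y + r • v‖ ^ 2)) 0 := fun v =>
        isLocalMax_line (g := fun y => E1 * energy (w τ) y - A - (1 + d) * (τ - s)
          - D * (1 + ‖y‖ ^ 2)) hyR (fun z hz => by rw [h0]; exact hmax z (by simpa using hz)) v
      have hsec : ∀ a, E1 * F2 a ≤ D * (2 * ‖σ (Ψ τ y).1 a‖ ^ 2) := by
        intro a
        have j := (((((hF a).const_mul E1).sub (HasJet2.const A)).sub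
          (HasJet2.const ((1 + (d:ℝ)) * (τ - s)))).sub
          ((hasJet2_one_add_norm_sq y (σ (Ψ τ y).1 a)).const_mul D)).nonpos_of_isLocalMax (hloc _)
        linarith [j.2]
      have hfirst : E1 * f1 = D * (2 * inner ℝ y bb) := by
        have j := (hloc bb).hasDerivAt_eq_zero ((((hf1.const_mul E1).sub_const A).sub_const
          ((1 + (d:ℝ)) * (τ - s))).sub ((hasJet2_one_add_norm_sq y bb).hasDerivAt.const_mul D))
        linarith
      have hfirst' : E1 * f1 ≤ D * (|Ab| * (1 + ‖y‖ ^ 2)) := by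
        rw [hfirst]
        refine mul_le_mul_of_nonneg_left ?_ hDp.le
        have h1 := real_inner_le_norm y bb
        have h2 : ‖y‖ * ‖bb‖ ≤ ‖y‖ * |Ab| :=
          mul_le_mul_of_nonneg_left (hbb.trans (le_abs_self _)) (norm_nonneg _)
        nlinarith [sq_nonneg (‖y‖ - 1), abs_nonneg Ab]
      have hlin : ∀ r : ℝ, HasDerivAt (fun τ' : ℝ => Real.exp (r * (τ' - s)))
          (Real.exp (r * (τ - s)) * r) τ := fun r => by
        simpa using (((hasDerivAt_id τ).sub_const s).const_mul r).exp
      have hder : HasDerivWithinAt (fun t => Real.exp (-Λ * (t - s)) * energy (w t) y - A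
          - (1 + d) * (t - s) - δ * Real.exp (C * (t - s)) * (1 + ‖y‖ ^ 2))
          (E1 * (-Λ) * energy (w τ) y + E1 * ℓ - (1 + d) - D * C * (1 + ‖y‖ ^ 2)) (Iic τ) τ := by
        have k1 := (hlin (-Λ)).hasDerivWithinAt (s := Iic τ) |>.fun_mul hℓ
        have k2 := ((((hasDerivAt_id τ).sub_const s).const_mul (1 + (d:ℝ)))).hasDerivWithinAt (s := Iic τ)
        have k3 := (((hlin C).const_mul δ).mul_const (1 + ‖y‖ ^ 2)).hasDerivWithinAt (s := Iic τ)
        refine (((k1.sub_const A).fun_sub k2).fun_sub k3).congr_deriv ?_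
        rw [hD]; ring
      have hnn := htime _ hder
      have hneg := barrier_neg (E1 := E1) (D := D) (F2 := ∑ a, F2 a) (f1 := f1) (F := energy (w τ) y)
        (ℓ := ℓ) (Λ := Λ) (P := 1 + d) (η := η) (Tr := d * AΨ) (Ab := |Ab|) (C := C) (n := ‖y‖ ^ 2)
        (S := ∑ a, 2 * (1 - μ) * S a) hE1p (hexp1 τ hτ') hDp (by linarith [(Nat.cast_nonneg d : (0:ℝ) ≤ d)])
        (by nlinarith) (Finset.sum_nonneg fun a _ => mul_nonneg (by linarith) (hS a))
        (by
          rw [Finset.mul_sum]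
          refine (Finset.sum_le_sum fun a _ => hsec a).trans ?_
          rw [← Finset.mul_sum, ← Finset.mul_sum]
          exact mul_le_mul_of_nonneg_left (mul_le_mul_of_nonneg_left (hTr τ y) (by norm_num)) hDp.le)
        hfirst' (by positivity) (by positivity)
        (by rw [Finset.sum_sub_distrib] at hineq; exact hineq) hC
      linarith
  have hlim : Real.exp (-Λ * (t - s)) * energy (w t) x - A - (1 + d) * (t - s) ≤ 0 := by
    set Q := Real.exp (C * (t - s)) * (1 + ‖x‖ ^ 2) with hQ
    have hQ0 : 0 < Q := by positivity
    refine le_of_forall_pos_le_add fun ε hε => ?_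
    have h1 := main (ε / Q) (by positivity)
    have h2 : ε / Q * Real.exp (C * (t - s)) * (1 + ‖x‖ ^ 2) = ε := by
      rw [mul_assoc, ← hQ]; field_simp
    rw [h2] at h1
    linarith
  have hA0 : 0 ≤ A := (energy_nonneg f x).trans (hA x)
  have e1 : energy (w t) x = Real.exp (Λ * (t - s)) * (Real.exp (-Λ * (t - s)) * energy (w t) x) := by
    rw [← mul_assoc, ← Real.exp_add]; ring_nf; simp
  rw [e1]
  have h1 : 0 ≤ t - s := by linarith [ht.1]
  have h2 : t - s ≤ T - s := by linarith [ht.2]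
  refine mul_le_mul (Real.exp_le_exp.2 (mul_le_mul_of_nonneg_left h2 (by linarith))) ?_
    (mul_nonneg (Real.exp_pos _).le (energy_nonneg _ _)) (Real.exp_pos _).le
  have h3 : (1 + (d:ℝ)) * (t - s) ≤ (1 + d) * (T - s) := mul_le_mul_of_nonneg_left h2 (by positivity)
  linarith

lemma HasJet2.norm_sq {F : Type*} [NormedAddCommGroup F] [InnerProductSpace ℝ F] {g : ℝ → F}
    {a b : F} (hg : HasJet2 g a b) :
    HasJet2 (fun τ => ‖g τ‖ ^ 2) (2 * inner ℝ (g 0) a) (2 * (‖a‖ ^ 2 + inner ℝ (g 0) b)) := by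
  obtain ⟨g', h1, h2, h3⟩ := hg
  refine ⟨fun τ => 2 * inner ℝ (g τ) (g' τ), fun τ => ?_, by simp only [h2], ?_⟩
  · exact (h1 τ).norm_sq
  · have := ((h1 0).inner ℝ h3).const_mul 2
    refine this.congr_deriv ?_
    rw [h2, real_inner_self_eq_norm_sq]
    ring

lemma young_drift {D κ lam N p Hb Lc θ : ℝ} (hlam : 0 ≤ lam) (hθ0 : 0 < θ) (hθ : θ ≤ 1 / 2)
    (hX : θ * (D ^ 2 * κ ^ 2 * lam) ≤ 1) (hLc : Lc + D ^ 2 * κ ^ 2 * lam / 4 ≤ Hb) :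
    2 * (D * (κ * lam) * (N * p)) + 2 * (Lc * N ^ 2) ≤
      (2 * Hb + 1) * N ^ 2 + 2 * (1 - θ) * (lam * p ^ 2) := by
  have h1 : 0 ≤ lam * (D * κ * N * (1 + 2 * θ) - 2 * p) ^ 2 := by positivity
  have h2 : D ^ 2 * κ ^ 2 * lam * N ^ 2 / 2 + θ * (D ^ 2 * κ ^ 2 * lam) * N ^ 2 ≤
      (2 * (Hb - Lc) + 1) * N ^ 2 := by nlinarith [sq_nonneg N]
  have h4 : 0 ≤ θ * (1 - 2 * θ) * (lam * p ^ 2) :=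
    mul_nonneg (mul_nonneg hθ0.le (by linarith)) (by positivity)
  have h5 : 0 < 1 + 2 * θ := by linarith
  have h6 : 2 * (D * (κ * lam) * (N * p)) * (1 + 2 * θ) ≤
      (D ^ 2 * κ ^ 2 * lam * N ^ 2 / 2 * (1 + 2 * θ) + 2 * (1 - θ) * (lam * p ^ 2)) * (1 + 2 * θ) := by
    nlinarith
  have h7 := le_of_mul_le_mul_right h6 h5
  nlinarith

lemma norm_fderiv_sq_eq {w : 𝔼 → 𝕍} {x : 𝔼} (hd : DifferentiableAt ℝ w x) (l : Fin d) :
    ∑ k, pd (fun z => w z k) x l ^ 2 = ‖fderiv ℝ w x (𝐞 l)‖ ^ 2 := by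
  rw [EuclideanSpace.real_norm_sq_eq]
  exact Finset.sum_congr rfl fun k _ => by rw [pd_coord hd]

lemma norm_clm_sq_le (L : 𝔼 →L[ℝ] 𝕍) (v : 𝔼) :
    ‖L v‖ ^ 2 ≤ ‖v‖ ^ 2 * ∑ l, ‖L (𝐞 l)‖ ^ 2 := by
  have h1 : ‖L v‖ ≤ ∑ l, |v l| * ‖L (𝐞 l)‖ := by
    rw [clm_eq_sum L v]
    refine (norm_sum_le _ _).trans (Finset.sum_le_sum fun l _ => ?_)
    rw [norm_smul, Real.norm_eq_abs]
  refine (pow_le_pow_left₀ (norm_nonneg _) h1 2).trans ?_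
  refine (Finset.sum_mul_sq_le_sq_mul_sq _ _ _).trans ?_
  simp only [sq_abs]
  rw [EuclideanSpace.real_norm_sq_eq]

lemma norm_sq_le_energy (w : 𝔼 → 𝕍) (x : 𝔼) : ‖w x‖ ^ 2 ≤ energy w x := by
  rw [EuclideanSpace.real_norm_sq_eq]
  exact le_add_of_nonneg_right (by positivity)

lemma norm_fderiv_apply_sq_le_energy {w : 𝔼 → 𝕍} {x : 𝔼} (hd : DifferentiableAt ℝ w x) (v : 𝔼) :
    ‖fderiv ℝ w x v‖ ^ 2 ≤ ‖v‖ ^ 2 * energy w x := by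
  refine (norm_clm_sq_le _ v).trans (mul_le_mul_of_nonneg_left ?_ (by positivity))
  rw [energy]
  simp only [norm_fderiv_sq_eq hd]
  exact le_add_of_nonneg_left (by positivity)

lemma inner_driftCoef (B : Fin d → Matrix (Fin m) (Fin m) ℝ) (z : 𝕍) (P : 𝔼 →L[ℝ] 𝕍) :
    inner ℝ z (driftCoef B P) =
      ∑ i, ∑ k, ∑ l, B i k l * z k * P (𝐞 i) l := by
  rw [driftCoef_apply, inner_sum]
  refine Finset.sum_congr rfl fun i _ => ?_
  rw [PiLp.inner_apply]
  refine Finset.sum_congr rfl fun k _ => ?_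
  rw [matOp_apply, Real.inner_apply, Finset.mul_sum]
  exact Finset.sum_congr rfl fun l _ => by ring

lemma inner_matOp (C : Matrix (Fin m) (Fin m) ℝ) (z : 𝕍) :
    inner ℝ z (matOp C z) = ∑ k, ∑ l, C k l * z k * z l := by
  rw [PiLp.inner_apply]
  refine Finset.sum_congr rfl fun k _ => ?_
  rw [matOp_apply, Real.inner_apply, Finset.mul_sum]
  exact Finset.sum_congr rfl fun l _ => by ring

lemma sum_norm_sq_ge {q : Matrix (Fin d) (Fin d) ℝ} {lam : ℝ} {σ : Fin d → 𝔼}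
    (hσ : ∀ i j, ∑ a, σ a i * σ a j = q i j)
    (hq : ∀ w : Fin d → ℝ, lam * ∑ k, (w k) ^ 2 ≤ ∑ k, ∑ l, q k l * w k * w l) (P : 𝔼 →L[ℝ] 𝕍) :
    lam * ∑ i, ∑ k, P (𝐞 i) k ^ 2 ≤ ∑ a, ‖P (σ a)‖ ^ 2 := by
  refine (sum_diffusion_ge hq fun i k => P (𝐞 i) k).trans (le_of_eq ?_)
  have h : ∀ a, ‖P (σ a)‖ ^ 2 = ∑ k, (∑ i, σ a i * P (𝐞 i) k) ^ 2 := by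
    intro a
    rw [EuclideanSpace.real_norm_sq_eq]
    refine Finset.sum_congr rfl fun k _ => ?_
    rw [clm_eq_sum P (σ a), euclidean_sum_apply]
    simp
  simp only [h]
  rw [Finset.sum_comm (γ := Fin d) (α := Fin m)]
  refine ((sum_sum_quad q fun k i => P (𝐞 i) k).symm).trans ?_
  exact Finset.sum_congr rfl fun k _ => (sum_sq_line hσ _).symm

/-- Dissipativity of the system up to a fraction `θ` of the diffusion term. -/
lemma system_form_le {q : Matrix (Fin d) (Fin d) ℝ} {B : Fin d → Matrix (Fin m) (Fin m) ℝ}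
    {C : Matrix (Fin m) (Fin m) ℝ} {lam κ Hb Lc θ : ℝ} {σ : Fin d → 𝔼}
    (hσ : ∀ i j, ∑ a, σ a i * σ a j = q i j)
    (hq : ∀ w : Fin d → ℝ, lam * ∑ k, (w k) ^ 2 ≤ ∑ k, ∑ l, q k l * w k * w l)
    (hB : ∀ i k l, |B i k l| ≤ κ * lam) (hlam : 0 ≤ lam) (hκ : 0 ≤ κ)
    (hC : ∀ w : Fin m → ℝ, ∑ k, ∑ l, C k l * w k * w l ≤ Lc * ∑ k, (w k) ^ 2)
    (hθ0 : 0 < θ) (hθ : θ ≤ 1 / 2) (hX : θ * (d * m ^ 2 * κ ^ 2 * lam) ≤ 1)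
    (hLc : Lc + d * m ^ 2 * κ ^ 2 * lam / 4 ≤ Hb) (z : 𝕍) (P : 𝔼 →L[ℝ] 𝕍) :
    2 * inner ℝ z (driftCoef B P) + 2 * inner ℝ z (matOp C z) ≤
      (2 * Hb + 1) * ‖z‖ ^ 2 + 2 * (1 - θ) * ∑ a, ‖P (σ a)‖ ^ 2 := by
  have hD : (√d * m) ^ 2 = (d * m ^ 2 : ℝ) := by
    rw [mul_pow, Real.sq_sqrt (Nat.cast_nonneg d)]
  have h1 := sum_drift_le (mul_nonneg hκ hlam) hB z (fun i k => P (𝐞 i) k)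
  rw [← inner_driftCoef] at h1
  have h2 := hC z
  rw [← inner_matOp, ← EuclideanSpace.real_norm_sq_eq] at h2
  have h3 := sum_norm_sq_ge hσ hq P
  rw [← EuclideanSpace.real_norm_sq_eq, Real.sqrt_sq (norm_nonneg z)] at h1
  have h4 := young_drift (D := √d * m) (κ := κ) (Hb := Hb) (Lc := Lc) (N := ‖z‖)
    (p := √(∑ i, ∑ k, P (𝐞 i) k ^ 2)) hlam hθ0 hθ
    (by rw [hD]; exact hX) (by rw [hD]; exact hLc)
  rw [Real.sq_sqrt (by positivity)] at h4
  have h5 : 2 * (1 - θ) * (lam * ∑ i, ∑ k, P (𝐞 i) k ^ 2) ≤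
      2 * (1 - θ) * ∑ a, ‖P (σ a)‖ ^ 2 := mul_le_mul_of_nonneg_left h3 (by linarith)
  linarith

lemma exists_norm_lower_order_le : ∃ c : ℝ, 0 ≤ c ∧ ∀ (X : CoefSpace d m) (L : 𝔼 →L[ℝ] 𝕍) (v : 𝕍) (A : ℝ),
    (∀ l, ‖L (𝐞 l)‖ ≤ A) → ‖v‖ ≤ A →
    ‖driftCoef (fun i => X.2.1 i) L + matOp X.2.2 v‖ ≤ c * ‖X‖ * A := by
  set c0 := ∑ k : Fin m, ∑ l : Fin m, ‖unitOp k l‖ with hc0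
  have hc : 0 ≤ c0 := by positivity
  have hM : ∀ (M : Matrix (Fin m) (Fin m) ℝ) (N : ℝ) (v : 𝕍) (A : ℝ), (∀ k l, |M k l| ≤ N) → ‖v‖ ≤ A →
      ‖matOp M v‖ ≤ c0 * N * A := by
    intro M N v A hN hv
    rw [hc0, Finset.sum_mul, Finset.sum_mul, matOp, sum_apply]
    refine (norm_sum_le _ _).trans (Finset.sum_le_sum fun k _ => ?_)
    rw [Finset.sum_mul, Finset.sum_mul, sum_apply]
    refine (norm_sum_le _ _).trans (Finset.sum_le_sum fun l _ => ?_)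
    rw [FunLike.coe_smul, Pi.smul_apply, norm_smul, Real.norm_eq_abs]
    have h1 := (unitOp k l).le_opNorm v
    have h2 : ‖unitOp k l‖ * ‖v‖ ≤ ‖unitOp k l‖ * A := by gcongr
    have h3 : 0 ≤ ‖unitOp k l‖ * A := le_trans (by positivity) h2
    calc |M k l| * ‖unitOp k l v‖ ≤ |M k l| * (‖unitOp k l‖ * A) := by gcongr; linarith
      _ ≤ N * (‖unitOp k l‖ * A) := by gcongr; exact hN k l
      _ = _ := by ring
  refine ⟨(d + 1) * c0, by positivity, fun X L v A hL hv => ?_⟩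
  refine (norm_add_le _ _).trans ?_
  have e := driftCoef_apply (fun i => (X.2.1 i : Matrix (Fin m) (Fin m) ℝ)) L
  have h1 : ‖∑ i, matOp (X.2.1 i) (L (𝐞 i))‖ ≤ ∑ _i : Fin d, c0 * ‖X‖ * A :=
    (norm_sum_le _ _).trans (Finset.sum_le_sum fun i _ =>
      hM _ _ _ _ (fun k l => abs_coefB_le i k l X) (hL i))
  have h2 := hM X.2.2 _ _ _ (fun k l => abs_coefC_le k l X) hv
  simp only [Finset.sum_const, Finset.card_univ, Fintype.card_fin, nsmul_eq_mul] at h1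
  rw [← e] at h1
  linarith

lemma one_sub_mul_norm_sq_le {F : Type*} [NormedAddCommGroup F] [InnerProductSpace ℝ F] {θ : ℝ}
    (hθ0 : 0 < θ) (p r : F) : (1 - θ) * ‖p‖ ^ 2 - ‖r‖ ^ 2 / θ ≤ ‖p + r‖ ^ 2 := by
  have h0 := sq_nonneg ‖θ • p + r‖
  have e1 : ‖θ • p + r‖ ^ 2 = θ ^ 2 * ‖p‖ ^ 2 + 2 * θ * inner ℝ p r + ‖r‖ ^ 2 := by
    rw [norm_add_sq_real, norm_smul, inner_smul_left, Real.norm_eq_abs, abs_of_pos hθ0]; simp; ring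
  rw [norm_add_sq_real]
  have h2 : 0 ≤ (θ ^ 2 * ‖p‖ ^ 2 + 2 * θ * inner ℝ p r + ‖r‖ ^ 2) / θ := by
    rw [← e1]; positivity
  have h3 : (θ ^ 2 * ‖p‖ ^ 2 + 2 * θ * inner ℝ p r + ‖r‖ ^ 2) / θ =
      θ * ‖p‖ ^ 2 + 2 * inner ℝ p r + ‖r‖ ^ 2 / θ := by field_simp
  nlinarith [sq_nonneg ‖r‖]

lemma matOp_sub (M M' : Matrix (Fin m) (Fin m) ℝ) (v : 𝕍) :
    matOp (M - M') v = matOp M v - matOp M' v := by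
  ext k
  simp only [matOp_apply, PiLp.sub_apply, Matrix.sub_apply, sub_mul, Finset.sum_sub_distrib]

lemma driftCoef_sub (B B' : Fin d → Matrix (Fin m) (Fin m) ℝ) (L : 𝔼 →L[ℝ] 𝕍) :
    driftCoef (fun i => B i - B' i) L = driftCoef B L - driftCoef B' L := by
  simp only [driftCoef_apply, matOp_sub, Finset.sum_sub_distrib]

lemma driftCoef_scalar (b : 𝔼) (L : 𝔼 →L[ℝ] 𝕍) :
    driftCoef (fun i => Matrix.of fun k l => b i * (if k = l then 1 else 0)) L = L b := by
  rw [driftCoef_apply, clm_eq_sum L b]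
  refine Finset.sum_congr rfl fun i _ => ?_
  ext k
  simp [matOp_apply]

/-- The inequality behind the doubling argument for the difference of an exact and an approximate
solution. -/
lemma system_inner_le {q q' : Matrix (Fin d) (Fin d) ℝ} {B B' : Fin d → Matrix (Fin m) (Fin m) ℝ}
    {C C' : Matrix (Fin m) (Fin m) ℝ} {lam κ Hb Lc θ c M0 r : ℝ} {σ σ' : Fin d → 𝔼} {bh : 𝔼}
    (hσ : ∀ i j, ∑ a, σ a i * σ a j = q i j) (hσ' : ∀ i j, ∑ a, σ' a i * σ' a j = q' i j)
    (hσσ : ∑ a, ‖σ a - σ' a‖ ^ 2 ≤ c ^ 2)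
    (hq : ∀ w : Fin d → ℝ, lam * ∑ k, (w k) ^ 2 ≤ ∑ k, ∑ l, q k l * w k * w l)
    (hB : ∀ i k l, |B i k l - bh i * (if k = l then 1 else 0)| ≤ κ * lam) (hlam : 0 ≤ lam) (hκ : 0 ≤ κ)
    (hC : ∀ w : Fin m → ℝ, ∑ k, ∑ l, C k l * w k * w l ≤ Lc * ∑ k, (w k) ^ 2)
    (hθ0 : 0 < θ) (hθ : θ ≤ 1 / 2) (hX : θ * (d * m ^ 2 * κ ^ 2 * lam) ≤ 1)
    (hLc : Lc + d * m ^ 2 * κ ^ 2 * lam / 4 ≤ Hb)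
    (u w res : 𝕍) (Du Dw : 𝔼 →L[ℝ] 𝕍) (U2 W2 : 𝔼 →L[ℝ] 𝔼 →L[ℝ] 𝕍) (hM0 : 0 ≤ M0)
    (hDw : ∀ v, ‖Dw v‖ ^ 2 ≤ ‖v‖ ^ 2 * M0)
    (hres : ‖driftCoef (fun i => B i - B' i) Dw + matOp (C - C') w - res‖ ≤ r) :
    2 * inner ℝ (u - w) ((diffusionCoef 𝕍 q U2 + driftCoef B Du + matOp C u) -
      (diffusionCoef 𝕍 q' W2 + driftCoef B' Dw + matOp C' w + res)) ≤
    ∑ a, 2 * (‖Du (σ a) - Dw (σ' a)‖ ^ 2 + inner ℝ (u - w) (U2 (σ a) (σ a) - W2 (σ' a) (σ' a))) +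
      2 * inner ℝ (u - w) (Du bh - Dw bh) + (2 * Hb + 2) * ‖u - w‖ ^ 2 +
      (2 * (c ^ 2 * M0 / θ) + r ^ 2) := by
  set z := u - w with hz
  set P := Du - Dw with hP
  set err := driftCoef (fun i => B i - B' i) Dw + matOp (C - C') w - res with herr
  have e1 : (diffusionCoef 𝕍 q U2 + driftCoef B Du + matOp C u) -
      (diffusionCoef 𝕍 q' W2 + driftCoef B' Dw + matOp C' w + res) =
      ∑ a, (U2 (σ a) (σ a) - W2 (σ' a) (σ' a)) + (Du bh - Dw bh) +
      driftCoef (fun i => B i - Matrix.of fun k l => bh i * (if k = l then 1 else 0)) P +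
      matOp C z + err := by
    rw [Finset.sum_sub_distrib, sum_bilin_eq_diffusionCoef hσ, sum_bilin_eq_diffusionCoef hσ',
      driftCoef_sub, driftCoef_scalar, herr, driftCoef_sub, matOp_sub, hz, hP, map_sub, map_sub,
      sub_apply]
    abel
  have h1 := system_form_le (B := fun i => B i - Matrix.of fun k l => bh i * (if k = l then 1 else 0))
    hσ hq hB hlam hκ hC hθ0 hθ hX hLc z P
  have h2 : 2 * inner ℝ z err ≤ ‖z‖ ^ 2 + r ^ 2 := by
    have a1 := real_inner_le_norm z err
    have a2 : ‖err‖ ^ 2 ≤ r ^ 2 := pow_le_pow_left₀ (norm_nonneg _) hres 2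
    nlinarith [sq_nonneg (‖z‖ - ‖err‖)]
  have h3 : ∀ a, (1 - θ) * ‖P (σ a)‖ ^ 2 - ‖σ a - σ' a‖ ^ 2 * M0 / θ ≤ ‖Du (σ a) - Dw (σ' a)‖ ^ 2 := by
    intro a
    have e : Du (σ a) - Dw (σ' a) = P (σ a) + Dw (σ a - σ' a) := by
      rw [hP, sub_apply, map_sub]; abel
    rw [e]
    refine le_trans ?_ (one_sub_mul_norm_sq_le hθ0 _ _)
    have := div_le_div_of_nonneg_right (hDw (σ a - σ' a)) hθ0.le
    linarith
  have h4 := Finset.sum_le_sum fun a (_ : a ∈ Finset.univ) => h3 a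
  rw [Finset.sum_sub_distrib, ← Finset.mul_sum, ← Finset.sum_div, ← Finset.sum_mul] at h4
  have h5 : (∑ a, ‖σ a - σ' a‖ ^ 2) * M0 / θ ≤ c ^ 2 * M0 / θ := by gcongr
  rw [e1, inner_add_right, inner_add_right, inner_add_right, inner_add_right, inner_sum]
  simp only [← Finset.mul_sum, Finset.sum_add_distrib]
  linarith

/-- Bounded solutions of the system with given coefficients. -/
structure BddSol (Φ : ℝ → EuclideanSpace ℝ (Fin d) → CoefSpace d m)
    (f : EuclideanSpace ℝ (Fin d) → EuclideanSpace ℝ (Fin m)) (s T : ℝ)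
    (u : ℝ → EuclideanSpace ℝ (Fin d) → EuclideanSpace ℝ (Fin m)) : Prop where
  cont : ContinuousOn (fun p : ℝ × EuclideanSpace ℝ (Fin d) => u p.1 p.2) (Icc s T ×ˢ univ)
  bdd : ∃ M : ℝ, ∀ t ∈ Icc s T, ∀ x, ‖u t x‖ ≤ M
  start : u s = f
  contDiff : ∀ t ∈ Ioc s T, ContDiff ℝ 2 (u t)
  deriv : ∀ t ∈ Ioc s T, ∀ x, HasDerivWithinAt (fun τ => u τ x)
    (diffusionCoef (EuclideanSpace ℝ (Fin m)) (Φ t x).1 (fderiv ℝ (fderiv ℝ (u t)) x) +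
      driftCoef (fun i => (Φ t x).2.1 i) (fderiv ℝ (u t) x) + matOp (Φ t x).2.2 (u t x)) (Iic t) t

/-- Structural bounds on the first order coupling and on the potential. -/
def DriftData (Φ : ℝ → EuclideanSpace ℝ (Fin d) → CoefSpace d m)
    (bh : ℝ → EuclideanSpace ℝ (Fin d) → EuclideanSpace ℝ (Fin d)) (Hb : ℝ) : Prop :=
  ∀ R : ℝ, ∃ X : ℝ, ∀ t x, ‖x‖ ≤ R → ∃ lam κ Lc : ℝ, 0 ≤ lam ∧ 0 ≤ κ ∧ d * m ^ 2 * κ ^ 2 * lam ≤ X ∧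
    (∀ i k l, |(Φ t x).2.1 i k l - bh t x i * (if k = l then 1 else 0)| ≤ κ * lam) ∧
    (∀ w : Fin d → ℝ, lam * ∑ k, (w k) ^ 2 ≤ ∑ k, ∑ l, (Φ t x).1 k l * w k * w l) ∧
    (∀ w : Fin m → ℝ, ∑ k, ∑ l, (Φ t x).2.2 k l * w k * w l ≤ Lc * ∑ k, (w k) ^ 2) ∧
    Lc + d * m ^ 2 * κ ^ 2 * lam / 4 ≤ Hb

lemma system_doublingIneq {q q' : Matrix (Fin d) (Fin d) ℝ} {B B' : Fin d → Matrix (Fin m) (Fin m) ℝ}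
    {C C' : Matrix (Fin m) (Fin m) ℝ} {lam κ Hb Lc θ c M0 r s t e : ℝ} {σ σ' : Fin d → 𝔼} {bh : 𝔼}
    (hσ : ∀ i j, ∑ a, σ a i * σ a j = q i j) (hσ' : ∀ i j, ∑ a, σ' a i * σ' a j = q' i j)
    (hσσ : ∑ a, ‖σ a - σ' a‖ ^ 2 ≤ c ^ 2)
    (hq : ∀ w : Fin d → ℝ, lam * ∑ k, (w k) ^ 2 ≤ ∑ k, ∑ l, q k l * w k * w l)
    (hB : ∀ i k l, |B i k l - bh i * (if k = l then 1 else 0)| ≤ κ * lam) (hlam : 0 ≤ lam) (hκ : 0 ≤ κ)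
    (hC : ∀ w : Fin m → ℝ, ∑ k, ∑ l, C k l * w k * w l ≤ Lc * ∑ k, (w k) ^ 2)
    (hθ0 : 0 < θ) (hθ : θ ≤ 1 / 2) (hX : θ * (d * m ^ 2 * κ ^ 2 * lam) ≤ 1)
    (hLc : Lc + d * m ^ 2 * κ ^ 2 * lam / 4 ≤ Hb) {u w : ℝ → 𝔼 → 𝕍} {x y : 𝔼} {res : 𝕍}
    (hst : s ≤ t) (hu2 : ContDiff ℝ 2 (u t)) (hw2 : ContDiff ℝ 2 (w t))
    (hu : HasDerivWithinAt (fun τ => u τ x) (diffusionCoef 𝕍 q (fderiv ℝ (fderiv ℝ (u t)) x) +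
      driftCoef B (fderiv ℝ (u t) x) + matOp C (u t x)) (Iic t) t)
    (hw : HasDerivWithinAt (fun τ => w τ y) (diffusionCoef 𝕍 q' (fderiv ℝ (fderiv ℝ (w t)) y) +
      driftCoef B' (fderiv ℝ (w t) y) + matOp C' (w t y) + res) (Iic t) t)
    (hE : energy (w t) y ≤ M0)
    (hres : ‖driftCoef (fun i => B i - B' i) (fderiv ℝ (w t) y) + matOp (C - C') (w t y) - res‖ ≤ r)
    {Λ : ℝ} (hΛ : 2 * Hb + 2 ≤ Λ) (hΛ0 : 0 ≤ Λ) (he : 2 * (c ^ 2 * M0 / θ) + r ^ 2 ≤ e) :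
    DoublingIneq q bh (fun t x y => Real.exp (-Λ * (t - s)) * ‖u t x - w t y‖ ^ 2) t x y c e := by
  set E := Real.exp (-Λ * (t - s)) with hEdef
  have hE0 : 0 < E := Real.exp_pos _
  have hE1 : E ≤ 1 := Real.exp_le_one_iff.2 (by nlinarith)
  have hM0 : 0 ≤ M0 := (energy_nonneg _ _).trans hE
  have key := system_inner_le hσ hσ' hσσ hq hB hlam hκ hC hθ0 hθ hX hLc (u t x) (w t y) res
    (fderiv ℝ (u t) x) (fderiv ℝ (w t) y) (fderiv ℝ (fderiv ℝ (u t)) x) (fderiv ℝ (fderiv ℝ (w t)) y) hM0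
    (fun v => (norm_fderiv_apply_sq_le_energy (hw2.differentiable (by norm_num) y) v).trans
      (mul_le_mul_of_nonneg_left hE (by positivity))) hres
  have hjet : ∀ v v' : 𝔼, HasJet2 (fun τ : ℝ => E * ‖u t (x + τ • v) - w t (y + τ • v')‖ ^ 2)
      (E * (2 * inner ℝ (u t x - w t y) (fderiv ℝ (u t) x v - fderiv ℝ (w t) y v')))
      (E * (2 * (‖fderiv ℝ (u t) x v - fderiv ℝ (w t) y v'‖ ^ 2 + inner ℝ (u t x - w t y)
        (fderiv ℝ (fderiv ℝ (u t)) x v v - fderiv ℝ (fderiv ℝ (w t)) y v' v')))) := by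
    intro v v'
    have := (((hasJet2_line hu2 x v).sub (hasJet2_line hw2 y v')).norm_sq).const_mul E
    simpa only [zero_smul, add_zero] using this
  have hexp : HasDerivWithinAt (fun τ => Real.exp (-Λ * (τ - s))) (E * -Λ) (Iic t) t := by
    have := (((hasDerivAt_id t).sub_const s).const_mul (-Λ)).exp.hasDerivWithinAt (s := Iic t)
    exact this.congr_deriv (by simp [hEdef])
  have htime := hexp.fun_mul ((hu.fun_sub hw).norm_sq)
  refine ⟨σ, σ', _, _, _, _, hσ, hσσ, htime, fun a => hjet (σ a) (σ' a), (hjet bh bh).hasDerivAt, ?_⟩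
  rw [← Finset.mul_sum]
  have e0 : 0 ≤ e := le_trans (by positivity) he
  have h2 : E * e ≤ e := by nlinarith
  have h3 : (2 * Hb + 2) * ‖u t x - w t y‖ ^ 2 ≤ Λ * ‖u t x - w t y‖ ^ 2 :=
    mul_le_mul_of_nonneg_right hΛ (by positivity)
  have h4 := mul_le_mul_of_nonneg_left (key.trans (add_le_add (add_le_add_right h3 _) he)) hE0.le
  rw [← hEdef]
  linarith

/-- A coercive supersolution for the scalar operator. -/
structure Lyap (q : ℝ → EuclideanSpace ℝ (Fin d) → Matrix (Fin d) (Fin d) ℝ)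
    (bh : ℝ → EuclideanSpace ℝ (Fin d) → EuclideanSpace ℝ (Fin d)) (φ : EuclideanSpace ℝ (Fin d) → ℝ)
    (lam K : ℝ) : Prop where
  contDiff : ContDiff ℝ 2 φ
  pos : ∀ x, 0 < φ x
  blowup : Tendsto φ (cocompact (EuclideanSpace ℝ (Fin d))) atTop
  lam_pos : 0 < lam
  K_nonneg : 0 ≤ K
  ineq : ∀ t x, ∑ i, ∑ j, q t x i j * fderiv ℝ (fderiv ℝ φ) x
      (𝐞 i) (𝐞 j) + fderiv ℝ φ x (bh t x)
      ≤ lam * φ x + K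

/-- Lipschitz continuity of the leading coefficients on balls, uniformly in time. -/
def LipLead (Φ : ℝ → EuclideanSpace ℝ (Fin d) → CoefSpace d m) : Prop :=
  ∀ r : ℝ, ∃ L : ℝ, 0 ≤ L ∧ ∀ t x y, ‖x‖ ≤ r → ‖y‖ ≤ r → ‖(Φ t x).1 - (Φ t y).1‖ ≤ L * ‖x - y‖

lemma exists_small {P Q G e : ℝ} (hP : 0 ≤ P) (hG : 0 ≤ G) (he : 0 < e) :
    ∃ τ > 0, τ ≤ 1 ∧ ∀ c r : ℝ, 0 ≤ c → 0 ≤ r → c ≤ Q * τ → r ≤ G * τ → 2 * (c ^ 2 * P) + r ^ 2 ≤ e := by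
  refine ⟨min 1 (e / (2 * Q ^ 2 * P + G ^ 2 + 1)), by positivity, min_le_left _ _, ?_⟩
  intro c r hc hr hcQ hrG
  set τ := min 1 (e / (2 * Q ^ 2 * P + G ^ 2 + 1)) with hτ
  have hτ0 : 0 < τ := by positivity
  have hτ1 : τ ≤ 1 := min_le_left _ _
  have h1 : c ^ 2 ≤ Q ^ 2 * τ := by
    have := pow_le_pow_left₀ hc hcQ 2
    nlinarith [mul_nonneg (sq_nonneg Q) (mul_nonneg hτ0.le (sub_nonneg.2 hτ1))]
  have h2 : r ^ 2 ≤ G ^ 2 * τ := by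
    have := pow_le_pow_left₀ hr hrG 2
    nlinarith [mul_nonneg (sq_nonneg G) (mul_nonneg hτ0.le (sub_nonneg.2 hτ1))]
  have h3 : τ * (2 * Q ^ 2 * P + G ^ 2 + 1) ≤ e := by
    rw [← le_div_iff₀ (by positivity)]; exact min_le_right _ _
  nlinarith [mul_le_mul_of_nonneg_right h1 hP]

lemma sq_sub_sq_small {E a b D N e : ℝ} (hE0 : 0 ≤ E) (hE : E ≤ 1) (ha : 0 ≤ a) (hb : 0 ≤ b) (hD : 0 ≤ D)
    (hab : a ≤ D + b) (haN : a ≤ N) (hbN : b ≤ N) (he : 0 ≤ e) (hDe : D * (2 * N + 1) ≤ e) :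
    E * a ^ 2 - E * b ^ 2 ≤ e := by
  have h1 : a ^ 2 - b ^ 2 ≤ e := by
    have : (a - b) * (a + b) ≤ D * (a + b) := mul_le_mul_of_nonneg_right (by linarith) (by linarith)
    nlinarith
  nlinarith [mul_le_mul_of_nonneg_left h1 hE0]

lemma le_one_add_of_sq_le {a M : ℝ} (h : a ^ 2 ≤ M) : a ≤ 1 + M := by nlinarith [sq_nonneg (a - 1)]

lemma CoefSol.deriv_eq {Ψ : ℝ → 𝔼 → CoefSpace d m} {f : 𝔼 → 𝕍} {s T η : ℝ} {w : ℝ → 𝔼 → 𝕍}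
    (hw : CoefSol Ψ f s T η w) {t : ℝ} (ht : t ∈ Ioc s T) (y : 𝔼) : ∃ res : 𝕍, ‖res‖ ≤ η ∧
      HasDerivWithinAt (fun τ => w τ y) (diffusionCoef 𝕍 (Ψ t y).1 (fderiv ℝ (fderiv ℝ (w t)) y) +
        driftCoef (fun i => (Ψ t y).2.1 i) (fderiv ℝ (w t) y) + matOp (Ψ t y).2.2 (w t y) + res)
        (Iic t) t := by
  obtain ⟨g, -, h1, -, h2⟩ := ApproxSol.deriv hw t ht
  refine ⟨_, (h2.2 y).1, (h1 y).congr_deriv ?_⟩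
  simp only [secondOrder]
  abel

set_option maxHeartbeats 1000000 in
/-- Approximate solutions for nearby coefficients are close to bounded solutions. -/
theorem BddSol.exists_close {Φ : ℝ → 𝔼 → CoefSpace d m} {bh : ℝ → 𝔼 → 𝔼} {μ ν H K Hb : ℝ}
    (h : CoefData Φ bh μ ν H K) (hdrift : DriftData Φ bh Hb) (hlip : LipLead Φ) (hd : 1 ≤ d)
    (hν : 0 < ν) (hμ : μ ≤ 1) {Kg : ℝ} (hKg : 0 ≤ Kg) {f : 𝔼 → 𝕍} {s T : ℝ} (hsT : s < T)
    {φ : 𝔼 → ℝ} {lam Kφ : ℝ} (hφ : Lyap (fun t x => (Φ t x).1) bh φ lam Kφ)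
    {u : ℝ → 𝔼 → 𝕍} (hu : BddSol Φ f s T u) {A : ℝ} (hA : ∀ x, energy f x ≤ A) (ρ : ℝ) {δ₀ : ℝ}
    (hδ₀ : 0 < δ₀) : ∃ R > 0, ∃ η₀ > 0, ∀ η ∈ Ioc 0 η₀, ∀ (Ψ : ℝ → 𝔼 → CoefSpace d m)
      (w : ℝ → 𝔼 → 𝕍), SmoothCoef Ψ μ ν H Kg → (∀ t x, ‖x‖ ≤ R → ‖Ψ t x - Φ t x‖ ≤ η) →
      CoefSol Ψ f s T η w → ∀ t ∈ Icc s T, ∀ x, ‖x‖ ≤ ρ → ‖u t x - w t x‖ ^ 2 ≤ δ₀ := by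
  obtain ⟨Mu, hMu⟩ := hu.bdd
  set M0 := Real.exp ((2 * Kg + 1) * (T - s)) * (A + (1 + d) * (T - s)) with hM0
  have hA0 : 0 ≤ A := (energy_nonneg f 0).trans (hA 0)
  have hTs : 0 < T - s := sub_pos.2 hsT
  have hM00 : 0 ≤ M0 := by positivity
  set Λ := |2 * Hb + 2| with hΛ
  have hΛ0 : 0 ≤ Λ := abs_nonneg _
  have hE : ∀ t ∈ Icc s T, Real.exp (-Λ * (t - s)) ≤ 1 := fun t ht =>
    Real.exp_le_one_iff.2 (by nlinarith [ht.1])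
  set N := max Mu 0 + (1 + M0) with hN
  have hN0 : 0 ≤ N := by positivity
  obtain ⟨R, hR, hρR, hmain⟩ := doubling_comparison hsT hφ.contDiff hφ.pos hφ.blowup hφ.lam_pos
    hφ.K_nonneg (fun t _ x => hφ.ineq t x) (N ^ 2) ρ
    (show 0 < δ₀ * Real.exp (-Λ * (T - s)) by positivity)
  refine ⟨R, hR, ?_⟩
  obtain ⟨AΦ, hAΦ⟩ := h.bdd R
  obtain ⟨σ, L, hL, hσ, hσL⟩ := exists_sqrtField hd hν (AΦ + 1)
  obtain ⟨Lq, hLq, hLq'⟩ := hlip R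
  obtain ⟨X, hX⟩ := hdrift R
  obtain ⟨c0, hc0, hc0'⟩ := exists_norm_lower_order_le (d := d) (m := m)
  set Lc := L * (Lq + 1) with hLc
  let 𝓗 : ℝ → Set (ℝ → 𝔼 → 𝔼 → ℝ) := fun η => {G | 0 < η ∧ η ≤ 1 ∧ ∃ (Ψ : ℝ → 𝔼 → CoefSpace d m)
      (w : ℝ → 𝔼 → 𝕍), SmoothCoef Ψ μ ν H Kg ∧ (∀ t x, ‖x‖ ≤ R → ‖Ψ t x - Φ t x‖ ≤ η) ∧
      CoefSol Ψ f s T η w ∧ G = fun t x y => Real.exp (-Λ * (t - s)) * ‖u t x - w t y‖ ^ 2}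
  have hwE : ∀ {η Ψ w}, 0 < η → η ≤ 1 → SmoothCoef Ψ μ ν H Kg → CoefSol Ψ f s T η w →
      ∀ t ∈ Icc s T, ∀ y : 𝔼, energy (w t) y ≤ M0 := by
    intro η Ψ w h1 h2 h3 h4 t ht y
    exact h3.energy_le hd hν hμ hKg h4 h1 h2 hA ht y
  have hwN : ∀ {η Ψ w}, 0 < η → η ≤ 1 → SmoothCoef Ψ μ ν H Kg → CoefSol Ψ f s T η w →
      ∀ t ∈ Icc s T, ∀ y : 𝔼, ‖w t y‖ ≤ 1 + M0 := by
    intro η Ψ w h1 h2 h3 h4 t ht y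
    exact le_one_add_of_sq_le ((norm_sq_le_energy (w t) y).trans (hwE h1 h2 h3 h4 t ht y))
  have hdiff : ∀ {η Ψ w}, 0 < η → η ≤ 1 → SmoothCoef Ψ μ ν H Kg → CoefSol Ψ f s T η w →
      ∀ t ∈ Icc s T, ∀ x y : 𝔼, ‖u t x - w t y‖ ≤ N := by
    intro η Ψ w h1 h2 h3 h4 t ht x y
    exact (norm_sub_le _ _).trans (add_le_add ((hMu t ht x).trans (le_max_left _ _))
      (hwN h1 h2 h3 h4 t ht y))
  refine Exists.elim (hmain 𝓗 Lc ?_ ?_ ?_ ?_ ?_) ?_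
  · rintro η G ⟨-, -, Ψ, w, -, -, hw, rfl⟩
    have c1 : ContinuousOn (fun p : ℝ × 𝔼 × 𝔼 => u p.1 p.2.1) (Icc s T ×ˢ univ) :=
      hu.cont.comp (f := fun p : ℝ × 𝔼 × 𝔼 => (p.1, p.2.1)) (by fun_prop)
        fun p hp => ⟨hp.1, mem_univ _⟩
    have c2 : Continuous (fun p : ℝ × 𝔼 × 𝔼 => w p.1 p.2.2) :=
      (ApproxSol.cont hw).comp (f := fun p : ℝ × 𝔼 × 𝔼 => (p.1, p.2.2)) (by fun_prop)
    exact (Continuous.continuousOn (by fun_prop)).mul ((c1.sub c2.continuousOn).norm.pow 2)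
  · rintro η G ⟨h1, h2, Ψ, w, hΨ, -, hw, rfl⟩ t ht x - y -
    have h3 := pow_le_pow_left₀ (norm_nonneg _) (hdiff h1 h2 hΨ hw t ht x y) 2
    have := hE t ht
    simp only
    nlinarith [sq_nonneg ‖u t x - w t y‖]
  · rintro η G ⟨-, -, Ψ, w, -, -, hw, rfl⟩ y -
    have e : u s y - w s y = 0 := by rw [hu.start, ApproxSol.start hw, sub_self]
    simp [e]
  · intro e he
    have huc := (isCompact_Icc.prod (isCompact_closedBall (0 : 𝔼) R)).uniformContinuousOn_of_continuous
      (hu.cont.mono (prod_mono (subset_refl (Icc s T)) (subset_univ _)))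
    rw [Metric.uniformContinuousOn_iff_le] at huc
    obtain ⟨r, hr, hr'⟩ := huc (e / (2 * N + 1)) (by positivity)
    refine ⟨r, hr, ?_⟩
    rintro η - G ⟨h1, h2, Ψ, w, hΨ, -, hw, rfl⟩ t ht x hx y hy hxy
    have a1 := hr' (t, x) ⟨ht, hx⟩ (t, y) ⟨ht, hy⟩ (by
      rw [Prod.dist_eq, dist_self, dist_eq_norm]; exact max_le hr.le hxy)
    rw [dist_eq_norm, le_div_iff₀ (by positivity)] at a1
    have a2 := hdiff h1 h2 hΨ hw t ht x y
    have a3 := hdiff h1 h2 hΨ hw t ht y y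
    have a4 : ‖u t x - w t y‖ ≤ ‖u t x - u t y‖ + ‖u t y - w t y‖ := norm_sub_le_norm_sub_add_norm_sub _ _ _
    have a5 := hE t ht
    have a6 := Real.exp_pos (-Λ * (t - s))
    have hb := norm_nonneg (u t y - w t y)
    have ha := norm_nonneg (u t x - w t y)
    have hdn := norm_nonneg (u t x - u t y)
    simp only at a1 ⊢
    exact sq_sub_sq_small a6.le a5 ha hb hdn a4 a2 a3 he.le a1
  · intro e he
    set θ := min (1 / 2) (1 / (|X| + 1)) with hθ
    have hθ0 : 0 < θ := by positivity
    have hθX : θ * |X| ≤ 1 := by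
      have : θ * (|X| + 1) ≤ 1 := by
        rw [← le_div_iff₀ (by positivity)]; exact min_le_right _ _
      nlinarith
    obtain ⟨τ, hτ0, hτ1, hτ⟩ := exists_small (P := M0 / θ) (Q := Lc * 2) (G := c0 * 2 * (1 + M0) + 1)
      (by positivity) (by positivity) he
    obtain ⟨δ, hδ, hδ'⟩ := h.unif_space R τ hτ0
    refine ⟨min τ δ, by positivity, ?_⟩
    rintro η hη G ⟨h1, h2, Ψ, w, hΨ, hcl, hw, rfl⟩ t ht x hx y hy hxy -
    have ht' : t ∈ Icc s T := Ioc_subset_Icc_self ht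
    rw [mem_closedBall_zero_iff] at hx hy
    have hητ : η ≤ τ := hη.2.trans (min_le_left _ _)
    have hxτ : ‖x - y‖ ≤ τ := hxy.trans (min_le_left _ _)
    have hω : ‖Φ t x - Ψ t y‖ ≤ 2 * τ := by
      have a1 := hδ' t x y hx hy (hxy.trans (min_le_right _ _))
      have a2 := hcl t y hy
      rw [norm_sub_rev] at a2
      have := norm_sub_le_norm_sub_add_norm_sub (Φ t x) (Φ t y) (Ψ t y)
      linarith
    obtain ⟨lm, κ, Cc, hlm, hκ, hκX, hB, hq, hC, hCc⟩ := hX t x hx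
    obtain ⟨res, hres, hwd⟩ := hw.deriv_eq ht y
    have hM1 : EllMat ν (AΦ + 1) (Φ t x).1 := ⟨h.symm t x, h.ell t x, fun i j =>
      (abs_coefQ_le i j _).trans ((hAΦ t x hx).trans (by linarith))⟩
    have hM2 : EllMat ν (AΦ + 1) (Ψ t y).1 := ⟨hΨ.symm t y, hΨ.ell t y, fun i j => by
      refine (abs_coefQ_le i j _).trans ?_
      have a1 := norm_le_norm_add_norm_sub' (Ψ t y) (Φ t y)
      have a2 := hcl t y hy
      have a3 := hAΦ t y hy
      linarith⟩
    have hσσ : ∑ a, ‖σ (Φ t x).1 a - σ (Ψ t y).1 a‖ ^ 2 ≤ (Lc * (η + ‖x - y‖)) ^ 2 := by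
      refine (hσL _ _ hM1 hM2).trans (pow_le_pow_left₀ (by positivity) ?_ 2)
      rw [hLc, mul_assoc]
      refine mul_le_mul_of_nonneg_left ?_ hL
      have a1 := hLq' t x y hx hy
      have a2 : ‖(Φ t y).1 - (Ψ t y).1‖ ≤ η := by
        have := (norm_fst_le (Ψ t y - Φ t y)).trans (hcl t y hy)
        rwa [Prod.fst_sub, norm_sub_rev] at this
      have a3 := norm_sub_le_norm_sub_add_norm_sub (Φ t x).1 (Φ t y).1 (Ψ t y).1
      have a4 := mul_nonneg hLq h1.le
      have a5 := norm_nonneg (x - y)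
      rw [mul_add, add_mul, add_mul]
      linarith
    have hwE' := hwE h1 h2 hΨ hw t ht' y
    have hwd' := (ApproxSol.smoothBdd hw).differentiable t y
    have herr : ‖driftCoef (fun i => (Φ t x).2.1 i - (Ψ t y).2.1 i) (fderiv ℝ (w t) y) +
        matOp ((Φ t x).2.2 - (Ψ t y).2.2) (w t y) - res‖ ≤ c0 * (2 * τ) * (1 + M0) + η := by
      have a1 := hc0' (Φ t x - Ψ t y) (fderiv ℝ (w t) y) (w t y) (1 + M0) (fun l => by
        have := norm_fderiv_apply_sq_le_energy hwd' (𝐞 l)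
        rw [PiLp.norm_single, norm_one, one_pow, one_mul] at this
        exact le_one_add_of_sq_le (this.trans hwE'))
        (hwN h1 h2 hΨ hw t ht' y)
      have a2 : c0 * ‖Φ t x - Ψ t y‖ * (1 + M0) ≤ c0 * (2 * τ) * (1 + M0) := by gcongr
      exact (norm_sub_le _ _).trans (add_le_add (a1.trans a2) hres)
    refine system_doublingIneq (σ := σ (Φ t x).1) (σ' := σ (Ψ t y).1) (hσ _ hM1) (hσ _ hM2) hσσ hq hB
      hlm hκ hC hθ0 (min_le_left _ _) ?_ hCc ht.1.le (hu.contDiff t ht) ?_ (hu.deriv t ht x) hwd hwE'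
      herr (le_abs_self _) hΛ0 ?_
    · exact (mul_le_mul_of_nonneg_left (hκX.trans (le_abs_self X)) hθ0.le).trans hθX
    · exact contDiff_infty.1 ((ApproxSol.smoothBdd hw).smooth t) 2
    · rw [mul_div_assoc]
      refine hτ _ _ (by positivity) (by positivity) ?_ ?_
      · have a1 : Lc * (η + ‖x - y‖) ≤ Lc * (τ + τ) :=
          mul_le_mul_of_nonneg_left (add_le_add hητ hxτ) (by positivity)
        exact a1.trans (le_of_eq (by ring))
      · rw [add_mul, one_mul]
        exact add_le_add (le_of_eq (by ring)) hητ
  · rintro η₀ ⟨hη₀, hfin⟩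
    refine ⟨min η₀ 1, by positivity, fun η hη Ψ w hΨ hcl hw t ht x hx => ?_⟩
    have h1 := hfin η ⟨hη.1, hη.2.trans (min_le_left _ _)⟩ _
      ⟨hη.1, hη.2.trans (min_le_right _ _), Ψ, w, hΨ, hcl, hw, rfl⟩ t ht x (by simpa using hx)
    have h2 : Real.exp (-Λ * (T - s)) ≤ Real.exp (-Λ * (t - s)) :=
      Real.exp_le_exp.2 (by nlinarith [ht.2])
    have h3 := mul_le_mul_of_nonneg_right h2 (sq_nonneg ‖u t x - w t x‖)
    have h4 : ‖u t x - w t x‖ ^ 2 * Real.exp (-Λ * (T - s)) ≤ δ₀ * Real.exp (-Λ * (T - s)) := by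
      linarith
    exact le_of_mul_le_mul_right h4 (Real.exp_pos _)

lemma HasJet2.add_const_rpow {g : ℝ → ℝ} {a b ε : ℝ} (P : ℝ) (hg : HasJet2 g a b) (hε : 0 < ε)
    (hg0 : ∀ τ, 0 ≤ g τ) : HasJet2 (fun τ => (g τ + ε) ^ P) (P * (g 0 + ε) ^ (P - 1) * a)
      (P * (P - 1) * (g 0 + ε) ^ (P - 2) * a ^ 2 + P * (g 0 + ε) ^ (P - 1) * b) := by
  refine HasJet2.comp (Θ := fun z => (z + ε) ^ P) (Θ' := fun z => P * (z + ε) ^ (P - 1)) hg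
    (fun τ => ?_) ?_
  · have := ((hasDerivAt_id (g τ)).add_const ε).rpow_const (p := P)
      (Or.inl (by have := hg0 τ; simp only [id]; positivity))
    exact this.congr_deriv (by simp)
  · have := (((hasDerivAt_id (g 0)).add_const ε).rpow_const (p := P - 1)
      (Or.inl (by have := hg0 0; simp only [id]; positivity))).const_mul P
    refine this.congr_deriv ?_
    simp only [id, one_mul]
    rw [show P - 1 - 1 = P - 2 by ring]
    ring

lemma rpow_second_ge {P μ F ε F1 F2 S : ℝ} (hP : 0 ≤ P) (hμ : μ ≤ 1) (hμP : μ ≤ 2 * P - 1) (hF : 0 ≤ F)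
    (hε : 0 < ε) (hS : 0 ≤ S) (h : F1 ^ 2 ≤ 4 * F * S) :
    P * (F + ε) ^ (P - 1) * (F2 - 2 * (1 - μ) * S) ≤
      P * (P - 1) * (F + ε) ^ (P - 2) * F1 ^ 2 + P * (F + ε) ^ (P - 1) * F2 := by
  have hFε : 0 < F + ε := by positivity
  have e : (F + ε) ^ (P - 1) = (F + ε) ^ (P - 2) * (F + ε) := by
    rw [show P - 1 = P - 2 + 1 by ring, Real.rpow_add_one hFε.ne']
  set X := (F + ε) ^ (P - 2) with hX
  have hX0 : 0 < X := Real.rpow_pos_of_pos hFε _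
  rw [e]
  have key : 0 ≤ (P - 1) * F1 ^ 2 + 2 * (1 - μ) * S * (F + ε) := by
    have h4 : F1 ^ 2 ≤ 4 * (F + ε) * S := h.trans (by nlinarith)
    have hFS : 0 ≤ (F + ε) * S := by positivity
    rcases le_total 1 P with h1 | h1
    · have := mul_nonneg (sub_nonneg.2 h1) (sq_nonneg F1)
      have := mul_nonneg (sub_nonneg.2 hμ) hFS
      nlinarith
    · have := mul_le_mul_of_nonneg_left h4 (sub_nonneg.2 h1)
      have := mul_nonneg (show 0 ≤ 2 * P - 1 - μ by linarith) hFS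
      nlinarith
  have := mul_nonneg (mul_nonneg hP hX0.le) key
  nlinarith

/-- Combination of the differential inequality for the energy with the power nonlinearity. -/
lemma rpow_energy_combine {P F ε Y K ℓ f1 η' Λ : ℝ} (hP : 0 ≤ P) (hF : 0 ≤ F) (hε : 0 < ε)
    (hℓ : ℓ ≤ Y + f1 + (2 * K + 1) * F + η') (hη : η' ≤ ε)
    (hΛ : P * (2 * |K| + 2) ≤ Λ) :
    P * (F + ε) ^ (P - 1) * ℓ ≤ P * (F + ε) ^ (P - 1) * Y + P * (F + ε) ^ (P - 1) * f1 +
      Λ * (F + ε) ^ P := by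
  have hFε : 0 < F + ε := by positivity
  have e : (F + ε) ^ P = (F + ε) ^ (P - 1) * (F + ε) := by
    rw [← Real.rpow_add_one hFε.ne', sub_add_cancel]
  have hX0 : 0 < (F + ε) ^ (P - 1) := Real.rpow_pos_of_pos hFε _
  rw [e]
  have h1 : (2 * K + 1) * F + η' ≤ (2 * |K| + 2) * (F + ε) := by
    nlinarith [le_abs_self K, abs_nonneg K, mul_le_mul_of_nonneg_right (le_abs_self K) hF,
      mul_nonneg (abs_nonneg K) hε.le]
  have h2 := mul_le_mul_of_nonneg_left (show ℓ ≤ Y + f1 + (2 * |K| + 2) * (F + ε) by linarith)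
    (mul_nonneg hP hX0.le)
  have h3 := mul_le_mul_of_nonneg_right hΛ (mul_nonneg hX0.le hFε.le)
  linarith

lemma energy_doublingIneq {Ψ : ℝ → 𝔼 → CoefSpace d m} {μ ν H K Kg : ℝ} {f : 𝔼 → 𝕍} {s T η : ℝ}
    {w : ℝ → 𝔼 → 𝕍} (h : SmoothCoef Ψ μ ν H Kg) (hw : CoefSol Ψ f s T η w) {t : ℝ} (ht : t ∈ Ioc s T)
    {x y bh : 𝔼} (hK : ∀ a Z Y, coefForm μ a Z Y (Ψ t y - scalarDrift bh, fderiv ℝ (Ψ t) y) ≤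
      K * (∑ k, a k ^ 2 + ∑ i, ∑ k, Z i k ^ 2)) {q : Matrix (Fin d) (Fin d) ℝ} {σ σ' : Fin d → 𝔼}
    (hσ : ∀ i j, ∑ a, σ a i * σ a j = q i j) (hσ' : ∀ i j, ∑ a, σ' a i * σ' a j = (Ψ t y).1 i j)
    {c e : ℝ} (hσσ : ∑ a, ‖σ a - σ' a‖ ^ 2 ≤ c ^ 2) (he : 0 ≤ e) {v : ℝ → 𝔼 → ℝ}
    (hv2 : ContDiff ℝ 2 (v t)) (hv : HasDerivWithinAt (fun τ => v τ x)
      (∑ i, ∑ j, q i j * fderiv ℝ (fderiv ℝ (v t)) x (𝐞 i)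
        (𝐞 j) + fderiv ℝ (v t) x bh) (Iic t) t)
    {P ε Λ cp κ : ℝ} (hP : 0 ≤ P) (hμ : μ ≤ 1) (hμP : μ ≤ 2 * P - 1) (hε : 0 < ε)
    (hη : (1 + d) * η ^ 2 ≤ ε) (hΛ : P * (2 * |K| + 2) ≤ Λ) :
    DoublingIneq q bh (fun t x y => Real.exp (-Λ * (t - s)) * (energy (w t) y + ε) ^ P - cp * v t x - κ)
      t x y c e := by
  obtain ⟨ℓ, f1, hℓ, hf1, hrest⟩ := h.energy_ineq hw ht y bh hK
  obtain ⟨F1, F2, S, hjet, hS, hFS, hineq⟩ := hrest σ' hσ'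
  have hF0 := energy_nonneg (w t) y
  have hFε : 0 < energy (w t) y + ε := by positivity
  set E := Real.exp (-Λ * (t - s)) with hEdef
  have hE0 : 0 < E := Real.exp_pos _
  set G1 := P * (energy (w t) y + ε) ^ (P - 1) with hG1
  have htime : HasDerivWithinAt (fun τ => (energy (w τ) y + ε) ^ P) (G1 * ℓ) (Iic t) t := by
    have := (hℓ.add_const ε).rpow_const (p := P) (Or.inl hFε.ne')
    exact this.congr_deriv (by rw [hG1]; ring)
  have hexp : HasDerivWithinAt (fun τ => Real.exp (-Λ * (τ - s))) (E * -Λ) (Iic t) t := by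
    have := (((hasDerivAt_id t).sub_const s).const_mul (-Λ)).exp.hasDerivWithinAt (s := Iic t)
    exact this.congr_deriv (by simp [hEdef])
  have hf1' : HasDerivAt (fun τ : ℝ => (energy (w t) (y + τ • bh) + ε) ^ P) (G1 * f1) 0 := by
    have := (hf1.add_const ε).rpow_const (p := P) (Or.inl (by simpa using hFε.ne'))
    refine this.congr_deriv ?_
    simp only [zero_smul, add_zero]
    rw [hG1]; ring
  have hjet' : ∀ a, HasJet2 (fun τ : ℝ => E * (energy (w t) (y + τ • σ' a) + ε) ^ P -
      cp * v t (x + τ • σ a) - κ) _ _ := fun a =>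
    ((((hjet a).add_const_rpow P hε fun τ => energy_nonneg _ _).const_mul E).sub
      ((hasJet2_line hv2 x (σ a)).const_mul cp)).sub (HasJet2.const κ)
  refine ⟨σ, σ', _, _, _, _, hσ, hσσ, ((hexp.fun_mul htime).fun_sub (hv.const_mul cp)).sub_const κ,
    hjet', ((hf1'.const_mul E).sub ((hasJet2_line hv2 x bh).hasDerivAt.const_mul cp)).sub_const κ, ?_⟩
  simp only [zero_smul, add_zero, sub_zero]
  rw [← hEdef, ← hG1, Finset.sum_sub_distrib, ← Finset.mul_sum, ← Finset.mul_sum]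
  have hq : ∑ a, fderiv ℝ (fderiv ℝ (v t)) x (σ a) (σ a) = ∑ i, ∑ j, q i j *
      fderiv ℝ (fderiv ℝ (v t)) x (𝐞 i) (𝐞 j) :=
    (sum_bilin_eq_diffusionCoef hσ _).trans (diffusionCoef_apply _ _)
  rw [hq]
  have h1 := rpow_energy_combine hP hF0 hε hineq hη hΛ
  rw [← hG1, Finset.mul_sum] at h1
  have h2 : ∑ a, G1 * (F2 a - 2 * (1 - μ) * S a) ≤ ∑ a, (P * (P - 1) * (energy (w t) y + ε) ^ (P - 2) *
      F1 a ^ 2 + G1 * F2 a) :=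
    Finset.sum_le_sum fun a _ => rpow_second_ge hP hμ hμP hF0 hε (hS a) (hFS a)
  have h3 := mul_le_mul_of_nonneg_left (h1.trans (add_le_add_left (add_le_add_left h2 _) _)) hE0.le
  linarith

/-- Bounded classical solutions of the scalar problem. -/
structure ScalarSol (q : ℝ → EuclideanSpace ℝ (Fin d) → Matrix (Fin d) (Fin d) ℝ)
    (bh : ℝ → EuclideanSpace ℝ (Fin d) → EuclideanSpace ℝ (Fin d)) (g : EuclideanSpace ℝ (Fin d) → ℝ)
    (s T : ℝ) (v : ℝ → EuclideanSpace ℝ (Fin d) → ℝ) : Prop where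
  cont : ContinuousOn (fun p : ℝ × EuclideanSpace ℝ (Fin d) => v p.1 p.2) (Icc s T ×ˢ univ)
  bdd : ∃ M, ∀ t ∈ Icc s T, ∀ x, |v t x| ≤ M
  start : ∀ x, v s x = g x
  contDiff : ∀ t ∈ Ioc s T, ContDiff ℝ 2 (v t)
  deriv : ∀ t ∈ Ioc s T, ∀ x, HasDerivWithinAt (fun τ => v τ x)
      (∑ i, ∑ j, q t x i j * fderiv ℝ (fderiv ℝ (v t)) x (𝐞 i)
        (𝐞 j) + fderiv ℝ (v t) x (bh t x)) (Iic t) t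

set_option maxHeartbeats 1000000 in
/-- Comparison of powers of the energy of approximate solutions with scalar solutions. -/
theorem ScalarSol.energy_rpow_le {Φ : ℝ → 𝔼 → CoefSpace d m} {bh : ℝ → 𝔼 → 𝔼} {μ ν H K : ℝ}
    (h : CoefData Φ bh μ ν H K) (hlip : LipLead Φ) (hd : 1 ≤ d)
    (hν : 0 < ν) (hμ : μ ≤ 1) {Kg : ℝ} (hKg : 0 ≤ Kg) {f : 𝔼 → 𝕍} {s T : ℝ} (hsT : s < T)
    {φ : 𝔼 → ℝ} {lam Kφ : ℝ} (hφ : Lyap (fun t x => (Φ t x).1) bh φ lam Kφ) {g : 𝔼 → ℝ}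
    {v : ℝ → 𝔼 → ℝ} (hv : ScalarSol (fun t x => (Φ t x).1) bh g s T v) {A : ℝ}
    (hA : ∀ x, energy f x ≤ A) {P ε Λ cp κ : ℝ} (hP : 0 ≤ P) (hμP : μ ≤ 2 * P - 1) (hε : 0 < ε)
    (hΛ : P * (2 * |K| + 2) ≤ Λ) (hcp : 0 ≤ cp) (hκ : 0 ≤ κ)
    (hstart : ∀ x, (energy f x + ε) ^ P ≤ cp * g x + κ) (ρ : ℝ) {δ₀ : ℝ} (hδ₀ : 0 < δ₀) :
    ∃ R > 0, ∀ r > 0, ∃ η₀ > 0, ∀ η ∈ Ioc 0 η₀, ∀ (Ψ : ℝ → 𝔼 → CoefSpace d m)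
      (w : ℝ → 𝔼 → 𝕍), SmoothCoef Ψ μ ν H Kg → (∀ t x, ‖x‖ ≤ R → ‖Ψ t x - Φ t x‖ ≤ η) →
      (∀ t x y, ‖x‖ ≤ R → ‖y‖ ≤ R → ‖x - y‖ ≤ r → ∀ a Z Y,
        coefForm μ a Z Y (Ψ t y - scalarDrift (bh t x), fderiv ℝ (Ψ t) y) ≤
          K * (∑ k, a k ^ 2 + ∑ i, ∑ k, Z i k ^ 2)) →
      CoefSol Ψ f s T η w → ∀ t ∈ Icc s T, ∀ x, ‖x‖ ≤ ρ →
        Real.exp (-Λ * (t - s)) * (energy (w t) x + ε) ^ P ≤ cp * v t x + κ + δ₀ := by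
  obtain ⟨Mv, hMv⟩ := hv.bdd
  set M0 := Real.exp ((2 * Kg + 1) * (T - s)) * (A + (1 + d) * (T - s)) with hM0
  have hA0 : 0 ≤ A := (energy_nonneg f 0).trans (hA 0)
  have hTs : 0 < T - s := sub_pos.2 hsT
  have hM00 : 0 ≤ M0 := by positivity
  have hΛ0 : 0 ≤ Λ := le_trans (by positivity) hΛ
  have hE : ∀ t ∈ Icc s T, Real.exp (-Λ * (t - s)) ≤ 1 := fun t ht =>
    Real.exp_le_one_iff.2 (by nlinarith [ht.1])
  obtain ⟨R, hR, hρR, hmain⟩ := doubling_comparison hsT hφ.contDiff hφ.pos hφ.blowup hφ.lam_pos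
    hφ.K_nonneg (fun t _ x => hφ.ineq t x) ((M0 + ε) ^ P + cp * Mv) ρ hδ₀
  refine ⟨R, hR, fun r₀ hr₀ => ?_⟩
  obtain ⟨AΦ, hAΦ⟩ := h.bdd R
  obtain ⟨σ, L, hL, hσ, hσL⟩ := exists_sqrtField hd hν (AΦ + 1)
  obtain ⟨Lq, hLq, hLq'⟩ := hlip R
  set Lc := L * (Lq + 1) with hLc
  let 𝓗 : ℝ → Set (ℝ → 𝔼 → 𝔼 → ℝ) := fun η => {G | 0 < η ∧ η ≤ 1 ∧ (1 + d) * η ^ 2 ≤ ε ∧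
      ∃ (Ψ : ℝ → 𝔼 → CoefSpace d m) (w : ℝ → 𝔼 → 𝕍), SmoothCoef Ψ μ ν H Kg ∧
      (∀ t x, ‖x‖ ≤ R → ‖Ψ t x - Φ t x‖ ≤ η) ∧ (∀ t x y, ‖x‖ ≤ R → ‖y‖ ≤ R → ‖x - y‖ ≤ r₀ → ∀ a Z Y,
        coefForm μ a Z Y (Ψ t y - scalarDrift (bh t x), fderiv ℝ (Ψ t) y) ≤
          K * (∑ k, a k ^ 2 + ∑ i, ∑ k, Z i k ^ 2)) ∧
      CoefSol Ψ f s T η w ∧ G = fun t x y =>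
        Real.exp (-Λ * (t - s)) * (energy (w t) y + ε) ^ P - cp * v t x - κ}
  refine Exists.elim (hmain 𝓗 Lc ?_ ?_ ?_ ?_ ?_) ?_
  · rintro η G ⟨-, -, -, Ψ, w, -, -, -, hw, rfl⟩
    have c1 : ContinuousOn (fun p : ℝ × 𝔼 × 𝔼 => v p.1 p.2.1) (Icc s T ×ˢ univ) :=
      hv.cont.comp (f := fun p : ℝ × 𝔼 × 𝔼 => (p.1, p.2.1)) (by fun_prop)
        fun p hp => ⟨hp.1, mem_univ _⟩
    have c0 := continuous_energy (ApproxSol.cont hw) (ApproxSol.cont_fderiv hw)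
      (fun t => (ApproxSol.smoothBdd hw).differentiable t)
    have c2 : Continuous (fun p : ℝ × 𝔼 × 𝔼 => energy (w p.1) p.2.2) :=
      c0.comp (f := fun p : ℝ × 𝔼 × 𝔼 => (p.1, p.2.2)) (by fun_prop)
    have c3 : Continuous (fun p : ℝ × 𝔼 × 𝔼 => (energy (w p.1) p.2.2 + ε) ^ P) :=
      (c2.add continuous_const).rpow_const fun p => Or.inl
        (add_pos_of_nonneg_of_pos (energy_nonneg _ _) hε).ne'
    exact ((Continuous.continuousOn (by fun_prop)).sub (c1.const_smul cp)).sub continuousOn_const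
  · rintro η G ⟨h1, h2, -, Ψ, w, hΨ, -, -, hw, rfl⟩ t ht x - y -
    have a1 : (energy (w t) y + ε) ^ P ≤ (M0 + ε) ^ P := by
      have := hΨ.energy_le hd hν hμ hKg hw h1 h2 hA ht y
      have := energy_nonneg (w t) y
      gcongr
    have a2 := hE t ht
    have a3 : 0 ≤ (energy (w t) y + ε) ^ P := by
      have := energy_nonneg (w t) y
      positivity
    have a4 := mul_le_mul_of_nonneg_left (neg_le_of_abs_le (hMv t ht x)) hcp
    have a5 := mul_le_mul_of_nonneg_right a2 a3
    simp only
    linarith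
  · rintro η G ⟨-, -, -, Ψ, w, -, -, -, hw, rfl⟩ y -
    simp only [sub_self, mul_zero, Real.exp_zero, one_mul]
    rw [ApproxSol.start hw, hv.start]
    linarith [hstart y]
  · intro e he
    have huc := (isCompact_Icc.prod (isCompact_closedBall (0 : 𝔼) R)).uniformContinuousOn_of_continuous
      (hv.cont.mono (prod_mono (subset_refl (Icc s T)) (subset_univ _)))
    rw [Metric.uniformContinuousOn_iff_le] at huc
    obtain ⟨r, hr, hr'⟩ := huc (e / (cp + 1)) (by positivity)
    refine ⟨r, hr, ?_⟩
    rintro η - G ⟨-, -, -, Ψ, w, -, -, -, -, rfl⟩ t ht x hx y hy hxy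
    have a1 := hr' (t, x) ⟨ht, hx⟩ (t, y) ⟨ht, hy⟩ (by
      rw [Prod.dist_eq, dist_self, dist_eq_norm]; exact max_le hr.le hxy)
    rw [Real.dist_eq, le_div_iff₀ (by positivity)] at a1
    simp only at a1 ⊢
    have a2 := mul_le_mul_of_nonneg_left (neg_le_abs (v t x - v t y)) hcp
    have a3 := abs_nonneg (v t x - v t y)
    linarith
  · intro e he
    refine ⟨r₀, hr₀, ?_⟩
    rintro η hη G ⟨h1, h2, h3, Ψ, w, hΨ, hcl, hform, hw, rfl⟩ t ht x hx y hy hxy -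
    rw [mem_closedBall_zero_iff] at hx hy
    have hM1 : EllMat ν (AΦ + 1) (Φ t x).1 := ⟨h.symm t x, h.ell t x, fun i j =>
      (abs_coefQ_le i j _).trans ((hAΦ t x hx).trans (by linarith))⟩
    have hM2 : EllMat ν (AΦ + 1) (Ψ t y).1 := ⟨hΨ.symm t y, hΨ.ell t y, fun i j => by
      refine (abs_coefQ_le i j _).trans ?_
      have a1 := norm_le_norm_add_norm_sub' (Ψ t y) (Φ t y)
      have a2 := hcl t y hy
      have a3 := hAΦ t y hy
      linarith⟩
    have hσσ : ∑ a, ‖σ (Φ t x).1 a - σ (Ψ t y).1 a‖ ^ 2 ≤ (Lc * (η + ‖x - y‖)) ^ 2 := by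
      refine (hσL _ _ hM1 hM2).trans (pow_le_pow_left₀ (by positivity) ?_ 2)
      rw [hLc, mul_assoc]
      refine mul_le_mul_of_nonneg_left ?_ hL
      have a1 := hLq' t x y hx hy
      have a2 : ‖(Φ t y).1 - (Ψ t y).1‖ ≤ η := by
        have := (norm_fst_le (Ψ t y - Φ t y)).trans (hcl t y hy)
        rwa [Prod.fst_sub, norm_sub_rev] at this
      have a3 := norm_sub_le_norm_sub_add_norm_sub (Φ t x).1 (Φ t y).1 (Ψ t y).1
      have a4 := mul_nonneg hLq h1.le
      have a5 := norm_nonneg (x - y)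
      rw [mul_add, add_mul, add_mul]
      linarith
    exact energy_doublingIneq hΨ hw ht (hform t x y hx hy hxy) (hσ _ hM1) (hσ _ hM2) hσσ he.le
      (hv.contDiff t ht) (hv.deriv t ht x) hP hμ hμP hε h3 hΛ
  · rintro η₀ ⟨hη₀, hfin⟩
    set η₁ := min η₀ (min 1 (ε / (1 + d))) with hη₁
    refine ⟨η₁, by positivity, fun η hη Ψ w hΨ hcl hform hw t ht x hx => ?_⟩
    have hη1 : η ≤ 1 := hη.2.trans ((min_le_right _ _).trans (min_le_left _ _))
    have hη2 : (1 + d) * η ^ 2 ≤ ε := by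
      have a1 : η ≤ ε / (1 + d) := hη.2.trans ((min_le_right _ _).trans (min_le_right _ _))
      rw [le_div_iff₀ (by positivity)] at a1
      have a2 : η ^ 2 ≤ η := by nlinarith [hη.1]
      have a3 := mul_le_mul_of_nonneg_left a2 (show (0 : ℝ) ≤ 1 + d by positivity)
      linarith
    have h1 := hfin η ⟨hη.1, hη.2.trans (min_le_left _ _)⟩ _
      ⟨hη.1, hη1, hη2, Ψ, w, hΨ, hcl, hform, hw, rfl⟩ t ht x (by simpa using hx)
    linarith

lemma integral_mul_pd_eq_neg {φ D : 𝔼 → ℝ} (hφ : ContDiff ℝ 1 φ) (hφc : HasCompactSupport φ)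
    (hD : ContDiff ℝ 1 D) (i : Fin d) : Integrable (fun x => φ x * pd D x i) ∧
      Integrable (fun x => pd φ x i * D x) ∧
      ∫ x, φ x * pd D x i = - ∫ x, pd φ x i * D x := by
  have c1 : Continuous (fun x => pd D x i) :=
    (hD.continuous_fderiv (by norm_num)).clm_apply continuous_const
  have c2 : Continuous (fun x => pd φ x i) :=
    (hφ.continuous_fderiv (by norm_num)).clm_apply continuous_const
  have s2 : HasCompactSupport (fun x => pd φ x i) := by
    refine (hφc.fderiv ℝ).mono fun x hx => ?_
    rw [Function.mem_support] at hx ⊢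
    intro h0
    exact hx (by rw [pd, h0]; rfl)
  have i1 : Integrable (fun x => φ x * pd D x i) :=
    (hφ.continuous.mul c1).integrable_of_hasCompactSupport hφc.mul_right
  have i2 : Integrable (fun x => pd φ x i * D x) :=
    (c2.mul hD.continuous).integrable_of_hasCompactSupport s2.mul_right
  refine ⟨i1, i2, integral_mul_fderiv_eq_neg_fderiv_mul_of_integrable i2 i1 ?_
    (fun x _ => hφ.differentiable (by norm_num) x) (fun x _ => hD.differentiable (by norm_num) x)⟩
  exact (hφ.continuous.mul hD.continuous).integrable_of_hasCompactSupport hφc.mul_right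

/-- Upper bounds for the divergence pass to locally uniform limits. -/
lemma divergence_le_of_approx {X : Fin d → 𝔼 → ℝ} (hX : ∀ i, ContDiff ℝ 1 (X i)) {x₀ : 𝔼} {r c : ℝ}
    (hr : 0 < r) (happ : ∀ δ > 0, ∃ Y : Fin d → 𝔼 → ℝ, (∀ i, ContDiff ℝ 1 (Y i)) ∧
      ∀ x ∈ Metric.closedBall x₀ r, (∀ i, |X i x - Y i x| ≤ δ) ∧ ∑ i, pd (Y i) x i ≤ c) :
    ∑ i, pd (X i) x₀ i ≤ c := by
  by_contra! hlt
  have hcont : Continuous (fun x => ∑ i, pd (X i) x i) := continuous_finsetSum _ fun i _ =>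
    ((hX i).continuous_fderiv (by norm_num)).clm_apply continuous_const
  set θ := (∑ i, pd (X i) x₀ i - c) / 2 with hθ
  have hθ0 : 0 < θ := by linarith
  obtain ⟨r₁, hr₁, hr₁'⟩ := Metric.continuousAt_iff.1 hcont.continuousAt θ hθ0
  set r' := min r (r₁ / 2) with hr'
  have hr'0 : 0 < r' := by positivity
  let φ : ContDiffBump x₀ := ⟨r' / 2, r', by positivity, by linarith⟩
  have hφ1 : ContDiff ℝ 1 φ := φ.contDiff
  have hφs : ∀ x, φ x ≠ 0 → x ∈ Metric.ball x₀ r' := fun x hx => by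
    rw [← φ.support_eq]; exact hx
  have hts : tsupport φ = Metric.closedBall x₀ r' := φ.tsupport_eq
  have hpds : ∀ i x, x ∉ Metric.closedBall x₀ r → pd φ x i = 0 := by
    intro i x hx
    have : fderiv ℝ φ x = 0 := by
      refine fderiv_of_notMem_tsupport ℝ fun h => hx ?_
      rw [hts] at h
      exact Metric.closedBall_subset_closedBall (min_le_left _ _) h
    rw [pd, this]; rfl
  have hφi : Integrable φ := φ.integrable
  have hφpos : 0 < ∫ x, φ x := φ.integral_pos
  have hpdi : ∀ i, Integrable (fun x => |pd φ x i|) := fun i => by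
    refine Integrable.abs ?_
    refine Continuous.integrable_of_hasCompactSupport
      ((hφ1.continuous_fderiv (by norm_num)).clm_apply continuous_const) ?_
    refine (φ.hasCompactSupport.fderiv ℝ).mono fun x hx => ?_
    rw [Function.mem_support] at hx ⊢
    intro h0
    exact hx (by rw [pd, h0]; rfl)
  set S := ∑ i, ∫ x, |pd φ x i| with hS
  have hS0 : 0 ≤ S := Finset.sum_nonneg fun i _ => integral_nonneg fun x => abs_nonneg _
  obtain ⟨Y, hY, hYX⟩ := happ (θ * (∫ x, φ x) / (2 * (S + 1))) (by positivity)
  set δ := θ * (∫ x, φ x) / (2 * (S + 1)) with hδ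
  have hδ0 : 0 < δ := by positivity
  have hD : ∀ i, ContDiff ℝ 1 (fun x => X i x - Y i x) := fun i => (hX i).sub (hY i)
  have hpdD : ∀ i x, pd (fun x => X i x - Y i x) x i = pd (X i) x i - pd (Y i) x i := by
    intro i x
    rw [pd, fderiv_fun_sub ((hX i).differentiable (by norm_num) x) ((hY i).differentiable (by norm_num) x)]
    rfl
  have hibp := fun i => integral_mul_pd_eq_neg hφ1 φ.hasCompactSupport (hD i) i
  have h1 : θ * ∫ x, φ x ≤ ∫ x, ∑ i, φ x * pd (fun x => X i x - Y i x) x i := by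
    rw [← integral_const_mul]
    refine integral_mono (hφi.const_mul θ) (integrable_finsetSum _ fun i _ => (hibp i).1) fun x => ?_
    simp only
    by_cases hx : φ x = 0
    · simp [hx]
    have hx' := hφs x hx
    have a1 := hr₁' (lt_of_lt_of_le hx' ((min_le_right _ _).trans (by linarith)))
    rw [Real.dist_eq, abs_lt] at a1
    have a2 := (hYX x (Metric.ball_subset_closedBall (Metric.ball_subset_ball (min_le_left _ _) hx'))).2
    rw [← Finset.mul_sum, mul_comm]
    refine mul_le_mul_of_nonneg_left ?_ φ.nonneg
    simp_rw [hpdD]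
    rw [Finset.sum_sub_distrib]
    linarith [a1.1]
  have h2 : ∫ x, ∑ i, φ x * pd (fun x => X i x - Y i x) x i ≤ δ * S := by
    rw [integral_finsetSum _ fun i _ => (hibp i).1, hS, Finset.mul_sum]
    refine Finset.sum_le_sum fun i _ => ?_
    rw [(hibp i).2.2, ← integral_neg, ← integral_const_mul]
    refine integral_mono (hibp i).2.1.neg ((hpdi i).const_mul δ) fun x => ?_
    simp only
    by_cases hx : x ∈ Metric.closedBall x₀ r
    · refine (neg_le_abs _).trans ?_
      rw [abs_mul, mul_comm]
      exact mul_le_mul_of_nonneg_right ((hYX x hx).1 i) (abs_nonneg _)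
    · simp [hpds i x hx]
  have h3 : δ * (2 * (S + 1)) = θ * ∫ x, φ x := by rw [hδ]; field_simp
  nlinarith

lemma pd_sum_mul {X : Fin m → 𝔼 → ℝ} {x : 𝔼} (hX : ∀ k, DifferentiableAt ℝ (X k) x) (z : Fin m → ℝ)
    (i : Fin d) : pd (fun y => ∑ k, z k * X k y) x i = ∑ k, z k * pd (X k) x i := by
  rw [pd, fderiv_fun_sum fun k _ => (hX k).const_mul (z k)]
  simp only [sum_apply]
  refine Finset.sum_congr rfl fun k _ => ?_
  rw [fderiv_const_mul (hX k)]
  rfl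

lemma sum_mul_le_of_sum_sq_le {z w : Fin d → Fin m → ℝ} {c : ℝ} (hc : 0 ≤ c)
    (hw : ∑ i, ∑ k, w i k ^ 2 ≤ c ^ 2) :
    ∑ i, ∑ k, z i k * w i k ≤ Real.sqrt (∑ i, ∑ k, z i k ^ 2) * c := by
  simp_rw [← Fintype.sum_prod_type'] at hw ⊢
  refine (Real.sum_mul_le_sqrt_mul_sqrt _ _ _).trans
    (mul_le_mul_of_nonneg_left ?_ (Real.sqrt_nonneg _))
  exact (Real.sqrt_le_sqrt hw).trans_eq (Real.sqrt_sq hc)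

/-- Bounds for the Frobenius norm of the Jacobian pass to locally uniform limits. -/
lemma sum_pd_sq_le_of_approx {u : 𝔼 → 𝕍} (hu : ContDiff ℝ 1 u) {x₀ : 𝔼} {r c : ℝ} (hr : 0 < r)
    (hc : 0 ≤ c) (happ : ∀ δ > 0, ∃ w : 𝔼 → 𝕍, ContDiff ℝ 1 w ∧ ∀ x ∈ Metric.closedBall x₀ r,
      ‖u x - w x‖ ≤ δ ∧ ∑ i, ∑ k, pd (fun z => w z k) x i ^ 2 ≤ c ^ 2) :
    ∑ i, ∑ k, pd (fun z => u z k) x₀ i ^ 2 ≤ c ^ 2 := by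
  set Z : Fin d → Fin m → ℝ := fun i k => pd (fun z => u z k) x₀ i with hZ
  set N := Real.sqrt (∑ i, ∑ k, Z i k ^ 2) with hN
  have hN2 : N ^ 2 = ∑ i, ∑ k, Z i k ^ 2 := Real.sq_sqrt (by positivity)
  have hN0 : 0 ≤ N := Real.sqrt_nonneg _
  have hdiff : ∀ {w : 𝔼 → 𝕍}, ContDiff ℝ 1 w → ∀ x k, DifferentiableAt ℝ (fun z => w z k) x :=
    fun hw x k => (contDiff_coord hw k).differentiable (by norm_num) x
  have hsm : ∀ {w : 𝔼 → 𝕍}, ContDiff ℝ 1 w → ∀ i, ContDiff ℝ 1 (fun x => ∑ k, Z i k * w x k) :=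
    fun hw i => ContDiff.sum fun k _ => contDiff_const.mul (contDiff_coord hw k)
  set B := ∑ i, ∑ k, |Z i k| with hB
  have hB0 : 0 ≤ B := by positivity
  have key : ∑ i, pd (fun x => ∑ k, Z i k * u x k) x₀ i ≤ N * c := by
    refine divergence_le_of_approx (X := fun i x => ∑ k, Z i k * u x k) (hsm hu) hr fun δ hδ => ?_
    obtain ⟨w, hw, hw'⟩ := happ (δ / (B + 1)) (by positivity)
    refine ⟨fun i x => ∑ k, Z i k * w x k, hsm hw, fun x hx => ⟨fun i => ?_, ?_⟩⟩
    · rw [← Finset.sum_sub_distrib]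
      have h1 := (hw' x hx).1
      rw [le_div_iff₀ (by positivity)] at h1
      have h2 : ∀ k, |u x k - w x k| ≤ ‖u x - w x‖ := fun k => PiLp.norm_apply_le (u x - w x) k
      have h3 : ∑ k, |Z i k| ≤ B := Finset.single_le_sum
        (f := fun i => ∑ k, |Z i k|) (fun j _ => by positivity) (Finset.mem_univ i)
      calc |∑ k, (Z i k * u x k - Z i k * w x k)| ≤ ∑ k, |Z i k| * ‖u x - w x‖ := by
            refine (Finset.abs_sum_le_sum_abs _ _).trans (Finset.sum_le_sum fun k _ => ?_)
            rw [← mul_sub, abs_mul]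
            exact mul_le_mul_of_nonneg_left (h2 k) (abs_nonneg _)
        _ = (∑ k, |Z i k|) * ‖u x - w x‖ := by rw [Finset.sum_mul]
        _ ≤ δ := by nlinarith [norm_nonneg (u x - w x), mul_le_mul_of_nonneg_right h3 (norm_nonneg (u x - w x))]
    · simp_rw [pd_sum_mul (X := fun k z => w z k) (hdiff hw x) _ _]
      exact sum_mul_le_of_sum_sq_le hc (hw' x hx).2
  simp_rw [pd_sum_mul (X := fun k z => u z k) (hdiff hu x₀) _ _] at key
  have e : ∑ i, ∑ k, Z i k * pd (fun z => u z k) x₀ i = N ^ 2 := by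
    rw [hN2]
    exact Finset.sum_congr rfl fun i _ => Finset.sum_congr rfl fun k _ => by rw [hZ]; ring
  rw [e] at key
  rw [← hN2]
  rcases hN0.eq_or_lt with h | h
  · rw [← h]; exact pow_le_pow_left₀ le_rfl hc 2
  · have : N ≤ c := by nlinarith
    exact pow_le_pow_left₀ hN0 this 2

lemma add_rpow_le_two_rpow_mul {a b P : ℝ} (ha : 0 ≤ a) (hb : 0 ≤ b) (hP : 0 ≤ P) :
    (a + b) ^ P ≤ (2 : ℝ) ^ (max (P - 1) 0) * (a ^ P + b ^ P) := by
  rcases le_total 1 P with h | h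
  · rw [max_eq_left (by linarith)]
    lift a to NNReal using ha
    lift b to NNReal using hb
    exact_mod_cast NNReal.rpow_add_le_mul_rpow_add_rpow a b h
  · rw [max_eq_right (by linarith), Real.rpow_zero, one_mul]
    exact Real.rpow_add_le_add_rpow ha hb hP h

lemma exists_add_rpow_le (A : ℝ) {P κ : ℝ} (hP : 0 ≤ P) (hκ : 0 < κ) :
    ∃ ε > 0, ∀ z, 0 ≤ z → z ≤ A → (z + ε) ^ P ≤ z ^ P + κ := by
  have huc := (isCompact_Icc (a := (0 : ℝ)) (b := A + 1)).uniformContinuousOn_of_continuous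
    (f := fun z : ℝ => z ^ P) (Real.continuous_rpow_const hP).continuousOn
  rw [Metric.uniformContinuousOn_iff_le] at huc
  obtain ⟨δ, hδ, h⟩ := huc κ hκ
  refine ⟨min δ 1, by positivity, fun z h0 hA => ?_⟩
  have h1 : 0 < min δ 1 := by positivity
  have := h (z + min δ 1) ⟨by linarith, by linarith [min_le_right δ 1]⟩ z ⟨h0, by linarith⟩ (by
    rw [Real.dist_eq, add_sub_cancel_left, abs_of_pos h1]; exact min_le_left _ _)
  rw [Real.dist_eq] at this
  linarith [le_abs_self ((z + min δ 1) ^ P - z ^ P)]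

lemma exists_energy_le {f : 𝔼 → 𝕍} (hf : SmoothBdd (fun _ : Unit => f)) :
    ∃ A, ∀ x, energy f x ≤ A := by
  obtain ⟨a, -, ha⟩ := hf.bound_zero
  obtain ⟨b, -, hb⟩ := hf.fderiv.bound_zero
  exact ⟨_, fun x => energy_le_of_norm_le (A := max a b) (hf.differentiable () x)
    ((ha () x).trans (le_max_left _ _)) ((hb () x).trans (le_max_right _ _))⟩

/-- Locally uniform approximation of a bounded solution by smooth functions whose energy is
controlled by the scalar solution. -/
theorem BddSol.exists_approx {Φ : ℝ → 𝔼 → CoefSpace d m} {bh : ℝ → 𝔼 → 𝔼} {μ ν H K Hb : ℝ}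
    (h : CoefData Φ bh μ ν H K) (hdrift : DriftData Φ bh Hb) (hlip : LipLead Φ) (hd : 1 ≤ d)
    (hν : 0 < ν) (hμ0 : 0 < μ) (hμ : μ ≤ 1) {f : 𝔼 → 𝕍} (hf : SmoothBdd (fun _ : Unit => f)) {s T : ℝ}
    (hsT : s < T) {φ : 𝔼 → ℝ} {lam Kφ : ℝ} (hφ : Lyap (fun t x => (Φ t x).1) bh φ lam Kφ)
    {u : ℝ → 𝔼 → 𝕍} (hu : BddSol Φ f s T u) {g : 𝔼 → ℝ} {v : ℝ → 𝔼 → ℝ}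
    (hv : ScalarSol (fun t x => (Φ t x).1) bh g s T v) {P Λ cp : ℝ} (hP : 0 ≤ P)
    (hμP : μ ≤ 2 * P - 1) (hΛ : P * (2 * |K| + 2) ≤ Λ) (hcp : 0 ≤ cp)
    (hg : ∀ x, energy f x ^ P ≤ cp * g x) {t : ℝ} (ht : t ∈ Ioc s T) (ρ : ℝ) {δ : ℝ} (hδ : 0 < δ) :
    ∃ w : 𝔼 → 𝕍, ContDiff ℝ 1 w ∧ ∀ x, ‖x‖ ≤ ρ → ‖u t x - w x‖ ≤ δ ∧
      energy w x ^ P ≤ Real.exp (Λ * (t - s)) * (cp * v t x + δ) := by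
  obtain ⟨A, hA⟩ := exists_energy_le hf
  obtain ⟨Kg, hKg, hΨ⟩ := h.exists_smoothCoef hμ0 hν
  obtain ⟨ε, hε, hε'⟩ := exists_add_rpow_le A hP (show 0 < δ / 2 by positivity)
  obtain ⟨R₁, hR₁, η₁, hη₁, h1⟩ := hu.exists_close h hdrift hlip hd hν hμ hKg hsT hφ hA ρ
    (show 0 < δ ^ 2 by positivity)
  obtain ⟨R₂, hR₂, h2⟩ := hv.energy_rpow_le h hlip hd hν hμ hKg hsT hφ hA hP hμP hε hΛ hcp
    (show 0 ≤ δ / 2 by positivity)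
    (fun x => (hε' _ (energy_nonneg f x) (hA x)).trans (add_le_add_left (hg x) _)) ρ
    (show 0 < δ / 2 by positivity)
  obtain ⟨r, hr, hr'⟩ := hΨ (max R₁ R₂) (lt_max_of_lt_left hR₁)
  obtain ⟨η₂, hη₂, h3⟩ := h2 r hr
  obtain ⟨Ψ, hsm, hcl, hform⟩ := hr' (min η₁ η₂) (lt_min hη₁ hη₂)
  obtain ⟨w, hw⟩ := hsm.exists_coefSol hd hν hf hsT (lt_min hη₁ hη₂)
  have ht' := Ioc_subset_Icc_self ht
  refine ⟨w t, contDiff_infty.1 ((ApproxSol.smoothBdd hw).smooth t) 1, fun x hx => ⟨?_, ?_⟩⟩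
  · exact (pow_le_pow_iff_left₀ (norm_nonneg _) hδ.le two_ne_zero).1
      (h1 (min η₁ η₂) ⟨lt_min hη₁ hη₂, min_le_left _ _⟩ Ψ w hsm
        (fun t x hx => hcl t x (hx.trans (le_max_left _ _))) hw t ht' x hx)
  · have k := h3 _ ⟨lt_min hη₁ hη₂, min_le_right _ _⟩ Ψ w hsm
      (fun t x hx => hcl t x (hx.trans (le_max_right _ _)))
      (fun t x y hx hy => hform t x y (hx.trans (le_max_right _ _)) (hy.trans (le_max_right _ _)))
      hw t ht' x hx
    have e : Real.exp (Λ * (t - s)) * Real.exp (-Λ * (t - s)) = 1 := by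
      rw [← Real.exp_add, ← Real.exp_zero]; congr 1; ring
    have k1 := mul_le_mul_of_nonneg_left k (Real.exp_pos (Λ * (t - s))).le
    rw [← mul_assoc, e, one_mul, add_assoc, add_halves] at k1
    refine le_trans ?_ k1
    exact Real.rpow_le_rpow (energy_nonneg _ _) (by linarith) hP

/-- The pointwise gradient estimate for abstract coefficients. -/
theorem BddSol.gradient_estimate {Φ : ℝ → 𝔼 → CoefSpace d m} {bh : ℝ → 𝔼 → 𝔼} {μ ν H K Hb : ℝ}
    (h : CoefData Φ bh μ ν H K) (hdrift : DriftData Φ bh Hb) (hlip : LipLead Φ) (hd : 1 ≤ d)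
    (hν : 0 < ν) (hμ0 : 0 < μ) (hμ : μ ≤ 1) {f : 𝔼 → 𝕍} (hf : SmoothBdd (fun _ : Unit => f)) {s T : ℝ}
    (hsT : s < T) {φ : 𝔼 → ℝ} {lam Kφ : ℝ} (hφ : Lyap (fun t x => (Φ t x).1) bh φ lam Kφ)
    {u : ℝ → 𝔼 → 𝕍} (hu : BddSol Φ f s T u) {g : 𝔼 → ℝ} {v : ℝ → 𝔼 → ℝ}
    (hv : ScalarSol (fun t x => (Φ t x).1) bh g s T v) {P Λ : ℝ} (hP : 0 < P)
    (hμP : μ ≤ 2 * P - 1) (hΛ : P * (2 * |K| + 2) ≤ Λ)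
    (hg : ∀ x, g x = (∑ k, f x k ^ 2) ^ P + (∑ i, ∑ k, pd (fun z => f z k) x i ^ 2) ^ P)
    {t : ℝ} (ht : t ∈ Ioc s T) (x₀ : 𝔼) :
    (∑ i, ∑ k, pd (fun z => u t z k) x₀ i ^ 2) ^ P ≤
      (2 : ℝ) ^ (max (P - 1) 0) * Real.exp (Λ * (t - s)) * v t x₀ := by
  set cp := (2 : ℝ) ^ (max (P - 1) 0) with hcp
  have hcp0 : 0 < cp := by positivity
  set E := Real.exp (Λ * (t - s)) with hE
  have hE0 : 0 < E := Real.exp_pos _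
  have happ := fun ρ δ hδ => hu.exists_approx h hdrift hlip hd hν hμ0 hμ hf hsT hφ hv hP.le hμP hΛ
    hcp0.le (fun x => by rw [hg]; exact add_rpow_le_two_rpow_mul (by positivity) (by positivity) hP.le)
    ht ρ (δ := δ) hδ
  refine le_of_forall_pos_le_add fun θ hθ => ?_
  have hvc : Continuous (v t) := (hv.contDiff t ht).continuous
  obtain ⟨r₁, hr₁, hr₁'⟩ := Metric.continuousAt_iff.1 hvc.continuousAt (θ / (2 * E * cp)) (by positivity)
  set V := cp * E * v t x₀ + θ with hV
  have hbd : ∀ x ∈ Metric.closedBall x₀ (r₁ / 2), ∀ δ ≤ θ / (2 * E), E * (cp * v t x + δ) ≤ V := by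
    intro x hx δ hδ
    have a1 := hr₁' (lt_of_le_of_lt hx (by linarith))
    rw [Real.dist_eq, lt_div_iff₀ (by positivity)] at a1
    rw [le_div_iff₀ (by positivity)] at hδ
    have a2 := le_abs_self (v t x - v t x₀)
    have a3 := mul_le_mul_of_nonneg_right a2 (show 0 ≤ 2 * E * cp by positivity)
    rw [hV]; linarith
  have hδ0 : 0 < θ / (2 * E) := by positivity
  have hV0 : 0 ≤ V := by
    obtain ⟨w, -, hw⟩ := happ ‖x₀‖ (θ / (2 * E)) hδ0
    refine le_trans ?_ (((hw x₀ le_rfl).2).trans (hbd x₀ (Metric.mem_closedBall_self (by positivity)) _ le_rfl))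
    exact Real.rpow_nonneg (energy_nonneg _ _) _
  set c := V ^ (1 / (2 * P)) with hc
  have hc0 : 0 ≤ c := Real.rpow_nonneg hV0 _
  have hc2 : (c ^ 2) ^ P = V := by
    rw [← Real.rpow_natCast c 2, hc, ← Real.rpow_mul hV0, ← Real.rpow_mul hV0]
    have : 1 / (2 * P) * ((2 : ℕ) : ℝ) * P = 1 := by push_cast; field_simp
    rw [this, Real.rpow_one]
  have key : ∑ i, ∑ k, pd (fun z => u t z k) x₀ i ^ 2 ≤ c ^ 2 := by
    refine sum_pd_sq_le_of_approx ((hu.contDiff t ht).of_le (by norm_num)) (half_pos hr₁) hc0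
      fun δ hδ => ?_
    obtain ⟨w, hw, hw'⟩ := happ (‖x₀‖ + r₁ / 2) (min δ (θ / (2 * E))) (lt_min hδ hδ0)
    refine ⟨w, hw, fun x hx => ?_⟩
    have hxn : ‖x‖ ≤ ‖x₀‖ + r₁ / 2 := by
      have := norm_le_norm_add_norm_sub' x x₀
      rw [mem_closedBall_iff_norm] at hx
      linarith
    obtain ⟨b1, b2⟩ := hw' x hxn
    refine ⟨b1.trans (min_le_left _ _), ?_⟩
    have b3 := b2.trans (hbd x hx _ (min_le_right _ _))
    rw [← hc2, Real.rpow_le_rpow_iff (energy_nonneg _ _) (by positivity) hP] at b3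
    refine le_trans ?_ b3
    unfold energy
    exact le_add_of_nonneg_left (by positivity)
  calc (∑ i, ∑ k, pd (fun z => u t z k) x₀ i ^ 2) ^ P ≤ (c ^ 2) ^ P :=
        Real.rpow_le_rpow (by positivity) key hP.le
    _ = _ := hc2

end GradientEstimate

section RawData

variable {d m : ℕ}

local notation "𝔼" => EuclideanSpace ℝ (Fin d)

/-- Joint continuity of a function which is constant in time outside of `[s, T]`. -/
def ClampCont {F : Type*} [NormedAddCommGroup F] (s T : ℝ)
    (g : ℝ → EuclideanSpace ℝ (Fin d) → F) : Prop :=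
  Continuous (fun p : ℝ × EuclideanSpace ℝ (Fin d) => g p.1 p.2) ∧
    ∀ t x, g (max s (min T t)) x = g t x

variable {F : Type*} [NormedAddCommGroup F] {s T : ℝ}

lemma clamp_mem (s T t : ℝ) : max s (min T t) ∈ Icc s (max s T) :=
  ⟨le_max_left _ _, max_le_max le_rfl (min_le_left _ _)⟩

lemma abs_clamp_sub_le (s T t t' : ℝ) : |max s (min T t) - max s (min T t')| ≤ |t - t'| := by
  refine (abs_max_sub_max_le_max _ _ _ _).trans ?_
  rw [sub_self, abs_zero, max_eq_right (abs_nonneg _)]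
  refine (abs_min_sub_min_le_max _ _ _ _).trans ?_
  rw [sub_self, abs_zero, max_eq_right (abs_nonneg _)]

namespace ClampCont

lemma bdd {g : ℝ → 𝔼 → F} (hg : ClampCont s T g) (r : ℝ) :
    ∃ A : ℝ, ∀ t x, ‖x‖ ≤ r → ‖g t x‖ ≤ A := by
  obtain ⟨A, hA⟩ := (isCompact_Icc.prod (isCompact_closedBall (0 : 𝔼) r)).exists_bound_of_continuousOn
    (s := Icc s (max s T) ×ˢ Metric.closedBall (0 : 𝔼) r) hg.1.continuousOn
  refine ⟨A, fun t x hx => ?_⟩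
  rw [← hg.2 t x]
  exact hA (_, x) ⟨clamp_mem _ _ _, by simpa using hx⟩

lemma unif {g : ℝ → 𝔼 → F} (hg : ClampCont s T g) (r : ℝ) {η : ℝ} (hη : 0 < η) :
    ∃ δ > 0, ∀ t t' x y, |t - t'| ≤ δ → ‖x‖ ≤ r → ‖y‖ ≤ r → ‖x - y‖ ≤ δ → ‖g t x - g t' y‖ ≤ η := by
  have h := (isCompact_Icc.prod (isCompact_closedBall (0 : 𝔼) r)).uniformContinuousOn_of_continuous
    (s := Icc s (max s T) ×ˢ Metric.closedBall (0 : 𝔼) r) hg.1.continuousOn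
  obtain ⟨δ, hδ, h⟩ := Metric.uniformContinuousOn_iff.1 h η hη
  refine ⟨δ / 2, half_pos hδ, fun t t' x y ht hx hy hxy => ?_⟩
  rw [← hg.2 t x, ← hg.2 t' y, ← dist_eq_norm]
  refine (h (_, x) ⟨clamp_mem _ _ _, by simpa using hx⟩ (_, y) ⟨clamp_mem _ _ _, by simpa using hy⟩
    ?_).le
  rw [Prod.dist_eq, max_lt_iff, Real.dist_eq, dist_eq_norm]
  exact ⟨((abs_clamp_sub_le s T t t').trans ht).trans_lt (half_lt_self hδ),
    hxy.trans_lt (half_lt_self hδ)⟩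

lemma add {g h : ℝ → 𝔼 → F} (hg : ClampCont s T g) (hh : ClampCont s T h) :
    ClampCont s T (fun t x => g t x + h t x) :=
  ⟨hg.1.add hh.1, fun t x => by simp only [hg.2, hh.2]⟩

lemma sum {ι : Type*} (S : Finset ι) {g : ι → ℝ → 𝔼 → F} (hg : ∀ i, ClampCont s T (g i)) :
    ClampCont s T (fun t x => ∑ i ∈ S, g i t x) :=
  ⟨continuous_finsetSum _ fun i _ => (hg i).1,
    fun t x => Finset.sum_congr rfl fun i _ => (hg i).2 t x⟩

lemma mul_const {g : ℝ → 𝔼 → ℝ} (hg : ClampCont s T g) (c : ℝ) :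
    ClampCont s T (fun t x => g t x * c) :=
  ⟨hg.1.mul continuous_const, fun t x => by simp only [hg.2]⟩

lemma pi {ι : Type*} [Fintype ι] {g : ι → ℝ → 𝔼 → F} (hg : ∀ i, ClampCont s T (g i)) :
    ClampCont s T (fun t x i => g i t x) :=
  ⟨continuous_pi fun i => (hg i).1, fun t x => funext fun i => (hg i).2 t x⟩

lemma prodMk {G : Type*} [NormedAddCommGroup G] {g : ℝ → 𝔼 → F} {h : ℝ → 𝔼 → G}
    (hg : ClampCont s T g) (hh : ClampCont s T h) : ClampCont s T (fun t x => (g t x, h t x)) :=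
  ⟨hg.1.prodMk hh.1, fun t x => by simp only [hg.2, hh.2]⟩

end ClampCont

lemma HolderLocPar.clampCont {α : ℝ} (hα : 0 < α) {I : Set ℝ} {f : ℝ → 𝔼 → ℝ}
    (hf : HolderLocPar d α I f) (hsT : s ≤ T) (hI : Icc s T ⊆ I) :
    ClampCont s T (fun t x => f (max s (min T t)) x) := by
  have hmem : ∀ t, max s (min T t) ∈ Icc s T := fun t => by
    simpa [max_eq_right hsT] using clamp_mem s T t
  constructor
  · rw [continuous_iff_continuousAt]
    rintro ⟨t₀, x₀⟩
    obtain ⟨c, hc⟩ := hf (Icc s T ×ˢ Metric.closedBall x₀ 1)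
      (isCompact_Icc.prod (isCompact_closedBall x₀ 1)) (fun pt hpt => hI hpt.1)
    rw [ContinuousAt, tendsto_iff_norm_sub_tendsto_zero]
    have hcont : Continuous (fun p : ℝ × 𝔼 => c * (|max s (min T p.1) - max s (min T t₀)| ^ (α / 2)
        + ‖p.2 - x₀‖ ^ α)) := by
      refine continuous_const.mul (Continuous.add ?_ ?_)
      · exact Continuous.rpow_const (by fun_prop) fun _ => Or.inr (by positivity)
      · exact Continuous.rpow_const (by fun_prop) fun _ => Or.inr hα.le
    have hlim := hcont.tendsto (t₀, x₀)
    simp only [sub_self, abs_zero, norm_zero, Real.zero_rpow hα.ne',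
      Real.zero_rpow (half_pos hα).ne', add_zero, mul_zero] at hlim
    refine squeeze_zero' (Eventually.of_forall fun _ => norm_nonneg _) ?_ hlim
    have : ∀ᶠ p : ℝ × 𝔼 in 𝓝 (t₀, x₀), p.2 ∈ Metric.closedBall x₀ 1 :=
      (continuous_snd.tendsto (t₀, x₀)).eventually (Metric.closedBall_mem_nhds x₀ one_pos)
    filter_upwards [this] with p hp
    exact hc (_, p.2) ⟨hmem _, hp⟩ (_, x₀) ⟨hmem _, Metric.mem_closedBall_self zero_le_one⟩
  · intro t x
    have h := hmem t
    simp only [min_eq_right h.2, max_eq_right h.1]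

/-- Coefficients in divergence form, constant in time outside of `[s, T]`, satisfying the structural
hypotheses of the gradient estimate. -/
structure RawData (q : ℝ → EuclideanSpace ℝ (Fin d) → Matrix (Fin d) (Fin d) ℝ)
    (b : Fin d → ℝ → EuclideanSpace ℝ (Fin d) → ℝ)
    (Bt Bm : Fin d → ℝ → EuclideanSpace ℝ (Fin d) → Matrix (Fin m) (Fin m) ℝ)
    (C : ℝ → EuclideanSpace ℝ (Fin d) → Matrix (Fin m) (Fin m) ℝ) (ξ : ℝ → ℝ)
    (lam LamC LamDb k : ℝ → EuclideanSpace ℝ (Fin d) → ℝ) (ν β γ Hb K₁ K₂ s T : ℝ) : Prop where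
  q_cont : ∀ i j, ClampCont s T (fun t x => q t x i j)
  Dq_cont : ∀ i j l, ClampCont s T (fun t x => pd (fun y => q t y i j) x l)
  B_cont : ∀ i k l, ClampCont s T (fun t x => Bm i t x k l)
  DB_cont : ∀ i k l j, ClampCont s T (fun t x => pd (fun y => Bm i t y k l) x j)
  C_cont : ∀ k l, ClampCont s T (fun t x => C t x k l)
  q_reg : ∀ t i j, ContDiff ℝ 2 (fun x => q t x i j)
  q_symm : ∀ t x, (q t x).IsSymm
  lam_eig : ∀ t x, IsMinEigen (q t x) (lam t x)
  lam_ge : ∀ t x, ν ≤ lam t x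
  B_eq : ∀ i t x, Bm i t x = b i t x • (1 : Matrix (Fin m) (Fin m) ℝ) + Bt i t x
  B_diff : ∀ i t k l, Differentiable ℝ (fun x => Bm i t x k l)
  b_diff : ∀ i t, Differentiable ℝ (b i t)
  Bt_diff : ∀ i t k l, Differentiable ℝ (fun x => Bt i t x k l)
  C_diff : ∀ t k l, Differentiable ℝ (fun x => C t x k l)
  ξ_pos : ∀ t, 0 < ξ t
  Bt_le : ∀ i t x k l, |Bt i t x k l| ≤ ξ t * lam t x
  LamC_eig : ∀ t x, IsMaxEigen (C t x) (LamC t x)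
  LamDb_eig : ∀ t x, IsMaxEigen (fun i j : Fin d => pd (b i t) x j) (LamDb t x)
  potential : ∀ t x, LamC t x + β * d * m ^ 2 * (ξ t) ^ 2 * lam t x ≤ Hb
  k_nonneg : ∀ t x, 0 ≤ k t x
  Dq_le : ∀ t x, ∀ i j : Fin d, √(∑ l : Fin d, (pd (fun y => q t y i j) x l) ^ 2) ≤ k t x * lam t x
  fin₁ : ∀ t x, √d * m * ξ t * lam t x +
    √(∑ i : Fin d, ∑ k' : Fin m, ∑ l : Fin m, (pd (fun y => C t y k' l) x i) ^ 2) +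
      2 * LamC t x ≤ K₁
  fin₂ : ∀ t x, √d * √(∑ i : Fin d, ∑ j : Fin d, ∑ l : Fin d,
          (pd (fun y => pd (fun z => q t z i j) y l) x i) ^ 2) +
        √(∑ i : Fin d, ∑ j : Fin d, ∑ k' : Fin m, ∑ l : Fin m,
          (pd (fun y => Bt i t y k' l) x j) ^ 2) +
        LamDb t x + LamC t x +
        (γ * (√d * m * ξ t + d * k t x) ^ 2 +
          1 / 2 * (√d * m * ξ t) + 1 / (4 * γ)) * lam t x +
        1 / 2 * √(∑ i : Fin d, ∑ k' : Fin m, ∑ l : Fin m,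
          (pd (fun y => C t y k' l) x i) ^ 2) ≤ K₂

/-- Divergence of the leading coefficients. -/
noncomputable def divCoef (q : ℝ → EuclideanSpace ℝ (Fin d) → Matrix (Fin d) (Fin d) ℝ) (t : ℝ)
    (x : EuclideanSpace ℝ (Fin d)) (i : Fin d) : ℝ := ∑ j, pd (fun y => q t y j i) x j

/-- The coefficients of the operator in nondivergence form. -/
noncomputable def rawCoef (q : ℝ → EuclideanSpace ℝ (Fin d) → Matrix (Fin d) (Fin d) ℝ)
    (Bm : Fin d → ℝ → EuclideanSpace ℝ (Fin d) → Matrix (Fin m) (Fin m) ℝ)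
    (C : ℝ → EuclideanSpace ℝ (Fin d) → Matrix (Fin m) (Fin m) ℝ) (t : ℝ)
    (x : EuclideanSpace ℝ (Fin d)) : CoefSpace d m :=
  (fun i j => q t x i j,
    fun i k l => Bm i t x k l + divCoef q t x i * (if k = l then 1 else 0), fun k l => C t x k l)

/-- The scalar drift of the operator in nondivergence form. -/
noncomputable def rawDrift (q : ℝ → EuclideanSpace ℝ (Fin d) → Matrix (Fin d) (Fin d) ℝ)
    (b : Fin d → ℝ → EuclideanSpace ℝ (Fin d) → ℝ) (t : ℝ) (x : EuclideanSpace ℝ (Fin d)) :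
    EuclideanSpace ℝ (Fin d) := WithLp.toLp 2 (fun i => b i t x + divCoef q t x i)

/-- Change of the minimal eigenvalue under perturbations of the matrix. -/
lemma IsMinEigen.le_add {n : ℕ} {M N : Matrix (Fin n) (Fin n) ℝ} {a b ε : ℝ} (hM : IsMinEigen M a)
    (hN : IsMinEigen N b) (hε : ∀ i j, |M i j - N i j| ≤ ε) : a ≤ b + n * ε := by
  obtain ⟨w, hw, hw'⟩ := hN.2
  have hpos : 0 < ∑ k, w k ^ 2 := by
    obtain ⟨i, hi⟩ := Function.ne_iff.1 hw
    exact Finset.sum_pos' (fun _ _ => sq_nonneg _) ⟨i, Finset.mem_univ _, by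
      have : w i ≠ 0 := hi
      positivity⟩
  have h1 := hM.1 w
  have h2 : ∑ k, ∑ l, (M k l - N k l) * w k * w l ≤ ∑ k, ∑ l, ε / 2 * (w k ^ 2 + w l ^ 2) := by
    refine Finset.sum_le_sum fun k _ => Finset.sum_le_sum fun l _ => ?_
    have h0 := hε k l
    have h3 : (M k l - N k l) * (w k * w l) ≤ ε * |w k * w l| := by
      refine (le_abs_self _).trans ?_
      rw [abs_mul]; gcongr
    have h4 : |w k * w l| ≤ (w k ^ 2 + w l ^ 2) / 2 := by
      rw [abs_le]; constructor <;> nlinarith [sq_nonneg (w k + w l), sq_nonneg (w k - w l)]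
    nlinarith [(abs_nonneg _).trans h0]
  have h3 : ∑ k, ∑ l, ε / 2 * (w k ^ 2 + w l ^ 2) = n * ε * ∑ k, w k ^ 2 := by
    simp only [← Finset.mul_sum, Finset.sum_add_distrib, Finset.sum_const, Finset.card_univ,
      Fintype.card_fin, nsmul_eq_mul]
    ring
  simp only [sub_mul, Finset.sum_sub_distrib] at h2
  rw [h3, hw'] at h2
  refine le_of_mul_le_mul_right ?_ hpos
  linarith

lemma IsMaxEigen.diag_le {n : ℕ} {M : Matrix (Fin n) (Fin n) ℝ} {a : ℝ} (hM : IsMaxEigen M a)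
    (i : Fin n) : M i i ≤ a := by
  have := hM.1 (fun j => if j = i then 1 else 0)
  simpa using this

lemma exists_common_bound {ι X : Type*} [Finite ι] {S : X → Prop} {g : ι → X → ℝ}
    (h : ∀ i, ∃ A : ℝ, ∀ x, S x → |g i x| ≤ A) : ∃ A : ℝ, 0 ≤ A ∧ ∀ i x, S x → |g i x| ≤ A := by
  have := Fintype.ofFinite ι
  choose A hA using h
  exact ⟨∑ i, |A i|, by positivity, fun i x hx => ((hA i x hx).trans (le_abs_self _)).trans
    (Finset.single_le_sum (f := fun i => |A i|) (fun _ _ => abs_nonneg _) (Finset.mem_univ i))⟩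

lemma norm_clm_le_of_single {F : Type*} [NormedAddCommGroup F] [NormedSpace ℝ F] (L : 𝔼 →L[ℝ] F)
    {A : ℝ} (hA : 0 ≤ A) (h : ∀ l, ‖L (𝐞 l)‖ ≤ A) : ‖L‖ ≤ d * A := by
  refine L.opNorm_le_bound (by positivity) fun v => ?_
  rw [clm_eq_sum L v]
  have : ∀ l ∈ Finset.univ, ‖v l • L (𝐞 l)‖ ≤ A * ‖v‖ := fun l _ => by
    rw [norm_smul, mul_comm A]
    exact mul_le_mul (PiLp.norm_apply_le v l) (h l) (norm_nonneg _) (norm_nonneg _)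
  refine (norm_sum_le_of_le _ this).trans (le_of_eq ?_)
  simp; ring

lemma norm_coef_le {X : CoefSpace d m} {A : ℝ} (hA : 0 ≤ A) (h1 : ∀ i j, |X.1 i j| ≤ A)
    (h2 : ∀ i k l, |X.2.1 i k l| ≤ A) (h3 : ∀ k l, |X.2.2 k l| ≤ A) : ‖X‖ ≤ A := by
  rw [norm_prod_le_iff, norm_prod_le_iff]
  simp only [pi_norm_le_iff_of_nonneg hA]
  exact ⟨h1, h2, h3⟩

lemma ContDiff.differentiable_pd {h : 𝔼 → ℝ} (hh : ContDiff ℝ 2 h) (j : Fin d) :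
    Differentiable ℝ (fun y => pd h y j) := by
  have h1 : ContDiff ℝ 1 (fderiv ℝ h) := hh.fderiv_right (by norm_num)
  exact (h1.clm_apply contDiff_const).differentiable (by norm_num)

lemma ContDiff.continuous_pd_pd {h : 𝔼 → ℝ} (hh : ContDiff ℝ 2 h) (i j : Fin d) :
    Continuous (fun x => pd (fun y => pd h y j) x i) := by
  have h1 : ContDiff ℝ 1 (fderiv ℝ h) := hh.fderiv_right (by norm_num)
  exact ((h1.clm_apply contDiff_const).continuous_fderiv (by norm_num)).clm_apply continuous_const

/-- The divergence form of the second order operator in terms of the Hessian. -/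
lemma sum_pd_mul_pd {q : 𝔼 → Matrix (Fin d) (Fin d) ℝ} {x : 𝔼}
    (hq : ∀ i j, DifferentiableAt ℝ (fun y => q y i j) x) {h : 𝔼 → ℝ} (hh : ContDiff ℝ 2 h) :
    ∑ i, ∑ j, pd (fun y => q y i j * pd h y j) x i =
      ∑ i, ∑ j, q x i j * fderiv ℝ (fderiv ℝ h) x (𝐞 i)
        (𝐞 j) + ∑ i, (∑ j, pd (fun y => q y j i) x j) * pd h x i := by
  have h1 : ∀ i j, pd (fun y => q y i j * pd h y j) x i = q x i j * fderiv ℝ (fderiv ℝ h) x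
      (𝐞 i) (𝐞 j) + pd (fun y => q y i j) x i * pd h x j :=
    fun i j => by rw [pd_mul (hq i j) (hh.differentiable_pd j x), pd_pd_eq hh]; ring
  simp only [h1, Finset.sum_add_distrib, Finset.sum_mul]
  congr 1
  exact Finset.sum_comm

lemma exists_small_perturbation {e A μ ν : ℝ} (he : 0 < e) (hA : 0 ≤ A) (hμ : 0 < μ) (hν : 0 < ν) :
    ∃ ζ > 0, ∀ X lam : ℝ, X ≤ A → ν ≤ lam →
      1 / 2 * e * ζ + e * ζ * X / (2 * μ) + (e * ζ) ^ 2 / (4 * μ * lam) ≤ 1 := by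
  set c := 1 / 2 + A / (2 * μ) + 1 / (4 * μ * ν) with hc
  have hc0 : 0 < c := by positivity
  set z := min 1 (1 / c) with hz
  have hz0 : 0 < z := by positivity
  refine ⟨z / e, by positivity, fun X lam hX hl => ?_⟩
  have h0 : e * (z / e) = z := by field_simp
  rw [mul_assoc (1 / 2), h0]
  have h1 : z * X / (2 * μ) ≤ z * A / (2 * μ) := by gcongr
  have h2 : z ^ 2 / (4 * μ * lam) ≤ z / (4 * μ * ν) := by
    have : z ^ 2 ≤ z := by nlinarith [min_le_left 1 (1 / c)]
    gcongr
  have h3 : z * c ≤ 1 := by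
    have := mul_le_mul_of_nonneg_right (min_le_right 1 (1 / c)) hc0.le
    rwa [one_div_mul_cancel hc0.ne'] at this
  have h4 : z * c = 1 / 2 * z + z * A / (2 * μ) + z / (4 * μ * ν) := by rw [hc]; ring
  linarith

namespace RawData

variable {q : ℝ → EuclideanSpace ℝ (Fin d) → Matrix (Fin d) (Fin d) ℝ}
  {b : Fin d → ℝ → EuclideanSpace ℝ (Fin d) → ℝ}
  {Bt Bm : Fin d → ℝ → EuclideanSpace ℝ (Fin d) → Matrix (Fin m) (Fin m) ℝ}
  {C : ℝ → EuclideanSpace ℝ (Fin d) → Matrix (Fin m) (Fin m) ℝ} {ξ : ℝ → ℝ}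
  {lam LamC LamDb k : ℝ → EuclideanSpace ℝ (Fin d) → ℝ} {ν β γ Hb K₁ K₂ s T μ : ℝ}

lemma divCoef_cont (h : RawData q b Bt Bm C ξ lam LamC LamDb k ν β γ Hb K₁ K₂ s T) (i : Fin d) :
    ClampCont s T (fun t x => divCoef q t x i) :=
  ClampCont.sum _ fun j => h.Dq_cont j i j

lemma rawCoef_cont (h : RawData q b Bt Bm C ξ lam LamC LamDb k ν β γ Hb K₁ K₂ s T) :
    ClampCont s T (rawCoef q Bm C) := by
  refine ClampCont.prodMk ?_ (ClampCont.prodMk ?_ ?_)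
  · exact ClampCont.pi fun i => ClampCont.pi fun j => h.q_cont i j
  · exact ClampCont.pi fun i => ClampCont.pi fun k => ClampCont.pi fun l =>
      (h.B_cont i k l).add ((h.divCoef_cont i).mul_const _)
  · exact ClampCont.pi fun i => ClampCont.pi fun j => h.C_cont i j

lemma coef_sub_drift (h : RawData q b Bt Bm C ξ lam LamC LamDb k ν β γ Hb K₁ K₂ s T) (t : ℝ) (x : 𝔼)
    (i : Fin d) (k l : Fin m) : (rawCoef q Bm C t x).2.1 i k l -
      rawDrift q b t x i * (if k = l then 1 else 0) = Bt i t x k l := by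
  simp only [rawCoef, rawDrift, h.B_eq, Matrix.add_apply, Matrix.smul_apply, Matrix.one_apply,
    smul_eq_mul]
  ring

lemma one_le_sqrt_mul (hd : 1 ≤ d) (hm : 1 ≤ m) : 1 ≤ √(d : ℝ) * m :=
  one_le_mul_of_one_le_of_one_le (Real.one_le_sqrt.2 (by exact_mod_cast hd)) (by exact_mod_cast hm)

lemma lam_pos (h : RawData q b Bt Bm C ξ lam LamC LamDb k ν β γ Hb K₁ K₂ s T) (hν : 0 < ν) (t : ℝ)
    (x : 𝔼) : 0 < lam t x := hν.trans_le (h.lam_ge t x)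

lemma neg_LamC_le (h : RawData q b Bt Bm C ξ lam LamC LamDb k ν β γ Hb K₁ K₂ s T) (hm : 1 ≤ m)
    (r : ℝ) : ∃ A : ℝ, 0 ≤ A ∧ ∀ t x, ‖x‖ ≤ r → -A ≤ LamC t x := by
  obtain ⟨A, hA⟩ := (h.C_cont ⟨0, hm⟩ ⟨0, hm⟩).bdd r
  refine ⟨|A|, abs_nonneg _, fun t x hx => ?_⟩
  have h1 := (h.LamC_eig t x).diag_le ⟨0, hm⟩
  have h2 := neg_le_of_abs_le (hA t x hx)
  linarith [le_abs_self A]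

lemma xi_lam_bdd (h : RawData q b Bt Bm C ξ lam LamC LamDb k ν β γ Hb K₁ K₂ s T) (hν : 0 < ν)
    (hd : 1 ≤ d) (hm : 1 ≤ m) (r : ℝ) : ∃ A : ℝ, 0 ≤ A ∧ ∀ t x, ‖x‖ ≤ r → ξ t * lam t x +
      √(∑ i : Fin d, ∑ k' : Fin m, ∑ l : Fin m, (pd (fun y => C t y k' l) x i) ^ 2) ≤ A := by
  obtain ⟨A, hA0, hA⟩ := h.neg_LamC_le hm r
  refine ⟨|K₁| + 2 * A, by positivity, fun t x hx => ?_⟩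
  have h1 := h.fin₁ t x
  have h2 : 1 * (ξ t * lam t x) ≤ √d * m * (ξ t * lam t x) :=
    mul_le_mul_of_nonneg_right (one_le_sqrt_mul hd hm)
      (mul_nonneg (h.ξ_pos t).le (h.lam_pos hν t x).le)
  linarith [hA t x hx, le_abs_self K₁]

lemma xi_bdd (h : RawData q b Bt Bm C ξ lam LamC LamDb k ν β γ Hb K₁ K₂ s T) (hν : 0 < ν)
    (hd : 1 ≤ d) (hm : 1 ≤ m) : ∃ A : ℝ, ∀ t, ξ t ≤ A := by
  obtain ⟨A, hA0, hA⟩ := h.xi_lam_bdd hν hd hm 0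
  refine ⟨A / ν, fun t => ?_⟩
  rw [le_div_iff₀ hν]
  have h1 := hA t 0 (by simp)
  have h2 := mul_le_mul_of_nonneg_left (h.lam_ge t 0) (h.ξ_pos t).le
  linarith [Real.sqrt_nonneg (∑ i : Fin d, ∑ k' : Fin m, ∑ l : Fin m,
    (pd (fun y => C t y k' l) (0 : 𝔼) i) ^ 2)]

lemma drift_bdd (h : RawData q b Bt Bm C ξ lam LamC LamDb k ν β γ Hb K₁ K₂ s T) (hν : 0 < ν)
    (hd : 1 ≤ d) (hm : 1 ≤ m) (r : ℝ) : ∃ A : ℝ, ∀ t x, ‖x‖ ≤ r → ‖rawDrift q b t x‖ ≤ A := by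
  obtain ⟨A, hA0, hA⟩ := h.xi_lam_bdd hν hd hm r
  obtain ⟨A', hA'⟩ := h.rawCoef_cont.bdd r
  refine ⟨√(∑ _i : Fin d, (A + A') ^ 2), fun t x hx => ?_⟩
  rw [EuclideanSpace.norm_eq]
  refine Real.sqrt_le_sqrt (Finset.sum_le_sum fun i _ => pow_le_pow_left₀ (norm_nonneg _) ?_ 2)
  have h1 := h.coef_sub_drift t x i ⟨0, hm⟩ ⟨0, hm⟩
  rw [if_pos rfl, mul_one] at h1
  have h2 : rawDrift q b t x i = (rawCoef q Bm C t x).2.1 i ⟨0, hm⟩ ⟨0, hm⟩ -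
      Bt i t x ⟨0, hm⟩ ⟨0, hm⟩ := by linarith
  have h3 := (abs_coefB_le i ⟨0, hm⟩ ⟨0, hm⟩ (rawCoef q Bm C t x)).trans (hA' t x hx)
  have h4 := h.Bt_le i t x ⟨0, hm⟩ ⟨0, hm⟩
  have h5 := hA t x hx
  rw [h2, Real.norm_eq_abs]
  refine (abs_sub _ _).trans ?_
  linarith [Real.sqrt_nonneg (∑ i : Fin d, ∑ k' : Fin m, ∑ l : Fin m,
    (pd (fun y => C t y k' l) x i) ^ 2)]

lemma lead_bdd (h : RawData q b Bt Bm C ξ lam LamC LamDb k ν β γ Hb K₁ K₂ s T) (hν : 0 < ν)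
    (hγ : 0 < γ) (hd : 1 ≤ d) (hm : 1 ≤ m) (r : ℝ) :
    ∃ A : ℝ, 0 ≤ A ∧ ∀ t x, ‖x‖ ≤ r → √d * m * ξ t + d * k t x ≤ A := by
  obtain ⟨A, hA0, hA⟩ := h.neg_LamC_le hm r
  obtain ⟨A', hA'⟩ := (h.DB_cont ⟨0, hd⟩ ⟨0, hm⟩ ⟨0, hm⟩ ⟨0, hd⟩).bdd r
  refine ⟨√((|K₂| + |A'| + A) / (γ * ν)), by positivity, fun t x hx => Real.le_sqrt_of_sq_le ?_⟩
  rw [le_div_iff₀ (by positivity)]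
  have h1 := h.fin₂ t x
  have h2 := (h.LamDb_eig t x).diag_le ⟨0, hd⟩
  have h3 : pd (fun y => Bm ⟨0, hd⟩ t y ⟨0, hm⟩ ⟨0, hm⟩) x ⟨0, hd⟩ = pd (b ⟨0, hd⟩ t) x ⟨0, hd⟩ +
      pd (fun y => Bt ⟨0, hd⟩ t y ⟨0, hm⟩ ⟨0, hm⟩) x ⟨0, hd⟩ := by
    rw [← pd_add (h.b_diff _ _ _) (h.Bt_diff _ _ _ _ _)]
    simp [h.B_eq]
  have h4 := neg_le_of_abs_le (hA' t x hx)
  have h5 : pd (fun y => Bt ⟨0, hd⟩ t y ⟨0, hm⟩ ⟨0, hm⟩) x ⟨0, hd⟩ ≤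
      √(∑ i : Fin d, ∑ j : Fin d, ∑ k' : Fin m, ∑ l : Fin m,
          (pd (fun y => Bt i t y k' l) x j) ^ 2) := by
    refine Real.le_sqrt_of_sq_le ?_
    refine le_trans ?_ (Finset.single_le_sum (fun i _ => by positivity) (Finset.mem_univ ⟨0, hd⟩))
    refine le_trans ?_ (Finset.single_le_sum (fun i _ => by positivity) (Finset.mem_univ ⟨0, hd⟩))
    refine le_trans ?_ (Finset.single_le_sum (fun i _ => by positivity) (Finset.mem_univ (⟨0, hm⟩ : Fin m)))
    exact Finset.single_le_sum (f := fun l => (pd (fun y => Bt ⟨0, hd⟩ t y ⟨0, hm⟩ l) x ⟨0, hd⟩) ^ 2)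
      (fun i _ => by positivity) (Finset.mem_univ (⟨0, hm⟩ : Fin m))
  have hl := h.lam_pos hν t x
  have h6 := mul_le_mul_of_nonneg_left (h.lam_ge t x)
    (show 0 ≤ γ * (√d * m * ξ t + d * k t x) ^ 2 by positivity)
  have h7 : 0 ≤ (1 / 2 * (√d * m * ξ t) + 1 / (4 * γ)) * lam t x := by
    have := (h.ξ_pos t).le
    positivity
  have h8 : 0 ≤ √d * √(∑ i : Fin d, ∑ j : Fin d, ∑ l : Fin d,
          (pd (fun y => pd (fun z => q t z i j) y l) x i) ^ 2) := by positivity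
  have h9 : 0 ≤ √(∑ i : Fin d, ∑ k' : Fin m, ∑ l : Fin m,
    (pd (fun y => C t y k' l) x i) ^ 2) := by positivity
  have hAA := hA t x hx
  rw [add_assoc (γ * _ ^ 2), add_mul] at h1
  generalize √(∑ i : Fin d, ∑ j : Fin d, ∑ k' : Fin m, ∑ l : Fin m,
          (pd (fun y => Bt i t y k' l) x j) ^ 2) = N at *
  generalize √d * √(∑ i : Fin d, ∑ j : Fin d, ∑ l : Fin d,
          (pd (fun y => pd (fun z => q t z i j) y l) x i) ^ 2) = N' at *
  generalize √(∑ i : Fin d, ∑ k' : Fin m, ∑ l : Fin m,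
    (pd (fun y => C t y k' l) x i) ^ 2) = N'' at *
  linarith [le_abs_self A', le_abs_self K₂]

lemma q_diff (h : RawData q b Bt Bm C ξ lam LamC LamDb k ν β γ Hb K₁ K₂ s T) (t : ℝ) (i j : Fin d) :
    Differentiable ℝ (fun x => q t x i j) := (h.q_reg t i j).differentiable (by norm_num)

lemma divCoef_diff (h : RawData q b Bt Bm C ξ lam LamC LamDb k ν β γ Hb K₁ K₂ s T) (t : ℝ)
    (i : Fin d) : Differentiable ℝ (fun x => divCoef q t x i) := by
  unfold divCoef
  exact Differentiable.fun_sum fun j _ => (h.q_reg t j i).differentiable_pd j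

lemma rawCoef_diff (h : RawData q b Bt Bm C ξ lam LamC LamDb k ν β γ Hb K₁ K₂ s T) (t : ℝ) :
    Differentiable ℝ (rawCoef q Bm C t) := by
  refine Differentiable.prodMk ?_ (Differentiable.prodMk ?_ ?_)
  · exact differentiable_pi.2 fun i => differentiable_pi.2 fun j => h.q_diff t i j
  · exact differentiable_pi.2 fun i => differentiable_pi.2 fun k => differentiable_pi.2 fun l =>
      (h.B_diff i t k l).add ((h.divCoef_diff t i).mul_const _)
  · exact differentiable_pi.2 fun i => differentiable_pi.2 fun j => h.C_diff t i j

lemma fderiv_coef_q (h : RawData q b Bt Bm C ξ lam LamC LamDb k ν β γ Hb K₁ K₂ s T) (t : ℝ) (x : 𝔼)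
    (l : Fin d) (i j : Fin d) : (fderiv ℝ (rawCoef q Bm C t) x (𝐞 l)).1 i j =
      pd (fun y => q t y i j) x l :=
  (pd_clm (coefQ i j) (h.rawCoef_diff t x) l).symm

lemma fderiv_coef_C (h : RawData q b Bt Bm C ξ lam LamC LamDb k ν β γ Hb K₁ K₂ s T) (t : ℝ) (x : 𝔼)
    (l : Fin d) (i j : Fin m) : (fderiv ℝ (rawCoef q Bm C t) x (𝐞 l)).2.2 i j =
      pd (fun y => C t y i j) x l :=
  (pd_clm (coefC i j) (h.rawCoef_diff t x) l).symm

lemma fderiv_coef_B (h : RawData q b Bt Bm C ξ lam LamC LamDb k ν β γ Hb K₁ K₂ s T) (t : ℝ) (x : 𝔼)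
    (l i : Fin d) (k k' : Fin m) :
    (fderiv ℝ (rawCoef q Bm C t) x (𝐞 l)).2.1 i k k' =
      pd (fun y => Bm i t y k k') x l +
        (∑ j, pd (fun y => pd (fun z => q t z j i) y j) x l) * (if k = k' then 1 else 0) := by
  refine (pd_clm (coefB i k k') (h.rawCoef_diff t x) l).symm.trans ?_
  have h1 : pd (fun y => Bm i t y k k' + divCoef q t y i * (if k = k' then 1 else 0)) x l = _ :=
    pd_add (h.B_diff i t k k' x) ((h.divCoef_diff t i x).mul_const _) l
  refine h1.trans ?_
  congr 1
  rw [pd_mul (h.divCoef_diff t i x) (differentiableAt_const _)]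
  have h2 : pd (fun y => divCoef q t y i) x l = _ :=
    pd_sum _ (fun j _ => (h.q_reg t j i).differentiable_pd j x) l
  rw [h2]
  simp [pd]

lemma pd_Bm (h : RawData q b Bt Bm C ξ lam LamC LamDb k ν β γ Hb K₁ K₂ s T) (t : ℝ) (x : 𝔼)
    (l i : Fin d) (k k' : Fin m) : pd (fun y => Bm i t y k k') x l =
      pd (b i t) x l * (if k = k' then 1 else 0) + pd (fun y => Bt i t y k k') x l := by
  have h1 : (fun y => Bm i t y k k') =
      fun y => b i t y * (if k = k' then 1 else 0) + Bt i t y k k' := by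
    funext y; simp [h.B_eq, Matrix.one_apply]
  rw [h1, pd_add ((h.b_diff i t x).mul_const _) (h.Bt_diff i t k k' x),
    pd_mul (h.b_diff i t x) (differentiableAt_const _)]
  simp [pd]

lemma fderiv_bdd (h : RawData q b Bt Bm C ξ lam LamC LamDb k ν β γ Hb K₁ K₂ s T) (hν : 0 < ν)
    (hd : 1 ≤ d) (hm : 1 ≤ m) (t r : ℝ) :
    ∃ A : ℝ, ∀ x, ‖x‖ ≤ r → ‖fderiv ℝ (rawCoef q Bm C t) x‖ ≤ A := by
  obtain ⟨A₁, hA₁, h1⟩ := exists_common_bound (ι := Fin d × Fin d × Fin d) (X := 𝔼)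
    (S := fun x => ‖x‖ ≤ r) (g := fun n x => pd (fun y => q t y n.1 n.2.1) x n.2.2) fun n => by
      obtain ⟨A, hA⟩ := (h.Dq_cont n.1 n.2.1 n.2.2).bdd r
      exact ⟨A, fun x hx => hA t x hx⟩
  obtain ⟨A₂, hA₂, h2⟩ := exists_common_bound (ι := Fin d × Fin d × Fin m × Fin m) (X := 𝔼)
    (S := fun x => ‖x‖ ≤ r) (g := fun n x => pd (fun y => Bm n.1 t y n.2.2.1 n.2.2.2) x n.2.1 +
      (∑ j, pd (fun y => pd (fun z => q t z j n.1) y j) x n.2.1) *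
        (if n.2.2.1 = n.2.2.2 then 1 else 0)) fun n => by
      have hc : Continuous (fun x => pd (fun y => Bm n.1 t y n.2.2.1 n.2.2.2) x n.2.1 +
        (∑ j, pd (fun y => pd (fun z => q t z j n.1) y j) x n.2.1) *
        (if n.2.2.1 = n.2.2.2 then (1 : ℝ) else 0)) := by
        refine Continuous.add ?_ (Continuous.mul (continuous_finsetSum _ fun j _ =>
          (h.q_reg t j n.1).continuous_pd_pd n.2.1 j) continuous_const)
        exact (h.DB_cont n.1 n.2.2.1 n.2.2.2 n.2.1).1.comp (Continuous.prodMk_right t)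
      obtain ⟨A, hA⟩ := (isCompact_closedBall (0 : 𝔼) r).exists_bound_of_continuousOn hc.continuousOn
      exact ⟨A, fun x hx => hA x (by simpa using hx)⟩
  obtain ⟨A₃, hA₃, h3⟩ := h.xi_lam_bdd hν hd hm r
  have h3' : ∀ x, ‖x‖ ≤ r → ∀ l i j, |pd (fun y => C t y i j) x l| ≤ A₃ := by
    intro x hx l i j
    have e1 := h3 t x hx
    have e2 := mul_pos (h.ξ_pos t) (h.lam_pos hν t x)
    refine le_trans (Real.le_sqrt_of_sq_le ?_) (by linarith : √(∑ i : Fin d, ∑ k' : Fin m,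
      ∑ l : Fin m, (pd (fun y => C t y k' l) x i) ^ 2) ≤ A₃)
    rw [sq_abs]
    refine le_trans ?_ (Finset.single_le_sum (fun i _ => by positivity) (Finset.mem_univ l))
    refine le_trans ?_ (Finset.single_le_sum (fun i _ => by positivity) (Finset.mem_univ i))
    exact Finset.single_le_sum (f := fun j => (pd (fun y => C t y i j) x l) ^ 2)
      (fun i _ => by positivity) (Finset.mem_univ j)
  refine ⟨d * (A₁ + A₂ + A₃), fun x hx => norm_clm_le_of_single _ (by positivity) fun l =>
    norm_coef_le (by positivity) (fun i j => ?_) (fun i k k' => ?_) (fun i j => ?_)⟩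
  · rw [h.fderiv_coef_q]
    linarith [h1 (i, j, l) x hx]
  · rw [h.fderiv_coef_B]
    linarith [h2 (i, l, k, k') x hx]
  · rw [h.fderiv_coef_C]
    linarith [h3' x hx l i j]

lemma sum_div_le (h : RawData q b Bt Bm C ξ lam LamC LamDb k ν β γ Hb K₁ K₂ s T) (t : ℝ) (x : 𝔼) :
    √(∑ l, ∑ i, (∑ j, pd (fun y => pd (fun z => q t z j i) y j) x l) ^ 2) ≤
      √d * √(∑ i : Fin d, ∑ j : Fin d, ∑ l : Fin d,
          (pd (fun y => pd (fun z => q t z i j) y l) x i) ^ 2) := by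
  rw [← Real.sqrt_mul (by positivity)]
  refine Real.sqrt_le_sqrt ?_
  have h1 : ∀ l i, (∑ j, pd (fun y => pd (fun z => q t z j i) y j) x l) ^ 2 ≤
      d * ∑ j, (pd (fun y => pd (fun z => q t z j i) y l) x j) ^ 2 := fun l i => by
    have := sq_sum_le_card_mul_sum_sq (s := Finset.univ)
      (f := fun j => pd (fun y => pd (fun z => q t z j i) y j) x l)
    rw [Finset.card_univ, Fintype.card_fin] at this
    refine this.trans (le_of_eq ?_)
    congr 1
    exact Finset.sum_congr rfl fun j _ => by rw [pd_comm (h.q_reg t j i)]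
  refine (Finset.sum_le_sum fun l _ => Finset.sum_le_sum fun i _ => h1 l i).trans (le_of_eq ?_)
  simp only [← Finset.mul_sum]
  congr 1
  rw [Finset.sum_comm]
  rw [Finset.sum_comm (s := (Finset.univ : Finset (Fin d))) (t := Finset.univ)
    (f := fun i j => ∑ l : Fin d, (pd (fun y => pd (fun z => q t z i j) y l) x i) ^ 2)]
  exact Finset.sum_congr rfl fun i _ => Finset.sum_comm

lemma loc (h : RawData q b Bt Bm C ξ lam LamC LamDb k ν β γ Hb K₁ K₂ s T) (hν : 0 < ν) (hγ : 0 < γ)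
    (hd : 1 ≤ d) (hm : 1 ≤ m) (hμ : 0 < μ) (hμγ : 1 / (4 * μ) ≤ γ) (r : ℝ) :
    ∃ δ > 0, ∀ t x y, ‖x‖ ≤ r → ‖y‖ ≤ r → ‖x - y‖ ≤ δ → ∀ a Z Y,
      coefForm μ a Z Y (rawCoef q Bm C t y - scalarDrift (rawDrift q b t x),
        fderiv ℝ (rawCoef q Bm C t) y) ≤
        (max (K₁ / 2) K₂ + 1) * (∑ k, a k ^ 2 + ∑ i, ∑ k, Z i k ^ 2) := by
  obtain ⟨A, hA0, hA⟩ := h.lead_bdd hν hγ hd hm r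
  obtain ⟨X, hX⟩ := h.xi_bdd hν hd hm
  have hX0 : 0 < X := (h.ξ_pos 0).trans_le (hX 0)
  have he : 0 < √(d : ℝ) * m := zero_lt_one.trans_le (one_le_sqrt_mul hd hm)
  obtain ⟨ζ, hζ, hζ'⟩ := exists_small_perturbation he hA0 hμ hν
  obtain ⟨δ, hδ, hδ'⟩ := h.rawCoef_cont.unif r (η := ζ / (1 + X * d)) (by positivity)
  refine ⟨δ, hδ, fun t x y hx hy hxy a Z Y => ?_⟩
  have hcl := hδ' t t x y (by simpa using hδ.le) hx hy hxy
  set η := ζ / (1 + X * d) with hη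
  have hη0 : 0 < η := by positivity
  have hη1 : η + X * (d * η) = ζ := by rw [hη]; field_simp
  have hlam : lam t x ≤ lam t y + d * η := (h.lam_eig t x).le_add (h.lam_eig t y) fun i j =>
    (abs_coefQ_le i j (rawCoef q Bm C t x - rawCoef q Bm C t y)).trans hcl
  have hl := h.lam_pos hν t y
  have hξ := h.ξ_pos t
  rw [coefForm_apply]
  have hB : ∀ i k l, |(rawCoef q Bm C t y).2.1 i k l - rawDrift q b t x i * (if k = l then 1 else 0)| ≤
      ξ t * lam t y + ζ := by
    intro i k l
    have h1 := h.coef_sub_drift t x i k l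
    have h2 := (abs_coefB_le i k l (rawCoef q Bm C t x - rawCoef q Bm C t y)).trans hcl
    have h3 := h.Bt_le i t x k l
    have h4 : (rawCoef q Bm C t y).2.1 i k l - rawDrift q b t x i * (if k = l then 1 else 0) =
        Bt i t x k l - (rawCoef q Bm C t x - rawCoef q Bm C t y).2.1 i k l := by
      rw [← h1]; simp only [Prod.snd_sub, Prod.fst_sub, Pi.sub_apply]; ring
    rw [h4]
    refine (abs_sub _ _).trans ?_
    have h5 := mul_le_mul_of_nonneg_left hlam hξ.le
    have h6 : ξ t * (d * η) ≤ X * (d * η) := mul_le_mul_of_nonneg_right (hX t) (by positivity)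
    rw [mul_add] at h5
    linarith
  have key := bernsteinForm_le (q := (rawCoef q Bm C t y).1) (C := (rawCoef q Bm C t y).2.2)
    (Dq := fun l i j => (fderiv ℝ (rawCoef q Bm C t) y (𝐞 l)).1 i j)
    (DB := fun l i k k' => (fderiv ℝ (rawCoef q Bm C t) y (𝐞 l)).2.1 i k k')
    (DC := fun l k k' => (fderiv ℝ (rawCoef q Bm C t) y (𝐞 l)).2.2 k k')
    (Db := fun i j => pd (b i t) y j)
    (S := fun l i => ∑ j, pd (fun y => pd (fun z => q t z j i) y j) y l)
    (DBt := fun i l k k' => pd (fun z => Bt i t z k k') y l)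
    (nC := √(∑ i : Fin d, ∑ k' : Fin m, ∑ l : Fin m, (pd (fun z => C t z k' l) y i) ^ 2))
    hμ hμγ hl hξ.le (h.k_nonneg t y) hζ.le (h.lam_eig t y).1 hB
    (fun i j => by simpa only [h.fderiv_coef_q] using h.Dq_le t y i j)
    (fun l i k k' => by
      rw [h.fderiv_coef_B, h.pd_Bm]
      split_ifs <;> ring)
    (h.LamDb_eig t y).1 (h.LamC_eig t y).1 (h.sum_div_le t y) le_rfl
    (le_of_eq (by simp only [h.fderiv_coef_C])) a Z Y
  refine key.trans ?_
  have f1 := h.fin₁ t y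
  have f2 := h.fin₂ t y
  have f3 := hζ' _ _ (hA t y hy) (h.lam_ge t y)
  have f4 : 0 ≤ 1 / (4 * γ) * lam t y := by positivity
  have f5 : 0 ≤ √d * m * ζ * (√d * m * ξ t + d * k t y) / (2 * μ) := by
    have := h.k_nonneg t y
    positivity
  have f6 : 0 ≤ (√d * m * ζ) ^ 2 / (4 * μ * lam t y) := by positivity
  have m1 := le_max_left (K₁ / 2) K₂
  have m2 := le_max_right (K₁ / 2) K₂
  have g1 : 0 ≤ ∑ k, a k ^ 2 := by positivity
  have g2 : 0 ≤ ∑ i, ∑ k, Z i k ^ 2 := by positivity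
  rw [mul_add (max (K₁ / 2) K₂ + 1)]
  refine add_le_add (mul_le_mul_of_nonneg_right ?_ g1) (mul_le_mul_of_nonneg_right ?_ g2)
  · linarith
  · rw [add_mul] at f2
    linarith

theorem coefData (h : RawData q b Bt Bm C ξ lam LamC LamDb k ν β γ Hb K₁ K₂ s T) (hν : 0 < ν)
    (hβ : 0 ≤ β) (hγ : 0 < γ) (hd : 1 ≤ d) (hm : 1 ≤ m) (hμ : 0 < μ) (hμγ : 1 / (4 * μ) ≤ γ) :
    CoefData (rawCoef q Bm C) (rawDrift q b) μ ν Hb (max (K₁ / 2) K₂ + 1) where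
  bdd := h.rawCoef_cont.bdd
  bh_bdd := h.drift_bdd hν hd hm
  unif_time r η hη := by
    obtain ⟨δ, hδ, hδ'⟩ := h.rawCoef_cont.unif r hη
    exact ⟨δ, hδ, fun t t' x ht hx => hδ' t t' x x ht hx hx (by simpa using hδ.le)⟩
  unif_space r η hη := by
    obtain ⟨δ, hδ, hδ'⟩ := h.rawCoef_cont.unif r hη
    exact ⟨δ, hδ, fun t x y hx hy hxy => hδ' t t x y (by simpa using hδ.le) hx hy hxy⟩
  diff := h.rawCoef_diff
  fderiv_bdd := h.fderiv_bdd hν hd hm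
  symm t x i j := (h.q_symm t x).apply j i
  ell t x w := (mul_le_mul_of_nonneg_right (h.lam_ge t x) (by positivity)).trans
    ((h.lam_eig t x).1 w)
  pot t x w := by
    refine ((h.LamC_eig t x).1 w).trans (mul_le_mul_of_nonneg_right ?_ (by positivity))
    have h1 := h.potential t x
    have h2 : 0 ≤ β * d * m ^ 2 * (ξ t) ^ 2 * lam t x := by
      have := (h.lam_pos hν t x).le
      positivity
    linarith
  loc := h.loc hν hγ hd hm hμ hμγ

theorem lipLead (h : RawData q b Bt Bm C ξ lam LamC LamDb k ν β γ Hb K₁ K₂ s T) :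
    LipLead (rawCoef q Bm C) := by
  intro r
  obtain ⟨A, hA0, hA⟩ := exists_common_bound (ι := Fin d × Fin d × Fin d) (X := ℝ × 𝔼)
    (S := fun p => ‖p.2‖ ≤ r) (g := fun n p => pd (fun y => q p.1 y n.1 n.2.1) p.2 n.2.2) fun n => by
      obtain ⟨A, hA⟩ := (h.Dq_cont n.1 n.2.1 n.2.2).bdd r
      exact ⟨A, fun p hp => hA p.1 p.2 hp⟩
  refine ⟨d * A, by positivity, fun t x y hx hy => ?_⟩
  rw [pi_norm_le_iff_of_nonneg (by positivity)]
  intro i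
  rw [pi_norm_le_iff_of_nonneg (by positivity)]
  intro j
  refine (convex_closedBall (0 : 𝔼) r).norm_image_sub_le_of_norm_fderiv_le
    (f := fun x => q t x i j) (fun z _ => h.q_diff t i j z) (fun z hz => ?_)
    (by simpa using hy) (by simpa using hx)
  exact norm_clm_le_of_single _ hA0 fun l => hA (i, j, l) (t, z) (by simpa using hz)

theorem driftData (h : RawData q b Bt Bm C ξ lam LamC LamDb k ν β γ Hb K₁ K₂ s T) (hν : 0 < ν)
    (hβ : 1 / 4 ≤ β) (hm : 1 ≤ m) : DriftData (rawCoef q Bm C) (rawDrift q b) Hb := by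
  intro R
  obtain ⟨A, hA0, hA⟩ := h.neg_LamC_le hm R
  refine ⟨4 * (Hb + A), fun t x hx => ⟨lam t x, ξ t, LamC t x, (h.lam_pos hν t x).le, (h.ξ_pos t).le,
    ?_, fun i k l => (h.coef_sub_drift t x i k l ▸ h.Bt_le i t x k l), (h.lam_eig t x).1,
    (h.LamC_eig t x).1, ?_⟩⟩
  all_goals
    have h1 := h.potential t x
    have h2 := hA t x hx
    have h3 : 0 ≤ d * m ^ 2 * (ξ t) ^ 2 * lam t x := by
      have := (h.lam_pos hν t x).le
      positivity
    have h4 := mul_le_mul_of_nonneg_right hβ h3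
    linarith

theorem lyap (h : RawData q b Bt Bm C ξ lam LamC LamDb k ν β γ Hb K₁ K₂ s T) {φ : 𝔼 → ℝ} {lamJ K : ℝ}
    (hφ : ContDiff ℝ 2 φ) (hpos : ∀ x, 0 < φ x) (hblow : Tendsto φ (cocompact 𝔼) atTop)
    (hlam : 0 < lamJ) (hK : ∀ t x, ((∑ i : Fin d, ∑ j : Fin d, pd (fun y => q t y i j * pd φ y j) x i) +
      ∑ i : Fin d, b i t x * pd φ x i) - lamJ * φ x ≤ K) :
    Lyap (fun t x => (rawCoef q Bm C t x).1) (rawDrift q b) φ lamJ |K| where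
  contDiff := hφ
  pos := hpos
  blowup := hblow
  lam_pos := hlam
  K_nonneg := abs_nonneg K
  ineq t x := by
    have h1 := hK t x
    rw [sum_pd_mul_pd (fun i j => h.q_diff t i j x) hφ] at h1
    rw [fderiv_eq_sum_pd]
    simp only [rawDrift, divCoef, add_mul, Finset.sum_add_distrib]
    simp only [rawCoef]
    linarith [le_abs_self K]

end RawData

end RawData

section Transfer

variable {d m : ℕ}

local notation "𝔼" => EuclideanSpace ℝ (Fin d)
local notation "𝕍" => EuclideanSpace ℝ (Fin m)

lemma SmoothBdd.of_hasCompactSupport {F : Type*} [NormedAddCommGroup F] [NormedSpace ℝ F]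
    {f : 𝔼 → F} (hf : ContDiff ℝ ∞ f) (hc : HasCompactSupport f) :
    SmoothBdd (fun _ : Unit => f) where
  smooth _ := hf
  bdd k := by
    obtain ⟨c, hc⟩ := (hc.iteratedFDeriv (𝕜 := ℝ) k).exists_bound_of_continuous
      (hf.continuous_iteratedFDeriv (m := k) (by exact_mod_cast le_top))
    exact ⟨c, fun _ => hc⟩

lemma coef_coord (q : Matrix (Fin d) (Fin d) ℝ) (B : Fin d → Matrix (Fin m) (Fin m) ℝ)
    (C : Matrix (Fin m) (Fin m) ℝ) (X : 𝔼 →L[ℝ] 𝔼 →L[ℝ] 𝕍) (Y : 𝔼 →L[ℝ] 𝕍) (z : 𝕍) (k : Fin m) :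
    (diffusionCoef 𝕍 q X + driftCoef B Y + matOp C z) k =
      ∑ i, ∑ j, q i j * X (𝐞 i) (𝐞 j) k +
        (∑ i, ∑ l, B i k l * Y (𝐞 i) l) + ∑ l, C k l * z l := by
  simp only [diffusionCoef_apply, driftCoef_apply, PiLp.add_apply, euclidean_sum_apply,
    matOp_apply, PiLp.smul_apply, smul_eq_mul]

/-- The nondivergence form of the system at a point. -/
lemma system_coord {q : ℝ → 𝔼 → Matrix (Fin d) (Fin d) ℝ} {Bm : Fin d → ℝ → 𝔼 → Matrix (Fin m) (Fin m) ℝ}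
    {C : ℝ → 𝔼 → Matrix (Fin m) (Fin m) ℝ} {t : ℝ} {x : 𝔼}
    (hq : ∀ i j, DifferentiableAt ℝ (fun y => q t y i j) x) {w : 𝔼 → 𝕍} (hw : ContDiff ℝ 2 w)
    (k : Fin m) :
    (diffusionCoef 𝕍 (rawCoef q Bm C t x).1 (fderiv ℝ (fderiv ℝ w) x) +
      driftCoef (fun i => (rawCoef q Bm C t x).2.1 i) (fderiv ℝ w x) +
        matOp (rawCoef q Bm C t x).2.2 (w x)) k =
      (∑ i, ∑ j, pd (fun y => q t y i j * pd (fun z => w z k) y j) x i) +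
        (∑ i, ∑ l, Bm i t x k l * pd (fun z => w z l) x i) + ∑ l, C t x k l * w x l := by
  have hw1 : Differentiable ℝ w := hw.differentiable (by simp)
  have hw2 : Differentiable ℝ (fderiv ℝ w) :=
    (hw.fderiv_right (m := 1) (by norm_num)).differentiable (by simp)
  have hpd : ∀ j, (fun y => pd (fun z => w z k) y j) =
      fun y => fderiv ℝ w y (𝐞 j) k :=
    fun j => funext fun y => pd_coord (hw1 y) k j
  have h2 : ∀ i j, fderiv ℝ (fderiv ℝ (fun z => w z k)) x (𝐞 i)
      (𝐞 j) =
      fderiv ℝ (fderiv ℝ w) x (𝐞 i) (𝐞 j) k := by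
    intro i j
    have hd : DifferentiableAt ℝ (fun y => fderiv ℝ w y (𝐞 j)) x :=
      (hw2 x).clm_apply (differentiableAt_const _)
    rw [← pd_pd_eq (contDiff_coord hw k), hpd j, pd_coord hd,
      fderiv_clm_apply (hw2 x) (differentiableAt_const _)]
    simp
  rw [sum_pd_mul_pd hq (contDiff_coord hw k)]
  have h3 : (diffusionCoef 𝕍 (rawCoef q Bm C t x).1 (fderiv ℝ (fderiv ℝ w) x) +
      driftCoef (fun i => (rawCoef q Bm C t x).2.1 i) (fderiv ℝ w x) +
        matOp (rawCoef q Bm C t x).2.2 (w x)) k =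
      ∑ i, ∑ j, q t x i j * fderiv ℝ (fderiv ℝ w) x (𝐞 i)
        (𝐞 j) k + (∑ i, ∑ l, (Bm i t x k l + divCoef q t x i *
          (if k = l then 1 else 0)) * fderiv ℝ w x (𝐞 i) l) +
        ∑ l, C t x k l * w x l := by
    exact coef_coord (rawCoef q Bm C t x).1 _ (rawCoef q Bm C t x).2.2 _ _ _ k
  rw [h3]
  simp only [h2, add_mul, Finset.sum_add_distrib, pd_coord (hw1 x), mul_ite, ite_mul, mul_one,
    mul_zero, zero_mul, Finset.sum_ite_eq, Finset.mem_univ, if_true, divCoef]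
  ring

lemma HasDerivWithinAt.Iic_of_Ioc {F : Type*} [NormedAddCommGroup F] [NormedSpace ℝ F] {g : ℝ → F}
    {g' : F} {s T t : ℝ} (ht : t ∈ Ioc s T) (hg : HasDerivWithinAt g g' (Ioc s T) t) :
    HasDerivWithinAt g g' (Iic t) t :=
  hg.mono_of_mem_nhdsWithin (mem_of_superset (Ioc_mem_nhdsLE ht.1) (Ioc_subset_Ioc_right ht.2))

lemma clamp_eq {s T t : ℝ} (ht : t ∈ Ioc s T) : max s (min T t) = t := by
  rw [min_eq_right ht.2, max_eq_right ht.1.le]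

namespace RawData

variable {q : ℝ → EuclideanSpace ℝ (Fin d) → Matrix (Fin d) (Fin d) ℝ}
  {b : Fin d → ℝ → EuclideanSpace ℝ (Fin d) → ℝ}
  {Bt Bm : Fin d → ℝ → EuclideanSpace ℝ (Fin d) → Matrix (Fin m) (Fin m) ℝ}
  {C : ℝ → EuclideanSpace ℝ (Fin d) → Matrix (Fin m) (Fin m) ℝ} {ξ : ℝ → ℝ}
  {lam LamC LamDb k : ℝ → EuclideanSpace ℝ (Fin d) → ℝ} {ν β γ Hb K₁ K₂ s T : ℝ}

theorem bddSol (h : RawData q b Bt Bm C ξ lam LamC LamDb k ν β γ Hb K₁ K₂ s T)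
    {f : 𝔼 → Fin m → ℝ} {u : ℝ → 𝔼 → Fin m → ℝ}
    (hcont : ContinuousOn (fun pt : ℝ × 𝔼 => u pt.1 pt.2) (Icc s T ×ˢ univ))
    (hbdd : ∃ Mu : ℝ, ∀ t ∈ Icc s T, ∀ x, ∑ k' : Fin m, (u t x k') ^ 2 ≤ Mu)
    (hstart : ∀ x, u s x = f x) (hC2 : ∀ t ∈ Ioc s T, ContDiff ℝ 2 (u t))
    (hderiv : ∀ t ∈ Ioc s T, ∀ x, HasDerivWithinAt (fun τ => u τ x)
      (fun k' : Fin m => (∑ i : Fin d, ∑ j : Fin d,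
          pd (fun y => q t y i j * pd (fun z => u t z k') y j) x i) +
        (∑ i : Fin d, ∑ l : Fin m, Bm i t x k' l * pd (fun z => u t z l) x i) +
        ∑ l : Fin m, C t x k' l * u t x l) (Ioc s T) t) :
    BddSol (rawCoef q Bm C) (fun x => WithLp.toLp 2 (f x)) s T
      (fun t x => WithLp.toLp 2 (u t x)) where
  cont := (PiLp.continuous_toLp 2 _).comp_continuousOn hcont
  bdd := by
    obtain ⟨M, hM⟩ := hbdd
    refine ⟨√M, fun t ht x => ?_⟩
    rw [EuclideanSpace.norm_eq]
    simpa using Real.sqrt_le_sqrt (hM t ht x)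
  start := funext fun x => congrArg _ (hstart x)
  contDiff t ht :=
    (PiLp.continuousLinearEquiv 2 ℝ (fun _ : Fin m => ℝ)).symm.contDiff.comp (hC2 t ht)
  deriv t ht x := by
    have hw : ContDiff ℝ 2 (fun x => (WithLp.toLp 2 (u t x) : 𝕍)) :=
      (PiLp.continuousLinearEquiv 2 ℝ (fun _ : Fin m => ℝ)).symm.contDiff.comp (hC2 t ht)
    have h1 := (PiLp.continuousLinearEquiv 2 ℝ (fun _ : Fin m => ℝ)).symm.toContinuousLinearMap
      |>.hasFDerivAt.comp_hasDerivWithinAt t ((hderiv t ht x).Iic_of_Ioc ht)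
    refine h1.congr_deriv ?_
    ext k'
    exact (system_coord (fun i j => (h.q_reg t i j).differentiable (by simp) x) hw k').symm

theorem scalarSol (h : RawData q b Bt Bm C ξ lam LamC LamDb k ν β γ Hb K₁ K₂ s T)
    {g : 𝔼 → ℝ} {v : ℝ → 𝔼 → ℝ}
    (hcont : ContinuousOn (fun pt : ℝ × 𝔼 => v pt.1 pt.2) (Icc s T ×ˢ univ))
    (hbdd : ∃ Mv : ℝ, ∀ t ∈ Icc s T, ∀ x, |v t x| ≤ Mv)
    (hstart : ∀ x, v s x = g x) (hC2 : ∀ t ∈ Ioc s T, ContDiff ℝ 2 (v t))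
    (hderiv : ∀ t ∈ Ioc s T, ∀ x, HasDerivWithinAt (fun τ => v τ x)
      ((∑ i : Fin d, ∑ j : Fin d, pd (fun y => q t y i j * pd (fun z => v t z) y j) x i) +
        ∑ i : Fin d, b i t x * pd (fun z => v t z) x i) (Ioc s T) t) :
    ScalarSol (fun t x => (rawCoef q Bm C t x).1) (rawDrift q b) g s T v where
  cont := hcont
  bdd := hbdd
  start := hstart
  contDiff := hC2
  deriv t ht x := by
    refine ((hderiv t ht x).Iic_of_Ioc ht).congr_deriv ?_
    have := sum_pd_mul_pd (q := q t) (x := x)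
      (fun i j => (h.q_reg t i j).differentiable (by simp) x) (hC2 t ht)
    rw [fderiv_eq_sum_pd]
    simp only [rawDrift, divCoef, add_mul, Finset.sum_add_distrib]
    refine (congrArg (· + _) this).trans ?_
    change _ = ∑ i, ∑ j, q t x i j * _ + _
    ring

end RawData

end Transfer

/-- Pointwise gradient estimate (Theorem 5.1 of the paper): under
Hypotheses 2.3 (with σ = 1) and the gradient Hypotheses 5.1, for every
`p ≥ 1 + 1/(4(β∧γ))` there is `C_{p,J} > 0` such that
`|D_x u(t,x)|^p ≤ c_p e^{C_{p,J}(t−s)} v(t,x)`, with `c_p = 2^{(p/2−1)∨0}`, whenever `u`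
solves the vector system with datum `f ∈ C_c^∞` and `v` solves the scalar problem with
datum `|f|^p + |Df|^p`. -/
theorem stmt_13 (d m : ℕ) (hd : 1 ≤ d) (hm : 1 ≤ m)
    (I : Set ℝ) (hI : I.OrdConnected)
    (J : Set ℝ) (hJ : J.OrdConnected) (hJbdd : Bornology.IsBounded J) (hJI : J ⊆ I)
    (α : ℝ) (hα : α ∈ Ioo (0:ℝ) 1)
    (ν₀ β γ : ℝ) (hν₀ : 0 < ν₀) (hβ : 1 / 4 ≤ β) (hγ : 1 / 4 ≤ γ)
    (ξ : ℝ → ℝ) (hξ : ∀ t ∈ I, 0 < ξ t)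
    (q : ℝ → EuclideanSpace ℝ (Fin d) → Matrix (Fin d) (Fin d) ℝ)
    (lamQ : ℝ → EuclideanSpace ℝ (Fin d) → ℝ)
    (hq_reg : ∀ i j : Fin d, Cpar1 d α I (fun t x => q t x i j))
    (hq_reg2 : ∀ t ∈ I, ∀ i j : Fin d, ContDiff ℝ 2 (fun x => q t x i j))
    (hq_symm : ∀ t ∈ I, ∀ x, (q t x).IsSymm)
    (hlamQ : ∀ t ∈ I, ∀ x, IsMinEigen (q t x) (lamQ t x) ∧ ν₀ ≤ lamQ t x)
    (b : Fin d → ℝ → EuclideanSpace ℝ (Fin d) → ℝ)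
    (Btil : Fin d → ℝ → EuclideanSpace ℝ (Fin d) → Matrix (Fin m) (Fin m) ℝ)
    (Bmat : Fin d → ℝ → EuclideanSpace ℝ (Fin d) → Matrix (Fin m) (Fin m) ℝ)
    (hBmat : ∀ i : Fin d, ∀ t : ℝ, ∀ x,
      Bmat i t x = b i t x • (1 : Matrix (Fin m) (Fin m) ℝ) + Btil i t x)
    (hB_reg : ∀ i : Fin d, ∀ k l : Fin m, Cpar1 d α I (fun t x => Bmat i t x k l))
    (hB_symm : ∀ i : Fin d, ∀ t ∈ I, ∀ x, (Bmat i t x).IsSymm)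
    (hb_diff : ∀ i : Fin d, ∀ t ∈ I, Differentiable ℝ (b i t))
    (hBtil_diff : ∀ i : Fin d, ∀ t ∈ I, ∀ k l : Fin m,
      Differentiable ℝ (fun x => Btil i t x k l))
    (hBtil : ∀ i : Fin d, ∀ t ∈ I, ∀ x, ∀ j k : Fin m,
      |Btil i t x j k| ≤ ξ t * lamQ t x)
    (C : ℝ → EuclideanSpace ℝ (Fin d) → Matrix (Fin m) (Fin m) ℝ)
    (LamC : ℝ → EuclideanSpace ℝ (Fin d) → ℝ)
    (hC_reg : ∀ k l : Fin m, HolderLocPar d α I (fun t x => C t x k l))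
    (hC_diff : ∀ t ∈ I, ∀ k l : Fin m, Differentiable ℝ (fun x => C t x k l))
    (hC_symm : ∀ t ∈ I, ∀ x, (C t x).IsSymm)
    (hLamC : ∀ t ∈ I, ∀ x, IsMaxEigen (C t x) (LamC t x))
    (Hb : ℝ) (hHb : ∀ t ∈ J, ∀ x, LamC t x + β * d * m ^ 2 * (ξ t) ^ 2 * lamQ t x ≤ Hb)
    (lamJ : ℝ) (hlamJ : 0 < lamJ) (φ : EuclideanSpace ℝ (Fin d) → ℝ)
    (hφ_reg : ContDiff ℝ 2 φ) (hφ_pos : ∀ x, 0 < φ x)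
    (hφ_blowup : Tendsto φ (cocompact (EuclideanSpace ℝ (Fin d))) atTop)
    (hφ_lyap : ∃ K : ℝ, ∀ t ∈ J, ∀ x,
      ((∑ i : Fin d, ∑ j : Fin d, pd (fun y => q t y i j * pd φ y j) x i) +
        ∑ i : Fin d, b i t x * pd φ x i) - lamJ * φ x ≤ K)
    (k : ℝ → EuclideanSpace ℝ (Fin d) → ℝ) (hk_nonneg : ∀ t ∈ I, ∀ x, 0 ≤ k t x)
    (hDq : ∀ t ∈ I, ∀ x, ∀ i j : Fin d,
      Real.sqrt (∑ l : Fin d, (pd (fun y => q t y i j) x l) ^ 2) ≤ k t x * lamQ t x)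
    (LamDb : ℝ → EuclideanSpace ℝ (Fin d) → ℝ)
    (hLamDb : ∀ t ∈ I, ∀ x,
      IsMaxEigen (fun i j : Fin d => pd (b i t) x j) (LamDb t x))
    (hfin1 : ∃ K₁ : ℝ, ∀ t ∈ J, ∀ x,
      Real.sqrt d * m * ξ t * lamQ t x +
        Real.sqrt (∑ i : Fin d, ∑ k' : Fin m, ∑ l : Fin m,
          (pd (fun y => C t y k' l) x i) ^ 2) +
        2 * LamC t x ≤ K₁)
    (hfin2 : ∃ K₂ : ℝ, ∀ t ∈ J, ∀ x,
      Real.sqrt d * Real.sqrt (∑ i : Fin d, ∑ j : Fin d, ∑ l : Fin d,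
          (pd (fun y => pd (fun z => q t z i j) y l) x i) ^ 2) +
        Real.sqrt (∑ i : Fin d, ∑ j : Fin d, ∑ k' : Fin m, ∑ l : Fin m,
          (pd (fun y => Btil i t y k' l) x j) ^ 2) +
        LamDb t x + LamC t x +
        (γ * (Real.sqrt d * m * ξ t + d * k t x) ^ 2 +
          1 / 2 * (Real.sqrt d * m * ξ t) + 1 / (4 * γ)) * lamQ t x +
        1 / 2 * Real.sqrt (∑ i : Fin d, ∑ k' : Fin m, ∑ l : Fin m,
          (pd (fun y => C t y k' l) x i) ^ 2) ≤ K₂) :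
    ∀ p : ℝ, 1 + 1 / (4 * min β γ) ≤ p →
      ∃ Cp : ℝ, 0 < Cp ∧
        ∀ f : EuclideanSpace ℝ (Fin d) → Fin m → ℝ,
          ContDiff ℝ (⊤ : ℕ∞) f → HasCompactSupport f →
        ∀ s T : ℝ, s ∈ J → T ∈ J → s < T →
        ∀ u : ℝ → EuclideanSpace ℝ (Fin d) → Fin m → ℝ,
          ContinuousOn (fun pt : ℝ × EuclideanSpace ℝ (Fin d) => u pt.1 pt.2)
            (Icc s T ×ˢ (univ : Set (EuclideanSpace ℝ (Fin d)))) →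
          (∃ Mu : ℝ, ∀ t ∈ Icc s T, ∀ x, ∑ k' : Fin m, (u t x k') ^ 2 ≤ Mu) →
          (∀ x, u s x = f x) →
          (∀ t ∈ Ioc s T, ContDiff ℝ 2 (u t)) →
          (∀ t ∈ Ioc s T, ∀ x,
            HasDerivWithinAt (fun τ => u τ x)
              (fun k' : Fin m =>
                (∑ i : Fin d, ∑ j : Fin d,
                  pd (fun y => q t y i j * pd (fun z => u t z k') y j) x i) +
                (∑ i : Fin d, ∑ l : Fin m,
                  Bmat i t x k' l * pd (fun z => u t z l) x i) +
                ∑ l : Fin m, C t x k' l * u t x l)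
              (Ioc s T) t) →
        ∀ v : ℝ → EuclideanSpace ℝ (Fin d) → ℝ,
          ContinuousOn (fun pt : ℝ × EuclideanSpace ℝ (Fin d) => v pt.1 pt.2)
            (Icc s T ×ˢ (univ : Set (EuclideanSpace ℝ (Fin d)))) →
          (∃ Mv : ℝ, ∀ t ∈ Icc s T, ∀ x, |v t x| ≤ Mv) →
          (∀ x, v s x = (∑ k' : Fin m, (f x k') ^ 2) ^ (p / 2) +
            (∑ i : Fin d, ∑ k' : Fin m, (pd (fun z => f z k') x i) ^ 2) ^ (p / 2)) →
          (∀ t ∈ Ioc s T, ContDiff ℝ 2 (v t)) →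
          (∀ t ∈ Ioc s T, ∀ x,
            HasDerivWithinAt (fun τ => v τ x)
              ((∑ i : Fin d, ∑ j : Fin d,
                pd (fun y => q t y i j * pd (fun z => v t z) y j) x i) +
                ∑ i : Fin d, b i t x * pd (fun z => v t z) x i)
              (Ioc s T) t) →
        ∀ t ∈ Ioc s T, ∀ x,
          (∑ i : Fin d, ∑ k' : Fin m, (pd (fun z => u t z k') x i) ^ 2) ^ (p / 2) ≤
            (2 : ℝ) ^ (max (p / 2 - 1) 0) * Real.exp (Cp * (t - s)) * v t x := by
  intro p hp
  obtain ⟨Kφ, hKφ⟩ := hφ_lyap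
  obtain ⟨K₁, hK₁⟩ := hfin1
  obtain ⟨K₂, hK₂⟩ := hfin2
  have hmin : 0 < min β γ := lt_min (by linarith) (by linarith)
  have hp1 : 0 < p - 1 := by
    have : 0 < 1 / (4 * min β γ) := by positivity
    linarith
  have hγ0 : 0 < γ := by linarith
  have hμ : 0 < min 1 (p - 1) := lt_min one_pos hp1
  have hμγ : 1 / (4 * min 1 (p - 1)) ≤ γ := by
    rw [div_le_iff₀ (by positivity)]
    rcases min_choice 1 (p - 1) with h | h <;> rw [h]
    · linarith
    · have h1 : 1 / (4 * γ) ≤ 1 / (4 * min β γ) :=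
        one_div_le_one_div_of_le (by positivity) (by linarith [min_le_right β γ])
      have h2 : 1 / (4 * γ) ≤ p - 1 := by linarith
      rw [div_le_iff₀ (by positivity)] at h2
      linarith
  refine ⟨p / 2 * (2 * |max (K₁ / 2) K₂ + 1| + 2), by
    have : 0 < p / 2 := by linarith
    positivity, ?_⟩
  intro f hf hfc s T hs hT hsT u hu_cont hu_bdd hu_init hu_C2 hu_deriv v hv_cont hv_bdd hv_init hv_C2
    hv_deriv t ht x
  have hsub : Icc s T ⊆ J := hJ.out hs hT
  have hclJ : ∀ τ, max s (min T τ) ∈ J := fun τ =>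
    hsub (by simpa only [max_eq_right hsT.le] using clamp_mem s T τ)
  have hclI : ∀ τ, max s (min T τ) ∈ I := fun τ => hJI (hclJ τ)
  have hsubI := hsub.trans hJI
  have hR : RawData (fun τ => q (max s (min T τ))) (fun i τ => b i (max s (min T τ)))
      (fun i τ => Btil i (max s (min T τ))) (fun i τ => Bmat i (max s (min T τ)))
      (fun τ => C (max s (min T τ))) (fun τ => ξ (max s (min T τ)))
      (fun τ => lamQ (max s (min T τ))) (fun τ => LamC (max s (min T τ)))
      (fun τ => LamDb (max s (min T τ))) (fun τ => k (max s (min T τ))) ν₀ β γ Hb K₁ K₂ s T :=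
    { q_cont := fun i j => (hq_reg i j).1.clampCont hα.1 hsT.le hsubI
      Dq_cont := fun i j l => ((hq_reg i j).2.2 l).clampCont hα.1 hsT.le hsubI
      B_cont := fun i k' l => (hB_reg i k' l).1.clampCont hα.1 hsT.le hsubI
      DB_cont := fun i k' l j => ((hB_reg i k' l).2.2 j).clampCont hα.1 hsT.le hsubI
      C_cont := fun k' l => (hC_reg k' l).clampCont hα.1 hsT.le hsubI
      q_reg := fun τ => hq_reg2 _ (hclI τ)
      q_symm := fun τ => hq_symm _ (hclI τ)
      lam_eig := fun τ y => (hlamQ _ (hclI τ) y).1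
      lam_ge := fun τ y => (hlamQ _ (hclI τ) y).2
      B_eq := fun i τ => hBmat i _
      B_diff := fun i τ k' l => (hB_reg i k' l).2.1 _ (hclI τ)
      b_diff := fun i τ => hb_diff i _ (hclI τ)
      Bt_diff := fun i τ => hBtil_diff i _ (hclI τ)
      C_diff := fun τ => hC_diff _ (hclI τ)
      ξ_pos := fun τ => hξ _ (hclI τ)
      Bt_le := fun i τ => hBtil i _ (hclI τ)
      LamC_eig := fun τ => hLamC _ (hclI τ)
      LamDb_eig := fun τ => hLamDb _ (hclI τ)
      potential := fun τ => hHb _ (hclJ τ)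
      k_nonneg := fun τ => hk_nonneg _ (hclI τ)
      Dq_le := fun τ => hDq _ (hclI τ)
      fin₁ := fun τ => hK₁ _ (hclJ τ)
      fin₂ := fun τ => hK₂ _ (hclJ τ) }
  have hL := hR.lyap hφ_reg hφ_pos hφ_blowup hlamJ fun τ => hKφ _ (hclJ τ)
  have hsolu := hR.bddSol hu_cont hu_bdd hu_init hu_C2 fun τ hτ => by
    simpa only [clamp_eq hτ] using hu_deriv τ hτ
  have hsolv := hR.scalarSol (g := v s) hv_cont hv_bdd (fun _ => rfl) hv_C2 fun τ hτ => by
    simpa only [clamp_eq hτ] using hv_deriv τ hτ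
  have hfs : SmoothBdd (fun _ : Unit => fun x => (WithLp.toLp 2 (f x) : EuclideanSpace ℝ (Fin m))) :=
    .of_hasCompactSupport
      ((PiLp.continuousLinearEquiv 2 ℝ (fun _ : Fin m => ℝ)).symm.contDiff.comp hf)
      (hfc.comp_left (WithLp.toLp_zero 2))
  exact hsolu.gradient_estimate (hR.coefData hν₀ (by linarith) hγ0 hd hm hμ hμγ)
    (hR.driftData hν₀ hβ hm) hR.lipLead hd hν₀ hμ (min_le_left _ _) hfs hsT hL hsolv
    (P := p / 2) (by linarith) (by linarith [min_le_right 1 (p - 1)]) le_rfl hv_init ht x
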